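/- In the setting of the proof of Theorem 4.3, there exists a positive real number r > 0 independent of the arc such that, for |w_q|, |x_q| < ε with ε sufficiently small, all the components Θ'_β(h(t)) = [(1/β!) ∂^{|β|}/∂(λ̄')^β R'_h(t, ν̄')]|_{λ̄'=0} of the reflection function extend as CR functions of class C^∞ over Σ_{γ_{w_q,x_q}} ∩ Δₙ(0, r). -/

import Mathlib

/-!
Common definitions: CR geometry of real analytic hypersurfaces in `ℂⁿ`,
following J. Merker, "On envelopes of holomorphy of domains with Levi-flat
hats and the reflection principle".

We model `ℂⁿ` with `n = m + 1` as `CS m := (Fin m → ℂ) × ℂ`, with coordinates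
`t = (w, z)`; the sup-norm balls of this product are polydiscs.
-/

noncomputable section

open Complex Topology Filter Metric Set

abbrev CS (m : ℕ) : Type := (Fin m → ℂ) × ℂ

section Basic

variable {E F : Type*} [NormedAddCommGroup E] [NormedSpace ℂ E]
  [NormedAddCommGroup F] [NormedSpace ℂ F]

/-- `v` is a real tangent vector to the set `M` at `q`: every real-differentiable
function vanishing on `M` near `q` has differential annihilating `v`. -/
def TangentAt (M : Set E) (q v : E) : Prop :=
  ∀ ρ : E → ℝ, DifferentiableAt ℝ ρ q → (∀ᶠ z in 𝓝 q, z ∈ M → ρ z = 0) →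
    fderiv ℝ ρ q v = 0

/-- `v` is a complex tangent vector to `M` at `q` (i.e. `v ∈ T^c_q M`). -/
def ComplexTangentAt (M : Set E) (q v : E) : Prop :=
  TangentAt M q v ∧ TangentAt M q (Complex.I • v)

/-- `M` is a real analytic real hypersurface: near each of its points it is the
zero set of a real analytic real-valued function with nonvanishing differential. -/
def IsRealAnalyticHypersurface (M : Set E) : Prop :=
  M.Nonempty ∧ ∀ p ∈ M, ∃ (U : Set E) (ρ : E → ℝ), IsOpen U ∧ p ∈ U ∧
    AnalyticOnNhd ℝ ρ U ∧ fderiv ℝ ρ p ≠ 0 ∧ M ∩ U = {z ∈ U | ρ z = 0}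

/-- A set `N ⊆ E` is generic in `E`: `T_q N + i T_q N = E` at each `q ∈ N`. -/
def IsGenericSet (N : Set E) : Prop :=
  ∀ q ∈ N, ∀ v : E, ∃ a b : E, TangentAt N q a ∧ TangentAt N q b ∧
    v = a + Complex.I • b

/-- The antiholomorphic part `∂̄f(q)(v)` of the real differential of `f` at `q`. -/
def antiCDeriv (f : E → ℂ) (q v : E) : ℂ :=
  (fderiv ℝ f q v + Complex.I * fderiv ℝ f q (Complex.I • v)) / 2

/-- `f` is a CR function of class `C^k` on the hypersurface `M`: locally it has
`C^k` extensions whose antiholomorphic differential annihilates the complex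
tangent spaces of `M`. -/
def IsCRFunctionOn (k : ℕ∞) (M : Set E) (f : E → ℂ) : Prop :=
  ∀ p ∈ M, ∃ (U : Set E) (g : E → ℂ), IsOpen U ∧ p ∈ U ∧
    ContDiffOn ℝ k g U ∧ (∀ z ∈ M ∩ U, g z = f z) ∧
    ∀ q ∈ M ∩ U, ∀ v : E, ComplexTangentAt M q v → antiCDeriv g q v = 0

/-- `h` is a CR mapping of class `C^k` from `M` to `M'`. -/
def IsCRMapOn (k : ℕ∞) (M : Set E) (M' : Set F) (h : E → F) : Prop :=
  Set.MapsTo h M M' ∧ ∀ ℓ : F →L[ℂ] ℂ, IsCRFunctionOn k M fun z => ℓ (h z)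

/-- `h` is a CR diffeomorphism of class `C^k` from `M` onto `M'`. -/
def IsCRDiffeoOn (k : ℕ∞) (M : Set E) (M' : Set F) (h : E → F) : Prop :=
  IsCRMapOn k M M' h ∧ Set.BijOn h M M' ∧
    ∃ g : F → E, IsCRMapOn k M' M g ∧ ∀ z ∈ M, g (h z) = z

/-- `f` is a CR function of class `C^{1,α}` on `M`. -/
def IsCRFunctionC1HolderOn (α : NNReal) (M : Set E) (f : E → ℂ) : Prop :=
  ∀ p ∈ M, ∃ (U : Set E) (g : E → ℂ), IsOpen U ∧ p ∈ U ∧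
    ContDiffOn ℝ 1 g U ∧
    (∃ C : NNReal, HolderOnWith C α (fderivWithin ℝ g U) U) ∧
    (∀ z ∈ M ∩ U, g z = f z) ∧
    ∀ q ∈ M ∩ U, ∀ v : E, ComplexTangentAt M q v → antiCDeriv g q v = 0

/-- `h` is a CR mapping of class `C^{1,α}` from `M` to `M'`. -/
def IsCRMapC1HolderOn (α : NNReal) (M : Set E) (M' : Set F) (h : E → F) : Prop :=
  Set.MapsTo h M M' ∧ ∀ ℓ : F →L[ℂ] ℂ, IsCRFunctionC1HolderOn α M fun z => ℓ (h z)

/-- `h` is a CR diffeomorphism of class `C^{1,α}` from `M` onto `M'`. -/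
def IsCRDiffeoC1HolderOn (α : NNReal) (M : Set E) (M' : Set F) (h : E → F) : Prop :=
  IsCRMapC1HolderOn α M M' h ∧ Set.BijOn h M M' ∧
    ∃ g : F → E, IsCRMapC1HolderOn α M' M g ∧ ∀ z ∈ M, g (h z) = z

/-- There is a germ of a (possibly singular) complex hypersurface through `q`
contained in `M`. -/
def HasComplexHypersurfaceGermIn (M : Set E) (q : E) : Prop :=
  ∃ (U : Set E) (f : E → ℂ), IsOpen U ∧ q ∈ U ∧ DifferentiableOn ℂ f U ∧
    f q = 0 ∧ ¬ (∀ᶠ z in 𝓝 q, f z = 0) ∧ {z ∈ U | f z = 0} ⊆ M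

/-- `M` is minimal in the sense of Tumanov at `q`: no germ of a complex
hypersurface through `q` is contained in `M`. -/
def MinimalAt (M : Set E) (q : E) : Prop := ¬ HasComplexHypersurfaceGermIn M q

/-- `M` is holomorphically nondegenerate: there is no holomorphic vector field,
defined and not identically zero near some point of `M`, tangent to `M`. -/
def HolomorphicallyNondegenerate (M : Set E) : Prop :=
  ¬ ∃ (U : Set E) (X : E → E) (q : E), IsOpen U ∧ q ∈ M ∩ U ∧
      DifferentiableOn ℂ X U ∧ ¬ (∀ᶠ z in 𝓝 q, X z = 0) ∧
      ∀ z ∈ M ∩ U, ComplexTangentAt M z (X z)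

/-- There exist `d` holomorphic vector fields tangent to `M`, defined near some
point of `M` and linearly independent at that (generic) point. -/
def HolDegDegreeGE (M : Set E) (d : ℕ) : Prop :=
  ∃ (U : Set E) (X : Fin d → E → E) (q : E), IsOpen U ∧ q ∈ M ∩ U ∧
    (∀ i, DifferentiableOn ℂ (X i) U) ∧
    (∀ i, ∀ z ∈ M ∩ U, ComplexTangentAt M z (X i z)) ∧
    LinearIndependent ℂ fun i => X i q

/-- The holomorphic degeneracy degree of `M` equals `κ`. -/
def HolDegDegree (M : Set E) (κ : ℕ) : Prop :=
  HolDegDegreeGE M κ ∧ ¬ HolDegDegreeGE M (κ + 1)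

/-- Near `b`, the set `A` is a complex submanifold of complex codimension `c`. -/
def IsComplexSubmanifoldAt (A : Set E) (b : E) (c : ℕ) : Prop :=
  ∃ (W : Set E) (f : E → Fin c → ℂ), IsOpen W ∧ b ∈ W ∧
    DifferentiableOn ℂ f W ∧ A ∩ W = {z ∈ W | f z = 0} ∧
    Function.Surjective ⇑(fderiv ℂ f b)

/-- `A` is a closed complex analytic subset of the open set `Ω`. -/
def IsAnalyticSubsetOf (Ω A : Set E) : Prop :=
  A ⊆ Ω ∧ closure A ∩ Ω ⊆ A ∧
    ∀ a ∈ Ω, ∃ (W : Set E) (N : ℕ) (f : E → Fin N → ℂ), IsOpen W ∧ a ∈ W ∧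
      W ⊆ Ω ∧ DifferentiableOn ℂ f W ∧ A ∩ W = {z ∈ W | f z = 0}

/-- `A` is a complex analytic subset of `Ω` of pure complex codimension `c`:
its regular points are dense in it, and they all have codimension `c`. -/
def IsPureCodimAnalyticSubsetOf (Ω A : Set E) (c : ℕ) : Prop :=
  IsAnalyticSubsetOf Ω A ∧
  (∀ a ∈ A, ∀ V ∈ 𝓝 a, ∃ b ∈ A ∩ V, IsComplexSubmanifoldAt A b c) ∧
  (∀ b ∈ A, ∀ c' : ℕ, IsComplexSubmanifoldAt A b c' → c' = c)

/-- `S` is a `C^∞`-smooth real hypersurface of the open set `Ω`. -/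
def IsSmoothHypersurfaceIn (Ω S : Set E) : Prop :=
  S ⊆ Ω ∧ ∀ q ∈ S, ∃ (U : Set E) (ρ : E → ℝ), IsOpen U ∧ q ∈ U ∧ U ⊆ Ω ∧
    ContDiffOn ℝ (⊤ : ℕ∞) ρ U ∧ (∀ z ∈ U, fderiv ℝ ρ z ≠ 0) ∧
    S ∩ U = {z ∈ U | ρ z = 0}

/-- A smooth real hypersurface is Levi-flat iff it is foliated by complex
hypersurfaces, i.e. through each of its points there passes a germ of a
complex hypersurface contained in it. -/
def IsLeviFlat (S : Set E) : Prop :=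
  ∀ q ∈ S, HasComplexHypersurfaceGermIn S q

/-- `f` is of class `C^{1,β}` on `s`. -/
def IsC1HolderOn {X Y : Type*} [NormedAddCommGroup X] [NormedSpace ℝ X]
    [NormedAddCommGroup Y] [NormedSpace ℝ Y] (β : NNReal) (f : X → Y)
    (s : Set X) : Prop :=
  ContDiffOn ℝ 1 f s ∧ ∃ C : NNReal, HolderOnWith C β (fderivWithin ℝ f s) s

/-- A continuous CR function on a smooth hypersurface `S`: continuous on `S`
and locally a uniform limit on `S` of holomorphic functions
(Baouendi–Trèves characterization). -/
def ContinuousCRFunctionOn (S : Set E) (ψ : E → ℂ) : Prop :=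
  ContinuousOn ψ S ∧ ∀ p ∈ S, ∃ U : Set E, IsOpen U ∧ p ∈ U ∧
    ∃ Fs : ℕ → E → ℂ, (∀ k, DifferentiableOn ℂ (Fs k) U) ∧
      TendstoUniformlyOn (fun k => Fs k) ψ atTop (S ∩ U)

end Basic

section Series

variable {m : ℕ}

/-- Total degree of a multiindex `β ∈ ℕ^m`. -/
def mdeg (β : Fin m → ℕ) : ℕ := ∑ i, β i

/-- Monomial `w^β`. -/
def mpow (w : Fin m → ℂ) (β : Fin m → ℕ) : ℂ := ∏ i, w i ^ β i

/-- Componentwise conjugation of `w ∈ ℂ^m`. -/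
def conjW (w : Fin m → ℂ) : Fin m → ℂ := fun i => starRingEnd ℂ (w i)

/-- Componentwise conjugation on `ℂ^{m+1}`. -/
def conjCS (t : CS m) : CS m := (conjW t.1, starRingEnd ℂ t.2)

/-- The series `Θ(ζ, t) = Σ_β ζ^β Θ_β(t)`. -/
def ThetaSum (Θ : (Fin m → ℕ) → CS m → ℂ) (ζ : Fin m → ℂ) (t : CS m) : ℂ :=
  ∑' β : Fin m → ℕ, mpow ζ β * Θ β t

/-- The conjugate series `Θ̄(w, τ) = Σ_β w^β conj(Θ_β(τ̄))`. -/
def ThetaBar (Θ : (Fin m → ℕ) → CS m → ℂ) (w : Fin m → ℂ) (τ : CS m) : ℂ :=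
  ∑' β : Fin m → ℕ, mpow w β * starRingEnd ℂ (Θ β (conjCS τ))

/-- Defining data for a hypersurface through `0`: a family of coefficient
functions `Θ_β`, a radius `r` and a constant `C`. -/
structure DefData (m : ℕ) where
  Θ : (Fin m → ℕ) → CS m → ℂ
  r : ℝ
  C : ℝ

/-- `d` is a normally convergent complex defining series for `M` near the
origin, i.e. in suitable holomorphic coordinates vanishing at the reference
point, `M = {(w, z) : z̄ = Θ(w̄, (w, z)) = Σ_β w̄^β Θ_β(w, z)}`, where the
coefficients are holomorphic on the polydisc of radius `2r` and satisfy the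
normal-convergence Cauchy estimates `|Θ_β| ≤ C / (2r)^{|β|}` there, and the
series vanishes at the origin. -/
def DefData.IsDefiningSeriesOf (d : DefData m) (M : Set (CS m)) : Prop :=
  0 < d.r ∧ 0 < d.C ∧
  (∀ β, DifferentiableOn ℂ (d.Θ β) (ball (0 : CS m) (2 * d.r))) ∧
  (∀ β, ∀ t ∈ ball (0 : CS m) (2 * d.r), ‖d.Θ β t‖ ≤ d.C / (2 * d.r) ^ mdeg β) ∧
  d.Θ 0 0 = 0 ∧
  ∀ t ∈ ball (0 : CS m) d.r,
    (t ∈ M ↔ starRingEnd ℂ t.2 = ThetaSum d.Θ (conjW t.1) t)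

/-- The Segre variety `S_{q̄}` of a point `q`, inside the polydisc of radius
`r`: `S_{q̄} = {(w, z) : z = Σ_β w^β conj(Θ_β(q))}`. -/
def segreVariety (Θ : (Fin m → ℕ) → CS m → ℂ) (r : ℝ) (q : CS m) : Set (CS m) :=
  {t ∈ ball (0 : CS m) r |
    t.2 = ∑' β : Fin m → ℕ, mpow t.1 β * starRingEnd ℂ (Θ β q)}

/-- The reflection function `R'_h(t, ν̄') = μ̄' - Σ_β λ̄'^β Θ'_β(h(t))` extends
holomorphically to a neighborhood of `(p, p̄')` in `ℂⁿ × ℂⁿ`. -/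
def ReflectionExtendsAt (Θ : (Fin m → ℕ) → CS m → ℂ) (h : CS m → CS m)
    (M : Set (CS m)) (p p' : CS m) : Prop :=
  ∃ r > (0 : ℝ), ∃ R : CS m × CS m → ℂ,
    DifferentiableOn ℂ R (ball p r ×ˢ ball (conjCS p') r) ∧
    ∀ t ∈ M ∩ ball p r, ∀ ν ∈ ball (conjCS p') r,
      R (t, ν) = ν.2 - ∑' β : Fin m → ℕ, mpow ν.1 β * Θ β (h t)

/-- All the components `Θ_β ∘ h` of the reflection function extend
holomorphically to a common neighborhood of `q`, with uniform Cauchy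
estimates `|Θ_β(h(t))| < C^{|β|+1}`; i.e. the reflection function is real
analytic at `q`. -/
def ReflectionAnalyticAt (Θ : (Fin m → ℕ) → CS m → ℂ) (h : CS m → CS m)
    (M : Set (CS m)) (q : CS m) : Prop :=
  ∃ r C : ℝ, 0 < r ∧ 0 < C ∧ ∃ φ : (Fin m → ℕ) → CS m → ℂ,
    (∀ β, DifferentiableOn ℂ (φ β) (ball q r)) ∧
    (∀ β, ∀ t ∈ M ∩ ball q r, φ β t = Θ β (h t)) ∧
    ∀ β, ∀ t ∈ ball q r, ‖φ β t‖ < C ^ (mdeg β + 1)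

end Series

section Jets

variable {m : ℕ}

/-- Partial derivative in the direction of the `i`-th `w`-coordinate. -/
def pderivW (i : Fin m) (f : CS m → ℂ) : CS m → ℂ :=
  fun t => fderiv ℂ f t (Pi.single i 1, 0)

def pderivList : List (Fin m) → (CS m → ℂ) → CS m → ℂ
  | [], f => f
  | i :: L, f => pderivW i (pderivList L f)

def indexList (β : Fin m → ℕ) : List (Fin m) :=
  (List.finRange m).flatMap fun i => List.replicate (β i) i

/-- The iterated partial derivative `∂_w^β f`. -/
def pderivMulti (β : Fin m → ℕ) (f : CS m → ℂ) : CS m → ℂ :=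
  pderivList (indexList β) f

/-- The morphism of `k`-jets of Segre varieties
`φ'_k : (t', τ') ↦ (t', (∂^β_{w'}[z' − Θ̄'(w', τ')](t'))_{|β| ≤ k})`, written in
the holomorphic parametrization `(t, ζ) ↦ (t, (ζ, Θ(ζ, t)))` of the extrinsic
complexification `M^c`. -/
def segreJetMap (Θ : (Fin m → ℕ) → CS m → ℂ) (k : ℕ) :
    CS m × (Fin m → ℂ) → CS m × ((Fin m → Fin (k + 1)) → ℂ) :=
  fun p =>
    (p.1, fun β =>
      if mdeg (fun i => (β i : ℕ)) ≤ k then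
        pderivMulti (fun i => (β i : ℕ))
          (fun s => s.2 - ThetaBar Θ s.1 (p.2, ThetaSum Θ p.2 p.1)) p.1
      else 0)

/-- The rank of the differential of a map at a point. -/
def mapRankAt {X Y : Type*} [NormedAddCommGroup X] [NormedSpace ℂ X]
    [NormedAddCommGroup Y] [NormedSpace ℂ Y] (f : X → Y) (p : X) : ℕ :=
  Module.finrank ℂ (LinearMap.range (fderiv ℂ f p).toLinearMap)

/-- Parameter domain for the complexification. -/
def segreDomain (m : ℕ) (r : ℝ) : Set (CS m × (Fin m → ℂ)) :=
  {p | ‖p.1‖ < r ∧ ‖p.2‖ < r}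

/-- The morphism of `k`-jets of Segre varieties has generic rank `ρ`. -/
def SegreGenericRank (Θ : (Fin m → ℕ) → CS m → ℂ) (r : ℝ) (k ρ : ℕ) : Prop :=
  (∀ p ∈ segreDomain m r, mapRankAt (segreJetMap Θ k) p ≤ ρ) ∧
  ∃ p ∈ segreDomain m r, mapRankAt (segreJetMap Θ k) p = ρ

/-- The `k`-jet morphism has locally constant rank `ρ` in a neighborhood of the
point of the complexification corresponding to `(q, q̄)`. -/
def SegreConstRankNear (Θ : (Fin m → ℕ) → CS m → ℂ) (k ρ : ℕ) (q : CS m) : Prop :=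
  ∀ᶠ p in 𝓝 (q, conjW q.1), mapRankAt (segreJetMap Θ k) p = ρ

/-- Normal form of a defining series with respect to the splitting
`t' = (w', v', z') ∈ ℂ^a × ℂ^{m-a} × ℂ`: the series involves no `v̄'` and its
coefficients are independent of `v'`. -/
def NormalFormSeries (a : ℕ) (Θ : (Fin m → ℕ) → CS m → ℂ) : Prop :=
  (∀ β : Fin m → ℕ, (∃ i : Fin m, a ≤ (i : ℕ) ∧ β i ≠ 0) → Θ β = 0) ∧
  ∀ β, ∀ s t : CS m, (∀ i : Fin m, (i : ℕ) < a → s.1 i = t.1 i) → s.2 = t.2 →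
    Θ β s = Θ β t

def extendIdx (m a : ℕ) (β : Fin a → ℕ) : Fin m → ℕ :=
  fun i => if h : (i : ℕ) < a then β ⟨i, h⟩ else 0

def embedCS (m a : ℕ) (t : CS a) : CS m :=
  ((fun i => if h : (i : ℕ) < a then t.1 ⟨i, h⟩ else 0), t.2)

/-- The defining series of the reduced hypersurface `M̲' ⊆ ℂ^{a+1}` underlying
a series in normal form. -/
def reducedSeries (m a : ℕ) (Θ : (Fin m → ℕ) → CS m → ℂ) :
    (Fin a → ℕ) → CS a → ℂ :=
  fun β t => Θ (extendIdx m a β) (embedCS m a t)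

end Jets

/-! ### Part A: several complex variables tools -/

theorem taylor2_bound {g : ℂ → ℂ} {R K : ℝ} (hR : 0 < R)
    (hg : DifferentiableOn ℂ g (ball 0 R)) (hK : ∀ s ∈ ball (0 : ℂ) R, ‖g s‖ ≤ K)
    {s : ℂ} (hs : s ∈ ball (0 : ℂ) R) :
    ‖g s - g 0 - s * deriv g 0‖ ≤ 4 * K / R ^ 2 * ‖s‖ ^ 2 := by
  have h0 : (0 : ℂ) ∈ ball (0 : ℂ) R := mem_ball_self hR
  have h1 : ∀ z ∈ ball (0 : ℂ) R, ‖dslope g 0 z‖ ≤ 2 * K / R := by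
    intro z hz
    refine norm_dslope_le_div_of_mapsTo_ball hg ?_ hz
    intro u hu
    rw [mem_closedBall, dist_eq_norm]
    calc ‖g u - g 0‖ ≤ ‖g u‖ + ‖g 0‖ := norm_sub_le _ _
      _ ≤ K + K := add_le_add (hK u hu) (hK 0 h0)
      _ = 2 * K := by ring
  have hd : DifferentiableOn ℂ (dslope g 0) (ball 0 R) :=
    (differentiableOn_dslope (ball_mem_nhds _ hR)).2 hg
  have h2 : ‖dslope (dslope g 0) 0 s‖ ≤ (4 * K / R) / R := by
    refine norm_dslope_le_div_of_mapsTo_ball hd ?_ hs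
    intro u hu
    rw [mem_closedBall, dist_eq_norm]
    calc ‖dslope g 0 u - dslope g 0 0‖ ≤ ‖dslope g 0 u‖ + ‖dslope g 0 0‖ := norm_sub_le _ _
      _ ≤ 2 * K / R + 2 * K / R := add_le_add (h1 u hu) (h1 0 h0)
      _ = 4 * K / R := by ring
  have e1 : s * dslope g 0 s = g s - g 0 := by simpa using sub_smul_dslope g 0 s
  have e2 : s * dslope (dslope g 0) 0 s = dslope g 0 s - deriv g 0 := by
    simpa using sub_smul_dslope (dslope g 0) 0 s
  have e3 : g s - g 0 - s * deriv g 0 = s ^ 2 * dslope (dslope g 0) 0 s := by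
    rw [← e1]; linear_combination (-s) * e2
  rw [e3, norm_mul, norm_pow]
  calc ‖s‖ ^ 2 * ‖dslope (dslope g 0) 0 s‖ ≤ ‖s‖ ^ 2 * (4 * K / R / R) := by gcongr
    _ = 4 * K / R ^ 2 * ‖s‖ ^ 2 := by field_simp

section Osgood
variable {E : Type*} [NormedAddCommGroup E] [NormedSpace ℂ E]

theorem line_diff_shift {U : Set E} {f : E → ℂ}
    (hl : ∀ x ∈ U, ∀ v, LineDifferentiableAt ℂ f x v) {x v : E} {s : ℂ} (hs : x + s • v ∈ U) :
    DifferentiableAt ℂ (fun s : ℂ => f (x + s • v)) s := by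
  have h := hl _ hs v
  unfold LineDifferentiableAt at h
  have h2 : DifferentiableAt ℂ (fun t : ℂ => t - s) s := by fun_prop
  have h3 : DifferentiableAt ℂ ((fun t : ℂ => f (x + s • v + t • v)) ∘ fun t : ℂ => t - s) s := by
    apply DifferentiableAt.comp _ _ h2
    simpa using h
  refine h3.congr_of_eventuallyEq (Eventually.of_forall fun t => ?_)
  simp only [Function.comp]
  congr 1
  rw [add_assoc, ← add_smul]; simp

theorem osgood {U : Set E} (hU : IsOpen U) {f : E → ℂ} (hc : ContinuousOn f U)
    (hl : ∀ x ∈ U, ∀ v, LineDifferentiableAt ℂ f x v) : DifferentiableOn ℂ f U := by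
  intro x hx
  apply DifferentiableAt.differentiableWithinAt
  -- local boundedness
  obtain ⟨ρ, hρ, K, hb⟩ : ∃ ρ > 0, ∃ K : ℝ, ∀ y ∈ ball x (2 * ρ), y ∈ U ∧ ‖f y‖ ≤ K := by
    have h1 : ∀ᶠ y in 𝓝 x, ‖f y‖ < ‖f x‖ + 1 :=
      ((hc.continuousAt (hU.mem_nhds hx)).norm).eventually_lt_const (by linarith)
    obtain ⟨ρ, hρ, h⟩ := Metric.eventually_nhds_iff_ball.1 (h1.and (hU.mem_nhds hx))
    exact ⟨ρ / 2, by positivity, ‖f x‖ + 1, fun y hy => by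
      have := h y (by convert hy using 2; ring)
      exact ⟨this.2, this.1.le⟩⟩
  set C : ℝ := 4 * K / ρ ^ 2 with hC
  have hrem : ∀ y ∈ ball x ρ, ∀ v : E, ‖v‖ < ρ →
      ‖f (y + v) - f y - lineDeriv ℂ f y v‖ ≤ C * ‖v‖ ^ 2 := by
    intro y hy v hv
    rcases eq_or_ne v 0 with rfl | hv0
    · simp [lineDeriv]
    have hvp : 0 < ‖v‖ := norm_pos_iff.2 hv0
    have hmem : ∀ s ∈ ball (0 : ℂ) (ρ / ‖v‖), y + s • v ∈ ball x (2 * ρ) := by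
      intro s hs
      rw [mem_ball, dist_eq_norm] at hy ⊢
      rw [mem_ball_zero_iff, lt_div_iff₀ hvp] at hs
      calc ‖y + s • v - x‖ = ‖(y - x) + s • v‖ := by congr 1; abel
        _ ≤ ‖y - x‖ + ‖s • v‖ := norm_add_le _ _
        _ < ρ + ρ := by rw [norm_smul]; exact add_lt_add hy hs
        _ = 2 * ρ := by ring
    have := taylor2_bound (g := fun s : ℂ => f (y + s • v)) (R := ρ / ‖v‖) (K := K) (by positivity)
      (fun s hs => (line_diff_shift hl (hb _ (hmem s hs)).1).differentiableWithinAt)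
      (fun s hs => (hb _ (hmem s hs)).2) (s := 1)
      (by rw [mem_ball_zero_iff, norm_one, lt_div_iff₀ hvp]; simpa using hv)
    simp only [one_smul, zero_smul, add_zero, one_mul, norm_one] at this
    rw [lineDeriv]
    refine this.trans (le_of_eq ?_)
    rw [hC]; field_simp
  have hLs : ∀ (y v : E) (s : ℂ), lineDeriv ℂ f y (s • v) = s * lineDeriv ℂ f y v := by
    intro y v s; rw [lineDeriv_smul]; rfl
  -- difference quotients
  have hquot : ∀ y ∈ ball x ρ, ∀ v : E, ∀ s : ℂ, s ≠ 0 → ‖s • v‖ < ρ →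
      ‖(f (y + s • v) - f y) / s - lineDeriv ℂ f y v‖ ≤ C * ‖v‖ ^ 2 * ‖s‖ := by
    intro y hy v s hs hsv
    have h := hrem y hy (s • v) hsv
    rw [hLs] at h
    have hsp : 0 < ‖s‖ := norm_pos_iff.2 hs
    have e : (f (y + s • v) - f y) / s - lineDeriv ℂ f y v
        = (f (y + s • v) - f y - s * lineDeriv ℂ f y v) / s := by field_simp
    rw [e, norm_div, div_le_iff₀ hsp]
    refine h.trans (le_of_eq ?_)
    rw [norm_smul]; ring
  have hcontL : ∀ v : E, ContinuousAt (fun y => lineDeriv ℂ f y v) x := by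
    intro v
    rw [Metric.continuousAt_iff']
    intro ε hε
    -- choose s
    obtain ⟨s, hs0, hsv, hsC⟩ : ∃ s : ℂ, s ≠ 0 ∧ ‖s • v‖ < ρ ∧ C * ‖v‖ ^ 2 * ‖s‖ < ε / 3 := by
      have h1 : Tendsto (fun s : ℂ => ‖s • v‖) (𝓝[≠] 0) (𝓝 0) := by
        have : Continuous fun s : ℂ => ‖s • v‖ := by fun_prop
        simpa using (this.tendsto 0).mono_left nhdsWithin_le_nhds
      have h2 : Tendsto (fun s : ℂ => C * ‖v‖ ^ 2 * ‖s‖) (𝓝[≠] 0) (𝓝 0) := by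
        have : Continuous fun s : ℂ => C * ‖v‖ ^ 2 * ‖s‖ := by fun_prop
        simpa using (this.tendsto 0).mono_left nhdsWithin_le_nhds
      obtain ⟨s, hs⟩ := ((h1.eventually_lt_const hρ).and
        ((h2.eventually_lt_const (by positivity : 0 < ε / 3)).and self_mem_nhdsWithin)).exists
      exact ⟨s, hs.2.2, hs.1, hs.2.1⟩
    have hxs : x + s • v ∈ U := by
      refine (hb _ ?_).1
      rw [mem_ball, dist_eq_norm]; simp only [add_sub_cancel_left]; linarith
    have hq : ContinuousAt (fun y => (f (y + s • v) - f y) / s) x := by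
      have a1 : ContinuousAt (fun y => f (y + s • v)) x :=
        ContinuousAt.comp (f := fun y => y + s • v) (hc.continuousAt (hU.mem_nhds hxs)) (by fun_prop)
      exact (a1.sub (hc.continuousAt (hU.mem_nhds hx))).div_const _
    filter_upwards [Metric.continuousAt_iff'.1 hq (ε / 3) (by positivity), ball_mem_nhds x hρ]
      with y h1 h2
    have b1 := hquot y h2 v s hs0 hsv
    have b2 := hquot x (mem_ball_self hρ) v s hs0 hsv
    rw [dist_eq_norm] at h1 ⊢
    have : lineDeriv ℂ f y v - lineDeriv ℂ f x v =
        -((f (y + s • v) - f y) / s - lineDeriv ℂ f y v)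
        + ((f (y + s • v) - f y) / s - (f (x + s • v) - f x) / s)
        + ((f (x + s • v) - f x) / s - lineDeriv ℂ f x v) := by ring
    rw [this]
    refine (norm_add₃_le).trans_lt ?_
    rw [norm_neg]
    linarith
  have hadd : ∀ u v : E, lineDeriv ℂ f x (u + v) = lineDeriv ℂ f x u + lineDeriv ℂ f x v := by
    intro u v
    have small : ∀ u : E, ∀ᶠ s : ℂ in 𝓝[≠] 0, ‖s • u‖ < ρ := by
      intro u
      have h1 : Tendsto (fun s : ℂ => ‖s • u‖) (𝓝[≠] 0) (𝓝 0) := by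
        have : Continuous fun s : ℂ => ‖s • u‖ := by fun_prop
        simpa using (this.tendsto 0).mono_left nhdsWithin_le_nhds
      exact h1.eventually_lt_const hρ
    have hto : ∀ (b : ℂ → E) (_ : ∀ᶠ s in 𝓝[≠] (0 : ℂ), b s ∈ ball x ρ)
        (_ : Tendsto b (𝓝[≠] 0) (𝓝 x)) (v : E),
        Tendsto (fun s : ℂ => (f (b s + s • v) - f (b s)) / s) (𝓝[≠] 0)
          (𝓝 (lineDeriv ℂ f x v)) := by
      intro b hbm hbt v
      have t1 : Tendsto (fun s : ℂ => (f (b s + s • v) - f (b s)) / s - lineDeriv ℂ f (b s) v)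
          (𝓝[≠] 0) (𝓝 0) := by
        apply squeeze_zero_norm' (a := fun s => C * ‖v‖ ^ 2 * ‖s‖)
        · filter_upwards [hbm, small v, self_mem_nhdsWithin] with s h1 h2 h3
          exact hquot _ h1 v s h3 h2
        · have : Continuous fun s : ℂ => C * ‖v‖ ^ 2 * ‖s‖ := by fun_prop
          simpa using (this.tendsto 0).mono_left nhdsWithin_le_nhds
      have t2 : Tendsto (fun s => lineDeriv ℂ f (b s) v) (𝓝[≠] (0 : ℂ)) (𝓝 (lineDeriv ℂ f x v)) :=
        (hcontL v).tendsto.comp hbt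
      simpa using t1.add t2
    have c1 := hto (fun _ => x) (Eventually.of_forall fun _ => mem_ball_self hρ)
      tendsto_const_nhds (u + v)
    have c2 := hto (fun _ => x) (Eventually.of_forall fun _ => mem_ball_self hρ)
      tendsto_const_nhds u
    have c3 := hto (fun s => x + s • u)
      (by filter_upwards [small u] with s hs; simpa [dist_eq_norm] using hs)
      (by
        have : Continuous fun s : ℂ => x + s • u := by fun_prop
        simpa using (this.tendsto 0).mono_left nhdsWithin_le_nhds) v
    refine tendsto_nhds_unique c1 ((c2.add c3).congr fun s => ?_)
    rw [smul_add, ← add_assoc]; ring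
  have hbd : ∀ v, ‖lineDeriv ℂ f x v‖ ≤ (2 * K / ρ) * ‖v‖ := by
    intro v
    have hK0 : 0 ≤ K := (norm_nonneg _).trans (hb x (mem_ball_self (by positivity))).2
    rcases eq_or_ne v 0 with rfl | hv0
    · have := hLs x 0 0; simp at this; simp [this]
    have hvp : 0 < ‖v‖ := norm_pos_iff.2 hv0
    have hmem : ∀ s ∈ ball (0 : ℂ) (ρ / ‖v‖), x + s • v ∈ ball x (2 * ρ) := by
      intro s hs
      rw [mem_ball_zero_iff, lt_div_iff₀ hvp] at hs
      rw [mem_ball, dist_eq_norm, add_sub_cancel_left, norm_smul]; linarith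
    have := norm_deriv_le_div_of_mapsTo_ball (f := fun s : ℂ => f (x + s • v)) (c := 0)
      (R₁ := ρ / ‖v‖) (R₂ := 2 * K)
      (fun s hs => (line_diff_shift hl (hb _ (hmem s hs)).1).differentiableWithinAt)
      (by
        intro s hs
        rw [mem_closedBall, dist_eq_norm]
        calc _ ≤ ‖f (x + s • v)‖ + ‖f (x + (0 : ℂ) • v)‖ := norm_sub_le _ _
          _ ≤ K + K := add_le_add (hb _ (hmem s hs)).2
            (hb _ (hmem 0 (mem_ball_self (by positivity)))).2
          _ = 2 * K := by ring) (by positivity)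
    rw [lineDeriv]
    refine this.trans (le_of_eq ?_)
    field_simp
  let L : E →L[ℂ] ℂ := LinearMap.mkContinuous
    { toFun := fun v => lineDeriv ℂ f x v
      map_add' := hadd
      map_smul' := fun s v => by rw [hLs]; rfl } (2 * K / ρ) hbd
  have hL : ∀ v, L v = lineDeriv ℂ f x v := fun v => rfl
  refine ⟨L, ?_⟩
  rw [hasFDerivAt_iff_isLittleO_nhds_zero]
  have hO : (fun v => f (x + v) - f x - L v) =O[𝓝 0] fun v => ‖v‖ ^ 2 := by
    apply Asymptotics.IsBigO.of_bound C
    filter_upwards [ball_mem_nhds (0 : E) hρ] with v hv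
    rw [hL, norm_pow, norm_norm]
    exact hrem x (mem_ball_self hρ) v (by simpa using hv)
  refine hO.trans_isLittleO ?_
  have := Asymptotics.isLittleO_norm_pow_id (E' := E) (n := 2) (by norm_num)
  exact this

end Osgood

section ParamInt
open MeasureTheory
variable {E : Type*} [NormedAddCommGroup E] [NormedSpace ℂ E]

theorem cauchy_deriv_bound {g : ℂ → ℂ} {c : ℂ} {R K : ℝ} (hR : 0 < R)
    (hg : DifferentiableOn ℂ g (ball c R)) (hK : ∀ s ∈ ball c R, ‖g s‖ ≤ K) :
    ‖deriv g c‖ ≤ 2 * K / R := by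
  refine norm_deriv_le_div_of_mapsTo_ball hg ?_ hR
  intro u hu
  rw [mem_closedBall, dist_eq_norm]
  calc ‖g u - g c‖ ≤ ‖g u‖ + ‖g c‖ := norm_sub_le _ _
    _ ≤ K + K := add_le_add (hK u hu) (hK c (mem_ball_self hR))
    _ = 2 * K := by ring

theorem hol_param_integral [ProperSpace E] {Y : Type*} [TopologicalSpace Y] [T2Space Y]
    [MeasurableSpace Y] [BorelSpace Y] {μ : Measure Y} [IsFiniteMeasureOnCompacts μ]
    {K : Set Y} (hK : IsCompact K) {U : Set E} (hU : IsOpen U) {f : Y → E → ℂ}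
    (hf : ContinuousOn (fun q : Y × E => f q.1 q.2) (K ×ˢ U))
    (hol : ∀ y ∈ K, DifferentiableOn ℂ (f y) U) :
    DifferentiableOn ℂ (fun x => ∫ y in K, f y x ∂μ) U := by
  have hKm : MeasurableSet K := hK.measurableSet
  have hfin : IsFiniteMeasure (μ.restrict K) := ⟨by
    rw [Measure.restrict_apply_univ]; exact hK.measure_lt_top⟩
  have hmeas : ∀ x ∈ U, AEStronglyMeasurable (fun y => f y x) (μ.restrict K) := by
    intro x hx
    have : ContinuousOn (fun y => f y x) K :=
      hf.comp (f := fun y => (y, x)) (by fun_prop) (fun y hy => ⟨hy, hx⟩)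
    exact this.aestronglyMeasurable hKm
  have hloc : ∀ x ∈ U, ∃ ρ > 0, ∃ C : ℝ, ∀ z ∈ ball x ρ, z ∈ U ∧ ∀ y ∈ K, ‖f y z‖ ≤ C := by
    intro x hx
    obtain ⟨ρ, hρ, hb⟩ := Metric.nhds_basis_closedBall.mem_iff.1 (hU.mem_nhds hx)
    obtain ⟨C, hC⟩ := (hK.prod (isCompact_closedBall x ρ)).exists_bound_of_continuousOn
      (hf.mono (prod_mono_right hb))
    exact ⟨ρ, hρ, C, fun z hz => ⟨hb (ball_subset_closedBall hz),
      fun y hy => hC (y, z) ⟨hy, ball_subset_closedBall hz⟩⟩⟩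
  apply osgood hU
  · intro x hx
    apply ContinuousAt.continuousWithinAt
    obtain ⟨ρ, hρ, C, hb⟩ := hloc x hx
    apply continuousAt_of_dominated (bound := fun _ => C)
    · filter_upwards [hU.mem_nhds hx] with z hz using hmeas z hz
    · filter_upwards [ball_mem_nhds x hρ] with z hz
      filter_upwards [ae_restrict_mem hKm] with y hy using (hb z hz).2 y hy
    · exact integrable_const C
    · filter_upwards [ae_restrict_mem hKm] with y hy
      exact ((hol y hy).continuousOn).continuousAt (hU.mem_nhds hx)
  · intro x hx v
    obtain ⟨ρ, hρ, C, hb⟩ := hloc x hx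
    obtain ⟨δ, hδ, hδb⟩ : ∃ δ > 0, ∀ s ∈ ball (0 : ℂ) (2 * δ), x + s • v ∈ ball x ρ := by
      have h1 : ContinuousAt (fun s : ℂ => x + s • v) 0 := by fun_prop
      have h2 : ∀ᶠ s in 𝓝 (0 : ℂ), x + s • v ∈ ball x ρ :=
        h1.eventually (by
          have : ∀ᶠ y in 𝓝 x, y ∈ ball x ρ := ball_mem_nhds x hρ
          simpa only [zero_smul, add_zero] using this)
      obtain ⟨δ, hδ, h⟩ := Metric.eventually_nhds_iff_ball.1 h2
      exact ⟨δ / 2, by positivity, fun s hs => h s (by convert hs using 2; ring)⟩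
    have hd : ∀ y ∈ K, DifferentiableOn ℂ (fun s : ℂ => f y (x + s • v)) (ball 0 (2 * δ)) := by
      intro y hy
      apply DifferentiableOn.comp (t := U) (hol y hy)
      · fun_prop
      · intro s hs; exact (hb _ (hδb s hs)).1
    have hda : ∀ y ∈ K, ∀ s ∈ ball (0 : ℂ) (2 * δ),
        DifferentiableAt ℂ (fun s : ℂ => f y (x + s • v)) s := fun y hy s hs =>
      (hd y hy).differentiableAt (isOpen_ball.mem_nhds hs)
    have key := hasDerivAt_integral_of_dominated_loc_of_deriv_le (μ := μ.restrict K) (𝕜 := ℂ)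
      (F := fun (s : ℂ) y => f y (x + s • v)) (x₀ := 0) (s := ball 0 δ)
      (bound := fun _ => 2 * C / δ)
      (F' := fun s y => deriv (fun s : ℂ => f y (x + s • v)) s) (ball_mem_nhds _ hδ)
      (by
        filter_upwards [ball_mem_nhds (0 : ℂ) (by positivity : 0 < 2 * δ)] with s hs
        exact hmeas _ (hb _ (hδb s hs)).1)
      (by
        refine Integrable.of_bound (hmeas _ (hb _ (hδb 0 (mem_ball_self (by positivity)))).1) C ?_
        filter_upwards [ae_restrict_mem hKm] with y hy
        exact (hb _ (hδb 0 (mem_ball_self (by positivity)))).2 y hy)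
      (by
        -- limit of difference quotients
        have hseq : Tendsto (fun n : ℕ => ((1 : ℂ) / ((n : ℂ) + 1))) atTop (𝓝[≠] 0) := by
          apply tendsto_nhdsWithin_of_tendsto_nhds_of_eventually_within
          · exact_mod_cast tendsto_one_div_add_atTop_nhds_zero_nat (𝕜 := ℂ)
          · refine Eventually.of_forall fun n => ?_
            have : (n : ℂ) + 1 ≠ 0 := by exact_mod_cast Nat.succ_ne_zero n
            simp only [mem_compl_iff, mem_singleton_iff]
            exact one_div_ne_zero this
        have hev : ∀ᶠ n : ℕ in atTop, ((1 : ℂ) / ((n : ℂ) + 1)) ∈ ball (0 : ℂ) (2 * δ) :=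
          (hseq.mono_right nhdsWithin_le_nhds).eventually (ball_mem_nhds _ (by positivity))
        obtain ⟨N, hN⟩ := eventually_atTop.1 hev
        refine aestronglyMeasurable_of_tendsto_ae atTop
          (f := fun (n : ℕ) y => (((1 : ℂ) / (((n + N : ℕ) : ℂ) + 1)))⁻¹ *
            (f y (x + ((1 : ℂ) / (((n + N : ℕ) : ℂ) + 1)) • v) - f y (x + (0 : ℂ) • v))) ?_ ?_
        · intro n
          apply AEStronglyMeasurable.const_mul
          exact (hmeas _ (hb _ (hδb _ (hN _ (by omega)))).1).sub
            (hmeas _ (hb _ (hδb 0 (mem_ball_self (by positivity)))).1)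
        · filter_upwards [ae_restrict_mem hKm] with y hy
          have h1 := (hda y hy 0 (mem_ball_self (by positivity))).hasDerivAt
          rw [hasDerivAt_iff_tendsto_slope] at h1
          have h2 := h1.comp (hseq.comp (tendsto_add_atTop_nat N))
          refine h2.congr fun n => ?_
          simp only [Function.comp, slope, vsub_eq_sub, sub_zero, smul_eq_mul])
      (by
        filter_upwards [ae_restrict_mem hKm] with y hy
        intro s hs
        have hsub : ball s δ ⊆ ball (0 : ℂ) (2 * δ) := by
          apply ball_subset_ball'
          rw [mem_ball] at hs; linarith
        refine cauchy_deriv_bound hδ ((hd y hy).mono hsub) ?_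
        intro u hu
        exact (hb _ (hδb _ (hsub hu))).2 y hy)
      (integrable_const _)
      (by
        filter_upwards [ae_restrict_mem hKm] with y hy
        intro s hs
        exact (hda y hy s (ball_subset_ball (by linarith) hs)).hasDerivAt)
    exact key.2.differentiableAt

/-- Parametric circle integrals of holomorphic functions are holomorphic. -/
theorem hol_circleIntegral [ProperSpace E] {U : Set E} (hU : IsOpen U) {c : ℂ} {R : ℝ}
    (hR : 0 ≤ R) {f : ℂ → E → ℂ}
    (hf : ContinuousOn (fun q : ℂ × E => f q.1 q.2) (sphere c R ×ˢ U))
    (hol : ∀ u ∈ sphere c R, DifferentiableOn ℂ (f u) U) :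
    DifferentiableOn ℂ (fun x => ∮ u in C(c, R), f u x) U := by
  have h : ∀ x, (∮ u in C(c, R), f u x) =
      ∫ θ in Icc (0 : ℝ) (2 * Real.pi), deriv (circleMap c R) θ • f (circleMap c R θ) x := by
    intro x
    rw [circleIntegral, intervalIntegral.integral_of_le (by positivity),
      integral_Icc_eq_integral_Ioc]
  simp_rw [h]
  have hm : ∀ θ, circleMap c R θ ∈ sphere c R := fun θ => circleMap_mem_sphere c hR θ
  apply hol_param_integral isCompact_Icc hU
  · apply ContinuousOn.fun_smul
    · simp only [deriv_circleMap]; fun_prop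
    · exact hf.comp (f := fun q : ℝ × E => (circleMap c R q.1, q.2)) (by fun_prop)
        (fun q hq => ⟨hm _, hq.2⟩)
  · intro θ _
    exact (hol _ (hm θ)).fun_const_smul _

/-- Directional derivatives of holomorphic functions are holomorphic. -/
theorem hol_fderiv_apply [ProperSpace E] {U : Set E} (hU : IsOpen U) {f : E → ℂ}
    (hf : DifferentiableOn ℂ f U) (v : E) :
    DifferentiableOn ℂ (fun x => fderiv ℂ f x v) U := by
  intro x hx
  obtain ⟨ρ, hρ, hb⟩ := Metric.isOpen_iff.1 hU x hx
  -- choose radius of circle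
  obtain ⟨δ, hδ, hδv⟩ : ∃ δ > 0, δ * ‖v‖ < ρ / 2 := by
    refine ⟨ρ / (4 * (‖v‖ + 1)), by positivity, ?_⟩
    rw [div_mul_eq_mul_div, div_lt_iff₀ (by positivity)]
    nlinarith [norm_nonneg v]
  have hmem : ∀ z ∈ ball x (ρ / 2), ∀ u ∈ closedBall (0 : ℂ) δ, z + u • v ∈ U := by
    intro z hz u hu
    apply hb
    rw [mem_ball, dist_eq_norm] at hz ⊢
    rw [mem_closedBall_zero_iff] at hu
    calc ‖z + u • v - x‖ = ‖(z - x) + u • v‖ := by congr 1; abel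
      _ ≤ ‖z - x‖ + ‖u‖ * ‖v‖ := by rw [← norm_smul]; exact norm_add_le _ _
      _ < ρ / 2 + ρ / 2 := by
        have : ‖u‖ * ‖v‖ ≤ δ * ‖v‖ := by gcongr
        linarith
      _ = ρ := by ring
  have heq : ∀ z ∈ ball x (ρ / 2), fderiv ℂ f z v =
      (2 * Real.pi * I : ℂ)⁻¹ • ∮ u in C(0, δ), ((u - 0) ^ 2)⁻¹ • f (z + u • v) := by
    intro z hz
    have hz0 : z ∈ U := by simpa using hmem z hz 0 (by simp [hδ.le])
    have hV : IsOpen {u : ℂ | z + u • v ∈ U} := hU.preimage (by fun_prop)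
    rw [two_pi_I_inv_smul_circleIntegral_sub_sq_inv_smul_of_differentiable (U := {u : ℂ | z + u • v ∈ U})
      (f := fun u => f (z + u • v)) hV (fun u hu => hmem z hz u hu) ?_ (mem_ball_self hδ)]
    · have h1 : HasFDerivAt f (fderiv ℂ f z) (z + (0 : ℂ) • v) := by
        simpa using (hf.differentiableAt (hU.mem_nhds hz0)).hasFDerivAt
      have h2 : HasDerivAt (fun u : ℂ => z + u • v) v 0 := by
        simpa using ((hasDerivAt_id (0 : ℂ)).smul_const v).const_add z
      exact (h1.comp_hasDerivAt (0 : ℂ) h2).deriv.symm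
    · exact hf.comp (by fun_prop) (fun u hu => hu)
  have hd : DifferentiableOn ℂ (fun z => (2 * Real.pi * I : ℂ)⁻¹ •
      ∮ u in C(0, δ), ((u - 0) ^ 2)⁻¹ • f (z + u • v)) (ball x (ρ / 2)) := by
    apply DifferentiableOn.fun_const_smul
    apply hol_circleIntegral isOpen_ball hδ.le
    · apply ContinuousOn.fun_smul
      · apply ContinuousOn.inv₀ (by fun_prop)
        intro q hq
        have : q.1 ≠ 0 := by
          intro h0; have := hq.1; rw [h0] at this; simp at this; exact hδ.ne this
        simpa using this
      · exact hf.continuousOn.comp (f := fun q : ℂ × E => q.2 + q.1 • v) (by fun_prop)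
          (fun q hq => hmem _ hq.2 _ (sphere_subset_closedBall hq.1))
    · intro u hu
      apply DifferentiableOn.fun_const_smul
      exact hf.comp (by fun_prop) (fun z hz => hmem z hz u (sphere_subset_closedBall hu))
  have hx2 := ball_mem_nhds x (by positivity : 0 < ρ / 2)
  exact ((hd.differentiableAt hx2).congr_of_eventuallyEq
    (by filter_upwards [hx2] with z hz using heq z hz)).differentiableWithinAt

theorem hol_contDiffOn [FiniteDimensional ℂ E] {U : Set E} (hU : IsOpen U) (n : ℕ) :
    ∀ {f : E → ℂ}, DifferentiableOn ℂ f U → ContDiffOn ℂ n f U := by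
  have : ProperSpace E := FiniteDimensional.proper ℂ E
  induction n with
  | zero => intro f hf; exact contDiffOn_zero.2 hf.continuousOn
  | succ n ih =>
    intro f hf
    have : ((n + 1 : ℕ) : WithTop ℕ∞) = (n : WithTop ℕ∞) + 1 := by norm_cast
    rw [this, contDiffOn_succ_iff_fderiv_of_isOpen hU]
    refine ⟨hf, by simp, ?_⟩
    rw [contDiffOn_clm_apply]
    intro v
    exact ih (hol_fderiv_apply hU hf v)

theorem hol_contDiffOn_real [FiniteDimensional ℂ E] {U : Set E} (hU : IsOpen U) {f : E → ℂ}
    (hf : DifferentiableOn ℂ f U) : ContDiffOn ℝ (⊤ : ℕ∞) f U := by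
  rw [contDiffOn_infty]
  intro n
  exact (hol_contDiffOn hU n hf).restrict_scalars ℝ

/-- Locally bounded series of holomorphic functions. -/
theorem hol_tsum {U : Set E} (hU : IsOpen U) {ι : Type*} {F : ι → E → ℂ} {u : ι → ℝ}
    (hu : Summable u) (hF : ∀ i, DifferentiableOn ℂ (F i) U)
    (hb : ∀ i, ∀ x ∈ U, ‖F i x‖ ≤ u i) : DifferentiableOn ℂ (fun x => ∑' i, F i x) U := by
  apply osgood hU
  · exact continuousOn_tsum (fun i => (hF i).continuousOn) hu hb
  · intro x hx v
    have hV : IsOpen {s : ℂ | x + s • v ∈ U} := hU.preimage (by fun_prop)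
    have h0 : (0 : ℂ) ∈ {s : ℂ | x + s • v ∈ U} := by simpa using hx
    exact (differentiableOn_tsum_of_summable_norm (F := fun i (s : ℂ) => F i (x + s • v)) hu
      (fun i => (hF i).comp (by fun_prop) (fun s hs => hs)) hV
      (fun i s hs => hb i _ hs)).differentiableAt (hV.mem_nhds h0)

end ParamInt

section Hartogs
variable {P : Type*} [NormedAddCommGroup P] [NormedSpace ℂ P]

theorem hol_slice_deriv {V : Set P} {D : Set ℂ} (hV : IsOpen V) (hD : IsOpen D) {f : P × ℂ → ℂ}
    (hf : DifferentiableOn ℂ f (V ×ˢ D)) {p : P} {z : ℂ} (hp : p ∈ V) (hz : z ∈ D) :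
    HasDerivAt (fun z => f (p, z)) (fderiv ℂ f (p, z) (0, 1)) z := by
  have h1 := (hf.differentiableAt ((hV.prod hD).mem_nhds (mk_mem_prod hp hz))).hasFDerivAt
  have h2 : HasDerivAt (fun z : ℂ => ((p, z) : P × ℂ)) (0, 1) z :=
    (hasDerivAt_const z p).prodMk (hasDerivAt_id z)
  exact h1.comp_hasDerivAt z h2

theorem hartogs_extend [ProperSpace P] {V : Set P} (hV : IsOpen V) {zc : ℂ} {R r C : ℝ}
    (hr : 0 < r) {f : P × ℂ → ℂ}
    (ha : ∀ p ∈ V, DifferentiableOn ℂ (fun z => f (p, z)) (ball zc R))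
    (hb : ∀ p ∈ V, ∀ z ∈ ball zc R, ‖f (p, z)‖ ≤ C)
    (hc : DifferentiableOn ℂ f (V ×ˢ ball zc r)) :
    DifferentiableOn ℂ f (V ×ˢ ball zc R) := by
  -- iterated derivatives in `z`
  have key : ∀ n : ℕ, DifferentiableOn ℂ (fun q : P × ℂ => iteratedDeriv n (fun z => f (q.1, z)) q.2)
      (V ×ˢ ball zc r) := by
    intro n
    induction n with
    | zero => simpa using hc
    | succ n ih =>
      have := hol_fderiv_apply (hV.prod isOpen_ball) ih (0, 1)
      refine this.congr ?_
      rintro ⟨p, z⟩ ⟨hp, hz⟩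
      simp only [iteratedDeriv_succ]
      exact (hol_slice_deriv hV isOpen_ball ih hp hz).deriv
  have hcoef : ∀ n : ℕ, DifferentiableOn ℂ (fun p => iteratedDeriv n (fun z => f (p, z)) zc) V := by
    intro n
    exact (key n).comp (f := fun p : P => (p, zc)) (by fun_prop) (fun p hp => ⟨hp, mem_ball_self hr⟩)
  rintro ⟨p0, z0⟩ ⟨hp0, hz0⟩
  simp only at hp0 hz0
  rw [mem_ball] at hz0
  obtain ⟨R1, h1, h1'⟩ := exists_between hz0
  obtain ⟨R2, h2, h2'⟩ := exists_between h1'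
  have hR1 : 0 < R1 := dist_nonneg.trans_lt h1
  have hR2 : 0 < R2 := hR1.trans h2
  have hopen : IsOpen (V ×ˢ ball zc R1) := hV.prod isOpen_ball
  have hsum : DifferentiableOn ℂ (fun q : P × ℂ => ∑' n : ℕ,
      ((n.factorial : ℂ)⁻¹ * (q.2 - zc) ^ n * iteratedDeriv n (fun z => f (q.1, z)) zc))
      (V ×ˢ ball zc R1) := by
    refine hol_tsum hopen (u := fun n => C * (R1 / R2) ^ n) ?_ ?_ ?_
    · apply Summable.mul_left
      apply summable_geometric_of_lt_one (by positivity)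
      rw [div_lt_one hR2]; exact h2
    · intro n
      apply DifferentiableOn.fun_mul
      · fun_prop
      · exact (hcoef n).comp (f := fun q : P × ℂ => q.1) (by fun_prop) (fun q hq => hq.1)
    · rintro n ⟨p, z⟩ ⟨hp, hz⟩
      have hbn : ‖iteratedDeriv n (fun z => f (p, z)) zc‖ ≤ n.factorial * C / R2 ^ n := by
        apply norm_iteratedDeriv_le_of_forall_mem_sphere_norm_le n hR2
        · apply DifferentiableOn.diffContOnCl
          rw [closure_ball _ hR2.ne']
          exact (ha p hp).mono (closedBall_subset_ball h2')
        · intro z hz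
          exact hb p hp z ((sphere_subset_closedBall.trans (closedBall_subset_ball h2')) hz)
      simp only [norm_mul, norm_pow, norm_inv, RCLike.norm_natCast]
      simp only [mem_ball, dist_eq_norm] at hz
      have hC : 0 ≤ C := (norm_nonneg _).trans (hb p hp zc (mem_ball_self (hR2.trans h2')))
      calc ((n.factorial : ℝ))⁻¹ * ‖z - zc‖ ^ n * ‖iteratedDeriv n (fun z => f (p, z)) zc‖
          ≤ ((n.factorial : ℝ))⁻¹ * R1 ^ n * (n.factorial * C / R2 ^ n) := by gcongr
        _ = C * (R1 / R2) ^ n := by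
          have : (n.factorial : ℝ) ≠ 0 := by positivity
          rw [div_pow]
          field_simp
  have hmem : V ×ˢ ball zc R1 ∈ 𝓝 (p0, z0) := hopen.mem_nhds ⟨hp0, h1⟩
  refine ((hsum.differentiableAt hmem).congr_of_eventuallyEq ?_).differentiableWithinAt
  filter_upwards [hmem] with q hq
  rcases q with ⟨p, z⟩
  have h3 := hasSum_taylorSeries_on_ball (ha p hq.1) (ball_subset_ball (h2.trans h2').le hq.2)
  rw [← h3.tsum_eq]
  congr 1
  ext n
  simp [mul_assoc]

end Hartogs

section ThetaSeries
variable {m : ℕ}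

theorem summable_mdeg {x : ℝ} (hx0 : 0 ≤ x) (hx : x < 1) :
    Summable fun β : Fin m → ℕ => x ^ mdeg β := by
  have h1 : Summable fun n : ℕ => x ^ n := summable_geometric_of_lt_one hx0 hx
  have hS : ∀ t : Finset ℕ, ∑ n ∈ t, x ^ n ≤ ∑' n : ℕ, x ^ n := fun t =>
    h1.sum_le_tsum t (fun _ _ => by positivity)
  apply summable_of_sum_le (c := (∑' n : ℕ, x ^ n) ^ m)
  · intro β; positivity
  · intro u
    classical
    let t : Fin m → Finset ℕ := fun i => u.image (fun β => β i)
    have hsub : u ⊆ Fintype.piFinset t := by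
      intro β hβ
      rw [Fintype.mem_piFinset]
      intro i
      exact Finset.mem_image_of_mem _ hβ
    calc ∑ β ∈ u, x ^ mdeg β ≤ ∑ β ∈ Fintype.piFinset t, x ^ mdeg β :=
          Finset.sum_le_sum_of_subset_of_nonneg hsub (fun _ _ _ => by positivity)
      _ = ∑ β ∈ Fintype.piFinset t, ∏ i, x ^ β i := by
          refine Finset.sum_congr rfl fun β _ => ?_
          rw [mdeg, Finset.prod_pow_eq_pow_sum]
      _ = ∏ i, ∑ n ∈ t i, x ^ n := (Finset.prod_univ_sum t fun _ n => x ^ n).symm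
      _ ≤ ∏ _i : Fin m, ∑' n : ℕ, x ^ n := by
          apply Finset.prod_le_prod
          · intro i _; positivity
          · intro i _; exact hS _
      _ = (∑' n : ℕ, x ^ n) ^ m := by simp

theorem norm_mpow_le (w : Fin m → ℂ) (β : Fin m → ℕ) : ‖mpow w β‖ ≤ ‖w‖ ^ mdeg β := by
  rw [mpow, norm_prod, mdeg, ← Finset.prod_pow_eq_pow_sum]
  apply Finset.prod_le_prod
  · intros; positivity
  · intro i _
    rw [norm_pow]
    gcongr
    exact norm_le_pi_norm w i

theorem theta_term_bound {d : DefData m} {M : Set (CS m)} (hd : d.IsDefiningSeriesOf M)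
    {ζ : Fin m → ℂ} {t : CS m} (hζ : ‖ζ‖ ≤ d.r) (ht : t ∈ ball (0 : CS m) (2 * d.r))
    (β : Fin m → ℕ) : ‖mpow ζ β * d.Θ β t‖ ≤ d.C * (1 / 2) ^ mdeg β := by
  obtain ⟨hr, hC, -, hb, -, -⟩ := hd
  rw [norm_mul]
  calc ‖mpow ζ β‖ * ‖d.Θ β t‖ ≤ d.r ^ mdeg β * (d.C / (2 * d.r) ^ mdeg β) := by
        gcongr
        · exact (norm_mpow_le ζ β).trans (by gcongr)
        · exact hb β t ht
    _ = d.C * (1 / 2) ^ mdeg β := by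
        rw [mul_pow, one_div, inv_pow]; field_simp

theorem mpow_differentiable (β : Fin m → ℕ) : Differentiable ℂ fun ζ : Fin m → ℂ => mpow ζ β := by
  unfold mpow
  fun_prop

theorem theta_hol {d : DefData m} {M : Set (CS m)} (hd : d.IsDefiningSeriesOf M) :
    DifferentiableOn ℂ (fun q : (Fin m → ℂ) × CS m => ThetaSum d.Θ q.1 q.2)
      (ball 0 d.r ×ˢ ball 0 (2 * d.r)) := by
  have hs : Summable fun β : Fin m → ℕ => d.C * (1 / 2 : ℝ) ^ mdeg β :=
    (summable_mdeg (by norm_num) (by norm_num)).mul_left _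
  refine hol_tsum (isOpen_ball.prod isOpen_ball) hs ?_ ?_
  · intro β
    apply DifferentiableOn.fun_mul
    · exact (mpow_differentiable β).comp_differentiableOn differentiableOn_fst
    · exact (hd.2.2.1 β).comp differentiableOn_snd (fun q hq => hq.2)
  · rintro β ⟨ζ, t⟩ ⟨h1, h2⟩
    exact theta_term_bound hd (by simpa using (mem_ball_zero_iff.1 h1).le) h2 β

theorem theta_zero_zero {d : DefData m} {M : Set (CS m)} (hd : d.IsDefiningSeriesOf M) :
    ThetaSum d.Θ 0 0 = 0 := by
  unfold ThetaSum
  have : ∀ β : Fin m → ℕ, mpow (0 : Fin m → ℂ) β * d.Θ β 0 = 0 := by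
    intro β
    by_cases hβ : β = 0
    · rw [hβ, hd.2.2.2.2.1, mul_zero]
    · obtain ⟨i, hi⟩ := Function.ne_iff.1 hβ
      have : mpow (0 : Fin m → ℂ) β = 0 := by
        unfold mpow
        exact Finset.prod_eq_zero (Finset.mem_univ i) (by simpa using hi)
      rw [this, zero_mul]
  simp [this]

open MeasureTheory in
/-- Fourier coefficient of a multi-variable power series. -/
theorem torus_coeff {a : (Fin m → ℕ) → ℂ} {s : ℝ} (hs : 0 < s)
    (ha : Summable fun β => s ^ mdeg β * ‖a β‖) (α : Fin m → ℕ) :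
    ∫ θ in Set.pi univ (fun _ : Fin m => Icc (0 : ℝ) (2 * Real.pi)),
      (∏ j, Complex.exp (-(α j * θ j * I))) *
        ∑' β, mpow (fun j => s * Complex.exp (θ j * I)) β * a β
      = (2 * Real.pi) ^ m * s ^ mdeg α * a α := by
  set μ : Measure (Fin m → ℝ) :=
    volume.restrict (Set.pi univ (fun _ : Fin m => Icc (0 : ℝ) (2 * Real.pi))) with hμ
  have hμ' : μ = Measure.pi fun _ : Fin m => (volume.restrict (Icc (0 : ℝ) (2 * Real.pi))) := by
    rw [hμ, volume_pi, Measure.restrict_pi_pi]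
  have : IsFiniteMeasure μ := by rw [hμ']; infer_instance
  -- single term
  have hterm : ∀ β : Fin m → ℕ, ∀ θ : Fin m → ℝ, (∏ j, Complex.exp (-(α j * θ j * I))) *
      (mpow (fun j => s * Complex.exp (θ j * I)) β * a β)
      = (s : ℂ) ^ mdeg β * a β * ∏ j, Complex.exp (((β j : ℂ) - α j) * θ j * I) := by
    intro β θ
    have e1 : mpow (fun j => s * Complex.exp (θ j * I)) β =
        (s : ℂ) ^ mdeg β * ∏ j, Complex.exp (β j * θ j * I) := by
      rw [mpow, mdeg, ← Finset.prod_pow_eq_pow_sum, ← Finset.prod_mul_distrib]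
      refine Finset.prod_congr rfl fun j _ => ?_
      rw [mul_pow, ← Complex.exp_nat_mul]; ring_nf
    have e2 : ∏ j, Complex.exp (((β j : ℂ) - α j) * θ j * I) =
        (∏ j, Complex.exp (β j * θ j * I)) * ∏ j, Complex.exp (-(α j * θ j * I)) := by
      rw [← Finset.prod_mul_distrib]
      refine Finset.prod_congr rfl fun j _ => ?_
      rw [← Complex.exp_add]; ring_nf
    rw [e1, e2]; ring
  have hone : ∀ n : ℤ, ∫ x in Icc (0 : ℝ) (2 * Real.pi), Complex.exp ((n : ℂ) * x * I) =
      if n = 0 then 2 * Real.pi else 0 := by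
    intro n
    rw [integral_Icc_eq_integral_Ioc, ← intervalIntegral.integral_of_le (by positivity)]
    split_ifs with h
    · simp [h]
    · have hc : (n : ℂ) * I ≠ 0 := mul_ne_zero (by exact_mod_cast h) I_ne_zero
      have := integral_exp_mul_complex (a := 0) (b := 2 * Real.pi) hc
      have e : ∀ x : ℝ, Complex.exp ((n : ℂ) * x * I) = Complex.exp ((n : ℂ) * I * x) := by
        intro x; ring_nf
      simp_rw [e]
      rw [this]
      have : Complex.exp ((n : ℂ) * I * ((2 * Real.pi : ℝ) : ℂ)) = 1 := by
        rw [Complex.exp_eq_one_iff]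
        exact ⟨n, by push_cast; ring⟩
      rw [this]; simp
  have hintg : ∀ β : Fin m → ℕ, ∫ θ, ∏ j, Complex.exp (((β j : ℂ) - α j) * θ j * I) ∂μ
      = if β = α then (2 * Real.pi : ℂ) ^ m else 0 := by
    intro β
    rw [hμ']
    have := integral_fintype_prod_eq_prod (ι := Fin m) (E := fun _ => ℝ)
      (μ := fun _ => volume.restrict (Icc (0 : ℝ) (2 * Real.pi)))
      (f := fun j (x : ℝ) => Complex.exp (((β j : ℂ) - α j) * x * I))
    rw [this]
    have h2 : ∀ j, ∫ x in Icc (0 : ℝ) (2 * Real.pi), Complex.exp (((β j : ℂ) - α j) * x * I)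
        = if β j = α j then (2 * Real.pi : ℂ) else 0 := by
      intro j
      have := hone ((β j : ℤ) - α j)
      push_cast at this
      rw [this]
      simp only [sub_eq_zero, Nat.cast_inj]
      split_ifs <;> simp
    simp_rw [h2]
    split_ifs with h
    · simp [h]
    · obtain ⟨j, hj⟩ := Function.ne_iff.1 h
      exact Finset.prod_eq_zero (Finset.mem_univ j) (by simp [hj])
  have hcont : ∀ β : Fin m → ℕ, Continuous fun θ : Fin m → ℝ =>
      (s : ℂ) ^ mdeg β * a β * ∏ j, Complex.exp (((β j : ℂ) - α j) * θ j * I) := by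
    intro β; fun_prop
  have hnorm : ∀ (β : Fin m → ℕ) (θ : Fin m → ℝ),
      ‖(s : ℂ) ^ mdeg β * a β * ∏ j, Complex.exp (((β j : ℂ) - α j) * θ j * I)‖
      = s ^ mdeg β * ‖a β‖ := by
    intro β θ
    rw [norm_mul, norm_mul, norm_pow, norm_prod, norm_real, Real.norm_of_nonneg hs.le]
    have : ∀ j, ‖Complex.exp (((β j : ℂ) - α j) * θ j * I)‖ = 1 := by
      intro j
      rw [Complex.norm_exp]; simp
    simp [this]
  have hsum := hasSum_integral_of_summable_integral_norm (μ := μ)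
    (F := fun (β : Fin m → ℕ) (θ : Fin m → ℝ) =>
      (s : ℂ) ^ mdeg β * a β * ∏ j, Complex.exp (((β j : ℂ) - α j) * θ j * I))
    (fun β => Integrable.of_bound (hcont β).aestronglyMeasurable (s ^ mdeg β * ‖a β‖)
      (Eventually.of_forall fun θ => (hnorm β θ).le))
    (by simp_rw [hnorm]; simp only [integral_const, smul_eq_mul]; exact ha.mul_left _)
  have e3 : (fun θ : Fin m → ℝ => (∏ j, Complex.exp (-(α j * θ j * I))) *
        ∑' β, mpow (fun j => s * Complex.exp (θ j * I)) β * a β) = fun θ =>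
      ∑' β, (s : ℂ) ^ mdeg β * a β * ∏ j, Complex.exp (((β j : ℂ) - α j) * θ j * I) := by
    ext θ
    rw [← tsum_mul_left]
    exact tsum_congr fun β => hterm β θ
  rw [e3, ← hsum.tsum_eq, tsum_eq_single α]
  · rw [integral_const_mul, hintg]; simp; ring
  · intro β hβ
    rw [integral_const_mul, hintg]; simp [hβ]

end ThetaSeries

section Setup
variable {m : ℕ}

/-- conjugation as a real continuous linear map -/
def conjWL (m : ℕ) : (Fin m → ℂ) →L[ℝ] (Fin m → ℂ) :=
  ContinuousLinearMap.pi fun i =>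
    (conjCLE : ℂ →L[ℝ] ℂ).comp (ContinuousLinearMap.proj (R := ℝ) (φ := fun _ : Fin m => ℂ) i)

theorem conjWL_apply (w : Fin m → ℂ) : conjWL m w = conjW w := rfl

theorem conjW_zero : conjW (0 : Fin m → ℂ) = 0 := by ext; simp [conjW]

theorem conjW_conjW (w : Fin m → ℂ) : conjW (conjW w) = w := by ext; simp [conjW]

theorem norm_conjW (w : Fin m → ℂ) : ‖conjW w‖ = ‖w‖ := by
  simp [Pi.norm_def, conjW]

theorem norm_conjWt (t : CS m) : ‖((conjW t.1, t) : (Fin m → ℂ) × CS m)‖ = ‖t‖ := by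
  rw [Prod.norm_def, Prod.norm_def]
  simp [norm_conjW]

structure IsQ (M : Set (CS m)) (Q : (Fin m → ℂ) × CS m → ℂ) (r : ℝ) : Prop where
  r_pos : 0 < r
  hol : DifferentiableOn ℂ Q (ball 0 r)
  zero : Q 0 = 0
  mem : ∀ t ∈ ball (0 : CS m) r, (t ∈ M ↔ starRingEnd ℂ t.2 = Q (conjW t.1, t))

/-- the real linear map `t ↦ (conj w, t)` -/
def ctL (m : ℕ) : CS m →L[ℝ] (Fin m → ℂ) × CS m :=
  ((conjWL m).comp (ContinuousLinearMap.fst ℝ _ _)).prod (ContinuousLinearMap.id ℝ _)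

theorem ctL_apply (t : CS m) : ctL m t = (conjW t.1, t) := rfl

theorem ctL_mem {t : CS m} {r : ℝ} : ctL m t ∈ ball (0 : (Fin m → ℂ) × CS m) r ↔ t ∈ ball (0 : CS m) r := by
  rw [mem_ball_zero_iff, mem_ball_zero_iff, ctL_apply, norm_conjWt]

def Xf (Q : (Fin m → ℂ) × CS m → ℂ) (κ : ℂ) (t : CS m) : ℂ :=
  (κ * t.2 + starRingEnd ℂ κ * Q (conjW t.1, t)) / 2

def yf (Q : (Fin m → ℂ) × CS m → ℂ) (κ : ℂ) (t : CS m) : ℝ := (Xf Q κ t).im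

variable {M : Set (CS m)} {Q : (Fin m → ℂ) × CS m → ℂ} {r : ℝ}

theorem IsQ.smooth (h : IsQ M Q r) : ContDiffOn ℝ (⊤ : ℕ∞) Q (ball 0 r) :=
  hol_contDiffOn_real isOpen_ball h.hol

theorem IsQ.smooth_ct (h : IsQ M Q r) :
    ContDiffOn ℝ (⊤ : ℕ∞) (fun t : CS m => Q (conjW t.1, t)) (ball 0 r) :=
  h.smooth.comp (ctL m).contDiff.contDiffOn (fun _ ht => ctL_mem.2 ht)

theorem IsQ.X_smooth (h : IsQ M Q r) (κ : ℂ) : ContDiffOn ℝ (⊤ : ℕ∞) (Xf Q κ) (ball 0 r) := by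
  unfold Xf
  have h1 := h.smooth_ct
  have h2 : ContDiffOn ℝ (⊤ : ℕ∞) (fun t : CS m => κ * t.2) (ball 0 r) := by fun_prop
  exact (h2.add (contDiffOn_const.mul h1)).div_const 2

theorem IsQ.y_smooth (h : IsQ M Q r) (κ : ℂ) : ContDiffOn ℝ (⊤ : ℕ∞) (yf Q κ) (ball 0 r) := by
  have := h.X_smooth κ
  exact Complex.imCLM.contDiff.comp_contDiffOn this

theorem Xf_neg (κ : ℂ) (t : CS m) : Xf Q (-κ) t = - Xf Q κ t := by
  simp [Xf]; ring

theorem yf_neg (κ : ℂ) (t : CS m) : yf Q (-κ) t = - yf Q κ t := by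
  simp [yf, Xf_neg]

theorem IsQ.X_zero (h : IsQ M Q r) (κ : ℂ) : Xf Q κ 0 = 0 := by
  have : ((conjW (0 : CS m).1, (0 : CS m)) : (Fin m → ℂ) × CS m) = 0 := by
    rw [Prod.fst_zero, conjW_zero]; rfl
  rw [Xf, this, h.zero]; simp

theorem yf_eq_zero_of_mem (h : IsQ M Q r) (κ : ℂ) {t : CS m} (ht : t ∈ ball (0 : CS m) r)
    (htM : t ∈ M) : yf Q κ t = 0 := by
  have := (h.mem t ht).1 htM
  rw [yf, Xf, ← this]
  simp
  ring

/-- the `z`-derivative of `Q` at the origin -/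
def Qz (Q : (Fin m → ℂ) × CS m → ℂ) : ℂ := fderiv ℂ Q 0 (0, (0, 1))

theorem IsQ.strict_ct (h : IsQ M Q r) : HasStrictFDerivAt (fun t : CS m => Q (conjW t.1, t))
    (((fderiv ℂ Q 0).restrictScalars ℝ).comp (ctL m)) 0 := by
  have h1 : HasFDerivAt Q (fderiv ℂ Q 0) 0 :=
    (h.hol.differentiableAt (isOpen_ball.mem_nhds (mem_ball_self h.r_pos))).hasFDerivAt
  have h2 : HasFDerivAt Q ((fderiv ℂ Q 0).restrictScalars ℝ) (ctL m 0) := by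
    rw [map_zero]; exact h1.restrictScalars ℝ
  have h3 := h2.comp (0 : CS m) (ctL m).hasFDerivAt
  have h4 : ContDiffAt ℝ (⊤ : ℕ∞) (fun t : CS m => Q (conjW t.1, t)) 0 :=
    h.smooth_ct.contDiffAt (isOpen_ball.mem_nhds (mem_ball_self h.r_pos))
  have h5 := h4.hasStrictFDerivAt (by simp)
  rwa [← h5.hasFDerivAt.unique h3]

theorem fderiv_z (z : ℂ) : fderiv ℂ Q 0 (0, (0, z)) = Qz Q * z := by
  have : ((0, (0, z)) : (Fin m → ℂ) × CS m) = z • (0, (0, 1)) := by simp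
  rw [this, map_smul, Qz, smul_eq_mul, mul_comm]

/-- Lagrange multipliers -/
theorem lagrange_mult {E : Type*} [NormedAddCommGroup E] [NormedSpace ℝ E] [CompleteSpace E]
    {ρ u : E → ℝ} {ρ' u' : E →L[ℝ] ℝ} {p : E} (hρ : HasStrictFDerivAt ρ ρ' p)
    (hu : HasStrictFDerivAt u u' p) (hρ' : ρ' ≠ 0) (hρ0 : ρ p = 0)
    (hz : ∀ᶠ t in 𝓝 p, ρ t = 0 → u t = 0) : ∃ c : ℝ, u' = c • ρ' := by
  have hp : u p = 0 := hz.self_of_nhds hρ0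
  have hext : IsLocalExtrOn u {t | ρ t = ρ p} p := by
    left
    refine Filter.eventually_inf_principal.2 ?_
    filter_upwards [hz] with t ht h1
    rw [hp, ht (by rw [h1, hρ0])]
  obtain ⟨a, b, hab, he⟩ := hext.exists_multipliers_of_hasStrictFDerivAt_1d hρ hu
  have hb : b ≠ 0 := by
    rintro rfl
    simp at he
    rcases he with h | h
    · subst h; exact hab rfl
    · exact hρ' h
  refine ⟨-(a / b), ?_⟩
  have : b • u' = -(a • ρ') := by rw [eq_neg_iff_add_eq_zero, add_comm]; exact he
  ext x
  have h2 := congrArg (fun l => l x) this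
  simp only [smul_apply, neg_apply, smul_eq_mul] at h2 ⊢
  field_simp
  linarith

theorem strict_dir {E : Type*} [NormedAddCommGroup E] [NormedSpace ℝ E]
    {f : E → ℝ} {f' : E →L[ℝ] ℝ} {p n : E} (hf : HasStrictFDerivAt f f' p) {η : ℝ} (hη : 0 < η) :
    ∃ δ > 0, ∀ t ∈ ball p δ, ∀ s : ℝ, t + s • n ∈ ball p δ →
      |f (t + s • n) - f t - f' n * s| ≤ η * |s| := by
  have hc : 0 < η / (‖n‖ + 1) := by positivity
  obtain ⟨S, hS, hS'⟩ := hf.approximates_deriv_on_nhds (c := ⟨η / (‖n‖ + 1), hc.le⟩) (Or.inr hc)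
  obtain ⟨δ, hδ, hb⟩ := Metric.mem_nhds_iff.1 hS
  refine ⟨δ, hδ, fun t ht s hs => ?_⟩
  have := hS' _ (hb hs) _ (hb ht)
  simp only [add_sub_cancel_left, map_smul, smul_eq_mul, norm_smul, Real.norm_eq_abs] at this
  rw [mul_comm (f' n)]
  refine this.trans ?_
  change η / (‖n‖ + 1) * (|s| * ‖n‖) ≤ _
  have : η / (‖n‖ + 1) * (|s| * ‖n‖) = η * |s| * (‖n‖ / (‖n‖ + 1)) := by field_simp
  rw [this]
  have h2 : ‖n‖ / (‖n‖ + 1) ≤ 1 := by rw [div_le_one (by positivity)]; linarith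
  exact mul_le_of_le_one_right (by positivity) h2

theorem zero_set_converse {E : Type*} [NormedAddCommGroup E] [NormedSpace ℝ E]
    {ρ u : E → ℝ} {ρ' u' : E →L[ℝ] ℝ} {p n : E} (hρ : HasStrictFDerivAt ρ ρ' p)
    (hu : HasStrictFDerivAt u u' p) (hρn : ρ' n ≠ 0) (hun : u' n ≠ 0) (hρ0 : ρ p = 0)
    {V : Set E} (hV : IsOpen V) (hpV : p ∈ V) (hρc : ContinuousOn ρ V)
    (hz : ∀ᶠ t in 𝓝 p, ρ t = 0 → u t = 0) : ∀ᶠ t in 𝓝 p, u t = 0 → ρ t = 0 := by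
  obtain ⟨δ1, hδ1, h1⟩ := strict_dir (n := n) hρ (η := |ρ' n| / 2) (by positivity)
  obtain ⟨δ2, hδ2, h2⟩ := strict_dir (n := n) hu (η := |u' n| / 2) (by positivity)
  obtain ⟨δ3, hδ3, h3⟩ := Metric.eventually_nhds_iff_ball.1 hz
  obtain ⟨δ4, hδ4, h4⟩ := Metric.isOpen_iff.1 hV p hpV
  set δ := min (min δ1 δ2) (min δ3 δ4) with hδ
  have hδ0 : 0 < δ := by positivity
  have hd1 : δ ≤ δ1 := (min_le_left _ _).trans (min_le_left _ _)
  have hd2 : δ ≤ δ2 := (min_le_left _ _).trans (min_le_right _ _)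
  have hd3 : δ ≤ δ3 := (min_le_right _ _).trans (min_le_left _ _)
  have hd4 : δ ≤ δ4 := (min_le_right _ _).trans (min_le_right _ _)
  set s0 : ℝ := δ / (4 * (‖n‖ + 1)) with hs0
  have hs0p : 0 < s0 := by positivity
  have hsn : s0 * ‖n‖ ≤ δ / 4 := by
    rw [hs0, div_mul_eq_mul_div, div_le_div_iff₀ (by positivity) (by positivity)]
    nlinarith [norm_nonneg n]
  have hev : ∀ᶠ t in 𝓝 p, |ρ t| < |ρ' n| * s0 / 2 := by
    have := (hρ.hasFDerivAt.continuousAt).abs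
    have h5 : |ρ p| < |ρ' n| * s0 / 2 := by rw [hρ0, abs_zero]; positivity
    exact this.eventually_lt continuousAt_const h5
  filter_upwards [hev, ball_mem_nhds p (show 0 < δ / 2 by positivity)] with t ht htb hut
  have hin : ∀ s ∈ Icc (-s0) s0, t + s • n ∈ ball p δ := by
    intro s hs
    rw [mem_ball, dist_eq_norm] at htb ⊢
    have : t + s • n - p = (t - p) + s • n := by abel
    rw [this]
    have h6 : ‖s • n‖ ≤ s0 * ‖n‖ := by
      rw [norm_smul, Real.norm_eq_abs]
      gcongr
      exact abs_le.2 hs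
    calc _ ≤ ‖t - p‖ + ‖s • n‖ := norm_add_le _ _
      _ < δ := by linarith
  have htδ : t ∈ ball p δ := ball_subset_ball (by linarith) htb
  have hcont : ContinuousOn (fun s : ℝ => ρ (t + s • n)) (Icc (-s0) s0) :=
    hρc.comp (by fun_prop) (fun s hs => h4 (ball_subset_ball hd4 (hin s hs)))
  have hA := h1 t (ball_subset_ball hd1 htδ) s0
    (ball_subset_ball hd1 (hin s0 ⟨by linarith, le_rfl⟩))
  have hB := h1 t (ball_subset_ball hd1 htδ) (-s0)
    (ball_subset_ball hd1 (hin (-s0) ⟨le_rfl, by linarith⟩))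
  rw [abs_neg, abs_of_pos hs0p] at hB
  rw [abs_of_pos hs0p] at hA
  have hex : ∃ s ∈ Icc (-s0) s0, ρ (t + s • n) = 0 := by
    have hle : -s0 ≤ s0 := by linarith
    rcases lt_or_gt_of_ne hρn with hneg | hpos
    · rw [abs_of_neg hneg] at ht hA hB
      have ha := abs_le.1 hA
      have hb := abs_le.1 hB
      have hc := abs_lt.1 ht
      have := intermediate_value_Icc' hle hcont
      exact this ⟨by nlinarith, by nlinarith⟩
    · rw [abs_of_pos hpos] at ht hA hB
      have ha := abs_le.1 hA
      have hb := abs_le.1 hB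
      have hc := abs_lt.1 ht
      have := intermediate_value_Icc hle hcont
      exact this ⟨by nlinarith, by nlinarith⟩
  obtain ⟨s, hs, hs'⟩ := hex
  have hu2 := h3 _ (ball_subset_ball hd3 (hin s hs)) hs'
  have hC := h2 t (ball_subset_ball hd2 htδ) s (ball_subset_ball hd2 (hin s hs))
  rw [hu2, hut] at hC
  have : s = 0 := by
    by_contra hne
    have hsp : 0 < |s| := abs_pos.2 hne
    have hup : 0 < |u' n| := abs_pos.2 hun
    simp only [sub_zero, zero_sub, abs_neg, abs_mul] at hC
    nlinarith [mul_pos hup hsp]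
  rw [this] at hs'
  simpa using hs'

theorem IsQ.y_strict (h : IsQ M Q r) (κ : ℂ) : ∃ y' : CS m →L[ℝ] ℝ,
    HasStrictFDerivAt (yf Q κ) y' 0 ∧
    ∀ t : CS m, y' t = ((κ * t.2 + starRingEnd ℂ κ * fderiv ℂ Q 0 (conjW t.1, t)) / 2).im := by
  have h1 := h.strict_ct
  have h2 : HasStrictFDerivAt (fun t : CS m => t.2) (ContinuousLinearMap.snd ℝ (Fin m → ℂ) ℂ) 0 :=
    (ContinuousLinearMap.snd ℝ (Fin m → ℂ) ℂ).hasStrictFDerivAt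
  have h3 := ((h2.const_mul κ).add (h1.const_mul (starRingEnd ℂ κ))).mul_const (2⁻¹ : ℂ)
  have h4 := Complex.imCLM.hasStrictFDerivAt.comp (0 : CS m) h3
  refine ⟨_, h4.congr_of_eventuallyEq (Eventually.of_forall fun t => ?_), fun t => ?_⟩
  · simp [yf, Xf, div_eq_mul_inv]
  · simp [ctL_apply, div_eq_mul_inv]
    ring

theorem conj_mul_of_norm_one {κ : ℂ} (h : ‖κ‖ = 1) : starRingEnd ℂ κ * κ = 1 := by
  rw [mul_comm, Complex.mul_conj, Complex.normSq_eq_norm_sq, h]; simp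

theorem IsQ.y_z {κ : ℂ} (hκ : starRingEnd ℂ κ * Qz Q = κ) {y' : CS m →L[ℝ] ℝ}
    (hy' : ∀ t : CS m, y' t = ((κ * t.2 + starRingEnd ℂ κ * fderiv ℂ Q 0 (conjW t.1, t)) / 2).im)
    (z : ℂ) : y' (0, z) = (κ * z).im := by
  rw [hy']
  simp only [conjW_zero]
  rw [fderiv_z, ← mul_assoc, hκ]
  congr 1; ring

theorem setup_kappa (hM : IsRealAnalyticHypersurface M) (h0 : (0 : CS m) ∈ M) (h : IsQ M Q r) :
    ∃ κ : ℂ, ‖κ‖ = 1 ∧ starRingEnd ℂ κ * Qz Q = κ ∧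
      ∃ δ > 0, δ ≤ r ∧ ∀ t ∈ ball (0 : CS m) δ, (t ∈ M ↔ yf Q κ t = 0) := by
  obtain ⟨U, ρ, hU, h0U, hρa, hρ', hMU⟩ := hM.2 0 h0
  have hρs : HasStrictFDerivAt ρ (fderiv ℝ ρ 0) 0 := (hρa 0 h0U).hasStrictFDerivAt
  have hmem : ∀ t ∈ U, (t ∈ M ↔ ρ t = 0) := fun t ht =>
    ⟨fun hh => (hMU.subset ⟨hh, ht⟩).2, fun hh => (hMU.symm.subset ⟨ht, hh⟩).1⟩
  have hρ0 : ρ 0 = 0 := (hmem 0 h0U).1 h0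
  have hr := h.r_pos
  -- real parts
  have key : ∀ z : ℂ, fderiv ℝ ρ 0 (0, z) = 0 → starRingEnd ℂ z = Qz Q * z := by
    intro z hz
    have hu : ∀ L : ℂ →L[ℝ] ℝ, L (starRingEnd ℂ z - Qz Q * z) = 0 := by
      intro L
      have h2 : HasStrictFDerivAt (fun t : CS m => starRingEnd ℂ t.2)
          ((conjCLE : ℂ →L[ℝ] ℂ).comp (ContinuousLinearMap.snd ℝ (Fin m → ℂ) ℂ)) 0 :=
        ((conjCLE : ℂ →L[ℝ] ℂ).comp (ContinuousLinearMap.snd ℝ (Fin m → ℂ) ℂ)).hasStrictFDerivAt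
      have h3 := L.hasStrictFDerivAt.comp (0 : CS m) (h2.sub h.strict_ct)
      obtain ⟨c, hc⟩ := lagrange_mult hρs h3 hρ' hρ0 (by
        filter_upwards [hU.mem_nhds h0U, ball_mem_nhds 0 hr] with t ht ht' hz
        have := (h.mem t ht').1 ((hmem t ht).2 hz)
        simp [this])
      have h4 := congrArg (fun l => l ((0, z) : CS m)) hc
      simp only [smul_apply, hz, smul_zero] at h4
      rw [← fderiv_z]
      simpa [ctL_apply, conjW_zero] using h4
    have h1 := hu Complex.reCLM
    have h2 := hu Complex.imCLM
    have : starRingEnd ℂ z - Qz Q * z = 0 := Complex.ext h1 h2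
    exact sub_eq_zero.1 this
  obtain ⟨z, hz0, hz⟩ : ∃ z : ℂ, z ≠ 0 ∧ fderiv ℝ ρ 0 (0, z) = 0 := by
    by_cases h1 : fderiv ℝ ρ 0 ((0, 1) : CS m) = 0
    · exact ⟨1, one_ne_zero, h1⟩
    · set a := fderiv ℝ ρ 0 ((0, 1) : CS m)
      set b := fderiv ℝ ρ 0 ((0, I) : CS m) with hb
      refine ⟨b - a * I, ?_, ?_⟩
      · intro h2
        have := congrArg Complex.im h2
        simp at this
        exact h1 this
      · have : ((0, (b : ℂ) - a * I) : CS m) = b • ((0, 1) : CS m) - a • ((0, I) : CS m) := by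
          ext <;> simp
        rw [this, map_sub, map_smul, map_smul]
        simp only [smul_eq_mul]
        change b * a - a * b = 0
        ring
  have hzn : (‖z‖ : ℂ) ≠ 0 := by exact_mod_cast norm_ne_zero_iff.2 hz0
  set κ : ℂ := starRingEnd ℂ z / ‖z‖ with hκdef
  have hκn : ‖κ‖ = 1 := by
    rw [hκdef, norm_div]; simp [norm_ne_zero_iff.2 hz0]
  have hκ : starRingEnd ℂ κ * Qz Q = κ := by
    have hk := key z hz
    rw [hκdef, map_div₀, Complex.conj_conj, Complex.conj_ofReal, hk]
    ring
  obtain ⟨y', hy', hy''⟩ := h.y_strict κ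
  have hyz := IsQ.y_z hκ hy''
  have hyn : y' (0, I * starRingEnd ℂ κ) = 1 := by
    rw [hyz]
    have : κ * (I * starRingEnd ℂ κ) = I * (starRingEnd ℂ κ * κ) := by ring
    rw [this, conj_mul_of_norm_one hκn]; simp
  have hzy : ∀ᶠ t in 𝓝 (0 : CS m), ρ t = 0 → yf Q κ t = 0 := by
    filter_upwards [hU.mem_nhds h0U, ball_mem_nhds 0 hr] with t ht ht' hz
    exact yf_eq_zero_of_mem h κ ht' ((hmem t ht).2 hz)
  obtain ⟨c, hc⟩ := lagrange_mult hρs hy' hρ' hρ0 hzy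
  have hρn : fderiv ℝ ρ 0 ((0, I * starRingEnd ℂ κ) : CS m) ≠ 0 := by
    intro h2
    rw [hc, smul_apply, h2] at hyn
    simp at hyn
  have hconv := zero_set_converse hρs hy' hρn (by rw [hyn]; exact one_ne_zero) hρ0 hU h0U
    hρa.continuousOn hzy
  have hev : ∀ᶠ t in 𝓝 (0 : CS m), (t ∈ M ↔ yf Q κ t = 0) := by
    filter_upwards [hU.mem_nhds h0U, hzy, hconv] with t ht h1 h2
    rw [hmem t ht]
    exact ⟨h1, h2⟩
  obtain ⟨δ, hδ, hb⟩ := Metric.eventually_nhds_iff_ball.1 hev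
  exact ⟨κ, hκn, hκ, min δ r, by positivity, min_le_right _ _, fun t ht =>
    hb t (ball_subset_ball (min_le_left _ _) ht)⟩

end Setup

section Reality
variable {m : ℕ} {M : Set (CS m)} {Q : (Fin m → ℂ) × CS m → ℂ} {r : ℝ}

/-- the transverse direction -/
def nv (m : ℕ) (κ : ℂ) : CS m := (0, I * starRingEnd ℂ κ)

/-- Full package of setup data. -/
structure IsSet (M : Set (CS m)) (Q : (Fin m → ℂ) × CS m → ℂ) (r : ℝ) (κ : ℂ) : Prop
    extends IsQ M Q r where
  kn : ‖κ‖ = 1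
  kq : starRingEnd ℂ κ * Qz Q = κ
  memy : ∀ t ∈ ball (0 : CS m) r, (t ∈ M ↔ yf Q κ t = 0)

theorem IsQ.mono (h : IsQ M Q r) {r' : ℝ} (h0 : 0 < r') (hr : r' ≤ r) : IsQ M Q r' :=
  ⟨h0, h.hol.mono (ball_subset_ball hr), h.zero, fun t ht => h.mem t (ball_subset_ball hr ht)⟩

theorem IsSet.mono {κ : ℂ} (h : IsSet M Q r κ) {r' : ℝ} (h0 : 0 < r') (hr : r' ≤ r) :
    IsSet M Q r' κ :=
  ⟨h.toIsQ.mono h0 hr, h.kn, h.kq, fun t ht => h.memy t (ball_subset_ball hr ht)⟩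

theorem IsSet.neg {κ : ℂ} (h : IsSet M Q r κ) : IsSet M Q r (-κ) :=
  ⟨h.toIsQ, by simpa using h.kn, by
    rw [map_neg, neg_mul, h.kq], fun t ht => by rw [h.memy t ht, yf_neg, neg_eq_zero]⟩

theorem exists_isSet (hM : IsRealAnalyticHypersurface M) (h0 : (0 : CS m) ∈ M) (h : IsQ M Q r) :
    ∃ κ : ℂ, ∃ δ > 0, δ ≤ r ∧ IsSet M Q δ κ := by
  obtain ⟨κ, h1, h2, δ, hδ, hδr, h3⟩ := setup_kappa hM h0 h
  exact ⟨κ, δ, hδ, hδr, h.mono hδ hδr, h1, h2, h3⟩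

variable {κ : ℂ}

theorem IsSet.y_dir (h : IsSet M Q r κ) {η : ℝ} (hη : 0 < η) :
    ∃ δ > 0, δ ≤ r ∧ ∀ t ∈ ball (0 : CS m) δ, ∀ s : ℝ, t + s • nv m κ ∈ ball (0 : CS m) δ →
      |yf Q κ (t + s • nv m κ) - yf Q κ t - s| ≤ η * |s| := by
  obtain ⟨y', hy', hy''⟩ := h.y_strict κ
  have hyz := IsQ.y_z h.kq hy''
  have hyn : y' (nv m κ) = 1 := by
    rw [nv, hyz]
    have : κ * (I * starRingEnd ℂ κ) = I * (starRingEnd ℂ κ * κ) := by ring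
    rw [this, conj_mul_of_norm_one h.kn]; simp
  obtain ⟨δ, hδ, h1⟩ := strict_dir (n := nv m κ) hy' hη
  refine ⟨min δ r, lt_min hδ h.r_pos, min_le_right _ _, fun t ht s hs => ?_⟩
  have := h1 t (ball_subset_ball (min_le_left _ _) ht) s (ball_subset_ball (min_le_left _ _) hs)
  rwa [hyn, one_mul] at this

theorem norm_nv (hκ : ‖κ‖ = 1) : ‖nv m κ‖ = 1 := by
  simp [nv, Prod.norm_def, hκ]

theorem IsSet.y_zero (h : IsSet M Q r κ) : yf Q κ 0 = 0 := by
  rw [yf, h.X_zero]; simp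

theorem IsSet.y_cont (h : IsSet M Q r κ) : ContinuousOn (yf Q κ) (ball 0 r) :=
  (h.y_smooth κ).continuousOn

theorem IsSet.proj_M (h : IsSet M Q r κ) {R : ℝ} (hR : 0 < R) :
    ∃ δ > 0, ∀ t ∈ ball (0 : CS m) δ, ∃ s : ℝ, |s| ≤ R ∧ yf Q κ (t + s • nv m κ) = 0 := by
  obtain ⟨δ1, hδ1, hδr, h1⟩ := h.y_dir (η := 1 / 2) (by norm_num)
  set s0 := min R (δ1 / 2) with hs0
  have hs0p : 0 < s0 := by positivity
  have hc : ContinuousAt (yf Q κ) 0 := h.y_cont.continuousAt (ball_mem_nhds _ h.r_pos)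
  have hev : ∀ᶠ t in 𝓝 (0 : CS m), |yf Q κ t| < s0 / 2 := by
    refine hc.abs.eventually_lt continuousAt_const ?_
    rw [h.y_zero, abs_zero]; positivity
  obtain ⟨δ2, hδ2, h2⟩ := Metric.eventually_nhds_iff_ball.1 hev
  refine ⟨min δ2 (δ1 / 2), by positivity, fun t ht => ?_⟩
  have ht2 := h2 t (ball_subset_ball (min_le_left _ _) ht)
  have ht1 : ‖t‖ < δ1 / 2 := mem_ball_zero_iff.1 (ball_subset_ball (min_le_right _ _) ht)
  have hin : ∀ s ∈ Icc (-s0) s0, t + s • nv m κ ∈ ball (0 : CS m) δ1 := by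
    intro s hs
    rw [mem_ball_zero_iff]
    have : ‖s • nv m κ‖ ≤ s0 := by
      rw [norm_smul, norm_nv h.kn, mul_one]; exact abs_le.2 hs
    have h3 : s0 ≤ δ1 / 2 := min_le_right _ _
    linarith [norm_add_le t (s • nv m κ)]
  have htδ : t ∈ ball (0 : CS m) δ1 := mem_ball_zero_iff.2 (by linarith)
  have hcont : ContinuousOn (fun s : ℝ => yf Q κ (t + s • nv m κ)) (Icc (-s0) s0) :=
    h.y_cont.comp (by fun_prop) (fun s hs => ball_subset_ball hδr (hin s hs))
  have hA := abs_le.1 (h1 t htδ s0 (hin s0 ⟨by linarith, le_rfl⟩))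
  have hB := abs_le.1 (h1 t htδ (-s0) (hin (-s0) ⟨le_rfl, by linarith⟩))
  rw [abs_neg, abs_of_pos hs0p] at hB
  rw [abs_of_pos hs0p] at hA
  have hc := abs_lt.1 ht2
  obtain ⟨s, hs, hs'⟩ := intermediate_value_Icc (show -s0 ≤ s0 by linarith) hcont
    (show (0 : ℝ) ∈ _ from ⟨by linarith, by linarith⟩)
  exact ⟨s, (abs_le.2 hs).trans (min_le_left _ _), hs'⟩

theorem IsQ.slice_hol (h : IsQ M Q r) {ω w : Fin m → ℂ} (hω : ‖ω‖ < r) (hw : ‖w‖ < r) :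
    DifferentiableOn ℂ (fun z : ℂ => Q (ω, (w, z))) (ball 0 r) := by
  refine h.hol.comp (by fun_prop) ?_
  intro z hz
  rw [mem_ball_zero_iff] at hz ⊢
  simp [Prod.norm_def, hω, hw, hz]

theorem IsQ.ct_tendsto (h : IsQ M Q r) : ContinuousAt (fun t : CS m => Q (conjW t.1, t)) 0 :=
  h.strict_ct.hasFDerivAt.continuousAt

theorem ct_zero : ((conjW (0 : CS m).1, (0 : CS m)) : (Fin m → ℂ) × CS m) = 0 := by
    rw [Prod.fst_zero, conjW_zero]; rfl

theorem IsSet.reality (h : IsSet M Q r κ) : ∃ δ > 0, δ ≤ r ∧ ∀ t ∈ ball (0 : CS m) δ,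
    ‖Q (conjW t.1, t)‖ < r ∧
    Q (conjW t.1, (t.1, starRingEnd ℂ (Q (conjW t.1, t)))) = starRingEnd ℂ t.2 := by
  have hr := h.r_pos
  have hev : ∀ᶠ t in 𝓝 (0 : CS m), ‖Q (conjW t.1, t)‖ < r := by
    refine h.ct_tendsto.norm.eventually_lt continuousAt_const ?_
    rw [ct_zero, h.zero, norm_zero]; exact hr
  obtain ⟨δ1, hδ1, h1⟩ := Metric.eventually_nhds_iff_ball.1 hev
  set δ2 := min δ1 r with hδ2
  have hδ2p : 0 < δ2 := by positivity
  obtain ⟨δ3, hδ3, h3⟩ := h.proj_M (R := δ2 / 4) (by positivity)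
  set δ := min δ2 δ3 with hδ
  refine ⟨δ, by positivity, (min_le_left _ _).trans (min_le_right _ _), ?_⟩
  rintro ⟨w, z⟩ ht
  have hwz := mem_ball_zero_iff.1 ht
  have hw : ‖w‖ < δ := (le_max_left _ _).trans_lt hwz
  have hz : ‖z‖ < δ := (le_max_right _ _).trans_lt hwz
  have hdd : δ ≤ δ2 := min_le_left _ _
  have hd1 : δ2 ≤ δ1 := min_le_left _ _
  have hdr : δ2 ≤ r := min_le_right _ _
  have hd3 : δ ≤ δ3 := min_le_right _ _
  refine ⟨h1 _ (ball_subset_ball (hdd.trans hd1) ht), ?_⟩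
  -- the slice function
  set q : ℂ → ℂ := fun z => Q (conjW w, (w, z)) with hq
  have hqd : DifferentiableOn ℂ q (ball 0 r) :=
    h.slice_hol (by rw [norm_conjW]; linarith) (by linarith)
  have hqr : ∀ z ∈ ball (0 : ℂ) δ2, ‖q z‖ < r := by
    intro z hz
    refine h1 (w, z) (mem_ball_zero_iff.2 ?_)
    rw [mem_ball_zero_iff] at hz
    exact max_lt (by linarith) (by linarith)
  set J : ℂ → ℂ := fun z => starRingEnd ℂ (q (starRingEnd ℂ (q z))) - z with hJ
  have hJd : DifferentiableOn ℂ J (ball 0 δ2) := by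
    intro u hu
    have hu1 : DifferentiableAt ℂ q u :=
      hqd.differentiableAt (isOpen_ball.mem_nhds (ball_subset_ball hdr hu))
    have hu2 : DifferentiableAt ℂ q (starRingEnd ℂ (q u)) :=
      hqd.differentiableAt (isOpen_ball.mem_nhds (by
        rw [mem_ball_zero_iff, RCLike.norm_conj]; exact hqr u hu))
    have hu3 : DifferentiableAt ℂ (starRingEnd ℂ ∘ q ∘ starRingEnd ℂ) (q u) := by
      rw [differentiableAt_conj_conj_iff]
      exact hu2
    have := (hu3.comp u hu1).sub differentiableAt_id
    exact this.differentiableWithinAt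
  have hJan : AnalyticOnNhd ℂ J (ball 0 δ2) := hJd.analyticOnNhd isOpen_ball
  -- zeros
  set Z : Set ℂ := {u ∈ closedBall (0 : ℂ) (δ2 / 2) | J u = 0} with hZ
  have hkk := conj_mul_of_norm_one h.kn
  have hκ0 : κ ≠ 0 := by intro hh; rw [hh] at hkk; simp at hkk
  have hex : ∀ s : ℝ, s ∈ Ioo 0 (min (δ / 2) (δ2 / 4)) → ∃ u ∈ Z, (κ * u).re = s := by
    intro s hs
    have hs1 : s < δ / 2 := hs.2.trans_le (min_le_left _ _)
    have hs2 : s < δ2 / 4 := hs.2.trans_le (min_le_right _ _)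
    have hns : ‖starRingEnd ℂ κ * s‖ = s := by
      rw [norm_mul, RCLike.norm_conj, h.kn]; simp [abs_of_pos hs.1]
    obtain ⟨a, ha, hya⟩ := h3 (w, starRingEnd ℂ κ * s) (mem_ball_zero_iff.2 (max_lt (by
      change ‖w‖ < _; linarith) (by change ‖starRingEnd ℂ κ * s‖ < _; rw [hns]; linarith)))
    have he : ((w, starRingEnd ℂ κ * s) : CS m) + a • nv m κ
        = (w, starRingEnd ℂ κ * (s + a * I)) := by
      ext <;> simp [nv] ; ring
    rw [he] at hya
    have hnu : ‖starRingEnd ℂ κ * (s + a * I)‖ ≤ δ2 / 2 := by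
      rw [norm_mul, RCLike.norm_conj, h.kn, one_mul]
      calc _ ≤ ‖(s : ℂ)‖ + ‖(a : ℂ) * I‖ := norm_add_le _ _
        _ = s + |a| := by simp [abs_of_pos hs.1]
        _ ≤ _ := by linarith
    have hmem : ((w, starRingEnd ℂ κ * (s + a * I)) : CS m) ∈ ball (0 : CS m) r := by
      rw [mem_ball_zero_iff]
      exact max_lt (by change ‖w‖ < r; linarith) (by
        change ‖starRingEnd ℂ κ * (s + a * I)‖ < r; linarith)
    have hM1 := (h.mem _ hmem).1 ((h.memy _ hmem).2 hya)
    refine ⟨starRingEnd ℂ κ * (s + a * I), ⟨by rwa [mem_closedBall_zero_iff], ?_⟩, ?_⟩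
    · change starRingEnd ℂ (q (starRingEnd ℂ (q _))) - _ = 0
      have : q (starRingEnd ℂ κ * (s + a * I)) = starRingEnd ℂ (starRingEnd ℂ κ * (s + a * I)) :=
        hM1.symm
      rw [this, Complex.conj_conj, this, Complex.conj_conj, sub_self]
    · have : κ * (starRingEnd ℂ κ * (s + a * I)) = s + a * I := by
        rw [← mul_assoc, mul_comm κ, hkk, one_mul]
      rw [this]; simp
  have hinf : Z.Infinite := by
    intro hfin
    have h4 : (Ioo (0 : ℝ) (min (δ / 2) (δ2 / 4))) ⊆ (fun u : ℂ => (κ * u).re) '' Z :=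
      fun s hs => hex s hs
    have hpos : (0 : ℝ) < min (δ / 2) (δ2 / 4) := by positivity
    exact (Ioo_infinite hpos) ((hfin.image _).subset h4)
  obtain ⟨u, hu, hacc⟩ := hinf.exists_accPt_of_subset_isCompact (isCompact_closedBall (0 : ℂ) (δ2 / 2))
    (fun x hx => hx.1)
  have hfreq : ∃ᶠ x in 𝓝[≠] u, J x = 0 :=
    (accPt_iff_frequently_nhdsNE.1 hacc).mono fun x hx => hx.2
  have := hJan.eqOn_zero_of_preconnected_of_frequently_eq_zero (convex_ball _ _).isPreconnected
    (closedBall_subset_ball (by linarith) hu) hfreq (mem_ball_zero_iff.2 (hz.trans_le hdd))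
  have h5 : starRingEnd ℂ (q (starRingEnd ℂ (q z))) = z := sub_eq_zero.1 this
  have h6 := congrArg (starRingEnd ℂ) h5
  rw [Complex.conj_conj] at h6
  exact h6

end Reality

section HolReal
variable {E F : Type*} [NormedAddCommGroup E] [NormedSpace ℂ E]
  [NormedAddCommGroup F] [NormedSpace ℂ F]

/-- a real linear map commuting with `I` is complex linear -/
def clmOfReal (L : E →L[ℝ] F) (h : ∀ v, L (I • v) = I • L v) : E →L[ℂ] F where
  toFun := L
  map_add' := map_add L
  map_smul' := by
    intro c v
    have hc : c • v = c.re • v + c.im • (I • v) := by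
      conv_lhs => rw [← Complex.re_add_im c]
      rw [add_smul, mul_smul]
      simp
    have hc2 : c • L v = c.re • L v + c.im • (I • L v) := by
      conv_lhs => rw [← Complex.re_add_im c]
      rw [add_smul, mul_smul]
      simp
    simp only [RingHom.id_apply]
    rw [hc, map_add, map_smul, map_smul, h, hc2]
  cont := L.cont

theorem hol_of_real {f : E → F} {x : E} {L : E →L[ℝ] F} (hf : HasFDerivAt f L x)
    (h : ∀ v, L (I • v) = I • L v) : HasFDerivAt f (clmOfReal L h) x :=
  hasFDerivAt_of_restrictScalars ℝ hf (by ext; rfl)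

theorem hol_conj_conj {c : E →L[ℝ] F} (hc : ∀ v, c (I • v) = -(I • c v)) {f : F → ℂ} {x : E}
    (hf : DifferentiableAt ℂ f (c x)) : DifferentiableAt ℂ (fun x => starRingEnd ℂ (f (c x))) x := by
  have h1 : HasFDerivAt f ((fderiv ℂ f (c x)).restrictScalars ℝ) (c x) :=
    hf.hasFDerivAt.restrictScalars ℝ
  have h2 := (conjCLE : ℂ →L[ℝ] ℂ).hasFDerivAt.comp x (h1.comp x c.hasFDerivAt)
  refine (hol_of_real (L := (conjCLE : ℂ →L[ℝ] ℂ).comp (((fderiv ℂ f (c x)).restrictScalars ℝ).comp c)) h2 ?_).differentiableAt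
  intro v
  simp [hc]

end HolReal

section Taylor2

abbrev C2 := ℂ × ℂ

def HomP (k : ℕ) (c : ℕ → ℂ) (x : C2) : ℂ :=
  ∑ a ∈ Finset.range (k + 1), c a * x.1 ^ a * x.2 ^ (k - a)

theorem homP_step (k : ℕ) (c1 c2 : ℕ → ℂ) (x : C2) :
    x.1 * HomP k c1 x + x.2 * HomP k c2 x =
      HomP (k + 1) (fun a => (if a = 0 then 0 else c1 (a - 1)) + (if a = k + 1 then 0 else c2 a)) x := by
  unfold HomP
  simp only [add_mul, Finset.sum_add_distrib]
  congr 1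
  · rw [Finset.sum_range_succ' _ (k + 1), Finset.mul_sum]
    simp only [Nat.add_sub_cancel, if_true, zero_mul, add_zero]
    refine Finset.sum_congr rfl fun a _ => ?_
    rw [if_neg (by omega), show k + 1 - (a + 1) = k - a by omega]; ring
  · rw [Finset.sum_range_succ _ (k + 1), Finset.mul_sum]
    simp only [if_true, zero_mul, add_zero]
    refine Finset.sum_congr rfl fun a ha => ?_
    have := Finset.mem_range.1 ha
    rw [if_neg (by omega), show k + 1 - a = (k - a) + 1 by omega]; ring

theorem C2_decomp (x : C2) : x = x.1 • ((1, 0) : C2) + x.2 • ((0, 1) : C2) := by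
  ext <;> simp

/-- division lemma -/
theorem hol_divide {f : C2 → ℂ} {ρ : ℝ} (hρ : 0 < ρ) (hf : DifferentiableOn ℂ f (ball 0 ρ)) :
    ∃ g1 g2 : C2 → ℂ, DifferentiableOn ℂ g1 (ball 0 ρ) ∧ DifferentiableOn ℂ g2 (ball 0 ρ) ∧
      (∀ x ∈ ball (0 : C2) ρ, f x = f 0 + (x.1 * g1 x + x.2 * g2 x)) ∧
      (∀ k : ℕ, (∃ C, ∀ x ∈ ball (0 : C2) ρ, ‖f x‖ ≤ C * ‖x‖ ^ (k + 1)) →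
        ∃ C', ∀ x ∈ ball (0 : C2) (ρ / 2), ‖g1 x‖ ≤ C' * ‖x‖ ^ k ∧ ‖g2 x‖ ≤ C' * ‖x‖ ^ k) := by
  set G : C2 → C2 → ℂ := fun e x => ∫ s in Icc (0 : ℝ) 1, fderiv ℂ f ((s : ℂ) • x) e with hG
  have hin : ∀ s ∈ Icc (0 : ℝ) 1, ∀ x ∈ ball (0 : C2) ρ, (s : ℂ) • x ∈ ball (0 : C2) ρ := by
    intro s hs x hx
    rw [mem_ball_zero_iff] at hx ⊢
    rw [norm_smul, Complex.norm_real, Real.norm_eq_abs, abs_of_nonneg hs.1]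
    nlinarith [norm_nonneg x, hs.1, hs.2]
  have hfd : ∀ e, DifferentiableOn ℂ (fun x => fderiv ℂ f x e) (ball 0 ρ) := fun e =>
    hol_fderiv_apply isOpen_ball hf e
  have hGd : ∀ e, DifferentiableOn ℂ (G e) (ball 0 ρ) := by
    intro e
    refine hol_param_integral isCompact_Icc isOpen_ball (f := fun (s : ℝ) x => fderiv ℂ f ((s : ℂ) • x) e) ?_ ?_
    · exact (hfd e).continuousOn.comp (by fun_prop) (fun q hq => hin q.1 hq.1 q.2 hq.2)
    · intro s hs
      exact (hfd e).comp (by fun_prop) (fun x hx => hin s hs x hx)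
  refine ⟨G (1, 0), G (0, 1), hGd _, hGd _, ?_, ?_⟩
  · intro x hx
    have hder : ∀ s ∈ uIcc (0 : ℝ) 1, HasDerivAt (fun s : ℝ => f ((s : ℂ) • x))
        (fderiv ℂ f ((s : ℂ) • x) x) s := by
      intro s hs
      rw [uIcc_of_le zero_le_one] at hs
      have h1 : HasFDerivAt f (fderiv ℂ f ((s : ℂ) • x)) ((s : ℂ) • x) :=
        (hf.differentiableAt (isOpen_ball.mem_nhds (hin s hs x hx))).hasFDerivAt
      have h2 : HasDerivAt (fun s : ℝ => (s : ℂ) • x) x s := by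
        simpa using (Complex.ofRealCLM.hasDerivAt (x := s)).smul_const x
      exact (h1.restrictScalars ℝ).comp_hasDerivAt s h2
    have hcont : ∀ e, ContinuousOn (fun s : ℝ => fderiv ℂ f ((s : ℂ) • x) e) (uIcc 0 1) := by
      intro e
      rw [uIcc_of_le zero_le_one]
      exact (hfd e).continuousOn.comp (by fun_prop) (fun s hs => hin s hs x hx)
    have hintg := intervalIntegral.integral_eq_sub_of_hasDerivAt hder (hcont x).intervalIntegrable
    have h3 : ∀ e, G e x = ∫ s in (0 : ℝ)..1, fderiv ℂ f ((s : ℂ) • x) e := by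
      intro e
      rw [intervalIntegral.integral_of_le zero_le_one, hG]
      exact MeasureTheory.integral_Icc_eq_integral_Ioc
    rw [h3, h3, ← intervalIntegral.integral_const_mul, ← intervalIntegral.integral_const_mul,
      ← intervalIntegral.integral_add]
    · have : ∀ s : ℝ, x.1 * fderiv ℂ f ((s : ℂ) • x) (1, 0) + x.2 * fderiv ℂ f ((s : ℂ) • x) (0, 1)
          = fderiv ℂ f ((s : ℂ) • x) x := by
        intro s
        conv_rhs => rw [C2_decomp x]
        rw [map_add, map_smul, map_smul, smul_eq_mul, smul_eq_mul]
        rw [← C2_decomp x]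
      simp_rw [this]
      rw [hintg]; simp
    · exact ((hcont _).const_smul x.1).intervalIntegrable
    · exact ((hcont _).const_smul x.2).intervalIntegrable
  · rintro k ⟨C, hC⟩
    have hC0 : 0 ≤ C := by
      have h1 := hC ((ρ / 2 : ℝ), 0) (by
        rw [mem_ball_zero_iff, Prod.norm_def]
        simp [abs_of_pos hρ]; linarith)
      have h2 : 0 < ‖(((ρ / 2 : ℝ) : ℂ), (0 : ℂ))‖ := by
        rw [norm_pos_iff]; simp [Prod.ext_iff, hρ.ne']
      by_contra hneg
      push Not at hneg
      have := mul_neg_of_neg_of_pos hneg (pow_pos h2 (k + 1))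
      linarith [norm_nonneg (f (((ρ / 2 : ℝ) : ℂ), (0 : ℂ)))]
    -- Cauchy estimate for the directional derivative
    have hcau : ∀ e : C2, ‖e‖ ≤ 1 → ∀ x ∈ ball (0 : C2) (ρ / 2),
        ‖fderiv ℂ f x e‖ ≤ 2 * C * 2 ^ (k + 1) * ‖x‖ ^ k := by
      intro e he x hx
      rw [mem_ball_zero_iff] at hx
      have hxρ : x ∈ ball (0 : C2) ρ := mem_ball_zero_iff.2 (by linarith)
      by_cases hx0 : x = 0
      · subst hx0
        -- at the origin use small radii
        have hle : ∀ t ∈ Ioo (0 : ℝ) (ρ / 2), ‖fderiv ℂ f 0 e‖ ≤ 2 * C * t ^ k := by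
          intro t ht
          have hg : DifferentiableOn ℂ (fun s : ℂ => f (s • e)) (ball 0 t) := by
            refine hf.comp (by fun_prop) fun s hs => ?_
            rw [mem_ball_zero_iff] at hs ⊢
            rw [norm_smul]
            nlinarith [norm_nonneg e, norm_nonneg s, ht.2]
          have := cauchy_deriv_bound (K := C * t ^ (k + 1)) ht.1 hg (by
            intro s hs
            rw [mem_ball_zero_iff] at hs
            have hse : ‖s • e‖ ≤ t := by
              rw [norm_smul]; nlinarith [norm_nonneg e, norm_nonneg s]
            refine (hC _ (mem_ball_zero_iff.2 (by linarith [ht.2]))).trans ?_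
            gcongr)
          have hd : deriv (fun s : ℂ => f (s • e)) 0 = fderiv ℂ f 0 e := by
            have h1 : HasFDerivAt f (fderiv ℂ f 0) ((0 : ℂ) • e) := by
              rw [zero_smul]
              exact (hf.differentiableAt (isOpen_ball.mem_nhds (mem_ball_self hρ))).hasFDerivAt
            have h2 : HasDerivAt (fun s : ℂ => s • e) e 0 := by
              simpa using (hasDerivAt_id (0 : ℂ)).smul_const e
            exact (h1.comp_hasDerivAt (0 : ℂ) h2).deriv
          rw [hd] at this
          refine this.trans (le_of_eq ?_)
          have := ht.1.ne'
          field_simp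
          ring
        have hlim : Tendsto (fun t : ℝ => 2 * C * t ^ k) (𝓝[>] 0) (𝓝 (2 * C * 0 ^ k)) := by
          have : Continuous fun t : ℝ => 2 * C * t ^ k := by fun_prop
          exact this.continuousAt.tendsto.mono_left nhdsWithin_le_nhds
        have h5 : ‖fderiv ℂ f 0 e‖ ≤ 2 * C * 0 ^ k := by
          refine ge_of_tendsto hlim ?_
          filter_upwards [Ioo_mem_nhdsGT (show (0 : ℝ) < ρ / 2 by linarith)] with t ht using hle t ht
        rw [norm_zero]
        refine h5.trans ?_
        have : (1 : ℝ) ≤ 2 ^ (k + 1) := one_le_pow₀ (by norm_num)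
        have h6 : (0 : ℝ) ≤ 0 ^ k := by positivity
        calc 2 * C * 0 ^ k = (2 * C) * 1 * 0 ^ k := by ring
          _ ≤ _ := by gcongr
      · have hxp : 0 < ‖x‖ := norm_pos_iff.2 hx0
        have hb : ∀ s ∈ ball (0 : ℂ) ‖x‖, ‖x + s • e‖ ≤ 2 * ‖x‖ := by
          intro s hs
          rw [mem_ball_zero_iff] at hs
          have : ‖s • e‖ ≤ ‖x‖ := by
              rw [norm_smul]; nlinarith [norm_nonneg e, norm_nonneg s]
          linarith [norm_add_le x (s • e)]
        have hg : DifferentiableOn ℂ (fun s : ℂ => f (x + s • e)) (ball 0 ‖x‖) := by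
          refine hf.comp (by fun_prop) fun s hs => ?_
          rw [mem_ball_zero_iff]
          linarith [hb s hs]
        have := cauchy_deriv_bound (K := C * (2 * ‖x‖) ^ (k + 1)) hxp hg (by
          intro s hs
          refine (hC _ (mem_ball_zero_iff.2 (by linarith [hb s hs]))).trans ?_
          gcongr
          exact hb s hs)
        have hd : deriv (fun s : ℂ => f (x + s • e)) 0 = fderiv ℂ f x e := by
          have h1 : HasFDerivAt f (fderiv ℂ f x) (x + (0 : ℂ) • e) := by
            rw [zero_smul, add_zero]
            exact (hf.differentiableAt (isOpen_ball.mem_nhds hxρ)).hasFDerivAt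
          have h2 : HasDerivAt (fun s : ℂ => x + s • e) e 0 := by
            simpa using ((hasDerivAt_id (0 : ℂ)).smul_const e).const_add x
          exact (h1.comp_hasDerivAt (0 : ℂ) h2).deriv
        rw [hd] at this
        refine this.trans (le_of_eq ?_)
        field_simp
        ring
    have hGb : ∀ e : C2, ‖e‖ ≤ 1 → ∀ x ∈ ball (0 : C2) (ρ / 2),
        ‖G e x‖ ≤ 2 * C * 2 ^ (k + 1) * ‖x‖ ^ k := by
      intro e he x hx
      rw [mem_ball_zero_iff] at hx
      have := MeasureTheory.norm_setIntegral_le_of_norm_le_const (μ := MeasureTheory.volume)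
        (s := Icc (0 : ℝ) 1) (f := fun s : ℝ => fderiv ℂ f ((s : ℂ) • x) e)
        (C := 2 * C * 2 ^ (k + 1) * ‖x‖ ^ k) (by simp) (by
          intro s hs
          have hsx : ‖(s : ℂ) • x‖ ≤ ‖x‖ := by
            rw [norm_smul, Complex.norm_real, Real.norm_eq_abs, abs_of_nonneg hs.1]
            nlinarith [norm_nonneg x, hs.1, hs.2]
          refine (hcau e he _ (mem_ball_zero_iff.2 (hsx.trans_lt hx))).trans ?_
          gcongr)
      have h0 : MeasureTheory.volume.real (Icc (0 : ℝ) 1) = 1 := by simp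
      rw [h0, mul_one] at this
      exact this
    exact ⟨_, fun x hx => ⟨hGb _ (by simp [Prod.norm_def]) x hx, hGb _ (by simp [Prod.norm_def]) x hx⟩⟩

/-- leading homogeneous term -/
theorem leading_term (k : ℕ) : ∀ (f : C2 → ℂ) (ρ : ℝ), 0 < ρ → DifferentiableOn ℂ f (ball 0 ρ) →
    (∃ C, ∀ x ∈ ball (0 : C2) ρ, ‖f x‖ ≤ C * ‖x‖ ^ k) →
    ∃ c : ℕ → ℂ, ∃ C ρ' : ℝ, 0 < ρ' ∧ ρ' ≤ ρ ∧ ∀ x ∈ ball (0 : C2) ρ', ‖f x - HomP k c x‖ ≤ C * ‖x‖ ^ (k + 1) := by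
  induction k with
  | zero =>
    intro f ρ hρ hf _
    obtain ⟨g1, g2, hg1, hg2, hdec, -⟩ := hol_divide hρ hf
    have hb : ∀ g : C2 → ℂ, DifferentiableOn ℂ g (ball 0 ρ) →
        ∃ C, ∃ δ > 0, ∀ x ∈ ball (0 : C2) δ, ‖g x‖ ≤ C := by
      intro g hg
      have hc : ContinuousAt g 0 :=
        (hg.differentiableAt (isOpen_ball.mem_nhds (mem_ball_self hρ))).continuousAt
      obtain ⟨δ, hδ, h⟩ := Metric.eventually_nhds_iff_ball.1
        (hc.norm.eventually_lt (continuousAt_const (y := ‖g 0‖ + 1)) (by linarith))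
      exact ⟨_, δ, hδ, fun x hx => (h x hx).le⟩
    obtain ⟨C1, δ1, hδ1, h1⟩ := hb g1 hg1
    obtain ⟨C2', δ2, hδ2, h2⟩ := hb g2 hg2
    refine ⟨fun _ => f 0, C1 + C2', min ρ (min δ1 δ2), by positivity, min_le_left _ _, fun x hx => ?_⟩
    have hx0 := ball_subset_ball (min_le_left _ _) hx
    have hx' := ball_subset_ball (min_le_right _ _) hx
    have e1 := h1 x (ball_subset_ball (min_le_left _ _) hx')
    have e2 := h2 x (ball_subset_ball (min_le_right _ _) hx')
    rw [hdec x hx0]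
    have : HomP 0 (fun _ => f 0) x = f 0 := by simp [HomP]
    rw [this, add_sub_cancel_left]
    have n1 : ‖x.1‖ ≤ ‖x‖ := norm_fst_le x
    have n2 : ‖x.2‖ ≤ ‖x‖ := norm_snd_le x
    calc _ ≤ ‖x.1‖ * ‖g1 x‖ + ‖x.2‖ * ‖g2 x‖ := by
          rw [← norm_mul, ← norm_mul]; exact norm_add_le _ _
      _ ≤ ‖x‖ * C1 + ‖x‖ * C2' := by gcongr
      _ = _ := by ring
  | succ k ih =>
    intro f ρ hρ hf hC
    obtain ⟨g1, g2, hg1, hg2, hdec, hord⟩ := hol_divide hρ hf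
    obtain ⟨C', hC'⟩ := hord k hC
    have hf0 : f 0 = 0 := by
      obtain ⟨C, hC⟩ := hC
      have := hC 0 (mem_ball_self hρ)
      simpa using this
    have hsub : ball (0 : C2) (ρ / 2) ⊆ ball 0 ρ := ball_subset_ball (by linarith)
    obtain ⟨c1, K1, ρ1, hρ1, hρ1', h1⟩ := ih g1 (ρ / 2) (by linarith) (hg1.mono hsub) ⟨C', fun x hx => (hC' x hx).1⟩
    obtain ⟨c2, K2, ρ2, hρ2, hρ2', h2⟩ := ih g2 (ρ / 2) (by linarith) (hg2.mono hsub) ⟨C', fun x hx => (hC' x hx).2⟩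
    refine ⟨fun a => (if a = 0 then 0 else c1 (a - 1)) + (if a = k + 1 then 0 else c2 a), K1 + K2, min ρ1 ρ2, by positivity, (min_le_left _ _).trans (by linarith), fun x hx => ?_⟩
    have e1 := h1 x (ball_subset_ball (min_le_left _ _) hx)
    have e2 := h2 x (ball_subset_ball (min_le_right _ _) hx)
    rw [← homP_step k c1 c2 x, hdec x (hsub (ball_subset_ball ((min_le_left _ _).trans hρ1') hx)), hf0]
    have n1 : ‖x.1‖ ≤ ‖x‖ := norm_fst_le x
    have n2 : ‖x.2‖ ≤ ‖x‖ := norm_snd_le x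
    have : 0 + (x.1 * g1 x + x.2 * g2 x) - (x.1 * HomP k c1 x + x.2 * HomP k c2 x)
      = x.1 * (g1 x - HomP k c1 x) + x.2 * (g2 x - HomP k c2 x) := by ring
    rw [this]
    calc _ ≤ ‖x.1‖ * ‖g1 x - HomP k c1 x‖ + ‖x.2‖ * ‖g2 x - HomP k c2 x‖ := by
          rw [← norm_mul, ← norm_mul]; exact norm_add_le _ _
      _ ≤ ‖x‖ * (K1 * ‖x‖ ^ (k + 1)) + ‖x‖ * (K2 * ‖x‖ ^ (k + 1)) := by gcongr
      _ = _ := by ring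

end Taylor2

section Trig

def Tr (G : ℂ → ℂ) (c : ℂ) : Prop :=
  ∃ g1 g2 : Polynomial ℂ, ∀ ζ : ℂ, ‖ζ‖ = 1 →
    G ζ = c + ζ * g1.eval ζ + starRingEnd ℂ (ζ * g2.eval ζ)

theorem Tr.add {G H : ℂ → ℂ} {c d : ℂ} (h1 : Tr G c) (h2 : Tr H d) :
    Tr (fun ζ => G ζ + H ζ) (c + d) := by
  obtain ⟨a, b, h⟩ := h1
  obtain ⟨a', b', h'⟩ := h2
  refine ⟨a + a', b + b', fun ζ hζ => ?_⟩
  beta_reduce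
  rw [h ζ hζ, h' ζ hζ]
  simp only [Polynomial.eval_add, mul_add, map_add]; ring

theorem Tr.const_mul {G : ℂ → ℂ} {c : ℂ} (x : ℂ) (h1 : Tr G c) :
    Tr (fun ζ => x * G ζ) (x * c) := by
  obtain ⟨a, b, h⟩ := h1
  refine ⟨Polynomial.C x * a, Polynomial.C (starRingEnd ℂ x) * b, fun ζ hζ => ?_⟩
  beta_reduce
  rw [h ζ hζ]
  simp only [Polynomial.eval_mul, Polynomial.eval_C, map_mul, Complex.conj_conj]; ring

theorem Tr.zero : Tr (fun _ => 0) 0 := ⟨0, 0, by simp⟩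

theorem conj_mul_self_one {ζ : ℂ} (h : ‖ζ‖ = 1) : ζ * starRingEnd ℂ ζ = 1 := by
  rw [Complex.mul_conj, Complex.normSq_eq_norm_sq, h]; simp

theorem Tr.mono (i j : ℕ) :
    Tr (fun ζ => ζ ^ i * starRingEnd ℂ ζ ^ j) (if i = j then 1 else 0) := by
  rcases lt_trichotomy i j with h | h | h
  · obtain ⟨d, rfl⟩ := Nat.exists_eq_add_of_lt h
    refine ⟨0, Polynomial.X ^ d, fun ζ hζ => ?_⟩
    beta_reduce
    rw [if_neg (by omega)]
    have : ζ ^ i * starRingEnd ℂ ζ ^ (i + d + 1) = (ζ * starRingEnd ℂ ζ) ^ i * starRingEnd ℂ ζ ^ (d + 1) := by ring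
    rw [this, conj_mul_self_one hζ]
    simp [pow_succ]; ring
  · subst h
    refine ⟨0, 0, fun ζ hζ => ?_⟩
    beta_reduce
    rw [← mul_pow, conj_mul_self_one hζ]; simp
  · obtain ⟨d, rfl⟩ := Nat.exists_eq_add_of_lt h
    refine ⟨Polynomial.X ^ d, 0, fun ζ hζ => ?_⟩
    beta_reduce
    rw [if_neg (by omega)]
    have : ζ ^ (j + d + 1) * starRingEnd ℂ ζ ^ j = (ζ * starRingEnd ℂ ζ) ^ j * ζ ^ (d + 1) := by ring
    rw [this, conj_mul_self_one hζ]
    simp [pow_succ]; ring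

theorem Tr.avg {G : ℂ → ℂ} {c : ℂ} (h : Tr G c) : Real.circleAverage G 0 1 = c := by
  obtain ⟨a, b, h⟩ := h
  have hm : ∀ q : Polynomial ℂ, Real.circleAverage (fun ζ => ζ * q.eval ζ) 0 1 = 0 := by
    intro q
    have := DiffContOnCl.circleAverage (f := fun ζ : ℂ => ζ * q.eval ζ) (c := 0) (R := 1) (by
      apply Differentiable.diffContOnCl
      exact differentiable_id.mul q.differentiable)
    rw [this]; simp
  have hc : ∀ q : Polynomial ℂ, Continuous fun ζ : ℂ => ζ * q.eval ζ := fun q =>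
    continuous_id.mul q.continuous
  have e : Real.circleAverage G 0 1 = Real.circleAverage
      (fun ζ => (c + ζ * a.eval ζ) + conjCLE (ζ * b.eval ζ)) 0 1 := by
    refine Real.circleAverage_congr_sphere fun ζ hζ => ?_
    rw [h ζ (by simpa using hζ)]; simp
  rw [e, Real.circleAverage_fun_add, Real.circleAverage_fun_add, Real.circleAverage_const, hm]
  · have := ContinuousLinearMap.circleAverage_comp_comm (c := 0) (R := 1)
      (f := fun ζ : ℂ => ζ * b.eval ζ) (conjCLE : ℂ →L[ℝ] ℂ) ((hc b).continuousOn.circleIntegrable' )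
    have h2 : Real.circleAverage (fun ζ : ℂ => conjCLE (ζ * b.eval ζ)) 0 1 = conjCLE (Real.circleAverage (fun ζ => ζ * b.eval ζ) 0 1) := this
    rw [h2, hm]; simp
  · exact continuousOn_const.circleIntegrable'
  · exact (hc a).continuousOn.circleIntegrable'
  · exact (continuous_const.add (hc a)).continuousOn.circleIntegrable'
  · exact (conjCLE.continuous.comp (hc b)).continuousOn.circleIntegrable'

/-- Laurent polynomials on the circle -/
def La (G : ℂ → ℂ) : Prop :=
  ∃ (n : ℕ) (P : Polynomial ℂ), ∀ ζ : ℂ, ‖ζ‖ = 1 → G ζ = starRingEnd ℂ ζ ^ n * P.eval ζ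

theorem La.const (c : ℂ) : La fun _ => c := ⟨0, Polynomial.C c, by simp⟩
theorem La.id : La fun ζ => ζ := ⟨0, Polynomial.X, by simp⟩
theorem La.conj : La fun ζ => starRingEnd ℂ ζ := ⟨1, 1, by simp⟩
theorem La.mul {G H : ℂ → ℂ} (h1 : La G) (h2 : La H) : La fun ζ => G ζ * H ζ := by
  obtain ⟨a, b, h⟩ := h1
  obtain ⟨a', b', h'⟩ := h2
  refine ⟨a + a', b * b', fun ζ hζ => ?_⟩
  beta_reduce
  rw [h ζ hζ, h' ζ hζ]
  simp only [Polynomial.eval_mul]; ring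
theorem La.add {G H : ℂ → ℂ} (h1 : La G) (h2 : La H) : La fun ζ => G ζ + H ζ := by
  obtain ⟨a, b, h⟩ := h1
  obtain ⟨a', b', h'⟩ := h2
  refine ⟨a + a', Polynomial.X ^ a' * b + Polynomial.X ^ a * b', fun ζ hζ => ?_⟩
  beta_reduce
  rw [h ζ hζ, h' ζ hζ]
  simp only [Polynomial.eval_mul, Polynomial.eval_add, Polynomial.eval_pow, Polynomial.eval_X]
  have e1 : ζ ^ a * starRingEnd ℂ ζ ^ a = 1 := by rw [← mul_pow, conj_mul_self_one hζ, one_pow]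
  have e2 : ζ ^ a' * starRingEnd ℂ ζ ^ a' = 1 := by rw [← mul_pow, conj_mul_self_one hζ, one_pow]
  rw [pow_add]
  linear_combination (-(starRingEnd ℂ ζ ^ a * b.eval ζ)) * e2 - starRingEnd ℂ ζ ^ a' * b'.eval ζ * e1
theorem La.pow {G : ℂ → ℂ} (h1 : La G) (n : ℕ) : La fun ζ => G ζ ^ n := by
  induction n with
  | zero => simpa using La.const 1
  | succ n ih => simpa only [pow_succ] using ih.mul h1
theorem La.sum {ι : Type*} (s : Finset ι) {G : ι → ℂ → ℂ} (h : ∀ i ∈ s, La (G i)) :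
    La fun ζ => ∑ i ∈ s, G i ζ := by
  classical
  induction s using Finset.induction_on with
  | empty => simpa using La.const 0
  | insert a s ha ih =>
    simp only [Finset.sum_insert ha]
    exact (h a (by simp)).add (ih fun i hi => h i (by simp [hi]))

theorem La.tr {G : ℂ → ℂ} (h : La G) : ∃ c, Tr G c := by
  obtain ⟨n, P, h⟩ := h
  have key : ∀ P : Polynomial ℂ, ∃ c, Tr (fun ζ => starRingEnd ℂ ζ ^ n * P.eval ζ) c := by
    intro P
    induction P using Polynomial.induction_on' with
    | add p q hp hq =>
      obtain ⟨c, hc⟩ := hp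
      obtain ⟨d, hd⟩ := hq
      exact ⟨c + d, by simpa only [Polynomial.eval_add, mul_add] using hc.add hd⟩
    | monomial i a =>
      have := (Tr.mono i n).const_mul a
      refine ⟨a * (if i = n then 1 else 0), ?_⟩
      simp only [Polynomial.eval_monomial]
      convert this using 2
      ring
  obtain ⟨c, g1, g2, hc⟩ := key P
  exact ⟨c, g1, g2, fun ζ hζ => by rw [h ζ hζ, ← hc ζ hζ]⟩

theorem binom_bound (a b : ℕ) : ∃ C : ℝ, 0 ≤ C ∧ ∀ (s : ℝ) (x x' : ℂ), ‖x‖ ≤ s → ‖x'‖ ≤ s → s ≤ 1 →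
    ‖(1 + x) ^ a * (1 + x') ^ b - 1 - a * x - b * x'‖ ≤ C * s ^ 2 := by
  have hb : ∀ b : ℕ, ∃ C : ℝ, 0 ≤ C ∧ ∀ (s : ℝ) (x' : ℂ), ‖x'‖ ≤ s → s ≤ 1 →
      ‖(1 + x') ^ b - 1 - b * x'‖ ≤ C * s ^ 2 := by
    intro b
    induction b with
    | zero => exact ⟨0, le_rfl, by simp⟩
    | succ b ih =>
      obtain ⟨C, hC, h⟩ := ih
      refine ⟨2 * C + b, by positivity, fun s x' hx hs => ?_⟩
      have e : (1 + x') ^ (b + 1) - 1 - ((b + 1 : ℕ) : ℂ) * x' =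
        ((1 + x') ^ b - 1 - b * x') * (1 + x') + b * (x' * x') := by push_cast; ring
      have h0 := norm_nonneg x'
      have hs0 : 0 ≤ s := h0.trans hx
      have h1 : ‖(1 + x')‖ ≤ 2 := (norm_add_le _ _).trans (by simp; linarith)
      rw [e]
      calc _ ≤ ‖((1 + x') ^ b - 1 - b * x')‖ * ‖1 + x'‖ + b * (‖x'‖ * ‖x'‖) := by
            refine (norm_add_le _ _).trans ?_
            simp
        _ ≤ (C * s ^ 2) * 2 + b * (s * s) := by gcongr; exact h s x' hx hs
        _ = _ := by ring
  obtain ⟨C0, hC0, hb⟩ := hb b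
  induction a with
  | zero => exact ⟨C0, hC0, fun s x x' _ hx hs => by simpa using hb s x' hx hs⟩
  | succ a ih =>
    obtain ⟨C, hC, h⟩ := ih
    refine ⟨2 * C + a + b, by positivity, fun s x x' hx hx' hs => ?_⟩
    have e : (1 + x) ^ (a + 1) * (1 + x') ^ b - 1 - ((a + 1 : ℕ) : ℂ) * x - b * x' =
      ((1 + x) ^ a * (1 + x') ^ b - 1 - a * x - b * x') * (1 + x) + (a * (x * x) + b * (x' * x)) := by
        push_cast; ring
    have h0 := norm_nonneg x
    have h0' := norm_nonneg x'
    have hs0 : 0 ≤ s := h0.trans hx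
    have h1 : ‖(1 + x)‖ ≤ 2 := (norm_add_le _ _).trans (by simp; linarith)
    rw [e]
    calc _ ≤ ‖((1 + x) ^ a * (1 + x') ^ b - 1 - a * x - b * x')‖ * ‖1 + x‖ + (a * (‖x‖ * ‖x‖) + b * (‖x'‖ * ‖x‖)) := by
          refine (norm_add_le _ _).trans ?_
          refine add_le_add (by simp) ((norm_add_le _ _).trans (by simp))
      _ ≤ (C * s ^ 2) * 2 + (a * (s * s) + b * (s * s)) := by gcongr; exact h s x x' hx hx' hs
      _ = _ := by ring

/-- Existence of a polynomial reparametrization making the mean nonzero. -/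
theorem exists_sigma (k : ℕ) (c : ℕ → ℂ) (a0 : ℕ) (ha0 : 1 ≤ a0) (ha0' : a0 + 1 ≤ k) (hc : c a0 ≠ 0) :
    ∃ (σ : Polynomial ℂ) (τ : ℂ), σ.eval 0 = 0 ∧ τ ≠ 0 ∧
      Tr (fun ζ => HomP k c (σ.eval ζ, starRingEnd ℂ (σ.eval ζ))) τ := by
  by_contra hcon
  push Not at hcon
  set N : ℕ := (k - 2 * a0) + (2 * a0 - k) with hN
  -- all means vanish
  set G : ℂ → ℂ → ℂ := fun s ζ => ∑ a ∈ Finset.range (k + 1), c a * (ζ ^ a * starRingEnd ℂ ζ ^ (k - a) *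
    ((1 + s * ζ ^ N) ^ a * (1 + starRingEnd ℂ (s * ζ ^ N)) ^ (k - a))) with hG
  have hLa : ∀ s, Tr (G s) 0 := by
    intro s
    have h1 : La (G s) := by
      refine La.sum _ fun a _ => (La.const _).mul (((La.id.pow _).mul (La.conj.pow _)).mul (La.mul ?_ ?_))
      · exact La.pow ((La.const _).add ((La.const _).mul (La.id.pow _))) _
      · refine La.pow ((La.const _).add ?_) _
        simpa only [map_mul, map_pow] using (La.const (starRingEnd ℂ s)).mul (La.conj.pow N)
    obtain ⟨τ, hτ⟩ := h1.tr
    set σ : Polynomial ℂ := Polynomial.X * (1 + Polynomial.C s * Polynomial.X ^ N) with hσ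
    have hs : ∀ ζ, HomP k c (σ.eval ζ, starRingEnd ℂ (σ.eval ζ)) = G s ζ := by
      intro ζ
      simp only [HomP, hG, hσ]
      refine Finset.sum_congr rfl fun a _ => ?_
      simp only [Polynomial.eval_mul, Polynomial.eval_add, Polynomial.eval_X, Polynomial.eval_one,
        Polynomial.eval_C, Polynomial.eval_pow, map_mul, map_add, map_one, map_pow, mul_pow]
      ring
    have hτ0 : τ = 0 := by
      by_contra hne
      refine hcon σ τ (by simp [hσ]) hne ?_
      simpa only [hs] using hτ
    rwa [hτ0] at hτ
  -- first order part
  set P0 : ℂ := ∑ a ∈ Finset.range (k + 1), c a * (if a = k - a then 1 else 0) with hP0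
  set P1 : ℂ := ∑ a ∈ Finset.range (k + 1), c a * (a * (if a + N = k - a then 1 else 0)) with hP1
  set P2 : ℂ := ∑ a ∈ Finset.range (k + 1), c a * ((k - a : ℕ) * (if a = k - a + N then 1 else 0)) with hP2
  have trsum : ∀ (n : ℕ) (f : ℕ → ℂ → ℂ) (d : ℕ → ℂ), (∀ a, Tr (f a) (d a)) →
      Tr (fun ζ => ∑ a ∈ Finset.range n, f a ζ) (∑ a ∈ Finset.range n, d a) := by
    intro n f d h
    induction n with
    | zero => simpa using Tr.zero
    | succ n ih => simpa only [Finset.sum_range_succ] using ih.add (h n)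
  choose Cb hCb0 hCb using fun a : ℕ => binom_bound a (k - a)
  have hest : ∀ s : ℂ, ‖s‖ ≤ 1 → ‖P0 + s * P1 + starRingEnd ℂ s * P2‖ ≤
      (∑ a ∈ Finset.range (k + 1), ‖c a‖ * Cb a) * ‖s‖ ^ 2 := by
    intro s hs
    set L : ℂ → ℂ := fun ζ => (∑ a ∈ Finset.range (k + 1), c a * (ζ ^ a * starRingEnd ℂ ζ ^ (k - a))
      + s * ∑ a ∈ Finset.range (k + 1), c a * (a * (ζ ^ (a + N) * starRingEnd ℂ ζ ^ (k - a))))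
      + starRingEnd ℂ s * ∑ a ∈ Finset.range (k + 1), c a * ((k - a : ℕ) * (ζ ^ a * starRingEnd ℂ ζ ^ (k - a + N))) with hL
    have hLt : Tr L (P0 + s * P1 + starRingEnd ℂ s * P2) :=
      ((trsum _ _ _ fun a => (Tr.mono _ _).const_mul _).add
        ((trsum _ _ _ fun a => ((Tr.mono _ _).const_mul _).const_mul _).const_mul s)).add
        ((trsum _ _ _ fun a => ((Tr.mono _ _).const_mul _).const_mul _).const_mul _)
    have hD := (hLt.add ((hLa s).const_mul (-1))).avg
    rw [mul_zero, add_zero] at hD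
    rw [← hD]
    have hb : ∀ ζ : ℂ, ‖ζ‖ = 1 → ‖L ζ + -1 * G s ζ‖ ≤ (∑ a ∈ Finset.range (k + 1), ‖c a‖ * Cb a) * ‖s‖ ^ 2 := by
      intro ζ hζ
      have e : L ζ + -1 * G s ζ = ∑ a ∈ Finset.range (k + 1), -(c a * (ζ ^ a * starRingEnd ℂ ζ ^ (k - a) *
        ((1 + s * ζ ^ N) ^ a * (1 + starRingEnd ℂ (s * ζ ^ N)) ^ (k - a) - 1 - a * (s * ζ ^ N) - (k - a : ℕ) * starRingEnd ℂ (s * ζ ^ N)))) := by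
        simp only [hL, hG, Finset.mul_sum, ← Finset.sum_add_distrib]
        refine Finset.sum_congr rfl fun a _ => ?_
        simp only [map_mul, map_pow]
        ring
      rw [e, Finset.sum_mul]
      refine (norm_sum_le _ _).trans (Finset.sum_le_sum fun a _ => ?_)
      rw [norm_neg, norm_mul, norm_mul, norm_mul, norm_pow, norm_pow, RCLike.norm_conj, hζ, one_pow, one_pow, one_mul, one_mul, mul_assoc]
      gcongr
      exact hCb a ‖s‖ _ _ (by simp [hζ]) (by simp [hζ]) hs
    rw [Real.circleAverage_def]
    have := intervalIntegral.norm_integral_le_of_norm_le_const (a := 0) (b := 2 * Real.pi)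
      (f := fun θ => L (circleMap 0 1 θ) + -1 * G s (circleMap 0 1 θ))
      (C := (∑ a ∈ Finset.range (k + 1), ‖c a‖ * Cb a) * ‖s‖ ^ 2) (fun θ _ => hb _ (by simp))
    rw [norm_smul]
    have hpi := Real.pi_pos
    rw [sub_zero, abs_of_pos (by positivity)] at this
    calc _ ≤ ‖(2 * Real.pi)⁻¹‖ * ((∑ a ∈ Finset.range (k + 1), ‖c a‖ * Cb a) * ‖s‖ ^ 2 * (2 * Real.pi)) := by gcongr
      _ = _ := by
        rw [Real.norm_eq_abs, abs_of_pos (by positivity)]; field_simp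
  set K := ∑ a ∈ Finset.range (k + 1), ‖c a‖ * Cb a with hK
  have hP0z : P0 = 0 := by simpa using hest 0 (by simp)
  have hlin : ∀ θ : ℂ, ‖θ‖ = 1 → θ * P1 + starRingEnd ℂ θ * P2 = 0 := by
    intro θ hθ
    have hle : ∀ t ∈ Ioo (0 : ℝ) 1, ‖θ * P1 + starRingEnd ℂ θ * P2‖ ≤ K * t := by
      intro t ht
      have h1 := hest (t * θ) (by simp [hθ, abs_of_pos ht.1, ht.2.le])
      rw [hP0z, zero_add] at h1
      have e : (t : ℂ) * θ * P1 + starRingEnd ℂ ((t : ℂ) * θ) * P2 = t * (θ * P1 + starRingEnd ℂ θ * P2) := by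
        simp only [map_mul, Complex.conj_ofReal]; ring
      rw [e, norm_mul, norm_mul, hθ, Complex.norm_real, Real.norm_eq_abs, abs_of_pos ht.1] at h1
      have := ht.1
      nlinarith
    have hlim : Tendsto (fun t : ℝ => K * t) (𝓝[>] 0) (𝓝 (K * 0)) := by
      have : Continuous fun t : ℝ => K * t := by fun_prop
      exact this.continuousAt.tendsto.mono_left nhdsWithin_le_nhds
    have h5 : ‖θ * P1 + starRingEnd ℂ θ * P2‖ ≤ K * 0 := by
      refine ge_of_tendsto hlim ?_
      filter_upwards [Ioo_mem_nhdsGT (show (0 : ℝ) < 1 by norm_num)] with t ht using hle t ht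
    rw [mul_zero] at h5
    exact norm_le_zero_iff.1 h5
  have l1 := hlin 1 (by simp)
  have l2 := hlin I (by simp)
  simp only [map_one, one_mul, Complex.conj_I] at l1 l2
  have hI := Complex.I_ne_zero
  have l3 : P1 - P2 = 0 := by
    have : I * (P1 - P2) = 0 := by linear_combination l2
    exact (mul_eq_zero.1 this).resolve_left hI
  have z1 : P1 = 0 := by linear_combination (l1 + l3) / 2
  have z2 : P2 = 0 := by linear_combination (l1 - l3) / 2
  rcases lt_trichotomy (2 * a0) k with h | h | h
  · rw [hP1, Finset.sum_eq_single a0] at z1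
    · rw [if_pos (by omega)] at z1
      simp [hc] at z1; omega
    · intro b hb hne
      have := Finset.mem_range.1 hb
      rw [if_neg (by omega)]; simp
    · intro hh; exact absurd (Finset.mem_range.2 (by omega)) hh
  · rw [hP0, Finset.sum_eq_single a0] at hP0z
    · rw [if_pos (by omega)] at hP0z
      simp [hc] at hP0z
    · intro b hb hne
      have := Finset.mem_range.1 hb
      rw [if_neg (by omega)]; simp
    · intro hh; exact absurd (Finset.mem_range.2 (by omega)) hh
  · rw [hP2, Finset.sum_eq_single a0] at z2
    · rw [if_pos (by omega), mul_one] at z2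
      rcases mul_eq_zero.1 z2 with h' | h'
      · exact hc h'
      · have : k - a0 = 0 := by exact_mod_cast h'
        omega
    · intro b hb hne
      have := Finset.mem_range.1 hb
      rw [if_neg (by omega)]; simp
    · intro hh; exact absurd (Finset.mem_range.2 (by omega)) hh

end Trig

section DiscCore

theorem le_zero_of_small {a K δ : ℝ} (hδ : 0 < δ) (h : ∀ t ∈ Ioo (0 : ℝ) δ, a ≤ K * t) : a ≤ 0 := by
  have hlim : Tendsto (fun t : ℝ => K * t) (𝓝[>] 0) (𝓝 (K * 0)) := by
    have : Continuous fun t : ℝ => K * t := by fun_prop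
    exact this.continuousAt.tendsto.mono_left nhdsWithin_le_nhds
  rw [mul_zero] at hlim
  refine ge_of_tendsto hlim ?_
  filter_upwards [Ioo_mem_nhdsGT hδ] with t ht using h t ht

theorem hol_zero_of_real {g : ℂ → ℂ} {ρ : ℝ} (hρ : 0 < ρ) (hg : DifferentiableOn ℂ g (ball 0 ρ))
    (h : ∀ x : ℝ, |x| < ρ → g x = 0) : ∀ z ∈ ball (0 : ℂ) ρ, g z = 0 := by
  refine (hg.analyticOnNhd isOpen_ball).eqOn_zero_of_preconnected_of_frequently_eq_zero
    (convex_ball _ _).isPreconnected (mem_ball_self hρ) ?_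
  have ht : Tendsto (fun x : ℝ => (x : ℂ)) (𝓝[>] 0) (𝓝[≠] 0) := by
    refine tendsto_nhdsWithin_iff.2 ⟨?_, ?_⟩
    · exact (Complex.continuous_ofReal.tendsto' 0 0 (by simp)).mono_left nhdsWithin_le_nhds
    · filter_upwards [self_mem_nhdsWithin] with x hx
      simpa using (ne_of_gt hx)
  refine ht.frequently (Eventually.frequently ?_)
  filter_upwards [Ioo_mem_nhdsGT hρ] with x hx
  exact h x (by rw [abs_of_pos hx.1]; exact hx.2)

theorem hol_zero_of_antidiag {f : C2 → ℂ} {ρ : ℝ} (hρ : 0 < ρ) (hf : DifferentiableOn ℂ f (ball 0 ρ))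
    (h : ∀ ξ : ℂ, ‖ξ‖ < ρ → f (ξ, starRingEnd ℂ ξ) = 0) : ∀ x ∈ ball (0 : C2) (ρ / 2), f x = 0 := by
  have hin : ∀ p q : ℂ, ‖p‖ < ρ / 2 → ‖q‖ < ρ / 2 → ((p + I * q, p - I * q) : C2) ∈ ball (0 : C2) ρ := by
    intro p q hp hq
    rw [mem_ball_zero_iff, Prod.norm_def]
    have e : ‖I * q‖ = ‖q‖ := by simp
    refine max_lt ?_ ?_
    · have := norm_add_le p (I * q); simp only; linarith
    · have := norm_sub_le p (I * q); simp only; linarith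
  have h1 : ∀ q : ℝ, |q| < ρ / 2 → ∀ p : ℂ, ‖p‖ < ρ / 2 → f (p + I * q, p - I * q) = 0 := by
    intro q hq p hp
    have hqc : ‖(q : ℂ)‖ < ρ / 2 := by simpa using hq
    refine hol_zero_of_real (g := fun p => f (p + I * q, p - I * q)) (ρ := ρ / 2) (by linarith) ?_ ?_ p (mem_ball_zero_iff.2 hp)
    · exact hf.comp (by fun_prop) fun p hp => hin p q (mem_ball_zero_iff.1 hp) hqc
    · intro x hx
      have := h (x + I * q) (by
        have := (mem_ball_zero_iff.1 (hin x q (by simpa using hx) hqc))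
        exact (norm_fst_le _).trans_lt this)
      simp only [map_add, map_mul, Complex.conj_ofReal, Complex.conj_I] at this
      rw [← this]; congr 2; ring
  have h2 : ∀ p q : ℂ, ‖p‖ < ρ / 2 → ‖q‖ < ρ / 2 → f (p + I * q, p - I * q) = 0 := by
    intro p q hp hq
    refine hol_zero_of_real (g := fun q => f (p + I * q, p - I * q)) (ρ := ρ / 2) (by linarith) ?_ ?_ q (mem_ball_zero_iff.2 hq)
    · exact hf.comp (by fun_prop) fun q hq => hin p q hp (mem_ball_zero_iff.1 hq)
    · intro x hx; exact h1 x hx p hp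
  intro x hx
  rw [mem_ball_zero_iff] at hx
  have n1 := norm_fst_le x
  have n2 := norm_snd_le x
  have := h2 ((x.1 + x.2) / 2) (-I * ((x.1 - x.2) / 2))
    (by rw [norm_div]; have := norm_add_le x.1 x.2; simp; linarith)
    (by rw [norm_mul, norm_div]; have := norm_sub_le x.1 x.2; simp; linarith)
  convert this using 2
  have : I * (-I * ((x.1 - x.2) / 2)) = (x.1 - x.2) / 2 := by
    rw [← mul_assoc, mul_neg, Complex.I_mul_I]; ring
  rw [this]
  ext
  · simp only; ring
  · simp only; ring

theorem homP_smul (k : ℕ) (c : ℕ → ℂ) (t : ℝ) (x : C2) : HomP k c ((t : ℂ) • x) = (t : ℂ) ^ k * HomP k c x := by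
  simp only [HomP, Finset.mul_sum, Prod.smul_fst, Prod.smul_snd, smul_eq_mul]
  refine Finset.sum_congr rfl fun a ha => ?_
  have := Finset.mem_range.1 ha
  rw [show (t : ℂ) ^ k = t ^ a * t ^ (k - a) by rw [← pow_add]; congr 1; omega]
  ring

theorem trig_core {F : C2 → ℂ} (hF : DifferentiableOn ℂ F (ball 0 2))
    (hax1 : ∀ ξ : ℂ, ‖ξ‖ < 2 → F (ξ, 0) = 0) (hax2 : ∀ ξ : ℂ, ‖ξ‖ < 2 → F (0, ξ) = 0)
    (hreal : ∀ ξ : ℂ, ‖ξ‖ < 2 → (F (ξ, starRingEnd ℂ ξ)).im = 0) (hne : F (1, 1) ≠ 0) :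
    ∃ (k : ℕ) (σ b : Polynomial ℂ) (τ C ε0 : ℝ), 1 ≤ k ∧ σ.eval 0 = 0 ∧ b.eval 0 = 0 ∧ τ ≠ 0 ∧ 0 ≤ C ∧ 0 < ε0 ∧
      ∀ ε ∈ Ioo (0 : ℝ) ε0, ∀ ζ : ℂ, ‖ζ‖ = 1 →
        |(F ((ε : ℂ) * σ.eval ζ, starRingEnd ℂ ((ε : ℂ) * σ.eval ζ))).re + ε ^ k * (b.eval ζ).im - ε ^ k * τ| ≤ C * ε ^ (k + 1) := by
  set S : ℕ → Prop := fun k => ∃ ρ > 0, ρ ≤ 2 ∧ ∃ C : ℝ, ∀ x ∈ ball (0 : C2) ρ, ‖F x‖ ≤ C * ‖x‖ ^ k with hS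
  have h0 : S 0 := by
    have hc : ContinuousAt F 0 :=
      (hF.differentiableAt (isOpen_ball.mem_nhds (mem_ball_self (by norm_num)))).continuousAt
    obtain ⟨δ, hδ, h⟩ := Metric.eventually_nhds_iff_ball.1
      (hc.norm.eventually_lt (continuousAt_const (y := ‖F 0‖ + 1)) (by linarith))
    exact ⟨min δ 2, by positivity, min_le_right _ _, ‖F 0‖ + 1, fun x hx => by
      simpa using (h x (ball_subset_ball (min_le_left _ _) hx)).le⟩
  have hnot : ¬ ∀ k, S k := by
    intro hall
    set g : ℂ → ℂ := fun z => F (z, z) with hg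
    have hgd : DifferentiableOn ℂ g (ball 0 2) := hF.comp (by fun_prop) fun z hz => by
      rw [mem_ball_zero_iff] at hz ⊢; simpa [Prod.norm_def] using hz
    have hga := hgd.analyticOnNhd isOpen_ball
    have hev : ∀ᶠ z in 𝓝 (0 : ℂ), g z = 0 := by
      by_contra hcon
      obtain ⟨n, u, hu, hu0, hgu⟩ := (hga 0 (mem_ball_self (by norm_num))).exists_eventuallyEq_pow_smul_nonzero_iff.2 hcon
      obtain ⟨ρ, hρ, -, C, hC⟩ := hall (n + 1)
      have hle : ∀ᶠ z in 𝓝[≠] (0 : ℂ), ‖u z‖ ≤ C * ‖z‖ := by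
        filter_upwards [nhdsWithin_le_nhds hgu, nhdsWithin_le_nhds (ball_mem_nhds (0 : ℂ) hρ), self_mem_nhdsWithin] with z h1 h2 h3
        have hz : 0 < ‖z‖ := norm_pos_iff.2 h3
        have h4 := hC (z, z) (by rw [mem_ball_zero_iff] at h2 ⊢; simpa [Prod.norm_def] using h2)
        have h5 : F (z, z) = (z - 0) ^ n • u z := h1
        rw [h5, sub_zero, norm_smul, norm_pow] at h4
        have h6 : ‖((z, z) : C2)‖ = ‖z‖ := by simp [Prod.norm_def]
        rw [h6, pow_succ] at h4
        have : 0 < ‖z‖ ^ n := by positivity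
        nlinarith
      have hl1 : Tendsto (fun z => ‖u z‖) (𝓝[≠] (0 : ℂ)) (𝓝 ‖u 0‖) := hu.continuousAt.norm.tendsto.mono_left nhdsWithin_le_nhds
      have hl2 : Tendsto (fun z : ℂ => C * ‖z‖) (𝓝[≠] (0 : ℂ)) (𝓝 0) := by
        have : Continuous fun z : ℂ => C * ‖z‖ := by fun_prop
        exact (this.tendsto' 0 0 (by simp)).mono_left nhdsWithin_le_nhds
      have := le_of_tendsto_of_tendsto hl1 hl2 hle
      exact hu0 (norm_le_zero_iff.1 this)
    have := hga.eqOn_zero_of_preconnected_of_eventuallyEq_zero (convex_ball _ _).isPreconnected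
      (mem_ball_self (by norm_num)) hev
    exact hne (this (x := 1) (by simp))
  obtain ⟨k, hk, hk1⟩ : ∃ k, S k ∧ ¬ S (k + 1) := by
    by_contra hcon
    push Not at hcon
    exact hnot fun k => Nat.rec h0 (fun n ih => hcon n ih) k
  obtain ⟨ρ, hρ, hρ2, hCk⟩ := hk
  obtain ⟨c, C, ρ', hρ', hρρ', hlead⟩ := leading_term k F ρ hρ (hF.mono (ball_subset_ball hρ2)) hCk
  -- homogeneous consequences
  have hscale : ∀ x : C2, ∀ t ∈ Ioo (0 : ℝ) (ρ' / (‖x‖ + 1)), (t : ℂ) • x ∈ ball (0 : C2) ρ' ∧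
      ‖F ((t : ℂ) • x) - (t : ℂ) ^ k * HomP k c x‖ ≤ (C * ‖x‖ ^ (k + 1)) * t ^ (k + 1) := by
    intro x t ht
    have hx := norm_nonneg x
    have hn : ‖(t : ℂ) • x‖ = t * ‖x‖ := by
      rw [norm_smul, Complex.norm_real, Real.norm_eq_abs, abs_of_pos ht.1]
    have hm : (t : ℂ) • x ∈ ball (0 : C2) ρ' := by
      rw [mem_ball_zero_iff, hn]
      have := (lt_div_iff₀ (by positivity)).1 ht.2
      nlinarith [ht.1]
    refine ⟨hm, ?_⟩
    have := hlead _ hm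
    rw [homP_smul, hn, mul_pow] at this
    linarith
  have hdiv : ∀ x : C2, ∀ φ : ℂ →L[ℝ] ℝ, (∀ t : ℝ, (t : ℂ) • x ∈ ball (0 : C2) ρ' → φ (F ((t : ℂ) • x)) = 0) → φ (HomP k c x) = 0 := by
    intro x φ hφ
    have : |φ (HomP k c x)| ≤ 0 := by
      refine le_zero_of_small (K := ‖φ‖ * (C * ‖x‖ ^ (k + 1))) (δ := ρ' / (‖x‖ + 1)) (by positivity) fun t ht => ?_
      obtain ⟨h1, h2⟩ := hscale x t ht
      have h3 := φ.le_opNorm (F ((t : ℂ) • x) - (t : ℂ) ^ k * HomP k c x)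
      have h4 : (t : ℂ) ^ k * HomP k c x = (t ^ k) • HomP k c x := by
        rw [Complex.real_smul]; push_cast; rfl
      rw [map_sub, hφ t h1, h4, map_smul, zero_sub, norm_neg, norm_smul] at h3
      rw [h4] at h2
      have htp : 0 < t ^ k := pow_pos ht.1 k
      rw [Real.norm_eq_abs, Real.norm_eq_abs, abs_of_pos htp] at h3
      have h5 : t ^ k * |φ (HomP k c x)| ≤ ‖φ‖ * ((C * ‖x‖ ^ (k + 1)) * t ^ (k + 1)) :=
        h3.trans (by gcongr)
      have h6 : t ^ k * |φ (HomP k c x)| ≤ t ^ k * (‖φ‖ * (C * ‖x‖ ^ (k + 1)) * t) :=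
        h5.trans (le_of_eq (by ring))
      exact le_of_mul_le_mul_left h6 htp
    exact abs_nonpos_iff.1 this
  have hnorm2 : ∀ x : C2, x ∈ ball (0 : C2) ρ' → ‖x.1‖ < 2 ∧ ‖x.2‖ < 2 := by
    intro x hx
    rw [mem_ball_zero_iff] at hx
    exact ⟨(norm_fst_le x).trans_lt (by linarith), (norm_snd_le x).trans_lt (by linarith)⟩
  have hax1' : HomP k c (1, 0) = 0 := by
    have h1 : ∀ t : ℝ, (t : ℂ) • ((1, 0) : C2) ∈ ball (0 : C2) ρ' → F ((t : ℂ) • ((1, 0) : C2)) = 0 := by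
      intro t ht
      have e : (t : ℂ) • ((1, 0) : C2) = ((t : ℂ), (0 : ℂ)) := by simp [Prod.ext_iff]
      have := (hnorm2 _ ht).1
      rw [e] at this ⊢
      exact hax1 _ this
    apply Complex.ext
    · exact hdiv _ reCLM fun t ht => by rw [h1 t ht]; simp
    · exact hdiv _ imCLM fun t ht => by rw [h1 t ht]; simp
  have hax2' : HomP k c (0, 1) = 0 := by
    have h1 : ∀ t : ℝ, (t : ℂ) • ((0, 1) : C2) ∈ ball (0 : C2) ρ' → F ((t : ℂ) • ((0, 1) : C2)) = 0 := by
      intro t ht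
      have e : (t : ℂ) • ((0, 1) : C2) = (0, (t : ℂ)) := by simp [Prod.ext_iff]
      have := (hnorm2 _ ht).2
      rw [e] at this ⊢
      exact hax2 _ this
    apply Complex.ext
    · exact hdiv _ reCLM fun t ht => by rw [h1 t ht]; simp
    · exact hdiv _ imCLM fun t ht => by rw [h1 t ht]; simp
  have hck : c k = 0 := by
    rw [HomP, Finset.sum_eq_single k] at hax1'
    · simpa using hax1'
    · intro b hb hbk
      have := Finset.mem_range.1 hb
      simp only
      rw [zero_pow (by omega), mul_zero]
    · intro hh; exact absurd (Finset.mem_range.2 (by omega)) hh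
  have hc0 : c 0 = 0 := by
    rw [HomP, Finset.sum_eq_single 0] at hax2'
    · simpa using hax2'
    · intro b hb hbk
      simp only
      rw [zero_pow hbk]; simp
    · intro hh; exact absurd (Finset.mem_range.2 (by omega)) hh
  have hreal' : ∀ ξ : ℂ, (HomP k c (ξ, starRingEnd ℂ ξ)).im = 0 := by
    intro ξ
    refine hdiv _ imCLM fun t ht => ?_
    have e : (t : ℂ) • ((ξ, starRingEnd ℂ ξ) : C2) = (t * ξ, starRingEnd ℂ (t * ξ)) := by
      simp [Prod.ext_iff]
    have := (hnorm2 _ ht).1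
    rw [e] at this ⊢
    exact hreal _ this
  obtain ⟨a0, ha0, ha0', hca0⟩ : ∃ a0, 1 ≤ a0 ∧ a0 + 1 ≤ k ∧ c a0 ≠ 0 := by
    by_contra hcon
    push Not at hcon
    refine hk1 ⟨ρ', hρ', hρρ'.trans hρ2, C, fun x hx => ?_⟩
    have hz : HomP k c x = 0 := by
      refine Finset.sum_eq_zero fun a ha => ?_
      have hak := Finset.mem_range.1 ha
      have : c a = 0 := by
        rcases Nat.eq_zero_or_pos a with h | h
        · rw [h, hc0]
        · rcases Nat.lt_or_ge a k with h' | h'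
          · exact hcon a h h'
          · rw [show a = k by omega, hck]
      rw [this]; simp
    have := hlead x hx
    rwa [hz, sub_zero] at this
  obtain ⟨σ, τ, hσ0, hτ0, hTr⟩ := exists_sigma k c a0 ha0 ha0' hca0
  have hτr : τ.im = 0 := by
    have h1 : Tr (fun ζ => HomP k c (σ.eval ζ, starRingEnd ℂ (σ.eval ζ))) (starRingEnd ℂ τ) := by
      obtain ⟨g1, g2, hg⟩ := hTr
      refine ⟨g2, g1, fun ζ hζ => ?_⟩
      have e : HomP k c (σ.eval ζ, starRingEnd ℂ (σ.eval ζ)) = starRingEnd ℂ (HomP k c (σ.eval ζ, starRingEnd ℂ (σ.eval ζ))) :=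
        (Complex.conj_eq_iff_im.2 (hreal' _)).symm
      have e2 := hg ζ hζ
      beta_reduce at e2 ⊢
      rw [e, e2]
      simp only [map_add, map_mul, Complex.conj_conj]; ring
    have := h1.avg
    rw [hTr.avg] at this
    exact Complex.conj_eq_iff_im.1 this.symm
  obtain ⟨g1, g2, hg⟩ := hTr
  -- bound of σ on the circle
  obtain ⟨S0, hS0⟩ := (isCompact_sphere (0 : ℂ) 1).exists_bound_of_continuousOn (f := fun ζ => σ.eval ζ) σ.continuous.continuousOn
  have hS00 : 0 ≤ S0 := (norm_nonneg _).trans (hS0 1 (by simp))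
  refine ⟨k, σ, Polynomial.C (-I) * Polynomial.X * (g1 + g2), τ.re, |C| * S0 ^ (k + 1), ρ' / (S0 + 1), by omega, hσ0, by simp, ?_, by positivity, by positivity, ?_⟩
  · intro h; exact hτ0 (Complex.ext h hτr)
  intro ε hε ζ hζ
  have hε0 := hε.1
  have hσζ := hS0 ζ (by simpa using hζ)
  set s := σ.eval ζ with hs
  have hp := hg ζ hζ
  beta_reduce at hp
  have hre : (HomP k c (s, starRingEnd ℂ s)).re + ((Polynomial.C (-I) * Polynomial.X * (g1 + g2)).eval ζ).im = τ.re := by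
    rw [hp]
    simp only [Polynomial.eval_mul, Polynomial.eval_add, Polynomial.eval_C, Polynomial.eval_X]
    have e : -I * ζ * (g1.eval ζ + g2.eval ζ) = -(I * (ζ * g1.eval ζ + ζ * g2.eval ζ)) := by ring
    rw [e, neg_im, I_mul_im]
    simp only [add_re, conj_re]
    ring
  have hsm : (ε : ℂ) • ((s, starRingEnd ℂ s) : C2) = (ε * s, starRingEnd ℂ (ε * s)) := by
    simp [Prod.ext_iff]
  have hns : ‖((s, starRingEnd ℂ s) : C2)‖ = ‖s‖ := by simp [Prod.norm_def]
  have hl := (hscale (s, starRingEnd ℂ s) ε ⟨hε0, hε.2.trans_le (by rw [hns]; gcongr)⟩).2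
  rw [hsm, hns] at hl
  have hl2 := (Complex.abs_re_le_norm _).trans hl
  have h4 : (ε : ℂ) ^ k * HomP k c (s, starRingEnd ℂ s) = ((ε ^ k : ℝ) : ℂ) * HomP k c (s, starRingEnd ℂ s) := by
    push_cast; rfl
  rw [h4, Complex.sub_re, Complex.re_ofReal_mul] at hl2
  have : (F ((ε : ℂ) * s, starRingEnd ℂ ((ε : ℂ) * s))).re + ε ^ k * ((Polynomial.C (-I) * Polynomial.X * (g1 + g2)).eval ζ).im - ε ^ k * τ.re
     = (F ((ε : ℂ) * s, starRingEnd ℂ ((ε : ℂ) * s))).re - ε ^ k * (HomP k c (s, starRingEnd ℂ s)).re := by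
    rw [← hre]; ring
  rw [this]
  refine hl2.trans ?_
  gcongr
  exact le_abs_self C

end DiscCore

section Disc
variable {m : ℕ} {M : Set (CS m)} {Q : (Fin m → ℂ) × CS m → ℂ} {r : ℝ} {κ : ℂ}

def h0f (Q : (Fin m → ℂ) × CS m → ℂ) (w : Fin m → ℂ) : ℂ := starRingEnd ℂ (Q (conjW w, 0))

theorem conjW_smul (a : ℂ) (w : Fin m → ℂ) : conjW (a • w) = starRingEnd ℂ a • conjW w := by
  ext i; simp [conjW]

theorem IsQ.h0_zero (h : IsQ M Q r) : h0f Q 0 = 0 := by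
  have := h.zero
  simp only [h0f, conjW_zero]
  rw [show ((0 : Fin m → ℂ), (0 : CS m)) = 0 from rfl, this, map_zero]

theorem IsQ.N_hol (h : IsQ M Q r) {ω w : Fin m → ℂ} (hω : ‖ω‖ < r) (hw : ‖w‖ < r) :
    DifferentiableAt ℂ (fun x : (Fin m → ℂ) × (Fin m → ℂ) =>
      starRingEnd ℂ (Q (conjW x.2, (conjW x.1, 0)))) (ω, w) := by
  have := hol_conj_conj (f := Q) (x := (ω, w)) (c := (((conjWL m).comp (ContinuousLinearMap.snd ℝ (Fin m → ℂ) (Fin m → ℂ))).prod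
    (((conjWL m).comp (ContinuousLinearMap.fst ℝ (Fin m → ℂ) (Fin m → ℂ))).prod (0 : _ →L[ℝ] ℂ)))) ?_ ?_
  · exact this
  · intro v
    ext <;> simp [conjWL_apply, conjW]
  · refine (h.hol _ ?_).differentiableAt (isOpen_ball.mem_nhds ?_) <;>
    · simp [conjWL_apply, Prod.norm_def, norm_conjW, hω, hw, h.r_pos]

theorem IsQ.h0_hol (h : IsQ M Q r) {w : Fin m → ℂ} (hw : ‖w‖ < r) :
    DifferentiableAt ℂ (h0f Q) w := by
  have h1 := h.N_hol (ω := 0) (w := w) (by simpa using h.r_pos) hw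
  have h2 : DifferentiableAt ℂ (fun w : Fin m → ℂ => ((0 : Fin m → ℂ), w)) w := by fun_prop
  have := DifferentiableAt.comp w (g := fun x : (Fin m → ℂ) × (Fin m → ℂ) =>
      starRingEnd ℂ (Q (conjW x.2, (conjW x.1, 0)))) (f := fun w : Fin m → ℂ => ((0 : Fin m → ℂ), w)) h1 h2
  refine this.congr_of_eventuallyEq (Eventually.of_forall fun x => ?_)
  simp [h0f, conjW_zero]
  rfl

theorem IsSet.segre (h : IsSet M Q r κ) : ∃ δ > 0, δ ≤ r ∧ ∀ w : Fin m → ℂ, ‖w‖ < δ →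
    ‖h0f Q w‖ < r ∧ Q (0, (w, h0f Q w)) = 0 := by
  obtain ⟨δ0, hδ0, hδ0r, hre⟩ := h.reality
  set N : (Fin m → ℂ) × (Fin m → ℂ) → ℂ := fun x => starRingEnd ℂ (Q (conjW x.2, (conjW x.1, 0))) with hN
  have hN0 : N 0 = 0 := by
    simp only [hN, Prod.fst_zero, Prod.snd_zero, conjW_zero]
    rw [show ((0 : Fin m → ℂ), ((0 : Fin m → ℂ), (0 : ℂ))) = 0 from rfl, h.zero, map_zero]
  have hr := h.r_pos
  have hNc : ContinuousAt N 0 := (h.N_hol (ω := 0) (w := 0) (by simpa using hr) (by simpa using hr)).continuousAt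
  obtain ⟨ρ, hρ, h1⟩ := Metric.eventually_nhds_iff_ball.1
      (hNc.norm.eventually_lt (continuousAt_const (y := r)) (by rw [hN0, norm_zero]; exact hr))
  set ρ1 := min ρ δ0 with hρ1
  have hρ1p : 0 < ρ1 := by positivity
  have hρ1δ : ρ1 ≤ δ0 := min_le_right _ _
  refine ⟨ρ1 / 8, by positivity, by linarith, fun v hv => ?_⟩
  have hb : ∀ (a : ℂ), ‖a‖ < 4 → ‖a • v‖ < ρ1 ∧ ‖a • conjW v‖ < ρ1 := by
    intro a ha
    rw [norm_smul, norm_smul, norm_conjW]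
    have : ‖a‖ * ‖v‖ ≤ 4 * (ρ1 / 8) := by gcongr
    constructor <;> linarith
  have hx4 : ∀ x : C2, x ∈ ball (0 : C2) 4 → ‖x.1‖ < 4 ∧ ‖x.2‖ < 4 := by
    intro x hx
    simp [Prod.norm_def] at hx
    exact hx
  have hNb : ∀ x : C2, x ∈ ball (0 : C2) 4 → ‖N (x.2 • conjW v, x.1 • v)‖ < r := by
    intro x hx
    refine h1 _ ?_
    obtain ⟨a, b⟩ := hx4 x hx
    rw [mem_ball_zero_iff, Prod.norm_def]
    exact max_lt ((hb _ b).2.trans_le (min_le_left _ _)) ((hb _ a).1.trans_le (min_le_left _ _))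
  have hkey := hol_zero_of_antidiag (ρ := 4) (by norm_num)
    (f := fun x : C2 => Q (x.2 • conjW v, (x.1 • v, N (x.2 • conjW v, x.1 • v)))) ?_ ?_
  · have h2 := hkey (1, 0) (by simp [Prod.norm_def]; norm_num)
    have h3 := hNb (1, 0) (by simp [Prod.norm_def])
    simp only [one_smul, zero_smul, hN, conjW_zero] at h2 h3
    exact ⟨h3, h2⟩
  · intro x hx
    apply DifferentiableAt.differentiableWithinAt
    obtain ⟨a, b⟩ := hx4 x hx
    have e1 : DifferentiableAt ℂ (fun x : C2 => (x.2 • conjW v, x.1 • v)) x := by fun_prop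
    have e2 : DifferentiableAt ℂ N (x.2 • conjW v, x.1 • v) :=
      h.N_hol ((hb _ b).2.trans_le (by linarith)) ((hb _ a).1.trans_le (by linarith))
    have e3 : DifferentiableAt ℂ (fun x : C2 => N (x.2 • conjW v, x.1 • v)) x :=
      DifferentiableAt.comp x (g := N) (f := fun x : C2 => (x.2 • conjW v, x.1 • v)) e2 e1
    have e4 : DifferentiableAt ℂ (fun x : C2 => (x.2 • conjW v, (x.1 • v, N (x.2 • conjW v, x.1 • v)))) x := by
      refine DifferentiableAt.prodMk (by fun_prop) (DifferentiableAt.prodMk (by fun_prop) e3)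
    refine DifferentiableAt.comp x (g := Q) ((h.hol).differentiableAt (isOpen_ball.mem_nhds ?_)) e4
    rw [mem_ball_zero_iff, Prod.norm_def, Prod.norm_def]
    exact max_lt ((hb _ b).2.trans_le (by linarith)) (max_lt ((hb _ a).1.trans_le (by linarith)) (hNb x hx))
  · intro ξ hξ
    have := (hre (ξ • v, 0) ?_).2
    · simp only [conjW_smul] at this
      simp only [hN, conjW_smul, conjW_conjW, Complex.conj_conj]
      simpa using this
    · rw [mem_ball_zero_iff, Prod.norm_def]
      simpa [hδ0] using (hb ξ hξ).1.trans_le hρ1δ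

theorem IsSet.exists_dir (h : IsSet M Q r κ) (hmin : MinimalAt M 0) :
    ∃ v : Fin m → ℂ, (∀ ξ : ℂ, ‖ξ‖ < 2 → ‖ξ • v‖ < r ∧ ‖h0f Q (ξ • v)‖ < r ∧ Q (0, (ξ • v, h0f Q (ξ • v))) = 0) ∧
      yf Q κ (v, h0f Q v) ≠ 0 := by
  obtain ⟨δ, hδ, hδr, hs⟩ := h.segre
  by_contra hcon
  push Not at hcon
  refine hmin ⟨ball 0 (δ / 2), fun t => t.2 - h0f Q t.1, isOpen_ball, mem_ball_self (by positivity), ?_, ?_, ?_, ?_⟩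
  · intro t ht
    have ht1 : ‖t.1‖ < r := by
      have := (norm_fst_le t).trans_lt (mem_ball_zero_iff.1 ht)
      linarith
    have e1 : DifferentiableAt ℂ (fun t : CS m => h0f Q t.1) t :=
      DifferentiableAt.comp t (g := h0f Q) (h.h0_hol ht1) differentiableAt_fst
    exact (differentiableAt_snd.sub e1).differentiableWithinAt
  · simp [h.h0_zero]
  · intro hev
    have hc : ContinuousAt (fun z : ℂ => ((0 : Fin m → ℂ), z)) 0 := by fun_prop
    have h2 : ∀ᶠ z : ℂ in 𝓝 0, z = 0 := by
      filter_upwards [hc.eventually hev] with z hz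
      simpa [h.h0_zero] using hz
    obtain ⟨ρ, hρ, h3⟩ := Metric.eventually_nhds_iff_ball.1 h2
    have := h3 ((ρ / 2 : ℝ) : ℂ) (by simp [abs_of_pos hρ, hρ])
    simp at this; linarith
  · rintro t ⟨ht, hz⟩
    have ht' := mem_ball_zero_iff.1 ht
    have ht1 : ‖t.1‖ < δ / 2 := (norm_fst_le t).trans_lt ht'
    have ht2 : t.2 = h0f Q t.1 := sub_eq_zero.1 hz
    have hb : ∀ ξ : ℂ, ‖ξ‖ < 2 → ‖ξ • t.1‖ < δ := by
      intro ξ hξ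
      rw [norm_smul]
      have : ‖ξ‖ * ‖t.1‖ ≤ 2 * ‖t.1‖ := by gcongr
      linarith
    have := hcon t.1 (fun ξ hξ => ⟨(hb ξ hξ).trans_le hδr, hs _ (hb ξ hξ)⟩)
    rw [h.memy t (ball_subset_ball (by linarith) ht)]
    rwa [← ht2] at this

/-- the two-variable function governing `y` along the Segre variety -/
theorem IsSet.exists_F (h : IsSet M Q r κ) (hmin : MinimalAt M 0) :
    ∃ v : Fin m → ℂ, (∀ ξ : ℂ, ‖ξ‖ < 2 → ‖ξ • v‖ < r ∧ ‖h0f Q (ξ • v)‖ < r) ∧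
    ∃ F : C2 → ℂ, DifferentiableOn ℂ F (ball 0 2) ∧ (∀ ξ : ℂ, ‖ξ‖ < 2 → F (ξ, 0) = 0) ∧
     (∀ ξ : ℂ, ‖ξ‖ < 2 → F (0, ξ) = 0) ∧
     (∀ ξ : ℂ, ‖ξ‖ < 2 → F (ξ, starRingEnd ℂ ξ) = (yf Q κ (ξ • v, h0f Q (ξ • v)) : ℝ)) ∧ F (1, 1) ≠ 0 := by
  obtain ⟨v, hv, hy⟩ := h.exists_dir hmin
  set q : C2 → ℂ := fun x => Q (x.2 • conjW v, 0) - Q (x.2 • conjW v, (x.1 • v, h0f Q (x.1 • v))) with hq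
  have hr := h.r_pos
  have hqd : ∀ x ∈ ball (0 : C2) 2, DifferentiableAt ℂ q x := by
    intro x hx
    have hx' : ‖x.1‖ < 2 ∧ ‖x.2‖ < 2 := by simpa [Prod.norm_def] using hx
    have h2 : ‖x.2 • conjW v‖ < r := by
      rw [norm_smul, norm_conjW, ← norm_smul]; exact (hv _ hx'.2).1
    have h1 := hv _ hx'.1
    have e0 : DifferentiableAt ℂ (fun x : C2 => h0f Q (x.1 • v)) x :=
      DifferentiableAt.comp x (g := h0f Q) (f := fun x : C2 => x.1 • v) (h.h0_hol h1.1) (by fun_prop)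
    refine DifferentiableAt.sub ?_ ?_
    · refine DifferentiableAt.comp x (g := Q) (f := fun x : C2 => (x.2 • conjW v, (0 : CS m)))
        ((h.hol).differentiableAt (isOpen_ball.mem_nhds ?_)) (by fun_prop)
      rw [mem_ball_zero_iff, Prod.norm_def]; simpa [hr] using h2
    · refine DifferentiableAt.comp x (g := Q) (f := fun x : C2 => (x.2 • conjW v, (x.1 • v, h0f Q (x.1 • v))))
        ((h.hol).differentiableAt (isOpen_ball.mem_nhds ?_)) ?_
      · rw [mem_ball_zero_iff, Prod.norm_def, Prod.norm_def]
        exact max_lt h2 (max_lt h1.1 h1.2.1)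
      · exact DifferentiableAt.prodMk (by fun_prop) (DifferentiableAt.prodMk (by fun_prop) e0)
  have hFd : DifferentiableOn ℂ (fun x : C2 => (I / 4) * (starRingEnd ℂ κ * q x - κ * starRingEnd ℂ (q (starRingEnd ℂ x.2, starRingEnd ℂ x.1)))) (ball 0 2) := by
    intro x hx
    apply DifferentiableAt.differentiableWithinAt
    have e1 := hqd x hx
    have e2 : DifferentiableAt ℂ (fun x : C2 => starRingEnd ℂ (q (starRingEnd ℂ x.2, starRingEnd ℂ x.1))) x := by
      refine hol_conj_conj (f := q) (c := ((conjCLE : ℂ →L[ℝ] ℂ).comp (ContinuousLinearMap.snd ℝ ℂ ℂ)).prod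
        ((conjCLE : ℂ →L[ℝ] ℂ).comp (ContinuousLinearMap.fst ℝ ℂ ℂ))) ?_ ?_
      · intro v
        ext <;> simp
      · refine hqd _ ?_
        have hx' : ‖x.1‖ < 2 ∧ ‖x.2‖ < 2 := by simpa [Prod.norm_def] using hx
        simp [Prod.norm_def, hx'.1, hx'.2]
    exact ((e1.const_mul _).sub (e2.const_mul _)).const_mul _
  have hq1 : ∀ ξ : ℂ, ‖ξ‖ < 2 → q (ξ, 0) = 0 := by
    intro ξ hξ
    simp only [hq, zero_smul]
    rw [(hv ξ hξ).2.2, show ((0 : Fin m → ℂ), (0 : CS m)) = 0 from rfl, h.zero, sub_zero]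
  have hq2 : ∀ ξ : ℂ, q (0, ξ) = 0 := by
    intro ξ
    simp only [hq, zero_smul]
    rw [h.h0_zero, show ((0 : Fin m → ℂ), (0 : ℂ)) = 0 from rfl, sub_self]
  have hFy : ∀ ξ : ℂ, ‖ξ‖ < 2 → (I / 4) * (starRingEnd ℂ κ * q (ξ, starRingEnd ℂ ξ) - κ * starRingEnd ℂ (q (ξ, starRingEnd ℂ ξ))) =
      (yf Q κ (ξ • v, h0f Q (ξ • v)) : ℝ) := by
    intro ξ hξ
    simp only [yf, Xf, hq, conjW_smul, h0f]
    generalize Q (starRingEnd ℂ ξ • conjW v, 0) = a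
    generalize Q (starRingEnd ℂ ξ • conjW v, ξ • v, starRingEnd ℂ a) = b
    apply Complex.ext <;> simp <;> ring
  refine ⟨v, fun ξ hξ => ⟨(hv ξ hξ).1, (hv ξ hξ).2.1⟩, _, hFd, ?_, ?_, ?_, ?_⟩
  · intro ξ hξ
    simp [hq1 ξ hξ, hq2]
  · intro ξ hξ
    simp [hq1 (starRingEnd ℂ ξ) (by simpa using hξ), hq2]
  · intro ξ hξ
    simpa using hFy ξ hξ
  · have := hFy 1 (by norm_num)
    simp only [map_one, one_smul] at this
    simp only [map_one]
    rw [this]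
    exact_mod_cast hy

theorem IsSet.disc (h : IsSet M Q r κ) (hmin : MinimalAt M 0) {δ : ℝ} (hδ : 0 < δ) :
    ∃ A : ℂ → CS m, DifferentiableOn ℂ A (ball 0 2) ∧ A 0 = 0 ∧ (∀ ζ ∈ ball (0 : ℂ) 2, ‖A ζ‖ < δ) ∧
      ((∀ ζ : ℂ, ‖ζ‖ = 1 → yf Q κ (A ζ) < 0) ∨ (∀ ζ : ℂ, ‖ζ‖ = 1 → 0 < yf Q κ (A ζ))) := by
  obtain ⟨v, hv, F, hF, hax1, hax2, hFy, hne⟩ := h.exists_F hmin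
  obtain ⟨k, σ, b, τ, C, ε0, hk, hσ, hb, hτ, hC, hε0, hmain⟩ := trig_core hF hax1 hax2
    (fun ξ hξ => by rw [hFy ξ hξ, Complex.ofReal_im]) hne
  obtain ⟨y', hy', hy''⟩ := h.y_strict κ
  have hyz := IsQ.y_z h.kq hy''
  have hr := h.r_pos
  -- bounds on polynomials
  obtain ⟨S, hS⟩ := (isCompact_closedBall (0 : ℂ) 2).exists_bound_of_continuousOn (f := fun ζ => σ.eval ζ) σ.continuous.continuousOn
  obtain ⟨B, hB⟩ := (isCompact_closedBall (0 : ℂ) 2).exists_bound_of_continuousOn (f := fun ζ => b.eval ζ) b.continuous.continuousOn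
  have hS0 : 0 ≤ S := (norm_nonneg _).trans (hS 0 (by simp))
  have hB0 : 0 ≤ B := (norm_nonneg _).trans (hB 0 (by simp))
  have hτ' : 0 < |τ| := abs_pos.2 hτ
  set η := |τ| / (4 * (B + 1)) with hη
  have hηp : 0 < η := by positivity
  have hηB : η * B ≤ |τ| / 4 := by
    rw [hη, div_mul_eq_mul_div, div_le_div_iff₀ (by positivity) (by positivity)]
    nlinarith
  have hst : ∃ δ' > 0, ∀ x ∈ ball (0 : CS m) δ', ∀ x' ∈ ball (0 : CS m) δ',
      ‖yf Q κ x - yf Q κ x' - y' (x - x')‖ ≤ η * ‖x - x'‖ := by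
    have := hy'.isLittleO.def hηp
    rw [Metric.eventually_nhds_iff_ball] at this
    obtain ⟨δ', h1, h2⟩ := this
    refine ⟨δ', h1, fun x hx x' hx' => h2 (x, x') ?_⟩
    rw [mem_ball, Prod.dist_eq]
    exact max_lt hx hx'
  obtain ⟨δ', hδ', hst⟩ := hst
  set d := min δ δ' with hd
  have hdp : 0 < d := by positivity
  -- small h0
  have hc0 : ContinuousAt (fun ξ : ℂ => h0f Q (ξ • v)) 0 := by
    have e1 : ContinuousAt (h0f Q) ((0 : ℂ) • v) := (h.h0_hol (by simpa using hr)).continuousAt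
    exact ContinuousAt.comp (f := fun ξ : ℂ => ξ • v) e1 (by fun_prop)
  obtain ⟨ρ, hρ, h1⟩ := Metric.eventually_nhds_iff_ball.1
      (hc0.norm.eventually_lt (continuousAt_const (y := d / 2)) (by
        beta_reduce; rw [zero_smul, h.h0_zero, norm_zero]; positivity))
  have hev : ∀ᶠ ε : ℝ in 𝓝 0, ε < ε0 ∧ ε < 1 ∧ ε * S < 2 ∧ ε * S < ρ ∧ ε * S * ‖v‖ < d ∧ ε * B < d / 2 ∧ C * ε < |τ| / 4 := by
    have T : ∀ (f : ℝ → ℝ) (c : ℝ), Continuous f → f 0 < c → ∀ᶠ ε : ℝ in 𝓝 0, f ε < c :=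
      fun f c hf h0 => hf.continuousAt.eventually_lt continuousAt_const h0
    refine (T id ε0 continuous_id hε0).and ((T id 1 continuous_id zero_lt_one).and
      ((T (fun ε => ε * S) 2 (by fun_prop) (by simp)).and ((T (fun ε => ε * S) ρ (by fun_prop) (by simpa using hρ)).and
      ((T (fun ε => ε * S * ‖v‖) d (by fun_prop) (by simpa using hdp)).and ((T (fun ε => ε * B) (d / 2) (by fun_prop) (by simpa using hdp)).and
       (T (fun ε => C * ε) (|τ| / 4) (by fun_prop) (by simpa using hτ)))))))
  obtain ⟨e, he, hE⟩ := Metric.eventually_nhds_iff_ball.1 hev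
  obtain ⟨g1, g2, g3, g4, g5, g6, g7⟩ := hE (e / 2) (by simp [abs_of_pos he, he])
  set ε := e / 2 with hεe
  have hε : 0 < ε := by positivity
  have hσb : ∀ ζ ∈ ball (0 : ℂ) 2, ‖(ε : ℂ) * σ.eval ζ‖ ≤ ε * S := by
    intro ζ hζ
    rw [norm_mul, Complex.norm_real, Real.norm_of_nonneg hε.le]
    exact mul_le_mul_of_nonneg_left (hS ζ (ball_subset_closedBall hζ)) hε.le
  have hx' : ∀ ζ ∈ ball (0 : ℂ) 2, ‖h0f Q (((ε : ℂ) * σ.eval ζ) • v)‖ < d / 2 := fun ζ hζ =>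
    h1 _ (by rw [mem_ball_zero_iff]; exact (hσb ζ hζ).trans_lt g4)
  have hw' : ∀ ζ ∈ ball (0 : ℂ) 2, ‖((ε : ℂ) * σ.eval ζ) • v‖ < d := fun ζ hζ => by
    rw [norm_smul]
    exact (mul_le_mul_of_nonneg_right (hσb ζ hζ) (norm_nonneg _)).trans_lt g5
  have hbk : ∀ ζ ∈ ball (0 : ℂ) 2, ‖(ε : ℂ) ^ k * starRingEnd ℂ κ * b.eval ζ‖ ≤ ε ^ k * B := fun ζ hζ => by
    rw [norm_mul, norm_mul, norm_pow, Complex.norm_real, Real.norm_of_nonneg hε.le, RCLike.norm_conj, h.kn, mul_one]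
    exact mul_le_mul_of_nonneg_left (hB ζ (ball_subset_closedBall hζ)) (by positivity)
  have hεk : ε ^ k ≤ ε := pow_le_of_le_one hε.le g2.le (by omega)
  have hbk' : ∀ ζ ∈ ball (0 : ℂ) 2, ‖(ε : ℂ) ^ k * starRingEnd ℂ κ * b.eval ζ‖ < d / 2 := fun ζ hζ =>
    ((hbk ζ hζ).trans (mul_le_mul_of_nonneg_right hεk hB0)).trans_lt g6
  set A : ℂ → CS m := fun ζ => (((ε : ℂ) * σ.eval ζ) • v, h0f Q (((ε : ℂ) * σ.eval ζ) • v) + (ε : ℂ) ^ k * starRingEnd ℂ κ * b.eval ζ) with hA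
  have hAd : ∀ ζ ∈ ball (0 : ℂ) 2, ‖A ζ‖ < d := fun ζ hζ => by
    rw [hA, Prod.norm_def]
    refine max_lt (hw' ζ hζ) ((norm_add_le _ _).trans_lt ?_)
    linarith [hx' ζ hζ, hbk' ζ hζ]
  have hy_main : ∀ ζ : ℂ, ‖ζ‖ = 1 → |yf Q κ (A ζ) - ε ^ k * τ| ≤ ε ^ k * (|τ| / 2) := by
    intro ζ hζ
    have hζ2 : ζ ∈ ball (0 : ℂ) 2 := by rw [mem_ball_zero_iff, hζ]; norm_num
    have e1 := hmain ε ⟨hε, g1⟩ ζ hζ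
    rw [hFy _ ((hσb ζ hζ2).trans_lt g3), Complex.ofReal_re] at e1
    have e2 := hst (A ζ) (by rw [mem_ball_zero_iff]; exact (hAd ζ hζ2).trans_le (min_le_right _ _))
      (((ε : ℂ) * σ.eval ζ) • v, h0f Q (((ε : ℂ) * σ.eval ζ) • v)) (by
        rw [mem_ball_zero_iff, Prod.norm_def]
        refine lt_of_lt_of_le (b := d) (max_lt (hw' ζ hζ2) ((hx' ζ hζ2).trans (by linarith))) (min_le_right _ _))
    have e3 : A ζ - (((ε : ℂ) * σ.eval ζ) • v, h0f Q (((ε : ℂ) * σ.eval ζ) • v)) = (0, (ε : ℂ) ^ k * starRingEnd ℂ κ * b.eval ζ) := by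
      simp [hA]
    have e4 : κ * ((ε : ℂ) ^ k * starRingEnd ℂ κ * b.eval ζ) = ((ε ^ k : ℝ) : ℂ) * b.eval ζ := by
      have := conj_mul_of_norm_one h.kn
      push_cast
      linear_combination ((ε : ℂ) ^ k * b.eval ζ) * this
    rw [e3, hyz, e4, Complex.im_ofReal_mul, Prod.norm_def] at e2
    simp only [norm_zero, Real.norm_eq_abs] at e2
    rw [max_eq_right (norm_nonneg _)] at e2
    have e5 : η * ‖(ε : ℂ) ^ k * starRingEnd ℂ κ * b.eval ζ‖ ≤ ε ^ k * (|τ| / 4) := by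
      calc _ ≤ η * (ε ^ k * B) := by gcongr; exact hbk ζ hζ2
        _ = ε ^ k * (η * B) := by ring
        _ ≤ _ := by gcongr
    have e6 : C * ε ^ (k + 1) ≤ ε ^ k * (|τ| / 4) := by
      calc _ = ε ^ k * (C * ε) := by ring
        _ ≤ _ := by gcongr
    have e7 := abs_add_le (yf Q κ (A ζ) - yf Q κ (((ε : ℂ) * σ.eval ζ) • v, h0f Q (((ε : ℂ) * σ.eval ζ) • v)) - ε ^ k * (b.eval ζ).im)
      (yf Q κ (((ε : ℂ) * σ.eval ζ) • v, h0f Q (((ε : ℂ) * σ.eval ζ) • v)) + ε ^ k * (b.eval ζ).im - ε ^ k * τ)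
    ring_nf at e7 e1 e2 e5 e6 ⊢
    linarith
  have hεkp : 0 < ε ^ k := by positivity
  refine ⟨A, ?_, ?_, fun ζ hζ => (hAd ζ hζ).trans_le (min_le_left _ _), ?_⟩
  · intro ζ hζ
    apply DifferentiableAt.differentiableWithinAt
    have e0 : DifferentiableAt ℂ (fun ζ : ℂ => ((ε : ℂ) * σ.eval ζ) • v) ζ :=
      (σ.differentiable.differentiableAt.const_mul _).smul_const v
    have e1 : DifferentiableAt ℂ (h0f Q) (((ε : ℂ) * σ.eval ζ) • v) :=
      h.h0_hol (hv _ ((hσb ζ hζ).trans_lt g3)).1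
    exact e0.prodMk ((DifferentiableAt.comp ζ (g := h0f Q) e1 e0).add (b.differentiable.differentiableAt.const_mul _))
  · simp [hA, hσ, hb, h.h0_zero]
  · rcases lt_or_gt_of_ne hτ with h' | h'
    · left
      intro ζ hζ
      have := (abs_le.1 (hy_main ζ hζ)).2
      rw [abs_of_neg h'] at this
      nlinarith
    · right
      intro ζ hζ
      have := (abs_le.1 (hy_main ζ hζ)).1
      rw [abs_of_pos h'] at this
      nlinarith

end Disc

section FlatSec
variable {E : Type*} [NormedAddCommGroup E] [NormedSpace ℂ E] [FiniteDimensional ℂ E]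
variable {F : Type*} [NormedAddCommGroup F] [NormedSpace ℝ F]

/-- smooth on `U` -/
def Sm (U : Set E) (u : E → F) : Prop := ContDiffOn ℝ (⊤ : ℕ∞) u U

theorem Sm.diffAt {U : Set E} {u : E → F} (hU : IsOpen U) (h : Sm U u) {t : E} (ht : t ∈ U) :
    DifferentiableAt ℝ u t :=
  (ContDiffOn.differentiableOn h (by simp)).differentiableAt (hU.mem_nhds ht)

theorem Sm.cdAt {U : Set E} {u : E → F} (hU : IsOpen U) (h : Sm U u) {t : E} (ht : t ∈ U) :
    ContDiffAt ℝ (⊤ : ℕ∞) u t := ContDiffOn.contDiffAt h (hU.mem_nhds ht)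

theorem Sm.fd {U : Set E} {u : E → F} (hU : IsOpen U) (h : Sm U u) (v : E) :
    Sm U (fun t => fderiv ℝ u t v) := by
  have : ContDiffOn ℝ (⊤ : ℕ∞) (fderiv ℝ u) U := ContDiffOn.fderiv_of_isOpen (n := (⊤ : ℕ∞)) h hU (by simp)
  exact this.clm_apply contDiffOn_const

theorem Sm.anti {U : Set E} {u : E → ℂ} (hU : IsOpen U) (h : Sm U u) (v : E) :
    Sm U (fun t => antiCDeriv u t v) := by
  have h1 := h.fd hU v
  have h2 := h.fd hU (I • v)
  unfold Sm at *
  simp only [antiCDeriv]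
  exact (h1.add (contDiffOn_const.mul h2)).div_const 2

theorem antiCDeriv_congr {u u' : E → ℂ} {t : E} (h : u =ᶠ[𝓝 t] u') (v : E) :
    antiCDeriv u t v = antiCDeriv u' t v := by
  simp only [antiCDeriv, h.fderiv_eq]

theorem antiCDeriv_mul {a b : E → ℂ} {t : E} (ha : DifferentiableAt ℝ a t) (hb : DifferentiableAt ℝ b t) (v : E) :
    antiCDeriv (fun t => a t * b t) t v = a t * antiCDeriv b t v + antiCDeriv a t v * b t := by
  simp only [antiCDeriv, fderiv_fun_mul ha hb]
  simp
  ring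

theorem antiCDeriv_sub {a b : E → ℂ} {t : E} (ha : DifferentiableAt ℝ a t) (hb : DifferentiableAt ℝ b t) (v : E) :
    antiCDeriv (fun t => a t - b t) t v = antiCDeriv a t v - antiCDeriv b t v := by
  simp only [antiCDeriv, fderiv_fun_sub ha hb]
  simp
  ring

theorem antiCDeriv_pow {a : E → ℂ} {t : E} (ha : DifferentiableAt ℝ a t) (k : ℕ) (v : E) :
    antiCDeriv (fun t => a t ^ (k + 1)) t v = (k + 1) * a t ^ k * antiCDeriv a t v := by
  induction k with
  | zero => simp
  | succ k ih =>
    have : (fun t => a t ^ (k + 1 + 1)) = fun t => a t ^ (k + 1) * a t := by ext; ring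
    rw [this, antiCDeriv_mul (ha.fun_pow _) ha, ih]
    push_cast
    ring

theorem antiCDeriv_conj_smul (u : E → ℂ) (t v : E) (c : ℂ) :
    antiCDeriv u t (c • v) = starRingEnd ℂ c * antiCDeriv u t v := by
  have hc : c • v = c.re • v + c.im • (I • v) := by
    conv_lhs => rw [← Complex.re_add_im c]
    rw [add_smul, mul_smul]
    simp [Complex.real_smul]
  have hc2 : I • (c • v) = c.re • (I • v) - c.im • v := by
    rw [hc, smul_add, smul_comm I c.re, smul_comm I c.im, smul_smul I I]
    simp [sub_eq_add_neg]
  rw [antiCDeriv, antiCDeriv, hc2, hc]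
  simp only [map_add, map_smul, map_sub, Complex.real_smul]
  have : starRingEnd ℂ c = c.re - c.im * I := by
    apply Complex.ext <;> simp
  rw [this]
  linear_combination (1/2 * fderiv ℝ u t (I • v) * c.im) * Complex.I_mul_I

theorem antiCDeriv_sub_vec (u : E → ℂ) (t v v' : E) :
    antiCDeriv u t (v - v') = antiCDeriv u t v - antiCDeriv u t v' := by
  simp only [antiCDeriv, smul_sub, map_sub]; ring

theorem fd_symm {U : Set E} {u : E → F} (hU : IsOpen U) (h : Sm U u) {t : E} (ht : t ∈ U) (v w : E) :
    fderiv ℝ (fun t => fderiv ℝ u t v) t w = fderiv ℝ (fun t => fderiv ℝ u t w) t v := by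
  have h1 := (h.cdAt hU ht)
  have hs : IsSymmSndFDerivAt ℝ u t := h1.isSymmSndFDerivAt (by simp only [minSmoothness_of_isRCLikeNormedField]; exact WithTop.coe_le_coe.2 (le_top : (2 : ℕ∞) ≤ ⊤))
  have hd : DifferentiableAt ℝ (fderiv ℝ u) t := by
    have : ContDiffOn ℝ (⊤ : ℕ∞) (fderiv ℝ u) U := ContDiffOn.fderiv_of_isOpen (n := (⊤ : ℕ∞)) h hU (by simp)
    exact (this.differentiableOn (by simp)).differentiableAt (hU.mem_nhds ht)
  rw [fderiv_clm_apply hd (differentiableAt_const _), fderiv_clm_apply hd (differentiableAt_const _)]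
  simpa using hs w v

theorem anti_fd {U : Set E} {u : E → ℂ} (hU : IsOpen U) (h : Sm U u) {t : E} (ht : t ∈ U) (v w : E) :
    antiCDeriv (fun t => fderiv ℝ u t v) t w = fderiv ℝ (fun t => antiCDeriv u t w) t v := by
  have h1 := (h.fd hU w).diffAt hU ht
  have h2 := (h.fd hU (I • w)).diffAt hU ht
  have h3 : HasFDerivAt (fun t => antiCDeriv u t w) _ t :=
    (h1.hasFDerivAt.add (h2.hasFDerivAt.const_mul I)).mul_const (2⁻¹ : ℂ)
  rw [h3.fderiv]
  rw [antiCDeriv, fd_symm hU h ht, fd_symm hU h ht v (I • w)]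
  simp
  ring

theorem anti_comm {U : Set E} {u : E → ℂ} (hU : IsOpen U) (h : Sm U u) {t : E} (ht : t ∈ U) (v w : E) :
    antiCDeriv (fun t => antiCDeriv u t v) t w = antiCDeriv (fun t => antiCDeriv u t w) t v := by
  have h1 := (h.fd hU v).diffAt hU ht
  have h2 := (h.fd hU (I • v)).diffAt hU ht
  have h3 : HasFDerivAt (fun t => antiCDeriv u t v) _ t :=
    (h1.hasFDerivAt.add (h2.hasFDerivAt.const_mul I)).mul_const (2⁻¹ : ℂ)
  have e1 := anti_fd hU h ht v w
  have e2 := anti_fd hU h ht (I • v) w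
  simp only [antiCDeriv] at e1 e2
  conv_lhs => rw [antiCDeriv, h3.fderiv]
  conv_rhs => rw [antiCDeriv]
  simp only [antiCDeriv] 
  rw [← e1, ← e2]
  simp
  ring

/-- vanishing to order `j` along `Z`. -/
def Flat (Z : Set E) : ℕ → (E → ℂ) → Prop
  | 0, u => ∀ t ∈ Z, u t = 0
  | j + 1, u => (∀ t ∈ Z, u t = 0) ∧ ∀ v, Flat Z j (fun t => fderiv ℝ u t v)

theorem Flat.zero {Z : Set E} {j : ℕ} {u : E → ℂ} (h : Flat Z j u) : ∀ t ∈ Z, u t = 0 := by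
  cases j with
  | zero => exact h
  | succ j => exact h.1

theorem Flat.pred {Z : Set E} {j : ℕ} {u : E → ℂ} (h : Flat Z (j + 1) u) : Flat Z j u := by
  induction j generalizing u with
  | zero => exact h.1
  | succ j ih => exact ⟨h.1, fun v => ih (h.2 v)⟩

theorem Flat.mono {Z : Set E} {i j : ℕ} {u : E → ℂ} (h : Flat Z j u) (hij : i ≤ j) : Flat Z i u := by
  induction j with
  | zero => rwa [Nat.le_zero.1 hij]
  | succ j ih =>
    rcases Nat.lt_or_ge i (j + 1) with h1 | h1
    · exact ih h.pred (by omega)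
    · rwa [le_antisymm hij h1]

theorem Flat.congr {Z U : Set E} (hU : IsOpen U) (hZ : Z ⊆ U) {j : ℕ} {u u' : E → ℂ} (h : Flat Z j u)
    (he : ∀ t ∈ U, u t = u' t) : Flat Z j u' := by
  induction j generalizing u u' with
  | zero => exact fun t ht => by rw [← he t (hZ ht)]; exact h t ht
  | succ j ih =>
    refine ⟨fun t ht => by rw [← he t (hZ ht)]; exact h.1 t ht, fun v => ih (h.2 v) fun t ht => ?_⟩
    have : u =ᶠ[𝓝 t] u' := by filter_upwards [hU.mem_nhds ht] with x hx using he x hx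
    rw [this.fderiv_eq]

theorem Flat.add {Z U : Set E} (hU : IsOpen U) (hZ : Z ⊆ U) {j : ℕ} {u u' : E → ℂ} (hu : Sm U u) (hu' : Sm U u')
    (h : Flat Z j u) (h' : Flat Z j u') : Flat Z j (fun t => u t + u' t) := by
  induction j generalizing u u' with
  | zero => exact fun t ht => by beta_reduce; rw [h t ht, h' t ht, add_zero]
  | succ j ih =>
    refine ⟨fun t ht => by beta_reduce; rw [h.1 t ht, h'.1 t ht, add_zero], fun v => ?_⟩
    refine (ih (hu.fd hU v) (hu'.fd hU v) (h.2 v) (h'.2 v)).congr hU hZ fun t ht => ?_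
    rw [fderiv_fun_add (hu.diffAt hU ht) (hu'.diffAt hU ht)]
    rfl

theorem Flat.mul {Z U : Set E} (hU : IsOpen U) (hZ : Z ⊆ U) {j : ℕ} {u a : E → ℂ} (hu : Sm U u) (ha : Sm U a)
    (h : Flat Z j u) : Flat Z j (fun t => a t * u t) := by
  induction j generalizing u a with
  | zero => exact fun t ht => by beta_reduce; rw [h t ht, mul_zero]
  | succ j ih =>
    refine ⟨fun t ht => by beta_reduce; rw [h.1 t ht, mul_zero], fun v => ?_⟩
    have e1 := ih (hu.fd hU v) ha (h.2 v)
    have e2 := ih hu (ha.fd hU v) h.pred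
    refine (Flat.add hU hZ (ContDiffOn.mul ha (hu.fd hU v)) (ContDiffOn.mul (ha.fd hU v) hu) e1 e2).congr hU hZ fun t ht => ?_
    rw [fderiv_fun_mul (ha.diffAt hU ht) (hu.diffAt hU ht)]
    simp
    ring

theorem Flat.anti {Z U : Set E} (hU : IsOpen U) (hZ : Z ⊆ U) {j : ℕ} {u : E → ℂ} (hu : Sm U u)
    (h : Flat Z (j + 1) u) (v : E) : Flat Z j (fun t => antiCDeriv u t v) := by
  have e1 := Flat.mul hU hZ (a := fun _ => 1/2) (hu.fd hU v) contDiffOn_const (h.2 v)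
  have e2 := Flat.mul hU hZ (a := fun _ => I/2) (hu.fd hU (I • v)) contDiffOn_const (h.2 (I • v))
  refine (Flat.add hU hZ (ContDiffOn.mul contDiffOn_const (hu.fd hU v)) (ContDiffOn.mul contDiffOn_const (hu.fd hU _)) e1 e2).congr hU hZ fun t ht => ?_
  simp only [antiCDeriv]
  ring

theorem flat_pow {Z U : Set E} (hU : IsOpen U) (hZ : Z ⊆ U) {y : E → ℂ} (hy : Sm U y) (hyZ : ∀ t ∈ Z, y t = 0)
    (k : ℕ) {a : E → ℂ} (ha : Sm U a) : Flat Z k (fun t => a t * y t ^ (k + 1)) := by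
  induction k generalizing a with
  | zero => exact fun t ht => by simp [hyZ t ht]
  | succ k ih =>
    refine ⟨fun t ht => by simp [hyZ t ht], fun v => ?_⟩
    have hs : Sm U (fun t => fderiv ℝ a t v * y t + a t * ((k + 2) * fderiv ℝ y t v)) :=
      ContDiffOn.add (ContDiffOn.mul (ha.fd hU v) hy) (ContDiffOn.mul ha (contDiffOn_const.mul (hy.fd hU v)))
    refine (ih hs).congr hU hZ fun t ht => ?_
    have hyd := hy.diffAt hU ht
    have hp := (hyd.hasFDerivAt.pow (k + 2))
    have := ((ha.diffAt hU ht).hasFDerivAt.mul hp).fderiv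
    have e : fderiv ℝ (fun t => a t * y t ^ (k + 1 + 1)) t = _ := this
    rw [e]
    simp
    ring

/-- Key flatness lemma. -/
theorem flat_key {Z U : Set E} (hU : IsOpen U) {y : E → ℝ} (hy : Sm U y) (hZ : Z = {t ∈ U | y t = 0})
    {e0 : E} (he0 : ∀ t ∈ U, antiCDeriv (fun t => (y t : ℂ)) t e0 ≠ 0) (j : ℕ) {u : E → ℂ} (hu : Sm U u)
    (h0 : ∀ t ∈ Z, u t = 0) (h1 : Flat Z j (fun t => antiCDeriv u t e0)) : Flat Z (j + 1) u := by
  have hZU : Z ⊆ U := by rw [hZ]; exact fun t ht => ht.1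
  have key : ∀ u : E → ℂ, Sm U u → (∀ t ∈ Z, u t = 0) → (∀ t ∈ Z, antiCDeriv u t e0 = 0) →
      ∀ t ∈ Z, ∀ v, fderiv ℝ u t v = 0 := by
    intro u hu h0 h1 t ht
    have htU := hZU ht
    have hyd := (hy.cdAt hU htU).hasStrictFDerivAt (by simp)
    have hud := (hu.cdAt hU htU).hasStrictFDerivAt (by simp)
    have hyt : y t = 0 := by rw [hZ] at ht; exact ht.2
    have hyc : ∀ v, fderiv ℝ (fun t => (y t : ℂ)) t v = (fderiv ℝ y t v : ℂ) := by
      intro v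
      have : HasFDerivAt (fun t => (y t : ℂ)) (Complex.ofRealCLM.comp (fderiv ℝ y t)) t :=
        Complex.ofRealCLM.hasFDerivAt.comp t hyd.hasFDerivAt
      rw [this.fderiv]; simp
    have hne : fderiv ℝ y t ≠ 0 := by
      intro h
      apply he0 t htU
      simp [antiCDeriv, hyc, h]
    have : CompleteSpace E := FiniteDimensional.complete ℂ E
    have hev : ∀ᶠ s in 𝓝 t, y s = 0 → u s = 0 := by
      filter_upwards [hU.mem_nhds htU] with s hs hs0
      exact h0 s (by rw [hZ]; exact ⟨hs, hs0⟩)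
    obtain ⟨c1, hc1⟩ := lagrange_mult (u := fun s => (u s).re) hyd (Complex.reCLM.hasStrictFDerivAt.comp t hud) hne hyt
      (hev.mono fun s hs hs' => by simp [hs hs'])
    obtain ⟨c2, hc2⟩ := lagrange_mult (u := fun s => (u s).im) hyd (Complex.imCLM.hasStrictFDerivAt.comp t hud) hne hyt
      (hev.mono fun s hs hs' => by simp [hs hs'])
    have hv : ∀ v, fderiv ℝ u t v = (c1 + c2 * I : ℂ) * fderiv ℝ y t v := by
      intro v
      have d1 := DFunLike.congr_fun hc1 v
      have d2 := DFunLike.congr_fun hc2 v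
      simp at d1 d2
      apply Complex.ext <;> simp [d1, d2]
    have h2 := h1 t ht
    have h3 : antiCDeriv u t e0 = (c1 + c2 * I : ℂ) * antiCDeriv (fun t => (y t : ℂ)) t e0 := by
      simp only [antiCDeriv, hyc, hv]; ring
    rw [h2] at h3
    have h4 : (c1 + c2 * I : ℂ) = 0 := by
      rcases mul_eq_zero.1 h3.symm with h | h
      · exact h
      · exact absurd h (he0 t htU)
    intro v
    rw [hv, h4, zero_mul]
  induction j generalizing u with
  | zero => exact ⟨h0, fun v t ht => key u hu h0 h1 t ht v⟩
  | succ j ih =>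
    refine ⟨h0, fun v => ih (hu.fd hU v) (fun t ht => key u hu h0 h1.zero t ht v) ?_⟩
    refine (h1.2 v).congr hU hZU fun t ht => ?_
    rw [anti_fd hU hu ht]

/-- Almost-analytic extension to finite order. -/
theorem almost_analytic {Z U : Set E} (hU : IsOpen U) {y : E → ℝ} (hy : Sm U y) (hZ : Z = {t ∈ U | y t = 0})
    {e0 : E} (he0 : ∀ t ∈ U, antiCDeriv (fun t => (y t : ℂ)) t e0 ≠ 0) {f : E → ℂ} (hf : Sm U f)
    (hCR : ∀ t ∈ Z, ∀ v, antiCDeriv (fun t => (y t : ℂ)) t v = 0 → antiCDeriv f t v = 0) (k : ℕ) :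
    ∃ g : E → ℂ, Sm U g ∧ (∀ t ∈ Z, g t = f t) ∧ ∀ v, Flat Z k (fun t => antiCDeriv g t v) := by
  have hZU : Z ⊆ U := by rw [hZ]; exact fun t ht => ht.1
  set yc : E → ℂ := fun t => (y t : ℂ) with hyc
  have hycS : Sm U yc := Complex.ofRealCLM.contDiff.comp_contDiffOn hy
  have hycZ : ∀ t ∈ Z, yc t = 0 := by
    intro t ht
    rw [hZ] at ht
    simp [hyc, ht.2]
  have hD : Sm U (fun t => antiCDeriv yc t e0) := hycS.anti hU e0
  have hind : ∀ k : ℕ, ∃ g a : E → ℂ, Sm U g ∧ Sm U a ∧ (∀ t ∈ Z, g t = f t) ∧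
      (∀ v, ∀ t ∈ Z, antiCDeriv g t v = 0) ∧ ∀ t ∈ U, antiCDeriv g t e0 = a t * yc t ^ (k + 1) := by
    intro k
    induction k with
    | zero =>
      set Lf : E → ℂ := fun t => antiCDeriv f t e0 / antiCDeriv yc t e0 with hLf
      have hL : Sm U Lf := (ContDiffOn.mul (hf.anti hU e0) (ContDiffOn.inv hD he0)).congr fun t _ => div_eq_mul_inv _ _
      have hg : Sm U (fun t => f t - yc t * Lf t) := ContDiffOn.sub hf (ContDiffOn.mul hycS hL)
      have hanti : ∀ t ∈ U, ∀ v, antiCDeriv (fun t => f t - yc t * Lf t) t v =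
          antiCDeriv f t v - (yc t * antiCDeriv Lf t v + antiCDeriv yc t v * Lf t) := by
        intro t ht v
        rw [antiCDeriv_sub (hf.diffAt hU ht) ((hycS.diffAt hU ht).fun_mul (hL.diffAt hU ht)),
          antiCDeriv_mul (hycS.diffAt hU ht) (hL.diffAt hU ht)]
      refine ⟨fun t => f t - yc t * Lf t, fun t => - antiCDeriv Lf t e0, hg, ContDiffOn.neg (hL.anti hU e0), ?_, ?_, ?_⟩
      · intro t ht; simp [hycZ t ht]
      · intro v t ht
        have htU := hZU ht
        rw [hanti t htU, hycZ t ht]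
        set c := starRingEnd ℂ (antiCDeriv yc t v / antiCDeriv yc t e0) with hc
        have h1 := hCR t ht (v - c • e0) (by
          rw [antiCDeriv_sub_vec, antiCDeriv_conj_smul, hc, Complex.conj_conj, div_mul_cancel₀ _ (he0 t htU), sub_self])
        rw [antiCDeriv_sub_vec, antiCDeriv_conj_smul, hc, Complex.conj_conj] at h1
        simp only [hLf]
        linear_combination h1
      · intro t ht
        rw [hanti t ht]
        simp only [hLf]
        have := he0 t ht
        field_simp
        ring
    | succ k ih =>
      obtain ⟨g, a, hg, ha, h1, h2, h3⟩ := ih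
      set b : E → ℂ := fun t => a t / ((k + 2) * antiCDeriv yc t e0) with hb
      have hk2 : ((k : ℂ) + 2) ≠ 0 := by
        have : ((k + 2 : ℕ) : ℂ) ≠ 0 := by exact Nat.cast_ne_zero.2 (by omega)
        push_cast at this; exact this
      have hbS : Sm U b := (ContDiffOn.mul ha (ContDiffOn.inv (contDiffOn_const.mul hD) fun t ht => mul_ne_zero hk2 (he0 t ht))).congr fun t _ => div_eq_mul_inv _ _
      have hpS : Sm U (fun t => yc t ^ (k + 1 + 1)) := ContDiffOn.pow hycS _
      have hanti : ∀ t ∈ U, ∀ v, antiCDeriv (fun t => g t - b t * yc t ^ (k + 1 + 1)) t v =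
          antiCDeriv g t v - (b t * ((((k + 1 : ℕ) : ℂ) + 1) * yc t ^ (k + 1) * antiCDeriv yc t v) + antiCDeriv b t v * yc t ^ (k + 1 + 1)) := by
        intro t ht v
        rw [antiCDeriv_sub (hg.diffAt hU ht) ((hbS.diffAt hU ht).fun_mul (hpS.diffAt hU ht)),
          antiCDeriv_mul (hbS.diffAt hU ht) (hpS.diffAt hU ht), antiCDeriv_pow (hycS.diffAt hU ht)]
      refine ⟨fun t => g t - b t * yc t ^ (k + 1 + 1), fun t => - antiCDeriv b t e0,
        ContDiffOn.sub hg (ContDiffOn.mul hbS hpS), ContDiffOn.neg (hbS.anti hU e0), ?_, ?_, ?_⟩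
      · intro t ht; simp [hycZ t ht, h1 t ht]
      · intro v t ht
        rw [hanti t (hZU ht), hycZ t ht, h2 v t ht]; simp
      · intro t ht
        rw [hanti t ht, h3 t ht]
        simp only [hb]
        have := he0 t ht
        have e : ((k + 1 : ℕ) : ℂ) + 1 = k + 2 := by push_cast; ring
        rw [e]
        field_simp
        ring
  obtain ⟨g, a, hg, ha, h1, h2, h3⟩ := hind (k + 1)
  refine ⟨g, hg, h1, fun v => ?_⟩
  cases k with
  | zero => exact h2 v
  | succ k =>
    refine flat_key hU hy hZ he0 k (hg.anti hU v) (h2 v) ?_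
    have e1 : Flat Z (k + 1) (fun t => antiCDeriv g t e0) :=
      ((flat_pow hU hZU hycS hycZ (k + 2) ha).mono (by omega)).congr hU hZU fun t ht => (h3 t ht).symm
    refine (e1.anti hU hZU (hg.anti hU e0) v).congr hU hZU fun t ht => ?_
    rw [anti_comm hU hg ht]

/-- cutting off by `y>0` -/
def cut (y : E → ℝ) (u : E → F) (t : E) : F := open Classical in if 0 < y t then u t else 0

theorem cut_hasFDerivAt {Z U : Set E} (hU : IsOpen U) {y : E → ℝ} (hy : ContinuousOn y U) (hZ : Z = {t ∈ U | y t = 0})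
    {u : E → ℂ} (hu : Sm U u) (h : Flat Z 1 u) {t : E} (ht : t ∈ U) :
    HasFDerivAt (cut y u) (cut y (fderiv ℝ u) t) t := by
  have hpos : ∀ t ∈ U, 0 < y t → ∀ᶠ s in 𝓝 t, 0 < y s := fun t ht h =>
    (hy.continuousAt (hU.mem_nhds ht)).eventually (lt_mem_nhds h)
  have hneg : ∀ t ∈ U, y t < 0 → ∀ᶠ s in 𝓝 t, y s < 0 := fun t ht h =>
    (hy.continuousAt (hU.mem_nhds ht)).eventually (gt_mem_nhds h)
  have hcp : ∀ t ∈ U, 0 < y t → ∀ u : E → ℂ, cut y u =ᶠ[𝓝 t] u := fun t ht h u =>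
    (hpos t ht h).mono fun s hs => by simp [cut, hs]
  have hcn : ∀ t ∈ U, y t < 0 → ∀ u : E → ℂ, cut y u =ᶠ[𝓝 t] 0 := fun t ht h u =>
    (hneg t ht h).mono fun s hs => by simp [cut, not_lt.2 hs.le]
  have hle : ∀ (u : E → ℂ) t, ‖cut y u t‖ ≤ ‖u t‖ := fun u t => by
    unfold cut; split_ifs <;> simp
  have hud := (hu.diffAt hU ht).hasFDerivAt
  rcases lt_trichotomy (y t) 0 with h1 | h1 | h1
  · have : cut y (fderiv ℝ u) t = 0 := by simp [cut, not_lt.2 h1.le]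
    rw [this]
    exact (hasFDerivAt_const (0 : ℂ) t).congr_of_eventuallyEq (hcn t ht h1 u)
  · have htZ : t ∈ Z := by rw [hZ]; exact ⟨ht, h1⟩
    have h0 : u t = 0 := h.1 t htZ
    have hd0 : fderiv ℝ u t = 0 := by
      ext v; exact (h.2 v).zero t htZ
    have : cut y (fderiv ℝ u) t = 0 := by simp [cut, h1]
    rw [this]
    rw [hd0] at hud
    rw [hasFDerivAt_iff_isLittleO_nhds_zero] at hud ⊢
    have hc0 : cut y u t = 0 := by simp [cut, h1]
    simp only [h0, hc0, sub_zero, zero_apply] at hud ⊢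
    exact (Asymptotics.IsBigO.of_bound 1 (Eventually.of_forall fun x => by rw [one_mul]; exact hle u _)).trans_isLittleO hud
  · have : cut y (fderiv ℝ u) t = fderiv ℝ u t := by simp [cut, h1]
    rw [this]
    exact hud.congr_of_eventuallyEq (hcp t ht h1 u)

theorem cut_contDiff {Z U : Set E} (hU : IsOpen U) {y : E → ℝ} (hy : ContinuousOn y U) (hZ : Z = {t ∈ U | y t = 0})
    (j : ℕ) {u : E → ℂ} (hu : Sm U u) (h : Flat Z j u) : ContDiffOn ℝ j (cut y u) U := by
  have hpos : ∀ t ∈ U, 0 < y t → ∀ᶠ s in 𝓝 t, 0 < y s := fun t ht h =>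
    (hy.continuousAt (hU.mem_nhds ht)).eventually (lt_mem_nhds h)
  have hneg : ∀ t ∈ U, y t < 0 → ∀ᶠ s in 𝓝 t, y s < 0 := fun t ht h =>
    (hy.continuousAt (hU.mem_nhds ht)).eventually (gt_mem_nhds h)
  have hcp : ∀ t ∈ U, 0 < y t → ∀ u : E → ℂ, cut y u =ᶠ[𝓝 t] u := fun t ht h u =>
    (hpos t ht h).mono fun s hs => by simp [cut, hs]
  have hcn : ∀ t ∈ U, y t < 0 → ∀ u : E → ℂ, cut y u =ᶠ[𝓝 t] 0 := fun t ht h u =>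
    (hneg t ht h).mono fun s hs => by simp [cut, not_lt.2 hs.le]
  have hle : ∀ (u : E → ℂ) t, ‖cut y u t‖ ≤ ‖u t‖ := fun u t => by
    unfold cut; split_ifs <;> simp
  have hR : FiniteDimensional ℝ E := FiniteDimensional.trans ℝ ℂ E
  induction j generalizing u with
  | zero =>
    rw [Nat.cast_zero, contDiffOn_zero]
    intro t ht
    apply ContinuousAt.continuousWithinAt
    have huc := (hu.diffAt hU ht).continuousAt
    rcases lt_trichotomy (y t) 0 with h1 | h1 | h1
    · exact continuousAt_const.congr (hcn t ht h1 u).symm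
    · have h0 : u t = 0 := h t (by rw [hZ]; exact ⟨ht, h1⟩)
      have hc0 : cut y u t = 0 := by simp [cut, h1]
      rw [ContinuousAt, hc0]
      refine squeeze_zero_norm (hle u) ?_
      have := huc.norm
      rwa [ContinuousAt, h0, norm_zero] at this
    · exact huc.congr (hcp t ht h1 u).symm
  | succ j ih =>
    have hder : ∀ t ∈ U, HasFDerivAt (cut y u) (cut y (fderiv ℝ u) t) t := fun t ht =>
      cut_hasFDerivAt hU hy hZ hu (h.mono (by omega)) ht
    rw [Nat.cast_add, Nat.cast_one, contDiffOn_succ_iff_fderiv_of_isOpen hU]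
    refine ⟨fun t ht => (hder t ht).differentiableAt.differentiableWithinAt, by simp, ?_⟩
    rw [contDiffOn_clm_apply]
    intro v
    refine (ih (hu.fd hU v) (h.2 v)).congr fun t ht => ?_
    rw [(hder t ht).fderiv]
    unfold cut; split_ifs <;> simp

end FlatSec

section PartK
open MeasureTheory

section ParamInt
variable {E : Type*} [NormedAddCommGroup E] [NormedSpace ℂ E] [FiniteDimensional ℂ E]

theorem param_hasFDerivAt {Φ : E × ℂ → ℂ} {V : Set E} {B K : Set ℂ} (hV : IsOpen V) (hB : IsOpen B) (hK : IsCompact K)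
    (hKB : K ⊆ B) (hΦ : ContDiffOn ℝ 1 Φ (V ×ˢ B)) {k : ℂ → ℂ} (hk : IntegrableOn k K) {t : E} (ht : t ∈ V) :
    HasFDerivAt (fun t => ∫ ζ in K, k ζ * Φ (t, ζ))
      (∫ ζ in K, k ζ • (fderiv ℝ Φ (t, ζ)).comp (ContinuousLinearMap.inl ℝ E ℂ)) t := by
  have hR : FiniteDimensional ℝ E := FiniteDimensional.trans ℝ ℂ E
  have : ProperSpace E := FiniteDimensional.proper ℝ E
  have hKm := hK.measurableSet
  have hVB := hV.prod hB
  have hD : ContinuousOn (fderiv ℝ Φ) (V ×ˢ B) := hΦ.continuousOn_fderiv_of_isOpen hVB le_rfl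
  have hD' : ContinuousOn (fun x => (fderiv ℝ Φ x).comp (ContinuousLinearMap.inl ℝ E ℂ)) (V ×ˢ B) :=
    hD.clm_comp continuousOn_const
  obtain ⟨ρ, hρ, hb⟩ := Metric.nhds_basis_closedBall.mem_iff.1 (hV.mem_nhds ht)
  obtain ⟨C, hC⟩ := ((isCompact_closedBall t ρ).prod hK).exists_bound_of_continuousOn
      (hD'.mono (prod_mono hb hKB))
  have hslice : ∀ {G : Type _} [NormedAddCommGroup G] (g : E × ℂ → G), ContinuousOn g (V ×ˢ B) → ∀ t ∈ V,
      ContinuousOn (fun ζ => g (t, ζ)) K := fun g hg t ht =>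
    hg.comp (f := fun ζ => (t, ζ)) (by fun_prop) fun ζ hζ => ⟨ht, hKB hζ⟩
  have hkm := hk.aestronglyMeasurable
  refine hasFDerivAt_integral_of_dominated_of_fderiv_le (ball_mem_nhds t hρ) (bound := fun ζ => ‖k ζ‖ * C)
    (F' := fun t ζ => k ζ • (fderiv ℝ Φ (t, ζ)).comp (ContinuousLinearMap.inl ℝ E ℂ)) ?_ ?_ ?_ ?_ ?_ ?_
  · filter_upwards [hV.mem_nhds ht] with s hs
    exact hkm.mul ((hslice Φ hΦ.continuousOn s hs).aestronglyMeasurable hKm)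
  · exact IntegrableOn.mul_continuousOn hk (hslice Φ hΦ.continuousOn t ht) hK
  · refine hkm.smul (ContinuousOn.aestronglyMeasurable ?_ hKm)
    exact hD'.comp (f := fun ζ => (t, ζ)) (by fun_prop) fun ζ hζ => ⟨ht, hKB hζ⟩
  · filter_upwards [ae_restrict_mem hKm] with ζ hζ s hs
    rw [norm_smul]
    exact mul_le_mul_of_nonneg_left (hC (s, ζ) ⟨ball_subset_closedBall hs, hζ⟩) (norm_nonneg _)
  · exact hk.norm.mul_const C
  · filter_upwards [ae_restrict_mem hKm] with ζ hζ s hs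
    have h1 : HasFDerivAt Φ (fderiv ℝ Φ (s, ζ)) (s, ζ) :=
      ((hΦ.differentiableOn (by simp)).differentiableAt (hVB.mem_nhds ⟨hb (ball_subset_closedBall hs), hKB hζ⟩)).hasFDerivAt
    have h2 : HasFDerivAt (fun s : E => (s, ζ)) (ContinuousLinearMap.inl ℝ E ℂ) s := hasFDerivAt_prodMk_left s ζ
    exact (h1.comp s h2).const_mul (k ζ)

theorem param_deriv_apply {Φ : E × ℂ → ℂ} {V : Set E} {B K : Set ℂ} (hV : IsOpen V) (hB : IsOpen B) (hK : IsCompact K)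
    (hKB : K ⊆ B) (hΦ : ContDiffOn ℝ 1 Φ (V ×ˢ B)) {k : ℂ → ℂ} (hk : IntegrableOn k K) {t : E} (ht : t ∈ V) (e : E) :
    fderiv ℝ (fun t => ∫ ζ in K, k ζ * Φ (t, ζ)) t e = ∫ ζ in K, k ζ * fderiv ℝ Φ (t, ζ) (e, 0) := by
  rw [(param_hasFDerivAt hV hB hK hKB hΦ hk ht).fderiv, ContinuousLinearMap.integral_apply]
  · simp
  · have hVB := hV.prod hB
    have hD : ContinuousOn (fderiv ℝ Φ) (V ×ˢ B) := hΦ.continuousOn_fderiv_of_isOpen hVB le_rfl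
    have hD' : ContinuousOn (fun x => (fderiv ℝ Φ x).comp (ContinuousLinearMap.inl ℝ E ℂ)) (V ×ˢ B) :=
      hD.clm_comp continuousOn_const
    refine IntegrableOn.smul_continuousOn hk ?_ hK
    exact hD'.comp (f := fun ζ => (t, ζ)) (by fun_prop) fun ζ hζ => ⟨ht, hKB hζ⟩

theorem param_contDiff (j : ℕ) {Φ : E × ℂ → ℂ} {V : Set E} {B K : Set ℂ} (hV : IsOpen V) (hB : IsOpen B) (hK : IsCompact K)
    (hKB : K ⊆ B) (hΦ : ContDiffOn ℝ j Φ (V ×ˢ B)) {k : ℂ → ℂ} (hk : IntegrableOn k K) :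
    ContDiffOn ℝ j (fun t => ∫ ζ in K, k ζ * Φ (t, ζ)) V := by
  have hR : FiniteDimensional ℝ E := FiniteDimensional.trans ℝ ℂ E
  have : ProperSpace E := FiniteDimensional.proper ℝ E
  induction j generalizing Φ with
  | zero =>
    rw [Nat.cast_zero, contDiffOn_zero] at *
    intro t ht
    apply ContinuousAt.continuousWithinAt
    have hKm := hK.measurableSet
    obtain ⟨ρ, hρ, hb⟩ := Metric.nhds_basis_closedBall.mem_iff.1 (hV.mem_nhds ht)
    obtain ⟨C, hC⟩ := ((isCompact_closedBall t ρ).prod hK).exists_bound_of_continuousOn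
      (hΦ.mono (prod_mono hb hKB))
    apply continuousAt_of_dominated (bound := fun ζ => ‖k ζ‖ * C)
    · filter_upwards [hV.mem_nhds ht] with s hs
      refine hk.aestronglyMeasurable.mul (ContinuousOn.aestronglyMeasurable ?_ hKm)
      exact hΦ.comp (f := fun ζ => (s, ζ)) (by fun_prop) fun ζ hζ => ⟨hs, hKB hζ⟩
    · filter_upwards [ball_mem_nhds t hρ] with s hs
      filter_upwards [ae_restrict_mem hKm] with ζ hζ
      rw [norm_mul]
      exact mul_le_mul_of_nonneg_left (hC (s, ζ) ⟨ball_subset_closedBall hs, hζ⟩) (norm_nonneg _)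
    · exact hk.norm.mul_const C
    · filter_upwards [ae_restrict_mem hKm] with ζ hζ
      have h1 : ContinuousAt Φ (t, ζ) := hΦ.continuousAt ((hV.prod hB).mem_nhds ⟨ht, hKB hζ⟩)
      exact continuousAt_const.mul (ContinuousAt.comp (f := fun s : E => (s, ζ)) h1 (by fun_prop))
  | succ j ih =>
    have hΦ1 : ContDiffOn ℝ 1 Φ (V ×ˢ B) := hΦ.of_le (by
      rw [Nat.cast_add, Nat.cast_one]; exact le_add_self)
    rw [Nat.cast_add, Nat.cast_one, contDiffOn_succ_iff_fderiv_of_isOpen hV]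
    refine ⟨fun t ht => (param_hasFDerivAt hV hB hK hKB hΦ1 hk ht).differentiableAt.differentiableWithinAt, by simp, ?_⟩
    rw [contDiffOn_clm_apply]
    intro e
    have hs : ContDiffOn ℝ j (fun x => fderiv ℝ Φ x (e, 0)) (V ×ˢ B) :=
      (hΦ.fderiv_of_isOpen (m := j) (hV.prod hB) (by simp)).clm_apply contDiffOn_const
    exact (ih hs).congr fun t ht => param_deriv_apply hV hB hK hKB hΦ1 hk ht e

end ParamInt

section Pompeiu

theorem anti_polar (u : ℂ → ℂ) (ζ e : ℂ) (he : ‖e‖ = 1) :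
    antiCDeriv u ζ 1 = e * ((fderiv ℝ u ζ e + I * fderiv ℝ u ζ (I * e)) / 2) := by
  have := antiCDeriv_conj_smul u ζ 1 e
  simp only [smul_eq_mul, mul_one] at this
  have h2 : e * starRingEnd ℂ e = 1 := by rw [mul_comm]; exact conj_mul_of_norm_one he
  calc antiCDeriv u ζ 1 = (e * starRingEnd ℂ e) * antiCDeriv u ζ 1 := by rw [h2, one_mul]
    _ = e * antiCDeriv u ζ e := by rw [this]; ring
    _ = _ := by rw [antiCDeriv, smul_eq_mul]

/-- Cauchy–Pompeiu at the centre for functions vanishing on the unit circle. -/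
theorem cauchy_pompeiu {u : ℂ → ℂ} {R : ℝ} (hR : 1 < R) (hu : ContDiffOn ℝ 1 u (ball 0 R))
    (h0 : ∀ ζ : ℂ, ‖ζ‖ = 1 → u ζ = 0) :
    u 0 = -(1 / (Real.pi : ℂ)) * ∫ ζ in closedBall (0 : ℂ) 1, ζ⁻¹ * antiCDeriv u ζ 1 := by
  set D := fderiv ℝ u with hD
  have hDc : ContinuousOn D (ball 0 R) := hu.continuousOn_fderiv_of_isOpen isOpen_ball le_rfl
  have hdiff : ∀ ζ ∈ ball (0 : ℂ) R, HasFDerivAt u (D ζ) ζ := fun ζ hζ =>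
    ((hu.differentiableOn (by simp)).differentiableAt (isOpen_ball.mem_nhds hζ)).hasFDerivAt
  set e : ℝ → ℂ := fun θ => exp (θ * I) with he
  have hen : ∀ θ, ‖e θ‖ = 1 := fun θ => Complex.norm_exp_ofReal_mul_I θ
  have hec : Continuous e := by fun_prop
  have hmemR : ∀ r ∈ Icc (0 : ℝ) 1, ∀ θ, (r : ℂ) * e θ ∈ ball (0 : ℂ) R := by
    intro r hr θ
    rw [mem_ball_zero_iff, norm_mul, hen, mul_one, Complex.norm_real, Real.norm_of_nonneg hr.1]
    linarith [hr.2]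
  set G1 : ℝ × ℝ → ℂ := fun p => D (p.1 * e p.2) (e p.2) with hG1
  set G2 : ℝ × ℝ → ℂ := fun p => D (p.1 * e p.2) (I * e p.2) with hG2
  have hcont : ∀ c : ℂ, ContinuousOn (fun p : ℝ × ℝ => D (p.1 * e p.2) (c * e p.2)) (Icc 0 1 ×ˢ univ) := by
    intro c
    refine ContinuousOn.clm_apply ?_ (by fun_prop)
    refine hDc.comp (by fun_prop) fun p hp => hmemR p.1 hp.1 p.2
  have hG1c : ContinuousOn G1 (Icc 0 1 ×ˢ univ) := by simpa using hcont 1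
  have hG2c : ContinuousOn G2 (Icc 0 1 ×ˢ univ) := hcont I
  have hintg : ∀ G : ℝ × ℝ → ℂ, ContinuousOn G (Icc 0 1 ×ˢ univ) →
      IntegrableOn G (Ioc 0 1 ×ˢ Ioo (-Real.pi) Real.pi) := fun G hG =>
    ((hG.mono (prod_mono_right (subset_univ (Icc (-Real.pi) Real.pi)))).integrableOn_compact (isCompact_Icc.prod isCompact_Icc)).mono_set
      (prod_mono Ioc_subset_Icc_self Ioo_subset_Icc_self)
  -- polar coordinates
  have hpol : ∫ ζ in closedBall (0 : ℂ) 1, ζ⁻¹ * antiCDeriv u ζ 1 =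
      ∫ p in Ioc (0 : ℝ) 1 ×ˢ Ioo (-Real.pi) Real.pi, (G1 p + I * G2 p) / 2 := by
    rw [← integral_indicator isClosed_closedBall.measurableSet, ← Complex.integral_comp_polarCoord_symm]
    have hT : polarCoord.target = Ioi (0 : ℝ) ×ˢ Ioo (-Real.pi) Real.pi := rfl
    rw [hT]
    have hsub : Ioc (0 : ℝ) 1 ×ˢ Ioo (-Real.pi) Real.pi ⊆ Ioi (0 : ℝ) ×ˢ Ioo (-Real.pi) Real.pi :=
      prod_mono_left Ioc_subset_Ioi_self
    have hval : ∀ p : ℝ × ℝ, Complex.polarCoord.symm p = p.1 * e p.2 := by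
      intro p
      rw [Complex.polarCoord_symm_apply, he]
      simp only [Complex.exp_mul_I]
      push_cast; rfl
    refine (setIntegral_eq_of_subset_of_forall_diff_eq_zero (measurableSet_Ioi.prod measurableSet_Ioo) hsub ?_).trans ?_
    swap
    · refine setIntegral_congr_fun (measurableSet_Ioc.prod measurableSet_Ioo) fun p hp => ?_
      have hp1 : 0 < p.1 := hp.1.1
      have hmem : (p.1 : ℂ) * e p.2 ∈ closedBall (0 : ℂ) 1 := by
        rw [mem_closedBall_zero_iff, norm_mul, hen, mul_one, Complex.norm_real, Real.norm_of_nonneg hp1.le]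
        exact hp.1.2
      beta_reduce
      rw [hval, indicator_of_mem hmem, anti_polar u _ (e p.2) (hen _)]
      have e0 : e p.2 ≠ 0 := Complex.exp_ne_zero _
      have p0 : (p.1 : ℂ) ≠ 0 := by exact_mod_cast hp1.ne'
      rw [Complex.real_smul]
      simp only [hG1, hG2, hD]
      field_simp
    · rintro p ⟨hp1, hp2⟩
      have hnm : (p.1 : ℂ) * e p.2 ∉ closedBall (0 : ℂ) 1 := by
        intro hm
        rw [mem_closedBall_zero_iff, norm_mul, hen, mul_one, Complex.norm_real, Real.norm_of_nonneg (le_of_lt hp1.1)] at hm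
        exact hp2 ⟨⟨hp1.1, hm⟩, hp1.2⟩
      rw [hval, indicator_of_notMem hnm, smul_zero]
  have hI1 : ∫ p in Ioc (0 : ℝ) 1 ×ˢ Ioo (-Real.pi) Real.pi, G1 p = -(2 * Real.pi) * u 0 := by
    have hI := hintg G1 hG1c
    rw [Measure.volume_eq_prod, IntegrableOn, ← Measure.prod_restrict] at hI
    rw [Measure.volume_eq_prod, ← Measure.prod_restrict, integral_prod_symm _ hI]
    have hin : ∀ θ : ℝ, ∫ r in Ioc (0 : ℝ) 1, G1 (r, θ) = - u 0 := by
      intro θ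
      rw [← intervalIntegral.integral_of_le zero_le_one]
      have hd : ∀ r ∈ uIcc (0 : ℝ) 1, HasDerivAt (fun r : ℝ => u (r * e θ)) (G1 (r, θ)) r := by
        intro r hr
        rw [uIcc_of_le zero_le_one] at hr
        have h1 := hdiff _ (hmemR r hr θ)
        have h2 : HasDerivAt (fun r : ℝ => (r : ℂ) * e θ) (e θ) r := by
          simpa using (Complex.ofRealCLM.hasDerivAt (x := r)).mul_const (e θ)
        exact h1.comp_hasDerivAt r h2
      rw [intervalIntegral.integral_eq_sub_of_hasDerivAt hd]
      · rw [Complex.ofReal_one, one_mul, h0 _ (hen θ)]; simp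
      · apply ContinuousOn.intervalIntegrable
        rw [uIcc_of_le zero_le_one]
        exact hG1c.comp (f := fun r : ℝ => (r, θ)) (by fun_prop) fun r hr => ⟨hr, mem_univ _⟩
    simp only [hin]
    rw [setIntegral_const]
    rw [Real.volume_real_Ioo_of_le (by linarith [Real.pi_pos]), Complex.real_smul]
    push_cast
    ring
  have hI2 : ∫ p in Ioc (0 : ℝ) 1 ×ˢ Ioo (-Real.pi) Real.pi, G2 p = 0 := by
    have hI := hintg G2 hG2c
    rw [Measure.volume_eq_prod, IntegrableOn, ← Measure.prod_restrict] at hI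
    rw [Measure.volume_eq_prod, ← Measure.prod_restrict, integral_prod _ hI]
    have hin : ∀ r ∈ Ioc (0 : ℝ) 1, ∫ θ in Ioo (-Real.pi) Real.pi, G2 (r, θ) = 0 := by
      intro r hr
      have hr' : r ∈ Icc (0 : ℝ) 1 := ⟨hr.1.le, hr.2⟩
      have r0 : (r : ℂ) ≠ 0 := by exact_mod_cast hr.1.ne'
      rw [← integral_Ioc_eq_integral_Ioo, ← intervalIntegral.integral_of_le (by linarith [Real.pi_pos])]
      have hd : ∀ θ ∈ uIcc (-Real.pi) Real.pi, HasDerivAt (fun θ : ℝ => (r : ℂ)⁻¹ * u (r * e θ)) (G2 (r, θ)) θ := by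
        intro θ _
        have h1 := hdiff _ (hmemR r hr' θ)
        have h2 : HasDerivAt (fun θ : ℝ => (r : ℂ) * e θ) (r * (e θ * (1 * I))) θ :=
          (((Complex.ofRealCLM.hasDerivAt (x := θ)).mul_const I).cexp).const_mul (r : ℂ)
        have h3 := (h1.comp_hasDerivAt θ h2).const_mul ((r : ℂ)⁻¹)
        refine h3.congr_deriv ?_
        have : (r : ℂ) * (e θ * (1 * I)) = r • (I * e θ) := by rw [Complex.real_smul]; ring
        rw [this, map_smul, Complex.real_smul, inv_mul_cancel_left₀ r0]
      rw [intervalIntegral.integral_eq_sub_of_hasDerivAt hd]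
      · have : e (-Real.pi) = e Real.pi := by
          simp only [he]
          push_cast
          rw [neg_mul, Complex.exp_neg, Complex.exp_pi_mul_I]; norm_num
        rw [this, sub_self]
      · apply Continuous.intervalIntegrable
        exact hG2c.comp_continuous (f := fun θ : ℝ => (r, θ)) (by fun_prop) fun θ => ⟨hr', mem_univ _⟩
    rw [setIntegral_congr_fun measurableSet_Ioc hin]
    simp
  rw [hpol]
  have hsplit : ∫ p in Ioc (0 : ℝ) 1 ×ˢ Ioo (-Real.pi) Real.pi, (G1 p + I * G2 p) / 2 =
      (-(2 * Real.pi) * u 0 + I * 0) / 2 := by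
    rw [integral_div, integral_add (hintg G1 hG1c) ((hintg G2 hG2c).const_mul I), hI1, integral_const_mul, hI2]
  rw [hsplit]
  have : (Real.pi : ℂ) ≠ 0 := by exact_mod_cast Real.pi_ne_zero
  field_simp
  ring

theorem inv_integrable : IntegrableOn (fun ζ : ℂ => ζ⁻¹) (closedBall 0 1) := by
  have h1 : Measurable (fun ζ : ℂ => ζ⁻¹) := measurable_inv
  refine ⟨h1.aestronglyMeasurable, ?_⟩
  rw [hasFiniteIntegral_iff_enorm, ← lintegral_indicator isClosed_closedBall.measurableSet,
    ← Complex.lintegral_comp_polarCoord_symm]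
  have hT : polarCoord.target = Ioi (0 : ℝ) ×ˢ Ioo (-Real.pi) Real.pi := rfl
  rw [hT]
  calc _ ≤ ∫⁻ p in Ioi (0 : ℝ) ×ˢ Ioo (-Real.pi) Real.pi, (Ioc (0 : ℝ) 1 ×ˢ Ioo (-Real.pi) Real.pi).indicator 1 p := by
        refine setLIntegral_mono_ae' (measurableSet_Ioi.prod measurableSet_Ioo) (Eventually.of_forall fun p hp => ?_)
        have hp1 : 0 < p.1 := hp.1
        have hn : ‖Complex.polarCoord.symm p‖ = p.1 := by
          rw [Complex.norm_polarCoord_symm, abs_of_pos hp1]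
        by_cases h : p.1 ≤ 1
        · have hm : Complex.polarCoord.symm p ∈ closedBall (0 : ℂ) 1 := by
            rw [mem_closedBall_zero_iff, hn]; exact h
          have hm2 : p ∈ Ioc (0 : ℝ) 1 ×ˢ Ioo (-Real.pi) Real.pi := ⟨⟨hp1, h⟩, hp.2⟩
          rw [indicator_of_mem hm, indicator_of_mem hm2, ← ofReal_norm_eq_enorm, norm_inv, hn, smul_eq_mul,
            ← ENNReal.ofReal_mul hp1.le, mul_inv_cancel₀ hp1.ne']
          simp
        · have hm : Complex.polarCoord.symm p ∉ closedBall (0 : ℂ) 1 := by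
            rw [mem_closedBall_zero_iff, hn]; exact h
          rw [indicator_of_notMem hm]; simp
    _ ≤ ∫⁻ p, (Ioc (0 : ℝ) 1 ×ˢ Ioo (-Real.pi) Real.pi).indicator 1 p := setLIntegral_le_lintegral _ _
    _ = volume (Ioc (0 : ℝ) 1 ×ˢ Ioo (-Real.pi) Real.pi) := by
        rw [lintegral_indicator_one (measurableSet_Ioc.prod measurableSet_Ioo)]
    _ < ⊤ := by
        rw [Measure.volume_eq_prod, Measure.prod_prod]
        simp [ENNReal.mul_lt_top_iff]

end Pompeiu

end PartK

section PartL
open MeasureTheory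

section OneSided
variable {E : Type*} [NormedAddCommGroup E] [NormedSpace ℂ E] [FiniteDimensional ℂ E]

theorem diff_of_anti {f : E → ℂ} {t : E} (hf : DifferentiableAt ℝ f t)
    (h : ∀ v, antiCDeriv f t v = 0) : DifferentiableAt ℂ f t := by
  refine (hol_of_real hf.hasFDerivAt fun v => ?_).differentiableAt
  have := h v
  rw [antiCDeriv, div_eq_zero_iff] at this
  have h2 : fderiv ℝ f t v + I * fderiv ℝ f t (I • v) = 0 := this.resolve_right (by norm_num)
  rw [smul_eq_mul]
  linear_combination (-I) * h2 + (fderiv ℝ f t (I • v)) * Complex.I_mul_I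

theorem anti_cut {Z U : Set E} (hU : IsOpen U) {y : E → ℝ} (hy : ContinuousOn y U) (hZ : Z = {t ∈ U | y t = 0})
    {u : E → ℂ} (hu : Sm U u) (h : Flat Z 1 u) {t : E} (ht : t ∈ U) (v : E) :
    antiCDeriv (cut y u) t v = cut y (fun x => antiCDeriv u x v) t := by
  simp only [antiCDeriv, (cut_hasFDerivAt hU hy hZ hu h ht).fderiv]
  unfold cut; split_ifs <;> simp

/-- chain rule for `∂bar` and a holomorphic curve -/
theorem anti_comp_hol {u : E → ℂ} {a : ℂ → E} {ζ : ℂ} {a' : E} (hu : DifferentiableAt ℝ u (a ζ))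
    (ha : HasDerivAt a a' ζ) : antiCDeriv (fun ζ => u (a ζ)) ζ 1 = antiCDeriv u (a ζ) a' := by
  have h1 := hu.hasFDerivAt.comp ζ (ha.hasFDerivAt.restrictScalars ℝ)
  have h2 : fderiv ℝ (fun ζ => u (a ζ)) ζ = _ := h1.fderiv
  simp [antiCDeriv, h2]

theorem anti_shift {u : E → ℂ} {t b : E} (v : E) :
    antiCDeriv (fun s => u (s + b)) t v = antiCDeriv u (t + b) v := by
  simp only [antiCDeriv, fderiv_comp_add_right]

/-- the operator `∂bar` as a real linear map -/
def antiCLM (g : E → ℂ) (x : E) : E →L[ℝ] ℂ :=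
  (1 / 2 : ℝ) • (fderiv ℝ g x + (I • (ContinuousLinearMap.id ℝ ℂ)).comp
    ((fderiv ℝ g x).comp (I • ContinuousLinearMap.id ℝ E)))

theorem antiCLM_apply (g : E → ℂ) (x v : E) : antiCLM g x v = antiCDeriv g x v := by
  simp [antiCLM, antiCDeriv, Complex.real_smul]
  ring

/-- the solution operator of `∂bar` along the discs `t + A` -/
def slv (y : E → ℝ) (g : E → ℂ) (A : ℂ → E) (t : E) : ℂ :=
  -(1 / (Real.pi : ℂ)) * ∫ ζ in closedBall (0 : ℂ) 1, ζ⁻¹ * cut y (antiCLM g) (t + A ζ) (deriv A ζ)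

theorem cutCLM_apply (y : E → ℝ) (g : E → ℂ) (x v : E) :
    cut y (antiCLM g) x v = cut y (fun x => antiCDeriv g x v) x := by
  unfold cut; split_ifs <;> simp [antiCLM_apply]

theorem cutCLM_contDiff {Z U : Set E} (hU : IsOpen U) {y : E → ℝ} (hy : ContinuousOn y U) (hZ : Z = {t ∈ U | y t = 0})
    {g : E → ℂ} (hg : Sm U g) {j : ℕ} (h : ∀ v, Flat Z j (fun t => antiCDeriv g t v)) :
    ContDiffOn ℝ j (cut y (antiCLM g)) U := by
  have hR : FiniteDimensional ℝ E := FiniteDimensional.trans ℝ ℂ E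
  rw [contDiffOn_clm_apply]
  intro v
  exact (cut_contDiff hU hy hZ j (hg.anti hU v) (h v)).congr fun x _ => cutCLM_apply y g x v

theorem slvΦ_contDiff {Z U V : Set E} (hU : IsOpen U) {y : E → ℝ} (hy : ContinuousOn y U)
    (hZ : Z = {t ∈ U | y t = 0}) {g : E → ℂ} (hg : Sm U g) {j : ℕ} (h : ∀ v, Flat Z j (fun t => antiCDeriv g t v))
    {A : ℂ → E} (hA : DifferentiableOn ℂ A (ball 0 2)) (hVU : ∀ t ∈ V, ∀ ζ ∈ ball (0 : ℂ) 2, t + A ζ ∈ U) :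
    ContDiffOn ℝ j (fun x : E × ℂ => cut y (antiCLM g) (x.1 + A x.2) (deriv A x.2)) (V ×ˢ ball 0 2) := by
  have : CompleteSpace E := FiniteDimensional.complete ℂ E
  have hA1 : ContDiffOn ℝ j A (ball 0 2) :=
    ((hA.contDiffOn (n := j) isOpen_ball)).restrict_scalars ℝ
  have hA2 : ContDiffOn ℝ j (deriv A) (ball 0 2) :=
    (((hA.deriv isOpen_ball).contDiffOn (n := j) isOpen_ball)).restrict_scalars ℝ
  refine ContDiffOn.clm_apply ((cutCLM_contDiff hU hy hZ hg h).comp (f := fun x : E × ℂ => x.1 + A x.2)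
    (contDiffOn_fst.add (hA1.comp contDiffOn_snd fun x hx => hx.2)) fun x hx => hVU _ hx.1 _ hx.2)
    (hA2.comp contDiffOn_snd fun x hx => hx.2)

theorem slv_contDiff {Z U V : Set E} (hU : IsOpen U) (hV : IsOpen V) {y : E → ℝ} (hy : ContinuousOn y U)
    (hZ : Z = {t ∈ U | y t = 0}) {g : E → ℂ} (hg : Sm U g) {j : ℕ} (h : ∀ v, Flat Z j (fun t => antiCDeriv g t v))
    {A : ℂ → E} (hA : DifferentiableOn ℂ A (ball 0 2)) (hVU : ∀ t ∈ V, ∀ ζ ∈ ball (0 : ℂ) 2, t + A ζ ∈ U) :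
    ContDiffOn ℝ j (slv y g A) V :=
  contDiffOn_const.mul (param_contDiff j hV isOpen_ball (isCompact_closedBall 0 1) (closedBall_subset_ball (by norm_num))
    (slvΦ_contDiff hU hy hZ hg h hA hVU) inv_integrable)

theorem cut_pompeiu {Z U V : Set E} (hU : IsOpen U) {y : E → ℝ} (hy : ContinuousOn y U)
    (hZ : Z = {t ∈ U | y t = 0}) {u : E → ℂ} (hu : Sm U u) (h : Flat Z 1 u)
    {A : ℂ → E} (hA : DifferentiableOn ℂ A (ball 0 2)) (hA0 : A 0 = 0)
    (hVU : ∀ t ∈ V, ∀ ζ ∈ ball (0 : ℂ) 2, t + A ζ ∈ U)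
    (hneg : ∀ t ∈ V, ∀ ζ : ℂ, ‖ζ‖ = 1 → y (t + A ζ) < 0) {t : E} (ht : t ∈ V) :
    cut y u t = -(1 / (Real.pi : ℂ)) * ∫ ζ in closedBall (0 : ℂ) 1, ζ⁻¹ *
      cut y (fun x => antiCDeriv u x (deriv A ζ)) (t + A ζ) := by
  have : CompleteSpace E := FiniteDimensional.complete ℂ E
  have hA1 : ContDiffOn ℝ 1 A (ball 0 2) :=
    ((hA.contDiffOn (n := 1) isOpen_ball)).restrict_scalars ℝ
  have hc := cut_contDiff hU hy hZ 1 hu h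
  rw [Nat.cast_one] at hc
  have hp := cauchy_pompeiu (R := 2) (u := fun ζ => cut y u (t + A ζ)) (by norm_num)
    (hc.comp (contDiffOn_const.add hA1) fun ζ hζ => hVU t ht ζ hζ)
    (fun ζ hζ => by simp [cut, not_lt.2 (hneg t ht ζ hζ).le])
  simp only [hA0, add_zero] at hp
  rw [hp]
  congr 1
  refine setIntegral_congr_fun isClosed_closedBall.measurableSet fun ζ hζ => ?_
  have hζ2 : ζ ∈ ball (0 : ℂ) 2 := closedBall_subset_ball (by norm_num) hζ
  have hmem := hVU t ht ζ hζ2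
  beta_reduce
  rw [anti_comp_hol (a := fun ζ => t + A ζ) (a' := deriv A ζ) (cut_hasFDerivAt hU hy hZ hu h hmem).differentiableAt,
    anti_cut hU hy hZ hu h hmem]
  exact ((hA.differentiableAt (isOpen_ball.mem_nhds hζ2)).hasDerivAt).const_add t

theorem slv_anti {Z U V : Set E} (hU : IsOpen U) (hV : IsOpen V) {y : E → ℝ} (hy : ContinuousOn y U)
    (hZ : Z = {t ∈ U | y t = 0}) {g : E → ℂ} (hg : Sm U g) (h : ∀ v, Flat Z 1 (fun t => antiCDeriv g t v))
    {A : ℂ → E} (hA : DifferentiableOn ℂ A (ball 0 2)) (hA0 : A 0 = 0)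
    (hVU : ∀ t ∈ V, ∀ ζ ∈ ball (0 : ℂ) 2, t + A ζ ∈ U)
    (hneg : ∀ t ∈ V, ∀ ζ : ℂ, ‖ζ‖ = 1 → y (t + A ζ) < 0) {t : E} (ht : t ∈ V) (e : E) :
    antiCDeriv (slv y g A) t e = cut y (fun x => antiCDeriv g x e) t := by
  rw [cut_pompeiu hU hy hZ (hg.anti hU e) (h e) hA hA0 hVU hneg ht]
  have hΦ := slvΦ_contDiff hU hy hZ hg h hA hVU
  rw [Nat.cast_one] at hΦ
  have hKB : closedBall (0 : ℂ) 1 ⊆ ball 0 2 := closedBall_subset_ball (by norm_num)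
  have hK := isCompact_closedBall (0 : ℂ) 1
  have hder : ∀ e, fderiv ℝ (slv y g A) t e = -(1 / (Real.pi : ℂ)) * ∫ ζ in closedBall (0 : ℂ) 1, ζ⁻¹ *
      fderiv ℝ (fun x : E × ℂ => cut y (antiCLM g) (x.1 + A x.2) (deriv A x.2)) (t, ζ) (e, 0) := by
    intro e
    rw [← param_deriv_apply hV isOpen_ball hK hKB hΦ inv_integrable ht e]
    have h1 := (param_hasFDerivAt hV isOpen_ball hK hKB hΦ inv_integrable ht)
    have h2 : fderiv ℝ (slv y g A) t = _ := (h1.const_mul (-(1 / (Real.pi : ℂ)))).fderiv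
    rw [h2, h1.fderiv]; rfl
  have hi : ∀ e, IntegrableOn (fun ζ => ζ⁻¹ *
      fderiv ℝ (fun x : E × ℂ => cut y (antiCLM g) (x.1 + A x.2) (deriv A x.2)) (t, ζ) (e, 0)) (closedBall (0 : ℂ) 1) := by
    intro e
    refine IntegrableOn.mul_continuousOn inv_integrable ?_ hK
    have := (hΦ.continuousOn_fderiv_of_isOpen (hV.prod isOpen_ball) le_rfl).clm_apply
      (continuousOn_const (c := ((e, 0) : E × ℂ)))
    exact this.comp (f := fun ζ => (t, ζ)) (by fun_prop) fun ζ hζ => ⟨ht, hKB hζ⟩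
  rw [antiCDeriv, hder, hder, ← mul_assoc, mul_comm I, mul_assoc, ← mul_add, mul_div_assoc]
  congr 1
  rw [← integral_const_mul, ← integral_add (hi e) ((hi (I • e)).const_mul I), ← integral_div]
  refine setIntegral_congr_fun isClosed_closedBall.measurableSet fun ζ hζ => ?_
  have hζ2 := hKB hζ
  have hmem := hVU t ht ζ hζ2
  set c := deriv A ζ with hc
  have hs : ∀ e, fderiv ℝ (fun x : E × ℂ => cut y (antiCLM g) (x.1 + A x.2) (deriv A x.2)) (t, ζ) (e, 0) =
      fderiv ℝ (fun s => cut y (fun x => antiCDeriv g x c) (s + A ζ)) t e := by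
    intro e
    have h1 : DifferentiableAt ℝ (fun x : E × ℂ => cut y (antiCLM g) (x.1 + A x.2) (deriv A x.2)) (t, ζ) :=
      (hΦ.differentiableOn (by simp)).differentiableAt ((hV.prod isOpen_ball).mem_nhds ⟨ht, hζ2⟩)
    have h2 := h1.hasFDerivAt.comp t (hasFDerivAt_prodMk_left (𝕜 := ℝ) t ζ)
    have h3 : (fun s => cut y (fun x => antiCDeriv g x c) (s + A ζ)) =
      (fun x : E × ℂ => cut y (antiCLM g) (x.1 + A x.2) (deriv A x.2)) ∘ fun s => (s, ζ) := by
      ext s; simp [cutCLM_apply, hc]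
    rw [h3, h2.fderiv]; simp
  beta_reduce
  rw [hs, hs]
  have h4 : antiCDeriv (fun s => cut y (fun x => antiCDeriv g x c) (s + A ζ)) t e =
      cut y (fun x => antiCDeriv (fun x => antiCDeriv g x e) x c) (t + A ζ) := by
    rw [anti_shift, anti_cut hU hy hZ (hg.anti hU c) (h c) hmem]
    unfold cut
    split_ifs
    · exact anti_comm hU hg hmem _ _
    · rfl
  rw [← h4, antiCDeriv]
  ring

theorem slv_sub {Z U V : Set E} (hU : IsOpen U) {y : E → ℝ} (hy : ContinuousOn y U)
    (hZ : Z = {t ∈ U | y t = 0}) {g g' : E → ℂ} (hg : Sm U g) (hg' : Sm U g')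
    (h : ∀ v, Flat Z 0 (fun t => antiCDeriv g t v)) (h' : ∀ v, Flat Z 0 (fun t => antiCDeriv g' t v))
    (hf : Flat Z 1 (fun t => g t - g' t))
    {A : ℂ → E} (hA : DifferentiableOn ℂ A (ball 0 2)) (hA0 : A 0 = 0)
    (hVU : ∀ t ∈ V, ∀ ζ ∈ ball (0 : ℂ) 2, t + A ζ ∈ U)
    (hneg : ∀ t ∈ V, ∀ ζ : ℂ, ‖ζ‖ = 1 → y (t + A ζ) < 0) {t : E} (ht : t ∈ V) :
    cut y (fun t => g t - g' t) t = slv y g A t - slv y g' A t := by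
  rw [cut_pompeiu hU hy hZ (ContDiffOn.sub hg hg') hf hA hA0 hVU hneg ht, slv, slv, ← mul_sub]
  have hKB : closedBall (0 : ℂ) 1 ⊆ ball 0 2 := closedBall_subset_ball (by norm_num)
  have hK := isCompact_closedBall (0 : ℂ) 1
  have hi : ∀ g : E → ℂ, Sm U g → (∀ v, Flat Z 0 (fun t => antiCDeriv g t v)) → IntegrableOn (fun ζ => ζ⁻¹ *
      cut y (antiCLM g) (t + A ζ) (deriv A ζ)) (closedBall (0 : ℂ) 1) := by
    intro g hg h
    refine IntegrableOn.mul_continuousOn inv_integrable ?_ hK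
    have := (slvΦ_contDiff hU hy hZ hg h hA hVU).continuousOn
    exact this.comp (f := fun ζ => (t, ζ)) (by fun_prop) fun ζ hζ => ⟨ht, hKB hζ⟩
  congr 1
  rw [← integral_sub (hi g hg h) (hi g' hg' h')]
  refine setIntegral_congr_fun isClosed_closedBall.measurableSet fun ζ hζ => ?_
  have hmem := hVU t ht ζ (hKB hζ)
  beta_reduce
  rw [cutCLM_apply, cutCLM_apply, ← mul_sub]
  congr 1
  unfold cut
  split_ifs
  · exact antiCDeriv_sub (hg.diffAt hU hmem) (hg'.diffAt hU hmem) _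
  · simp

theorem slv_zero {y : E → ℝ} {g : E → ℂ} {A : ℂ → E} {t : E}
    (h : ∀ ζ : ℂ, ‖ζ‖ ≤ 1 → y (t + A ζ) < 0) : slv y g A t = 0 := by
  rw [slv, setIntegral_eq_zero_of_forall_eq_zero, mul_zero]
  intro ζ hζ
  rw [mem_closedBall_zero_iff] at hζ
  simp [cut, not_lt.2 (h ζ hζ).le]

end OneSided

end PartL

section PartM
open MeasureTheory

section OneSidedCore
variable {E : Type*} [NormedAddCommGroup E] [NormedSpace ℂ E] [FiniteDimensional ℂ E]

theorem one_sided_core {U : Set E} (hU : IsOpen U) {y : E → ℝ} (hy : Sm U y) {e0 : E}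
    (he0 : ∀ t ∈ U, antiCDeriv (fun t => (y t : ℂ)) t e0 ≠ 0)
    {A : ℂ → E} (hA : DifferentiableOn ℂ A (ball 0 2)) (hA0 : A 0 = 0) {n : E} {δ T : ℝ} (hT : 0 < T)
    (h1 : ∀ t ∈ ball (0 : E) δ, ∀ s ∈ Icc (0 : ℝ) T, ∀ ζ ∈ ball (0 : ℂ) 2, t - (s : ℂ) • n + A ζ ∈ U)
    (h2 : ∀ t ∈ ball (0 : E) δ, ∀ s ∈ Icc (0 : ℝ) T, ∀ ζ : ℂ, ‖ζ‖ = 1 → y (t - (s : ℂ) • n + A ζ) < 0)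
    (h3 : ∀ t ∈ ball (0 : E) δ, ∀ ζ : ℂ, ‖ζ‖ ≤ 1 → y (t - (T : ℂ) • n + A ζ) < 0)
    (h4 : ∀ t ∈ ball (0 : E) δ, ∀ s ∈ Icc (0 : ℝ) T, y (t - (s : ℂ) • n) ≤ y t - s / 2)
    {f : E → ℂ} (hf : Sm U f)
    (hCR : ∀ t ∈ U, y t = 0 → ∀ v, antiCDeriv (fun t => (y t : ℂ)) t v = 0 → antiCDeriv f t v = 0) :
    ∃ H : E → ℂ, DifferentiableOn ℂ H (ball 0 δ ∩ {t | 0 < y t}) ∧ ∀ j : ℕ, ∃ Hj : E → ℂ,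
      ContDiffOn ℝ j Hj (ball 0 δ) ∧ (∀ t ∈ ball (0 : E) δ, 0 < y t → Hj t = H t) ∧
      ∀ t ∈ ball (0 : E) δ, y t = 0 → Hj t = f t := by
  have hcE : CompleteSpace E := FiniteDimensional.complete ℂ E
  set Z : Set E := {t ∈ U | y t = 0} with hZ
  have hyc : ContinuousOn y U := ContDiffOn.continuousOn hy
  set V : Set E := {x | ∃ s ∈ Icc (0 : ℝ) T, x + (s : ℂ) • n ∈ ball (0 : E) δ} with hVd
  have hV : IsOpen V := by
    have : V = ⋃ s ∈ Icc (0 : ℝ) T, (fun x : E => x + (s : ℂ) • n) ⁻¹' ball 0 δ := by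
      ext x; simp only [hVd, mem_setOf_eq, mem_iUnion, mem_preimage, exists_prop]
    rw [this]
    exact isOpen_biUnion fun s _ => isOpen_ball.preimage (by fun_prop)
  have hbV : ball (0 : E) δ ⊆ V := fun t ht => ⟨0, ⟨le_rfl, hT.le⟩, by simpa using ht⟩
  have hVU : ∀ t ∈ V, ∀ ζ ∈ ball (0 : ℂ) 2, t + A ζ ∈ U := by
    rintro t ⟨s, hs, hts⟩ ζ hζ
    simpa using h1 _ hts s hs ζ hζ
  have hneg : ∀ t ∈ V, ∀ ζ : ℂ, ‖ζ‖ = 1 → y (t + A ζ) < 0 := by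
    rintro t ⟨s, hs, hts⟩ ζ hζ
    simpa using h2 _ hts s hs ζ hζ
  have hVU0 : V ⊆ U := fun t ht => by simpa [hA0] using hVU t ht 0 (by simp)
  have hex : ∀ j : ℕ, ∃ g : E → ℂ, Sm U g ∧ (∀ t ∈ Z, g t = f t) ∧ ∀ v, Flat Z (j + 1) (fun t => antiCDeriv g t v) :=
    fun j => almost_analytic hU hy hZ he0 hf (fun t ht => hCR t ht.1 ht.2) (j + 1)
  choose g hgS hgf hgF using hex
  have hF1 : ∀ j v, Flat Z 1 (fun t => antiCDeriv (g j) t v) := fun j v => (hgF j v).mono (by omega)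
  have hcd : ∀ j : ℕ, ContDiffOn ℝ j (slv y (g j) A) V := fun j =>
    slv_contDiff hU hV hyc hZ (hgS j) (fun v => (hgF j v).mono (by omega)) hA hVU
  have hcd1 : ∀ j, DifferentiableOn ℝ (slv y (g j) A) V := fun j => by
    have := slv_contDiff hU hV hyc hZ (hgS j) (fun v => hF1 j v) hA hVU
    exact this.differentiableOn (by simp)
  have hanti : ∀ j, ∀ t ∈ V, ∀ e, antiCDeriv (slv y (g j) A) t e = cut y (fun x => antiCDeriv (g j) x e) t :=
    fun j t ht e => slv_anti hU hV hyc hZ (hgS j) (hF1 j) hA hA0 hVU hneg ht e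
  -- vanishing below
  have hlow : ∀ j, ∀ t ∈ ball (0 : E) δ, y t < 0 → slv y (g j) A t = 0 := by
    intro j t ht hyt
    have hlin : ∀ s : ℂ, HasDerivAt (fun s : ℂ => t - s • n) (-n) s := fun s => by
      simpa using ((hasDerivAt_id s).smul_const n).const_sub t
    set Ω : Set ℂ := (fun s : ℝ => (s : ℂ)) '' Icc 0 T with hΩ
    have hmemV : ∀ s ∈ Icc (0 : ℝ) T, t - (s : ℂ) • n ∈ V := fun s hs => ⟨s, hs, by simpa using ht⟩
    have hhol : ∀ x ∈ V, y x < 0 → DifferentiableAt ℂ (slv y (g j) A) x := by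
      intro x hx hyx
      refine diff_of_anti ((hcd1 j).differentiableAt (hV.mem_nhds hx)) fun v => ?_
      rw [hanti j x hx]
      simp [cut, not_lt.2 hyx.le]
    have han : AnalyticOnNhd ℂ (fun s : ℂ => slv y (g j) A (t - s • n)) Ω := by
      rintro _ ⟨s, hs, rfl⟩
      rw [Complex.analyticAt_iff_eventually_differentiableAt]
      have hx := hmemV s hs
      have hyx : y (t - (s : ℂ) • n) < 0 := by linarith [h4 t ht s hs, hs.1]
      have hev : ∀ᶠ x in 𝓝 (t - (s : ℂ) • n), DifferentiableAt ℂ (slv y (g j) A) x := by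
        filter_upwards [hV.mem_nhds hx, (hyc.continuousAt (hU.mem_nhds (hVU0 hx))).eventually (gt_mem_nhds hyx)]
          with x hx hx' using hhol x hx hx'
      have := (hlin (s : ℂ)).continuousAt.eventually hev
      filter_upwards [this] with z hz
      exact DifferentiableAt.comp (g := slv y (g j) A) (f := fun s : ℂ => t - s • n) z hz (hlin z).differentiableAt
    have hpre : IsPreconnected Ω := isPreconnected_Icc.image _ (by fun_prop)
    have hTm : (T : ℂ) ∈ Ω := ⟨T, ⟨hT.le, le_rfl⟩, rfl⟩
    have h0m : (0 : ℂ) ∈ Ω := ⟨0, ⟨le_rfl, hT.le⟩, by simp⟩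
    have hev0 : (fun s : ℂ => slv y (g j) A (t - s • n)) =ᶠ[𝓝 (T : ℂ)] 0 := by
      have hc : ContinuousAt (fun s : ℂ => t - s • n + (T : ℂ) • n) (T : ℂ) := by fun_prop
      have : ∀ᶠ s in 𝓝 (T : ℂ), t - s • n + (T : ℂ) • n ∈ ball (0 : E) δ :=
        hc.eventually (isOpen_ball.mem_nhds (by simpa using ht))
      filter_upwards [this] with s hs
      refine slv_zero fun ζ hζ => ?_
      simpa using h3 _ hs ζ hζ
    have := han.eqOn_zero_of_preconnected_of_eventuallyEq_zero hpre hTm hev0 h0m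
    simpa using this
  have hM : ∀ j, ∀ t ∈ ball (0 : E) δ, y t = 0 → slv y (g j) A t = 0 := by
    intro j t ht hyt
    have hc : ContinuousAt (fun s : ℝ => slv y (g j) A (t - (s : ℂ) • n)) 0 := by
      have hc0 : ContinuousAt (slv y (g j) A) (t - ((0 : ℝ) : ℂ) • n) := by
        simpa using ((hcd j).continuousOn.continuousAt (hV.mem_nhds (hbV ht)))
      exact hc0.comp (f := fun s : ℝ => t - (s : ℂ) • n) (by fun_prop)
    have hb : ∀ᶠ s : ℝ in 𝓝 0, t - (s : ℂ) • n ∈ ball (0 : E) δ := by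
      have hc : ContinuousAt (fun s : ℝ => t - (s : ℂ) • n) 0 := by fun_prop
      exact hc.eventually (isOpen_ball.mem_nhds (by simpa using ht))
    have h5 : ∀ᶠ s : ℝ in 𝓝[>] 0, slv y (g j) A (t - (s : ℂ) • n) = 0 := by
      filter_upwards [nhdsWithin_le_nhds hb, Ioo_mem_nhdsGT hT] with s hs hs'
      exact hlow j _ hs (by linarith [h4 t ht s ⟨hs'.1.le, hs'.2.le⟩, hs'.1])
    have h6 := tendsto_nhds_unique ((hc.tendsto.mono_left nhdsWithin_le_nhds).congr' h5) tendsto_const_nhds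
    simpa using h6
  refine ⟨fun t => g 1 t - slv y (g 1) A t, ?_, fun j => ⟨fun t => g j t - slv y (g j) A t, ?_, ?_, ?_⟩⟩
  · rintro t ⟨ht, hyt⟩
    have htU := hVU0 (hbV ht)
    have hd1 := (hgS 1).diffAt hU htU
    have hd2 := (hcd1 1).differentiableAt (hV.mem_nhds (hbV ht))
    refine (diff_of_anti (hd1.sub hd2) fun v => ?_).differentiableWithinAt
    refine (antiCDeriv_sub hd1 hd2 v).trans ?_
    rw [hanti 1 t (hbV ht)]
    have : (0 : ℝ) < y t := hyt
    simp [cut, this]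
  · exact (ContDiffOn.of_le ((hgS j).mono (hbV.trans hVU0)) (by exact_mod_cast le_top)).sub ((hcd j).mono hbV)
  · intro t ht hyt
    have hu : Flat Z 1 (fun t => g j t - g 1 t) := by
      refine (flat_key hU hy hZ he0 0 (ContDiffOn.sub (hgS j) (hgS 1)) (fun t ht => ?_) (fun t ht => ?_))
      · rw [hgf j t ht, hgf 1 t ht, sub_self]
      · beta_reduce
        rw [antiCDeriv_sub ((hgS j).diffAt hU ht.1) ((hgS 1).diffAt hU ht.1), (hF1 j e0).zero t ht,
          (hF1 1 e0).zero t ht, sub_zero]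
    have := slv_sub hU hyc hZ (hgS j) (hgS 1) (fun v => (hF1 j v).mono (by omega)) (fun v => (hF1 1 v).mono (by omega))
      hu hA hA0 hVU hneg (hbV ht)
    simp only [cut, hyt, if_true] at this
    linear_combination this
  · intro t ht hyt
    beta_reduce
    rw [hM j t ht hyt, hgf j t ⟨hVU0 (hbV ht), hyt⟩, sub_zero]

end OneSidedCore

end PartM

section PartN
open MeasureTheory

section OneSidedSet
variable {m : ℕ} {M : Set (CS m)} {Q : (Fin m → ℂ) × CS m → ℂ} {r : ℝ} {κ : ℂ}

theorem IsSet.curve (h : IsSet M Q r κ) {ρ : ℝ} (hρr : ρ ≤ r)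
    (hdir : ∀ t ∈ ball (0 : CS m) ρ, ∀ s : ℝ, t + s • nv m κ ∈ ball (0 : CS m) ρ →
      |yf Q κ (t + s • nv m κ) - yf Q κ t - s| ≤ 1 / 2 * |s|)
    {t : CS m} (ht : t ∈ ball (0 : CS m) ρ) (hyt : yf Q κ t = 0) {v : CS m}
    (hv : fderiv ℝ (yf Q κ) t v = 0) : ∃ c : ℝ → CS m, c 0 = t ∧ HasDerivAt c v 0 ∧
      ∀ᶠ s in 𝓝 (0 : ℝ), c s ∈ M ∧ yf Q κ (c s) = 0 := by
  set y := yf Q κ with hy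
  have hsub := ball_subset_ball (x := (0 : CS m)) hρr
  have hyd : HasFDerivAt y (fderiv ℝ y t) t :=
    (Sm.diffAt isOpen_ball (h.y_smooth κ) (hsub ht)).hasFDerivAt
  have hline : HasDerivAt (fun s : ℝ => t + s • v) v 0 := by
    simpa using ((hasDerivAt_id (0 : ℝ)).smul_const v).const_add t
  have ha : HasDerivAt (fun s : ℝ => y (t + s • v)) 0 0 := by
    have h1 : HasFDerivAt y (fderiv ℝ y t) (t + (0 : ℝ) • v) := by simpa using hyd
    have := h1.comp_hasDerivAt (0 : ℝ) hline
    rwa [hv] at this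
  have hca : ContinuousAt (fun s : ℝ => t + s • v) 0 := by fun_prop
  obtain ⟨η, hη, hηb⟩ : ∃ η > 0, ball t η ⊆ ball (0 : CS m) ρ := Metric.isOpen_iff.1 isOpen_ball t ht
  have hex : ∀ s : ℝ, ∃ σ : ℝ, |σ| ≤ 2 * |y (t + s • v)| ∧
      (‖s • v‖ + 2 * |y (t + s • v)| < η → y (t + s • v + σ • nv m κ) = 0) := by
    intro s
    by_cases hs : ‖s • v‖ + 2 * |y (t + s • v)| < η
    swap
    · exact ⟨0, by simp, fun h => absurd h hs⟩
    set a := y (t + s • v) with haa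
    have hmem : ∀ σ ∈ Icc (-(2 * |a|)) (2 * |a|), t + s • v + σ • nv m κ ∈ ball (0 : CS m) ρ := by
      intro σ hσ
      apply hηb
      rw [mem_ball_iff_norm]
      have e1 : t + s • v + σ • nv m κ - t = s • v + σ • nv m κ := by abel
      rw [e1]
      have : ‖σ • nv m κ‖ ≤ 2 * |a| := by
        rw [norm_smul, norm_nv h.kn, mul_one]; exact abs_le.2 hσ
      linarith [norm_add_le (s • v) (σ • nv m κ)]
    have h0 : t + s • v ∈ ball (0 : CS m) ρ := by
      simpa using hmem 0 ⟨by linarith [abs_nonneg a], by linarith [abs_nonneg a]⟩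
    have hc : ContinuousOn (fun σ : ℝ => y (t + s • v + σ • nv m κ)) (Icc (-(2 * |a|)) (2 * |a|)) :=
      h.y_cont.comp (by fun_prop) fun σ hσ => hsub (hmem σ hσ)
    have hle : -(2 * |a|) ≤ 2 * |a| := by linarith [abs_nonneg a]
    have hd1 := hdir _ h0 _ (hmem _ (left_mem_Icc.2 hle))
    have hd2 := hdir _ h0 _ (hmem _ (right_mem_Icc.2 hle))
    rw [abs_le] at hd1 hd2
    have e2 : abs (-(2 * |a|)) = 2 * |a| := by rw [abs_neg, abs_of_nonneg (by positivity)]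
    have e3 : abs (2 * |a|) = 2 * |a| := abs_of_nonneg (by positivity)
    rw [e2] at hd1
    rw [e3] at hd2
    obtain ⟨σ, hσ, hσ0⟩ := intermediate_value_Icc hle hc (show (0 : ℝ) ∈ Icc _ _ from
      ⟨by linarith [hd1.2, neg_abs_le a, le_abs_self a], by linarith [hd2.1, neg_abs_le a, le_abs_self a]⟩)
    exact ⟨σ, abs_le.2 hσ, fun _ => hσ0⟩
  choose σ hσ1 hσ2 using hex
  have hσd : HasDerivAt σ 0 0 := by
    rw [hasDerivAt_iff_isLittleO_nhds_zero] at ha ⊢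
    have hσ0 : σ 0 = 0 := by
      have := hσ1 0
      simp only [zero_smul, add_zero, hyt, abs_zero, mul_zero] at this
      exact abs_eq_zero.1 (le_antisymm this (abs_nonneg _))
    simp only [hσ0, zero_add, zero_smul, add_zero, hyt, sub_zero, smul_zero] at ha ⊢
    refine (Asymptotics.IsBigO.of_bound 2 (Eventually.of_forall fun s => ?_)).trans_isLittleO ha
    simpa using hσ1 s
  have hσ0 : σ 0 = 0 := by
    have := hσ1 0
    simp only [zero_smul, add_zero, hyt, abs_zero, mul_zero] at this
    exact abs_eq_zero.1 (le_antisymm this (abs_nonneg _))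
  have hcurve : HasDerivAt (fun s : ℝ => t + s • v + σ s • nv m κ) v 0 := by
    have := hline.fun_add (hσd.smul_const (nv m κ))
    rwa [zero_smul, add_zero] at this
  have hcz : t + (0 : ℝ) • v + σ 0 • nv m κ = t := by simp [hσ0]
  refine ⟨fun s : ℝ => t + s • v + σ s • nv m κ, hcz, hcurve, ?_⟩
  have hc1 : Tendsto (fun s : ℝ => t + s • v + σ s • nv m κ) (𝓝 0) (𝓝 t) := by
    have := hcurve.continuousAt.tendsto
    rwa [hcz] at this
  have hc2 : Tendsto (fun s : ℝ => ‖s • v‖ + 2 * |y (t + s • v)|) (𝓝 0) (𝓝 0) := by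
    have h1 : Tendsto (fun s : ℝ => ‖s • v‖) (𝓝 0) (𝓝 0) := by
      have : ContinuousAt (fun s : ℝ => ‖s • v‖) 0 := by fun_prop
      simpa using this.tendsto
    have h2 := ha.continuousAt.abs.tendsto
    simp only [zero_smul, add_zero, hyt, abs_zero] at h2
    simpa using h1.add (h2.const_mul 2)
  filter_upwards [hc1.eventually (isOpen_ball.mem_nhds (hsub ht)),
    hc2.eventually (gt_mem_nhds hη)] with s h2 h3
  exact ⟨(h.memy _ h2).2 (hσ2 s h3), hσ2 s h3⟩

theorem IsSet.tangent (h : IsSet M Q r κ) {ρ : ℝ} (hρr : ρ ≤ r)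
    (hdir : ∀ t ∈ ball (0 : CS m) ρ, ∀ s : ℝ, t + s • nv m κ ∈ ball (0 : CS m) ρ →
      |yf Q κ (t + s • nv m κ) - yf Q κ t - s| ≤ 1 / 2 * |s|)
    {t : CS m} (ht : t ∈ ball (0 : CS m) ρ) (hyt : yf Q κ t = 0) {v : CS m}
    (hv : fderiv ℝ (yf Q κ) t v = 0) : TangentAt M t v := by
  intro u hu huM
  obtain ⟨c, hc0, hc, hcM⟩ := h.curve hρr hdir ht hyt hv
  have h1 : HasFDerivAt u (fderiv ℝ u t) (c 0) := by rw [hc0]; exact hu.hasFDerivAt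
  have h2 := h1.comp_hasDerivAt (0 : ℝ) hc
  have hct := hc.continuousAt.tendsto
  rw [hc0] at hct
  have h3 : HasDerivAt (u ∘ c) 0 0 :=
    (hasDerivAt_const (0 : ℝ) (0 : ℝ)).congr_of_eventuallyEq (by
      filter_upwards [hct.eventually huM, hcM] with s h1 h2 using h1 h2.1)
  exact h2.unique h3

theorem anti_real_zero {E : Type*} [NormedAddCommGroup E] [NormedSpace ℂ E] {y : E → ℝ} {t v : E} (hy : DifferentiableAt ℝ y t) :
    antiCDeriv (fun t => (y t : ℂ)) t v = ((fderiv ℝ y t v : ℂ) + I * (fderiv ℝ y t (I • v) : ℂ)) / 2 := by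
  have : HasFDerivAt (fun t => (y t : ℂ)) (Complex.ofRealCLM.comp (fderiv ℝ y t)) t :=
    Complex.ofRealCLM.hasFDerivAt.comp t hy.hasFDerivAt
  rw [antiCDeriv, this.fderiv]; rfl

theorem anti_real_zero_iff {E : Type*} [NormedAddCommGroup E] [NormedSpace ℂ E] {y : E → ℝ} {t v : E} (hy : DifferentiableAt ℝ y t) :
    antiCDeriv (fun t => (y t : ℂ)) t v = 0 ↔ fderiv ℝ y t v = 0 ∧ fderiv ℝ y t (I • v) = 0 := by
  rw [anti_real_zero hy, Complex.ext_iff]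
  simp

/-- one-sided extension data -/
def OneSide (y : CS m → ℝ) (δ : ℝ) (f H : CS m → ℂ) : Prop :=
  DifferentiableOn ℂ H (ball 0 δ ∩ {t | 0 < y t}) ∧ ∀ j : ℕ, ∃ Hj : CS m → ℂ,
      ContDiffOn ℝ j Hj (ball 0 δ) ∧ (∀ t ∈ ball (0 : CS m) δ, 0 < y t → Hj t = H t) ∧
      ∀ t ∈ ball (0 : CS m) δ, y t = 0 → Hj t = f t

theorem IsSet.anti_e0 (h : IsSet M Q r κ) : ∃ δ > 0, δ ≤ r ∧ ∀ t ∈ ball (0 : CS m) δ,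
    antiCDeriv (fun t => (yf Q κ t : ℂ)) t ((0, 1) : CS m) ≠ 0 := by
  have hS : Sm (ball (0 : CS m) r) (fun t => (yf Q κ t : ℂ)) := Complex.ofRealCLM.contDiff.comp_contDiffOn (h.y_smooth κ)
  have hc : ContinuousAt (fun t => antiCDeriv (fun t => (yf Q κ t : ℂ)) t ((0, 1) : CS m)) 0 :=
    ((hS.anti isOpen_ball (0, 1)).diffAt isOpen_ball (mem_ball_self h.r_pos)).continuousAt
  have h0 : antiCDeriv (fun t => (yf Q κ t : ℂ)) 0 ((0, 1) : CS m) ≠ 0 := by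
    obtain ⟨y', hy', hy''⟩ := h.y_strict κ
    have hyz := IsQ.y_z h.kq hy''
    intro h0
    rw [anti_real_zero_iff hy'.hasFDerivAt.differentiableAt, hy'.hasFDerivAt.fderiv] at h0
    have e1 : I • ((0, 1) : CS m) = (0, I) := by simp
    rw [e1, hyz, hyz] at h0
    have : κ = 0 := by
      apply Complex.ext
      · simpa using h0.2
      · simpa using h0.1
    have hk := h.kn
    rw [this] at hk
    simp at hk
  obtain ⟨δ, hδ, hb⟩ := Metric.eventually_nhds_iff_ball.1 (hc.eventually_ne h0)
  exact ⟨min δ r, lt_min hδ h.r_pos, min_le_right _ _, fun t ht => hb t (ball_subset_ball (min_le_left _ _) ht)⟩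

theorem IsSet.one_sided_aux (h : IsSet M Q r κ) {ρ0 : ℝ} (hρ0 : 0 < ρ0) :
    ∃ δA > 0, ∀ A : ℂ → CS m, DifferentiableOn ℂ A (ball 0 2) → A 0 = 0 → (∀ ζ ∈ ball (0 : ℂ) 2, ‖A ζ‖ < δA) →
      (∀ ζ : ℂ, ‖ζ‖ = 1 → yf Q κ (A ζ) < 0) → ∃ δ > 0, δ ≤ r ∧ δ ≤ ρ0 ∧ ∀ f : CS m → ℂ, Sm (ball 0 ρ0) f →
      (∀ t ∈ M, t ∈ ball (0 : CS m) ρ0 → ∀ v, ComplexTangentAt M t v → antiCDeriv f t v = 0) →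
      ∃ H, OneSide (yf Q κ) δ f H := by
  obtain ⟨r1, hr1, hr1r, hdir⟩ := h.y_dir (η := 1 / 2) (by norm_num)
  obtain ⟨r2, hr2, hr2r, he0⟩ := h.anti_e0
  set ρ := min (min r1 r2) ρ0 with hρ
  have hρp : 0 < ρ := by positivity
  have hρr1 : ρ ≤ r1 := (min_le_left _ _).trans (min_le_left _ _)
  have hρr2 : ρ ≤ r2 := (min_le_left _ _).trans (min_le_right _ _)
  have hρρ0 : ρ ≤ ρ0 := min_le_right _ _
  have hρr : ρ ≤ r := hρr1.trans hr1r
  set y := yf Q κ with hy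
  set T := ρ / 8 with hT
  have hTp : 0 < T := by positivity
  have hsub := ball_subset_ball (x := (0 : CS m)) hρr
  have hyd : Sm (ball (0 : CS m) ρ) y := ContDiffOn.mono (h.y_smooth κ) hsub
  have hy0 : ContinuousAt y 0 := h.y_cont.continuousAt (ball_mem_nhds _ h.r_pos)
  have hev : ∀ᶠ t in 𝓝 (0 : CS m), y t < T / 2 := by
    refine hy0.eventually (gt_mem_nhds ?_)
    rw [hy, h.y_zero]; positivity
  obtain ⟨ρ2, hρ2, hb2⟩ := Metric.eventually_nhds_iff_ball.1 hev
  refine ⟨min (ρ / 8) (ρ2 / 2), by positivity, fun A hA hA0 hAn hAy => ?_⟩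
  have hAn1 : ∀ ζ ∈ ball (0 : ℂ) 2, ‖A ζ‖ < ρ / 8 := fun ζ hζ => (hAn ζ hζ).trans_le (min_le_left _ _)
  have hAn2 : ∀ ζ ∈ ball (0 : ℂ) 2, ‖A ζ‖ < ρ2 / 2 := fun ζ hζ => (hAn ζ hζ).trans_le (min_le_right _ _)
  have hev2 : ∀ᶠ t in 𝓝 (0 : CS m), ∀ ζ ∈ sphere (0 : ℂ) 1, y (t + A ζ) < 0 := by
    refine (isCompact_sphere (0 : ℂ) 1).eventually_forall_of_forall_eventually fun ζ hζ => ?_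
    have hζ1 : ‖ζ‖ = 1 := by simpa using hζ
    have hζ2 : ζ ∈ ball (0 : ℂ) 2 := by rw [mem_ball_zero_iff, hζ1]; norm_num
    have hAc : ContinuousAt A ζ := (hA.differentiableAt (isOpen_ball.mem_nhds hζ2)).continuousAt
    have hyc : ContinuousAt y ((0 : CS m) + A ζ) := by
      rw [zero_add]
      refine h.y_cont.continuousAt (isOpen_ball.mem_nhds (hsub ?_))
      rw [mem_ball_zero_iff]; linarith [hAn1 ζ hζ2]
    have : ContinuousAt (fun z : CS m × ℂ => y (z.1 + A z.2)) (0, ζ) :=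
      ContinuousAt.comp (g := y) (f := fun z : CS m × ℂ => z.1 + A z.2) hyc
        (continuousAt_fst.add (ContinuousAt.comp (f := Prod.snd) (g := A) hAc continuousAt_snd))
    refine this.eventually (gt_mem_nhds ?_)
    simpa using hAy ζ hζ1
  obtain ⟨δ1, hδ1, hb1⟩ := Metric.eventually_nhds_iff_ball.1 hev2
  set δ := min (min δ1 (ρ / 8)) (ρ2 / 2) with hδ
  have hδ1' : δ ≤ δ1 := (min_le_left _ _).trans (min_le_left _ _)
  have hδρ : δ ≤ ρ / 8 := (min_le_left _ _).trans (min_le_right _ _)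
  have hδ2 : δ ≤ ρ2 / 2 := min_le_right _ _
  refine ⟨δ, by positivity, by linarith, by linarith, fun f hf hCR => ?_⟩
  have hnn : ∀ s ∈ Icc (0 : ℝ) T, ‖(s : ℂ) • nv m κ‖ ≤ T := fun s hs => by
    rw [norm_smul, norm_nv h.kn, mul_one, Complex.norm_real, Real.norm_of_nonneg hs.1]; exact hs.2
  have hdir' : ∀ x : CS m, ∀ s ∈ Icc (0 : ℝ) T, ‖x‖ < ρ / 4 → y (x - (s : ℂ) • nv m κ) ≤ y x - s / 2 := by
    intro x s hs hx
    have e1 : x - (s : ℂ) • nv m κ = x + (-s) • nv m κ := by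
      rw [Complex.coe_smul, neg_smul, sub_eq_add_neg]
    have hm : x + (-s) • nv m κ ∈ ball (0 : CS m) r1 := by
      rw [← e1, mem_ball_zero_iff]
      linarith [norm_sub_le x ((s : ℂ) • nv m κ), hnn s hs]
    have := hdir x (by rw [mem_ball_zero_iff]; linarith) (-s) hm
    rw [abs_neg, abs_of_nonneg hs.1, abs_le] at this
    rw [e1]
    linarith [this.2]
  refine one_sided_core (U := ball 0 ρ) isOpen_ball hyd (e0 := (0, 1)) (fun t ht => he0 t (ball_subset_ball hρr2 ht))
    hA hA0 hTp (n := nv m κ) ?_ ?_ ?_ ?_ (ContDiffOn.mono hf (ball_subset_ball hρρ0)) ?_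
  · intro t ht s hs ζ hζ
    rw [mem_ball_zero_iff] at ht ⊢
    linarith [norm_add_le (t - (s : ℂ) • nv m κ) (A ζ), norm_sub_le t ((s : ℂ) • nv m κ), hnn s hs, hAn1 ζ hζ]
  · intro t ht s hs ζ hζ
    have hζ2 : ζ ∈ ball (0 : ℂ) 2 := by rw [mem_ball_zero_iff, hζ]; norm_num
    have e1 : t - (s : ℂ) • nv m κ + A ζ = t + A ζ - (s : ℂ) • nv m κ := by abel
    have h1 := hb1 t (ball_subset_ball hδ1' ht) ζ (by simpa using hζ)
    rw [mem_ball_zero_iff] at ht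
    rw [e1]
    linarith [hdir' (t + A ζ) s hs (by linarith [norm_add_le t (A ζ), hAn1 ζ hζ2]), hs.1]
  · intro t ht ζ hζ
    have hζ2 : ζ ∈ ball (0 : ℂ) 2 := by rw [mem_ball_zero_iff]; linarith
    have e1 : t - (T : ℂ) • nv m κ + A ζ = t + A ζ - (T : ℂ) • nv m κ := by abel
    rw [mem_ball_zero_iff] at ht
    rw [e1]
    have h1 := hb2 (t + A ζ) (by rw [mem_ball_zero_iff]; linarith [norm_add_le t (A ζ), hAn2 ζ hζ2])
    linarith [hdir' (t + A ζ) T ⟨hTp.le, le_rfl⟩ (by linarith [norm_add_le t (A ζ), hAn1 ζ hζ2])]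
  · intro t ht s hs
    rw [mem_ball_zero_iff] at ht
    exact hdir' t s hs (by linarith)
  · intro t ht hyt v hv
    have htr := hsub ht
    refine hCR t ((h.memy t htr).2 hyt) (ball_subset_ball hρρ0 ht) v ?_
    rw [anti_real_zero_iff (hyd.diffAt isOpen_ball ht)] at hv
    have hd2 : ∀ t ∈ ball (0 : CS m) ρ, ∀ s : ℝ, t + s • nv m κ ∈ ball (0 : CS m) ρ →
        |yf Q κ (t + s • nv m κ) - yf Q κ t - s| ≤ 1 / 2 * |s| := fun t ht s hs =>
      hdir t (ball_subset_ball hρr1 ht) s (ball_subset_ball hρr1 hs)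
    exact ⟨h.tangent hρr hd2 ht hyt hv.1, h.tangent hρr hd2 ht hyt hv.2⟩

theorem IsSet.one_sided (h : IsSet M Q r κ) (hmin : MinimalAt M 0) {ρ0 : ℝ} (hρ0 : 0 < ρ0) :
    ∃ κ' : ℂ, IsSet M Q r κ' ∧ ∃ δ > 0, δ ≤ r ∧ δ ≤ ρ0 ∧ ∀ f : CS m → ℂ, Sm (ball 0 ρ0) f →
      (∀ t ∈ M, t ∈ ball (0 : CS m) ρ0 → ∀ v, ComplexTangentAt M t v → antiCDeriv f t v = 0) →
      ∃ H, OneSide (yf Q κ') δ f H := by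
  obtain ⟨δA, hδA, h1⟩ := h.one_sided_aux hρ0
  obtain ⟨δA', hδA', h2⟩ := h.neg.one_sided_aux hρ0
  obtain ⟨A, hA, hA0, hAn, hsgn⟩ := h.disc hmin (δ := min δA δA') (lt_min hδA hδA')
  rcases hsgn with hs | hs
  · exact ⟨κ, h, h1 A hA hA0 (fun ζ hζ => (hAn ζ hζ).trans_le (min_le_left _ _)) hs⟩
  · exact ⟨-κ, h.neg, h2 A hA hA0 (fun ζ hζ => (hAn ζ hζ).trans_le (min_le_right _ _))
      (fun ζ hζ => by rw [yf_neg]; linarith [hs ζ hζ])⟩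

end OneSidedSet

end PartN

section RegTheory
variable {X F : Type*} [NormedAddCommGroup X] [NormedSpace ℂ X] [NormedAddCommGroup F] [NormedSpace ℂ F]

structure Dom (S Ω : Set X) : Prop where
  op : IsOpen Ω
  sub : Ω ⊆ S
  cl : S ⊆ closure Ω
  ud : UniqueDiffOn ℝ S

structure Reg (S Ω : Set X) (u : X → F) : Prop where
  sm : ContDiffOn ℝ (⊤ : ℕ∞) u S
  hol : DifferentiableOn ℂ u Ω

theorem Dom.nhds {S Ω : Set X} (hD : Dom S Ω) {x : X} (hx : x ∈ Ω) : S ∈ 𝓝 x :=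
  mem_of_superset (hD.op.mem_nhds hx) hD.sub

theorem Dom.fd {S Ω : Set X} (hD : Dom S Ω) {u : X → F} (hu : DifferentiableOn ℂ u Ω) {x : X} (hx : x ∈ Ω)
    (v : X) : fderivWithin ℝ u S x v = fderiv ℂ u x v := by
  rw [fderivWithin_of_mem_nhds (hD.nhds hx)]
  have h1 := ((hu x hx).differentiableAt (hD.op.mem_nhds hx)).hasFDerivAt.restrictScalars ℝ
  rw [h1.fderiv]; rfl

theorem Reg.diff {S Ω : Set X} {u : X → F} (h : Reg S Ω u) {x : X} (hx : x ∈ S) :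
    HasFDerivWithinAt u (fderivWithin ℝ u S x) S x :=
  ((h.sm x hx).differentiableWithinAt (by simp)).hasFDerivWithinAt

theorem Reg.fd_cont {S Ω : Set X} (hD : Dom S Ω) {u : X → F} (h : Reg S Ω u) :
    ContinuousOn (fderivWithin ℝ u S) S :=
  h.sm.continuousOn_fderivWithin hD.ud (by simp)

theorem Reg.cl {S Ω : Set X} (hD : Dom S Ω) {u : X → F} (h : Reg S Ω u) {x : X} (hx : x ∈ S) (v : X) :
    fderivWithin ℝ u S x (I • v) = I • fderivWithin ℝ u S x v := by
  have hc := h.fd_cont hD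
  have : EqOn (fun x => fderivWithin ℝ u S x (I • v)) (fun x => I • fderivWithin ℝ u S x v) S := by
    refine Set.EqOn.of_subset_closure (s := Ω) ?_ (hc.clm_apply continuousOn_const)
      ((hc.clm_apply continuousOn_const).const_smul I) hD.sub hD.cl
    intro x hx
    beta_reduce
    rw [hD.fd h.hol hx, hD.fd h.hol hx, map_smul]
  exact this hx

theorem Reg.dir [FiniteDimensional ℂ X] {S Ω : Set X} (hD : Dom S Ω) {u : X → ℂ} (h : Reg S Ω u) {b : X → X}
    (hb : Reg S Ω b) : Reg S Ω (fun x => fderivWithin ℝ u S x (b x)) := by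
  refine ⟨(h.sm.fderivWithin (m := (⊤ : ℕ∞)) hD.ud (by simp)).clm_apply hb.sm, ?_⟩
  have h1 : DifferentiableOn ℂ (fun x => fderiv ℂ u x (b x)) Ω := by
    have h2 := hol_contDiffOn hD.op 2 h.hol
    have h3 : ContDiffOn ℂ 1 (fderiv ℂ u) Ω := h2.fderiv_of_isOpen hD.op (by norm_num)
    exact (h3.differentiableOn (by norm_num)).clm_apply hb.hol
  exact h1.congr fun x hx => hD.fd h.hol hx _

theorem Dom.half [CompleteSpace X] {U : Set X} (hU : IsOpen U) {ψ : X → ℝ} (hψ : DifferentiableOn ℝ ψ U)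
    (h0 : ∀ x ∈ U, ψ x = 0 → ∃ v, fderiv ℝ ψ x v ≠ 0) :
    Dom {x | x ∈ U ∧ 0 ≤ ψ x} {x | x ∈ U ∧ 0 < ψ x} := by
  have hop : IsOpen {x | x ∈ U ∧ 0 < ψ x} := hψ.continuousOn.isOpen_inter_preimage hU isOpen_Ioi
  have hray : ∀ x ∈ U, ψ x = 0 → ∀ v, 0 < fderiv ℝ ψ x v →
      ∀ᶠ s : ℝ in 𝓝[>] 0, x + s • v ∈ {x | x ∈ U ∧ 0 < ψ x} := by
    intro x hx hx0 v hv
    have hd := ((hψ x hx).differentiableAt (hU.mem_nhds hx)).hasFDerivAt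
    have hl : HasDerivAt (fun s : ℝ => x + s • v) v 0 := by
      simpa using ((hasDerivAt_id (0 : ℝ)).smul_const v).const_add x
    have hd' : HasFDerivAt ψ (fderiv ℝ ψ x) (x + (0 : ℝ) • v) := by simpa using hd
    have hc := hd'.comp_hasDerivAt (0 : ℝ) hl
    have h1 : ∀ᶠ s : ℝ in 𝓝[>] 0, 0 < ψ (x + s • v) := by
      have := (hasDerivAt_iff_tendsto_slope.1 hc).eventually (lt_mem_nhds hv)
      have h2 := this.filter_mono (nhdsWithin_mono 0 (show Ioi (0 : ℝ) ⊆ {0}ᶜ from fun s hs => ne_of_gt hs))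
      filter_upwards [h2, self_mem_nhdsWithin] with s hs hs0
      simp only [slope_def_field, Function.comp, zero_smul, add_zero, hx0, sub_zero] at hs
      exact (div_pos_iff_of_pos_right hs0).1 hs
    have h2 : ∀ᶠ s : ℝ in 𝓝[>] 0, x + s • v ∈ U := by
      have : Tendsto (fun s : ℝ => x + s • v) (𝓝 0) (𝓝 x) := by
        simpa using hl.continuousAt.tendsto
      exact (this.eventually (hU.mem_nhds hx)).filter_mono nhdsWithin_le_nhds
    filter_upwards [h1, h2] with s a b using ⟨b, a⟩
  have hv0 : ∀ x ∈ U, ψ x = 0 → ∃ v, 0 < fderiv ℝ ψ x v := by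
    intro x hx hx0
    obtain ⟨v, hv⟩ := h0 x hx hx0
    rcases lt_or_gt_of_ne hv with h | h
    · exact ⟨-v, by rw [map_neg]; linarith⟩
    · exact ⟨v, h⟩
  have hcl : {x | x ∈ U ∧ 0 ≤ ψ x} ⊆ closure {x | x ∈ U ∧ 0 < ψ x} := by
    rintro x ⟨hx, hx0⟩
    rcases hx0.lt_or_eq with h | h
    · exact subset_closure ⟨hx, h⟩
    · obtain ⟨v, hv⟩ := hv0 x hx h.symm
      have hl : Tendsto (fun s : ℝ => x + s • v) (𝓝[>] 0) (𝓝 x) := by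
        have : ContinuousAt (fun s : ℝ => x + s • v) 0 := by fun_prop
        have := this.tendsto
        simp only [zero_smul, add_zero] at this
        exact this.mono_left nhdsWithin_le_nhds
      exact mem_closure_of_tendsto hl (hray x hx h.symm v hv)
  refine ⟨hop, fun x hx => ⟨hx.1, hx.2.le⟩, hcl, ?_⟩
  rintro x ⟨hx, hx0⟩
  rcases hx0.lt_or_eq with h | h
  · exact uniqueDiffWithinAt_of_mem_nhds (mem_of_superset (hop.mem_nhds ⟨hx, h⟩) fun x hx => ⟨hx.1, hx.2.le⟩)
  · have hmem : ∀ v, 0 < fderiv ℝ ψ x v → v ∈ tangentConeAt ℝ {x | x ∈ U ∧ 0 ≤ ψ x} x := by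
      intro v hv
      refine mem_tangentConeAt_of_seq (l := 𝓝[>] (0 : ℝ)) (c := fun s : ℝ => s⁻¹) (d := fun s : ℝ => s • v) ?_ ?_ ?_
      · have : ContinuousAt (fun s : ℝ => s • v) 0 := by fun_prop
        have := this.tendsto
        simp only [zero_smul] at this
        exact this.mono_left nhdsWithin_le_nhds
      · filter_upwards [hray x hx h.symm v hv] with s hs using ⟨hs.1, hs.2.le⟩
      · refine tendsto_const_nhds.congr' ?_
        filter_upwards [self_mem_nhdsWithin] with s hs
        rw [smul_smul, inv_mul_cancel₀ (ne_of_gt hs), one_smul]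
    refine ⟨?_, subset_closure ⟨hx, h.le⟩⟩
    have htop : Submodule.span ℝ (tangentConeAt ℝ {x | x ∈ U ∧ 0 ≤ ψ x} x) = ⊤ := by
      rw [eq_top_iff]
      intro v _
      obtain ⟨v0, hv0⟩ := hv0 x hx h.symm
      set k : ℝ := (|fderiv ℝ ψ x v| + 1) / fderiv ℝ ψ x v0 with hk
      have hk0 : 0 < k := by positivity
      have e : v = (v + k • v0) - k • v0 := by abel
      rw [e]
      refine Submodule.sub_mem _ (Submodule.subset_span (hmem _ ?_))
        (Submodule.smul_mem _ _ (Submodule.subset_span (hmem _ hv0)))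
      rw [map_add, map_smul, smul_eq_mul, hk, div_mul_cancel₀ _ hv0.ne']
      linarith [neg_abs_le (fderiv ℝ ψ x v)]
    rw [htop]
    exact dense_univ

theorem Dom.prod_univ {Y : Type*} [NormedAddCommGroup Y] [NormedSpace ℂ Y] {S Ω : Set X} (hD : Dom S Ω) :
    Dom ((univ : Set Y) ×ˢ S) ((univ : Set Y) ×ˢ Ω) := by
  refine ⟨isOpen_univ.prod hD.op, prod_mono le_rfl hD.sub, ?_, uniqueDiffOn_univ.prod hD.ud⟩
  rw [closure_prod_eq, closure_univ]
  exact prod_mono le_rfl hD.cl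

end RegTheory

section RPsec
variable {m : ℕ}

def SE (Q : (Fin m → ℂ) × CS m → ℂ) (κ : ℂ) (ρ : ℝ) : Set (CS m) := {t | t ∈ ball (0 : CS m) ρ ∧ 0 ≤ yf Q κ t}
def OE (Q : (Fin m → ℂ) × CS m → ℂ) (κ : ℂ) (ρ : ℝ) : Set (CS m) := {t | t ∈ ball (0 : CS m) ρ ∧ 0 < yf Q κ t}

/-- The reflection package. -/
structure RP (M : Set (CS m)) (Q : (Fin m → ℂ) × CS m → ℂ) (r : ℝ) (κ : ℂ)
    (Q' : (Fin m → ℂ) × CS m → ℂ) (r' : ℝ) (HH : CS m → CS m) : Prop extends IsSet M Q r κ where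
  dir : ∀ t ∈ ball (0 : CS m) r, ∀ s : ℝ, t + s • nv m κ ∈ ball (0 : CS m) r →
      |yf Q κ (t + s • nv m κ) - yf Q κ t - s| ≤ 1 / 2 * |s|
  dn : ∀ t ∈ ball (0 : CS m) r, fderiv ℝ (yf Q κ) t (nv m κ) ≠ 0
  reg : Reg (SE Q κ r) (OE Q κ r) HH
  H0 : HH 0 = 0
  r'_pos : 0 < r'
  hol' : DifferentiableOn ℂ Q' (ball 0 r')
  eq' : ∀ t ∈ ball (0 : CS m) r, yf Q κ t = 0 → starRingEnd ℂ (HH t).2 = Q' (conjW (HH t).1, HH t)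
  small : ∀ t ∈ SE Q κ r, ‖HH t‖ < r' / 4
  inj : ∀ v, fderiv ℝ (yf Q κ) 0 v = 0 → fderivWithin ℝ HH (SE Q κ r) 0 v = 0 → v = 0

variable {M : Set (CS m)} {Q : (Fin m → ℂ) × CS m → ℂ} {r : ℝ} {κ : ℂ}

theorem IsSet.dy_nv (h : IsSet M Q r κ) : fderiv ℝ (yf Q κ) 0 (nv m κ) = 1 := by
  obtain ⟨y', hy', hy''⟩ := h.y_strict κ
  rw [hy'.hasFDerivAt.fderiv, nv, IsQ.y_z h.kq hy'']
  have : κ * (I * starRingEnd ℂ κ) = I := by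
    have := conj_mul_of_norm_one h.kn
    linear_combination I * this
  rw [this, I_im]

theorem IsSet.dn (h : IsSet M Q r κ) : ∃ δ > 0, δ ≤ r ∧ ∀ t ∈ ball (0 : CS m) δ,
    fderiv ℝ (yf Q κ) t (nv m κ) ≠ 0 := by
  have hc : ContinuousAt (fun t => fderiv ℝ (yf Q κ) t (nv m κ)) 0 := by
    have h1 : ContDiffOn ℝ (⊤ : ℕ∞) (fderiv ℝ (yf Q κ)) (ball 0 r) :=
      (h.y_smooth κ).fderiv_of_isOpen isOpen_ball (by simp)
    exact (h1.continuousOn.clm_apply continuousOn_const).continuousAt (ball_mem_nhds _ h.r_pos)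
  have hev := hc.eventually_ne (by rw [h.dy_nv]; exact one_ne_zero)
  obtain ⟨δ, hδ, hb⟩ := Metric.eventually_nhds_iff_ball.1 hev
  exact ⟨min δ r, lt_min hδ h.r_pos, min_le_right _ _, fun t ht => hb t (ball_subset_ball (min_le_left _ _) ht)⟩

theorem SE_dom (h : IsSet M Q r κ) (hdn : ∀ t ∈ ball (0 : CS m) r, fderiv ℝ (yf Q κ) t (nv m κ) ≠ 0) :
    Dom (SE Q κ r) (OE Q κ r) :=
  Dom.half isOpen_ball ((h.y_smooth κ).differentiableOn (by simp)) fun x hx _ => ⟨_, hdn x hx⟩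

/-- Local smooth vector-valued extensions of a CR map. -/
theorem crmap_ext {M M' : Set (CS m)} {h : CS m → CS m} (hCR : IsCRMapOn (⊤ : ℕ∞) M M' h) {p : CS m} (hp : p ∈ M) :
    ∃ ρ > 0, ∃ g : CS m → CS m, Sm (ball p ρ) (fun t => (g t).2) ∧ (∀ i, Sm (ball p ρ) (fun t => (g t).1 i)) ∧
      (∀ t ∈ M, t ∈ ball p ρ → g t = h t) ∧
      ∀ t ∈ M, t ∈ ball p ρ → ∀ v, ComplexTangentAt M t v →
        antiCDeriv (fun t => (g t).2) t v = 0 ∧ ∀ i, antiCDeriv (fun t => (g t).1 i) t v = 0 := by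
  obtain ⟨U, gz, hU, hpU, h1, h2, h3⟩ := hCR.2 (ContinuousLinearMap.snd ℂ _ _) p hp
  have hw := fun i : Fin m => hCR.2 ((ContinuousLinearMap.proj (R := ℂ) (φ := fun _ : Fin m => ℂ) i).comp
    (ContinuousLinearMap.fst ℂ _ _)) p hp
  choose V gw hV hpV k1 k2 k3 using hw
  have ho : IsOpen (U ∩ ⋂ i, V i) := hU.inter (isOpen_iInter_of_finite hV)
  obtain ⟨ρ, hρ, hb⟩ := Metric.isOpen_iff.1 ho p ⟨hpU, mem_iInter.2 hpV⟩
  have hbU : ball p ρ ⊆ U := fun t ht => (hb ht).1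
  have hbV : ∀ i, ball p ρ ⊆ V i := fun i t ht => mem_iInter.1 (hb ht).2 i
  refine ⟨ρ, hρ, fun t => (fun i => gw i t, gz t), h1.mono hbU, fun i => (k1 i).mono (hbV i), ?_, ?_⟩
  · intro t ht htb
    refine Prod.ext (funext fun i => ?_) ?_
    · exact k2 i t ⟨ht, hbV i htb⟩
    · exact h2 t ⟨ht, hbU htb⟩
  · intro t ht htb v hv
    exact ⟨h3 t ⟨ht, hbU htb⟩ v hv, fun i => k3 i t ⟨ht, hbV i htb⟩ v hv⟩

theorem sm_pi {ρ : ℝ} {p : CS m} {g : CS m → CS m} {s : Set (CS m)} (h1 : ContDiffOn ℝ (⊤ : ℕ∞) (fun t => (g t).2) s)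
    (h2 : ∀ i, ContDiffOn ℝ (⊤ : ℕ∞) (fun t => (g t).1 i) s) : ContDiffOn ℝ (⊤ : ℕ∞) g s := by
  have : ContDiffOn ℝ (⊤ : ℕ∞) (fun t => (g t).1) s := contDiffOn_pi.2 h2
  exact this.prodMk h1

theorem oneSide_reg {y : CS m → ℝ} {δ : ℝ} {f H c : CS m → ℂ} (hO : OneSide y δ f H)
    (h1 : ∀ t ∈ ball (0 : CS m) δ, 0 < y t → c t = H t) (h2 : ∀ t ∈ ball (0 : CS m) δ, y t = 0 → c t = f t) :
    ContDiffOn ℝ (⊤ : ℕ∞) c {t | t ∈ ball (0 : CS m) δ ∧ 0 ≤ y t} ∧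
    DifferentiableOn ℂ c {t | t ∈ ball (0 : CS m) δ ∧ 0 < y t} := by
  constructor
  · rw [contDiffOn_infty]
    intro j
    obtain ⟨Hj, hj, hj1, hj2⟩ := hO.2 j
    refine (hj.mono fun t ht => ht.1).congr ?_
    rintro t ⟨ht, hy⟩
    rcases hy.lt_or_eq with hy | hy
    · rw [h1 t ht hy, hj1 t ht hy]
    · rw [h2 t ht hy.symm, hj2 t ht hy.symm]
  · exact hO.1.congr fun t ht => h1 t ht.1 ht.2

theorem exists_HH {M M' : Set (CS m)} (h : IsSet M Q r κ) (hmin : MinimalAt M 0) (h0M : (0 : CS m) ∈ M)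
    {hh : CS m → CS m} (hCR : IsCRMapOn (⊤ : ℕ∞) M M' hh) :
    ∃ κ', IsSet M Q r κ' ∧ ∃ δ > 0, δ ≤ r ∧ ∃ HH : CS m → CS m, Reg (SE Q κ' δ) (OE Q κ' δ) HH ∧
      ∀ t ∈ ball (0 : CS m) δ, yf Q κ' t = 0 → HH t = hh t := by
  obtain ⟨ρ0, hρ0, g, g1, g2, g3, g4⟩ := crmap_ext hCR h0M
  obtain ⟨κ', hs, δ, hδ, hδr, hδρ, hone⟩ := h.one_sided hmin hρ0
  obtain ⟨Hz, hz⟩ := hone _ g1 fun t ht htb v hv => (g4 t ht htb v hv).1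
  have hw := fun i => hone _ (g2 i) fun t ht htb v hv => (g4 t ht htb v hv).2 i
  choose Hw hw using hw
  set y := yf Q κ' with hy
  set HH : CS m → CS m := fun t => if 0 < y t then (fun i => Hw i t, Hz t) else hh t with hHH
  have hM : ∀ t ∈ ball (0 : CS m) δ, y t = 0 → HH t = g t := by
    intro t ht hyt
    have htM : t ∈ M := (hs.memy t (ball_subset_ball hδr ht)).2 hyt
    rw [g3 t htM (ball_subset_ball hδρ ht)]
    simp [hHH, hyt]
  refine ⟨κ', hs, δ, hδ, hδr, HH, ?_, ?_⟩
  · have c1 := oneSide_reg (c := fun t => (HH t).2) hz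
      (fun t ht hyt => by simp [hHH, hyt]) (fun t ht hyt => by beta_reduce; rw [hM t ht hyt])
    have c2 := fun i => oneSide_reg (c := fun t => (HH t).1 i) (hw i)
      (fun t ht hyt => by simp [hHH, hyt]) (fun t ht hyt => by beta_reduce; rw [hM t ht hyt])
    refine ⟨sm_pi (ρ := 0) (p := 0) c1.1 fun i => (c2 i).1, ?_⟩
    have : DifferentiableOn ℂ (fun t => (HH t).1) {t | t ∈ ball (0 : CS m) δ ∧ 0 < y t} :=
      differentiableOn_pi.2 fun i => (c2 i).2
    exact this.prodMk c1.2
  · intro t ht hyt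
    have : ¬ (0 < y t) := by rw [hy, hyt]; exact lt_irrefl _
    simp only [hHH, if_neg this]

theorem zero_mem_SE (h : IsSet M Q r κ) : (0 : CS m) ∈ SE Q κ r :=
  ⟨mem_ball_self h.r_pos, h.y_zero.ge⟩

theorem exists_RP {M M' : Set (CS m)} (h : IsSet M Q r κ) (hmin : MinimalAt M 0) (h0M : (0 : CS m) ∈ M)
    {hh : CS m → CS m} (hCR : IsCRDiffeoOn (⊤ : ℕ∞) M M' hh) (h00 : hh 0 = 0)
    {Q' : (Fin m → ℂ) × CS m → ℂ} {r' : ℝ} (hQ' : IsQ M' Q' r') :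
    ∃ κ' δ HH, δ ≤ r ∧ RP M Q δ κ' Q' r' HH ∧ ∀ t ∈ ball (0 : CS m) δ, yf Q κ' t = 0 → HH t = hh t := by
  obtain ⟨κ', hs, δ1, hδ1, hδ1r, HH, hreg, hHM⟩ := exists_HH h hmin h0M hCR.1
  obtain ⟨δ2, hδ2, hδ2r, hdir⟩ := hs.y_dir (η := 1 / 2) (by norm_num)
  obtain ⟨δ3, hδ3, hδ3r, hdn⟩ := hs.dn
  have hr' := hQ'.r_pos
  have hH0 : HH 0 = 0 := by rw [hHM 0 (mem_ball_self hδ1) hs.y_zero, h00]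
  have hHc : ContinuousWithinAt HH (SE Q κ' δ1) 0 :=
    hreg.sm.continuousOn 0 ⟨mem_ball_self hδ1, hs.y_zero.ge⟩
  have hsm : ∀ᶠ t in 𝓝[SE Q κ' δ1] 0, ‖HH t‖ < r' / 4 := by
    have := hHc.norm.eventually_lt (continuousWithinAt_const (b := r' / 4)) (by beta_reduce; rw [hH0, norm_zero]; positivity)
    exact this
  obtain ⟨δ4, hδ4, hb4⟩ := Metric.mem_nhdsWithin_iff.1 hsm
  set δ := min (min δ1 δ2) (min δ3 δ4) with hδ
  have hδp : 0 < δ := by positivity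
  have l1 : δ ≤ δ1 := (min_le_left _ _).trans (min_le_left _ _)
  have l2 : δ ≤ δ2 := (min_le_left _ _).trans (min_le_right _ _)
  have l3 : δ ≤ δ3 := (min_le_right _ _).trans (min_le_left _ _)
  have l4 : δ ≤ δ4 := (min_le_right _ _).trans (min_le_right _ _)
  have hs' := hs.mono hδp (l1.trans hδ1r)
  have b1 := ball_subset_ball (x := (0 : CS m)) l1
  have hreg' : Reg (SE Q κ' δ) (OE Q κ' δ) HH :=
    ⟨hreg.sm.mono fun t ht => ⟨b1 ht.1, ht.2⟩, hreg.hol.mono fun t ht => ⟨b1 ht.1, ht.2⟩⟩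
  have hdir' : ∀ t ∈ ball (0 : CS m) δ, ∀ s : ℝ, t + s • nv m κ' ∈ ball (0 : CS m) δ →
      |yf Q κ' (t + s • nv m κ') - yf Q κ' t - s| ≤ 1 / 2 * |s| := fun t ht s hts =>
    hdir t (ball_subset_ball l2 ht) s (ball_subset_ball l2 hts)
  have hsm4 : ∀ t ∈ SE Q κ' δ, ‖HH t‖ < r' / 4 := fun t ht =>
    hb4 ⟨ball_subset_ball l4 ht.1, ⟨b1 ht.1, ht.2⟩⟩
  refine ⟨κ', δ, HH, l1.trans hδ1r, ⟨hs', hdir', fun t ht => hdn t (ball_subset_ball l3 ht),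
    hreg', hH0, hr', hQ'.hol, ?_, hsm4, ?_⟩, fun t ht => hHM t (b1 ht)⟩
  · intro t ht hyt
    have h1 := hsm4 t ⟨ht, hyt.ge⟩
    rw [hHM t (b1 ht) hyt] at h1 ⊢
    have htM : t ∈ M := (hs'.memy t ht).2 hyt
    exact (hQ'.mem _ (mem_ball_zero_iff.2 (by linarith))).1 (hCR.1.1 htM)
  · intro v hv hL
    obtain ⟨g, hg, hgh⟩ := hCR.2.2
    have h0M' : (0 : CS m) ∈ M' := h00 ▸ hCR.1.1 h0M
    obtain ⟨ρ0, hρ0, gt, g1, g2, g3, -⟩ := crmap_ext hg h0M'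
    have hgs := sm_pi (ρ := 0) (p := 0) (s := ball (0 : CS m) ρ0) g1 g2
    have hgd : DifferentiableAt ℝ gt 0 :=
      (hgs.differentiableOn (by simp)).differentiableAt (ball_mem_nhds _ hρ0)
    obtain ⟨c, hc0, hc, hcM⟩ := hs'.curve le_rfl hdir' (mem_ball_self hδp) hs'.y_zero hv
    have hct := hc.continuousAt.tendsto
    rw [hc0] at hct
    have hcS : ∀ᶠ s in 𝓝 (0 : ℝ), c s ∈ SE Q κ' δ := by
      filter_upwards [hcM, hct.eventually (ball_mem_nhds _ hδp)] with s h1 h2 using ⟨h2, h1.2.ge⟩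
    have hHd : HasFDerivWithinAt HH (fderivWithin ℝ HH (SE Q κ' δ) 0) (SE Q κ' δ) (c 0) := by
      rw [hc0]; exact hreg'.diff (zero_mem_SE hs')
    have hHc := hHd.comp_hasDerivAt (0 : ℝ) hc hcS
    rw [hL] at hHc
    have hH0c : (HH ∘ c) 0 = 0 := by simp [hc0, hH0]
    have hgd' : HasFDerivAt gt (fderiv ℝ gt 0) ((HH ∘ c) 0) := by rw [hH0c]; exact hgd.hasFDerivAt
    have hfin := hgd'.comp_hasDerivAt (0 : ℝ) hHc
    rw [map_zero] at hfin
    have hHt := hHc.continuousAt.tendsto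
    rw [hH0c] at hHt
    have heq : gt ∘ (HH ∘ c) =ᶠ[𝓝 0] c := by
      filter_upwards [hcM, hct.eventually (ball_mem_nhds _ hδp), hHt.eventually (ball_mem_nhds _ hρ0)]
        with s h1 h2 h3
      simp only [Function.comp] at h3 ⊢
      rw [hHM _ (b1 h2) h1.2] at h3 ⊢
      rw [g3 _ (hCR.1.1 h1.1) h3, hgh _ h1.1]
    exact hc.unique (hfin.congr_of_eventuallyEq heq.symm)

end RPsec

section PQsec
variable {m : ℕ} {M : Set (CS m)} {Q : (Fin m → ℂ) × CS m → ℂ} {r : ℝ} {κ : ℂ}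
  {Q' : (Fin m → ℂ) × CS m → ℂ} {r' : ℝ} {HH : CS m → CS m}

theorem RP.tang (h : RP M Q r κ Q' r' HH) {t : CS m} (ht : t ∈ ball (0 : CS m) r) (hy : yf Q κ t = 0) {v : CS m}
    (hv : fderiv ℝ (yf Q κ) t v = 0) {f : CS m → ℂ} {f' : CS m →L[ℝ] ℂ}
    (hf : HasFDerivWithinAt f f' (SE Q κ r) t) (h0 : ∀ᶠ s in 𝓝 t, yf Q κ s = 0 → f s = 0) : f' v = 0 := by
  obtain ⟨c, hc0, hc, hcM⟩ := h.toIsSet.curve le_rfl h.dir ht hy hv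
  have hct := hc.continuousAt.tendsto
  rw [hc0] at hct
  have hcS : ∀ᶠ s in 𝓝 (0 : ℝ), c s ∈ SE Q κ r := by
    filter_upwards [hcM, hct.eventually (isOpen_ball.mem_nhds ht)] with s h1 h2 using ⟨h2, h1.2.ge⟩
  have hf2 : HasFDerivWithinAt f f' (SE Q κ r) (c 0) := by rw [hc0]; exact hf
  have h1 := hf2.comp_hasDerivAt (0 : ℝ) hc hcS
  have h3 : HasDerivAt (f ∘ c) 0 0 :=
    (hasDerivAt_const (0 : ℝ) (0 : ℂ)).congr_of_eventuallyEq (by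
      filter_upwards [hct.eventually h0, hcM] with s h1 h2 using h1 h2.2)
  exact h1.unique h3

def conjCSL (m : ℕ) : CS m →L[ℝ] CS m := (conjWL m).prodMap (conjCLE : ℂ →L[ℝ] ℂ)

theorem conjCSL_apply (t : CS m) : conjCSL m t = (conjW t.1, starRingEnd ℂ t.2) := rfl

theorem conjCSL_I (v : CS m) : conjCSL m (I • v) = -(I • conjCSL m v) := by
  refine Prod.ext (funext fun i => ?_) ?_
  · simp [conjCSL_apply, conjW]
  · simp [conjCSL_apply]

def kf (Q : (Fin m → ℂ) × CS m → ℂ) (x : (Fin m → ℂ) × CS m) : CS m := (x.1, Q x)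
def pf (Q : (Fin m → ℂ) × CS m → ℂ) (x : (Fin m → ℂ) × CS m) : CS m := (conjW x.1, starRingEnd ℂ (Q x))
theorem pf_eq (x : (Fin m → ℂ) × CS m) : pf Q x = conjCSL m (kf Q x) := rfl

def psf (Q : (Fin m → ℂ) × CS m → ℂ) (κ : ℂ) (x : (Fin m → ℂ) × CS m) : ℝ := yf Q κ (pf Q x)
def SP (Q : (Fin m → ℂ) × CS m → ℂ) (κ : ℂ) (ρ : ℝ) : Set ((Fin m → ℂ) × CS m) :=
  {x | x ∈ ball (0 : (Fin m → ℂ) × CS m) ρ ∧ 0 ≤ psf Q κ x}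
def OP (Q : (Fin m → ℂ) × CS m → ℂ) (κ : ℂ) (ρ : ℝ) : Set ((Fin m → ℂ) × CS m) :=
  {x | x ∈ ball (0 : (Fin m → ℂ) × CS m) ρ ∧ 0 < psf Q κ x}
def Gf (Q : (Fin m → ℂ) × CS m → ℂ) (HH : CS m → CS m) (x : (Fin m → ℂ) × CS m) : Fin m → ℂ :=
  conjW (HH (pf Q x)).1
def S0f (Q : (Fin m → ℂ) × CS m → ℂ) (HH : CS m → CS m) (x : (Fin m → ℂ) × CS m) : ℂ :=
  starRingEnd ℂ (HH (pf Q x)).2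

theorem IsQ.kf_hol (h : IsQ M Q r) : DifferentiableOn ℂ (kf Q) (ball 0 r) :=
  differentiableOn_fst.prodMk h.hol

theorem IsQ.pf_smooth (h : IsQ M Q r) : ContDiffOn ℝ (⊤ : ℕ∞) (pf Q) (ball 0 r) := by
  have h1 : ContDiffOn ℝ (⊤ : ℕ∞) (kf Q) (ball 0 r) := contDiffOn_fst.prodMk h.smooth
  exact (conjCSL m).contDiff.comp_contDiffOn h1

theorem IsQ.pf_zero (h : IsQ M Q r) : pf Q 0 = 0 := by
  rw [pf, h.zero]; simp [conjW_zero]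

theorem IsQ.pf_deriv (h : IsQ M Q r) : HasFDerivAt (pf Q)
    ((conjCSL m).comp (((ContinuousLinearMap.fst ℂ _ _).prod (fderiv ℂ Q 0)).restrictScalars ℝ)) 0 := by
  have h1 : HasFDerivAt Q (fderiv ℂ Q 0) 0 := (h.hol.differentiableAt (ball_mem_nhds _ h.r_pos)).hasFDerivAt
  have h2 : HasFDerivAt (kf Q) ((ContinuousLinearMap.fst ℂ _ _).prod (fderiv ℂ Q 0)) 0 :=
    hasFDerivAt_fst.prodMk h1
  exact (conjCSL m).hasFDerivAt.comp 0 (h2.restrictScalars ℝ)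

theorem IsSet.psf_deriv_ne (h : IsSet M Q r κ) : fderiv ℝ (psf Q κ) 0 (0, -nv m κ) ≠ 0 := by
  obtain ⟨y', hy', hy''⟩ := h.y_strict κ
  have h1 : HasFDerivAt (yf Q κ) y' (pf Q 0) := by rw [h.pf_zero]; exact hy'.hasFDerivAt
  have h2 := h1.comp 0 h.pf_deriv
  have h3 : fderiv ℝ (psf Q κ) 0 = _ := h2.fderiv
  rw [h3]
  have e : fderiv ℂ Q 0 (0, -nv m κ) = -(I * starRingEnd ℂ κ) * Qz Q := by
    have : ((0, -nv m κ) : (Fin m → ℂ) × CS m) = (-(I * starRingEnd ℂ κ)) • ((0, (0, 1)) : (Fin m → ℂ) × CS m) := by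
      simp [nv]
    rw [this, map_smul, Qz, smul_eq_mul]
  simp only [ContinuousLinearMap.coe_comp, Function.comp_apply, ContinuousLinearMap.coe_restrictScalars',
    ContinuousLinearMap.prod_apply, ContinuousLinearMap.coe_fst', conjCSL_apply, e, conjW_zero]
  rw [IsQ.y_z h.kq hy'']
  have e2 : κ * starRingEnd ℂ (-(I * starRingEnd ℂ κ) * Qz Q) = I := by
    have e3 : -(I * starRingEnd ℂ κ) * Qz Q = -(I * κ) := by linear_combination (-I) * h.kq
    rw [e3]
    have := conj_mul_of_norm_one h.kn
    simp only [map_neg, map_mul, conj_I]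
    linear_combination I * this
  rw [e2, I_im]; exact one_ne_zero

theorem RP.Q'_deriv (h : RP M Q r κ Q' r' HH) {x : (Fin m → ℂ) × CS m} (hx : x ∈ ball (0 : (Fin m → ℂ) × CS m) r') :
    HasFDerivAt Q' (fderiv ℂ Q' x) x := (h.hol'.differentiableAt (isOpen_ball.mem_nhds hx)).hasFDerivAt

theorem RP.domE (h : RP M Q r κ Q' r' HH) : Dom (SE Q κ r) (OE Q κ r) := SE_dom h.toIsSet h.dn

theorem RP.HM_deriv (h : RP M Q r κ Q' r' HH) {v : CS m} (hv : fderiv ℝ (yf Q κ) 0 v = 0) :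
    let u := fderivWithin ℝ HH (SE Q κ r) 0 v
    starRingEnd ℂ u.2 = fderiv ℂ Q' 0 (conjW u.1, u) := by
  intro u
  have h0 := zero_mem_SE h.toIsSet
  have hd := h.reg.diff h0
  have hq : HasFDerivAt Q' (fderiv ℂ Q' 0) (ctL m (HH 0)) := by
    rw [h.H0, map_zero]; exact h.Q'_deriv (mem_ball_self h.r'_pos)
  have h1 := (hq.restrictScalars ℝ).comp_hasFDerivWithinAt 0 ((ctL m).hasFDerivAt.comp_hasFDerivWithinAt 0 hd)
  have h2 := ((conjCLE : ℂ →L[ℝ] ℂ).comp (ContinuousLinearMap.snd ℝ (Fin m → ℂ) ℂ)).hasFDerivAt.comp_hasFDerivWithinAt 0 hd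
  have h3 := h.tang (mem_ball_self h.r_pos) h.y_zero hv (h2.sub h1) (by
    filter_upwards [ball_mem_nhds _ h.r_pos] with s hs hys
    have := h.eq' s hs hys
    simp only [Pi.sub_apply, Function.comp, ContinuousLinearMap.coe_comp, ContinuousLinearMap.coe_snd', ctL_apply]
    rw [← this]; simp)
  simp only [sub_apply, ContinuousLinearMap.coe_comp, Function.comp_apply, ContinuousLinearMap.coe_snd', ctL_apply,
    ContinuousLinearMap.coe_restrictScalars', ContinuousLinearEquiv.coe_coe, conjCLE_apply] at h3
  exact sub_eq_zero.1 h3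

theorem RP.HM_derivC (h : RP M Q r κ Q' r' HH) {v : CS m} (hv : fderiv ℝ (yf Q κ) 0 v = 0)
    (hv2 : fderiv ℝ (yf Q κ) 0 (I • v) = 0) :
    let u := fderivWithin ℝ HH (SE Q κ r) 0 v
    starRingEnd ℂ u.2 = fderiv ℂ Q' 0 (conjW u.1, 0) := by
  intro u
  have h1 := h.HM_deriv hv
  have h2 := h.HM_deriv hv2
  simp only [h.reg.cl h.domE (zero_mem_SE h.toIsSet)] at h1 h2
  have e1 : ((conjW u.1, u) : (Fin m → ℂ) × CS m) = (conjW u.1, 0) + (0, u) := by simp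
  have e2 : ((conjW (I • u).1, I • u) : (Fin m → ℂ) × CS m) = (-I) • (conjW u.1, 0) + I • (0, u) := by
    refine Prod.ext (funext fun i => ?_) ?_
    · simp [conjW]
    · simp
  change starRingEnd ℂ u.2 = fderiv ℂ Q' 0 (conjW u.1, u) at h1
  change starRingEnd ℂ (I • u).2 = fderiv ℂ Q' 0 (conjW (I • u).1, I • u) at h2
  rw [e1, map_add] at h1
  rw [e2, map_add, map_smul, map_smul] at h2
  simp only [Prod.smul_snd, smul_eq_mul, map_mul, conj_I] at h2
  linear_combination (1 / 2) * h1 + (I / 2) * h2 - (-(1/2) * (starRingEnd ℂ u.2) + (1/2) * fderiv ℂ Q' 0 (conjW u.1, 0) - 1 / 2 * fderiv ℂ Q' 0 (0, u)) * I_sq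

theorem IsSet.segre_deriv (h : IsSet M Q r κ) (w : Fin m → ℂ) :
    fderiv ℂ Q 0 (0, (conjW w, starRingEnd ℂ (fderiv ℂ Q 0 (w, 0)))) = 0 := by
  obtain ⟨δ, hδ, hδr, hs⟩ := h.segre
  have hQ : HasFDerivAt Q (fderiv ℂ Q 0) 0 := (h.hol.differentiableAt (ball_mem_nhds _ h.r_pos)).hasFDerivAt
  set a := fderiv ℂ Q 0 (w, 0) with ha
  have hl : HasDerivAt (fun s : ℝ => ((s • w, 0) : (Fin m → ℂ) × CS m)) (w, 0) 0 := by
    have := (hasDerivAt_id (0 : ℝ)).smul_const ((w, 0) : (Fin m → ℂ) × CS m)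
    simpa using this
  have hQ1 : HasFDerivAt Q ((fderiv ℂ Q 0).restrictScalars ℝ) ((fun s : ℝ => ((s • w, 0) : (Fin m → ℂ) × CS m)) 0) := by
    have e : (fun s : ℝ => ((s • w, 0) : (Fin m → ℂ) × CS m)) 0 = 0 := by simp
    rw [e]; exact hQ.restrictScalars ℝ
  have h1 := hQ1.comp_hasDerivAt (0 : ℝ) hl
  have h2 := (conjCLE : ℂ →L[ℝ] ℂ).hasFDerivAt.comp_hasDerivAt (0 : ℝ) h1
  have h3 : HasDerivAt (fun s : ℝ => ((0, (s • conjW w, starRingEnd ℂ (Q (s • w, 0)))) : (Fin m → ℂ) × CS m))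
      (0, (conjW w, starRingEnd ℂ a)) 0 := by
    refine (hasDerivAt_const _ _).prodMk (HasDerivAt.prodMk ?_ h2)
    have := (hasDerivAt_id (0 : ℝ)).smul_const (conjW w)
    simpa using this
  have hQ2 : HasFDerivAt Q ((fderiv ℂ Q 0).restrictScalars ℝ)
      ((fun s : ℝ => ((0, (s • conjW w, starRingEnd ℂ (Q (s • w, 0)))) : (Fin m → ℂ) × CS m)) 0) := by
    have e : ((0, (0, starRingEnd ℂ (Q ((0 : Fin m → ℂ), (0 : CS m))))) : (Fin m → ℂ) × CS m) = 0 := by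
      rw [show ((0, 0) : (Fin m → ℂ) × CS m) = 0 from rfl, h.zero]; simp
    simp only [zero_smul]
    rw [e]; exact hQ.restrictScalars ℝ
  have h4 := hQ2.comp_hasDerivAt (0 : ℝ) h3
  have h5 : HasDerivAt (Q ∘ fun s : ℝ => ((0, (s • conjW w, starRingEnd ℂ (Q (s • w, 0)))) : (Fin m → ℂ) × CS m)) 0 0 := by
    refine (hasDerivAt_const (0 : ℝ) (0 : ℂ)).congr_of_eventuallyEq ?_
    have hc : ContinuousAt (fun s : ℝ => s • conjW w) 0 := by fun_prop
    have := hc.tendsto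
    rw [zero_smul] at this
    filter_upwards [this.eventually (ball_mem_nhds _ hδ)] with s hs'
    have h6 := (hs _ (mem_ball_zero_iff.1 hs')).2
    have e : h0f Q (s • conjW w) = starRingEnd ℂ (Q (s • w, 0)) := by
      rw [h0f]; congr 3
      ext i; simp [conjW]
    rw [e] at h6
    exact h6
  exact h4.unique h5

def Vv (Q : (Fin m → ℂ) × CS m → ℂ) (w : Fin m → ℂ) : CS m := (conjW w, starRingEnd ℂ (fderiv ℂ Q 0 (w, 0)))

theorem IsSet.Vv_tan (h : IsSet M Q r κ) (w : Fin m → ℂ) : fderiv ℝ (yf Q κ) 0 (Vv Q w) = 0 := by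
  obtain ⟨y', hy', hy''⟩ := h.y_strict κ
  have hs := h.segre_deriv w
  rw [hy'.hasFDerivAt.fderiv, hy'', Vv]
  set a := fderiv ℂ Q 0 (w, 0) with ha
  have e : ((conjW (conjW w), (conjW w, starRingEnd ℂ a)) : (Fin m → ℂ) × CS m) = (w, 0) + (0, (conjW w, starRingEnd ℂ a)) := by
    rw [conjW_conjW]; simp
  simp only
  rw [e, map_add, hs, ← ha, add_zero]
  have : κ * starRingEnd ℂ a + starRingEnd ℂ κ * a = ((2 * (κ * starRingEnd ℂ a).re : ℝ) : ℂ) := by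
    rw [← Complex.add_conj (κ * starRingEnd ℂ a)]; simp
  rw [this]
  simp

theorem Vv_I (w : Fin m → ℂ) : I • Vv Q w = Vv Q ((-I) • w) := by
  have e : (((-I) • w, 0) : (Fin m → ℂ) × CS m) = (-I) • (w, 0) := by simp
  refine Prod.ext (funext fun i => ?_) ?_
  · simp [Vv, conjW]
  · simp only [Vv, e, map_smul]; simp

end PQsec

section PRsec
variable {m : ℕ} {M : Set (CS m)} {Q : (Fin m → ℂ) × CS m → ℂ} {r : ℝ} {κ : ℂ}
  {Q' : (Fin m → ℂ) × CS m → ℂ} {r' : ℝ} {HH : CS m → CS m}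

structure RPm (M : Set (CS m)) (Q : (Fin m → ℂ) × CS m → ℂ) (r : ℝ) (κ : ℂ)
    (Q' : (Fin m → ℂ) × CS m → ℂ) (r' : ℝ) (HH : CS m → CS m) (ρ : ℝ) : Prop extends RP M Q r κ Q' r' HH where
  ρ_pos : 0 < ρ
  ρ_le : ρ ≤ r
  pm : ∀ x ∈ ball (0 : (Fin m → ℂ) × CS m) ρ, pf Q x ∈ ball (0 : CS m) r
  psn : ∀ x ∈ ball (0 : (Fin m → ℂ) × CS m) ρ, fderiv ℝ (psf Q κ) x (0, -nv m κ) ≠ 0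
  ref : ∀ t ∈ ball (0 : CS m) ρ, psf Q κ (conjW t.1, t) = -yf Q κ t

theorem RPm.mono {ρ ρ' : ℝ} (h : RPm M Q r κ Q' r' HH ρ) (h0 : 0 < ρ') (hle : ρ' ≤ ρ) : RPm M Q r κ Q' r' HH ρ' :=
  ⟨h.toRP, h0, hle.trans h.ρ_le, fun x hx => h.pm x (ball_subset_ball hle hx),
    fun x hx => h.psn x (ball_subset_ball hle hx), fun x hx => h.ref x (ball_subset_ball hle hx)⟩

theorem RP.exists_RPm (h : RP M Q r κ Q' r' HH) : ∃ ρ, RPm M Q r κ Q' r' HH ρ := by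
  obtain ⟨δ1, hδ1, hδ1r, hre⟩ := h.toIsSet.reality
  have hpc : ContinuousAt (pf Q) 0 := h.pf_smooth.continuousOn.continuousAt (ball_mem_nhds _ h.r_pos)
  have hpt := hpc.tendsto
  rw [h.pf_zero] at hpt
  have hev : ∀ᶠ x in 𝓝 (0 : (Fin m → ℂ) × CS m), pf Q x ∈ ball (0 : CS m) r := hpt.eventually (ball_mem_nhds _ h.r_pos)
  obtain ⟨δ2, hδ2, hb2⟩ := Metric.eventually_nhds_iff_ball.1 hev
  set δ := min δ2 r with hδ
  have hδp : 0 < δ := lt_min hδ2 h.r_pos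
  have hps : ContDiffOn ℝ (⊤ : ℕ∞) (psf Q κ) (ball 0 δ) :=
    (h.y_smooth κ).comp (h.pf_smooth.mono (ball_subset_ball (min_le_right _ _)))
      fun x hx => hb2 x (ball_subset_ball (min_le_left _ _) hx)
  have hc : ContinuousAt (fun t => fderiv ℝ (psf Q κ) t (0, -nv m κ)) 0 := by
    have h1 : ContDiffOn ℝ (⊤ : ℕ∞) (fderiv ℝ (psf Q κ)) (ball 0 δ) :=
      hps.fderiv_of_isOpen isOpen_ball (by simp)
    exact (h1.continuousOn.clm_apply continuousOn_const).continuousAt (ball_mem_nhds _ hδp)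
  obtain ⟨δ3, hδ3, hb3⟩ := Metric.eventually_nhds_iff_ball.1 (hc.eventually_ne h.toIsSet.psf_deriv_ne)
  refine ⟨min (min δ δ1) δ3, h, by positivity, ?_, ?_, ?_, ?_⟩
  · exact (min_le_left _ _).trans ((min_le_left _ _).trans (min_le_right _ _))
  · exact fun x hx => hb2 x (ball_subset_ball ((min_le_left _ _).trans ((min_le_left _ _).trans (min_le_left _ _))) hx)
  · exact fun x hx => hb3 x (ball_subset_ball (min_le_right _ _) hx)
  · intro t ht
    have h1 := (hre t (ball_subset_ball ((min_le_left _ _).trans (min_le_right _ _)) ht)).2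
    have e : pf Q (conjW t.1, t) = (t.1, starRingEnd ℂ (Q (conjW t.1, t))) := by
      rw [pf]; simp [conjW_conjW]
    rw [psf, e, yf, yf, Xf, Xf]
    simp only
    rw [h1, ← Complex.conj_im]
    congr 1
    simp only [map_div₀, map_add, map_mul, Complex.conj_conj, map_ofNat]
    rw [add_comm]

variable {ρ : ℝ}

theorem RPm.ps_smooth (h : RPm M Q r κ Q' r' HH ρ) : ContDiffOn ℝ (⊤ : ℕ∞) (psf Q κ) (ball 0 ρ) :=
    (h.y_smooth κ).comp (h.pf_smooth.mono (ball_subset_ball h.ρ_le)) h.pm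

theorem RPm.dom (h : RPm M Q r κ Q' r' HH ρ) : Dom (SP Q κ ρ) (OP Q κ ρ) :=
  Dom.half isOpen_ball (h.ps_smooth.differentiableOn (by simp)) fun x hx _ => ⟨_, h.psn x hx⟩

theorem RPm.pSE (h : RPm M Q r κ Q' r' HH ρ) : MapsTo (pf Q) (SP Q κ ρ) (SE Q κ r) :=
  fun x hx => ⟨h.pm x hx.1, hx.2⟩

theorem RPm.pOE (h : RPm M Q r κ Q' r' HH ρ) : MapsTo (pf Q) (OP Q κ ρ) (OE Q κ r) :=
  fun x hx => ⟨h.pm x hx.1, hx.2⟩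

theorem RPm.p_smooth (h : RPm M Q r κ Q' r' HH ρ) : ContDiffOn ℝ (⊤ : ℕ∞) (pf Q) (SP Q κ ρ) :=
  h.pf_smooth.mono fun _ hx => ball_subset_ball h.ρ_le hx.1

theorem RPm.Hp_smooth (h : RPm M Q r κ Q' r' HH ρ) : ContDiffOn ℝ (⊤ : ℕ∞) (fun x => HH (pf Q x)) (SP Q κ ρ) :=
  h.reg.sm.comp h.p_smooth h.pSE

theorem RPm.conj_hol (h : RPm M Q r κ Q' r' HH ρ) {f : CS m → ℂ} (hf : DifferentiableOn ℂ f (OE Q κ r)) :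
    DifferentiableOn ℂ (fun x => starRingEnd ℂ (f (pf Q x))) (OP Q κ ρ) := by
  intro x hx
  have h1 : DifferentiableAt ℂ f (conjCSL m (kf Q x)) :=
    (hf _ (h.pOE hx)).differentiableAt (h.domE.op.mem_nhds (h.pOE hx))
  have h2 := hol_conj_conj (c := conjCSL m) conjCSL_I h1
  have h3 : DifferentiableAt ℂ (kf Q) x :=
    h.kf_hol.differentiableAt (isOpen_ball.mem_nhds (ball_subset_ball h.ρ_le hx.1))
  exact (DifferentiableAt.comp (g := fun u => starRingEnd ℂ (f (conjCSL m u))) (f := kf Q) x h2 h3).differentiableWithinAt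

theorem RPm.G_reg (h : RPm M Q r κ Q' r' HH ρ) : Reg (SP Q κ ρ) (OP Q κ ρ) (Gf Q HH) := by
  have h0 : ContDiffOn ℝ (⊤ : ℕ∞) (Gf Q HH) (SP Q κ ρ) :=
    ((conjWL m).comp (ContinuousLinearMap.fst ℝ (Fin m → ℂ) ℂ)).contDiff.comp_contDiffOn h.Hp_smooth
  refine ⟨h0, ?_⟩
  refine differentiableOn_pi.2 fun i => ?_
  have h1 : DifferentiableOn ℂ (fun t => (HH t).1) (OE Q κ r) := h.reg.hol.fst
  exact h.conj_hol (f := fun t => (HH t).1 i) (differentiableOn_pi.1 h1 i)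

theorem RPm.S_reg (h : RPm M Q r κ Q' r' HH ρ) : Reg (SP Q κ ρ) (OP Q κ ρ) (S0f Q HH) := by
  have h0 : ContDiffOn ℝ (⊤ : ℕ∞) (S0f Q HH) (SP Q κ ρ) :=
    ((conjCLE : ℂ →L[ℝ] ℂ).comp (ContinuousLinearMap.snd ℝ (Fin m → ℂ) ℂ)).contDiff.comp_contDiffOn h.Hp_smooth
  refine ⟨h0, ?_⟩
  exact h.conj_hol (f := fun t => (HH t).2) h.reg.hol.snd

theorem RPm.p_M (h : RPm M Q r κ Q' r' HH ρ) {t : CS m} (ht : t ∈ ball (0 : CS m) r) (hy : yf Q κ t = 0) :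
    pf Q (conjW t.1, t) = t := by
  have h1 := (h.mem t ht).1 ((h.memy t ht).2 hy)
  rw [pf]
  simp only [conjW_conjW]
  rw [← h1, Complex.conj_conj]

theorem RPm.G_M (h : RPm M Q r κ Q' r' HH ρ) {t : CS m} (ht : t ∈ ball (0 : CS m) r) (hy : yf Q κ t = 0) :
    Gf Q HH (conjW t.1, t) = conjW (HH t).1 := by rw [Gf, h.p_M ht hy]

theorem RPm.S_M (h : RPm M Q r κ Q' r' HH ρ) {t : CS m} (ht : t ∈ ball (0 : CS m) r) (hy : yf Q κ t = 0) :
    S0f Q HH (conjW t.1, t) = Q' (conjW (HH t).1, HH t) := by rw [S0f, h.p_M ht hy, h.eq' t ht hy]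

theorem RPm.zero_mem (h : RPm M Q r κ Q' r' HH ρ) : (0 : (Fin m → ℂ) × CS m) ∈ SP Q κ ρ :=
  ⟨mem_ball_self h.ρ_pos, by rw [psf, h.pf_zero, h.y_zero]⟩

/-- The partial differential of `G` in the `ζ` variable. -/
def Br (Q : (Fin m → ℂ) × CS m → ℂ) (κ : ℂ) (HH : CS m → CS m) (ρ : ℝ) (x : (Fin m → ℂ) × CS m) :
    (Fin m → ℂ) →L[ℝ] (Fin m → ℂ) :=
  (fderivWithin ℝ (Gf Q HH) (SP Q κ ρ) x).comp (ContinuousLinearMap.inl ℝ (Fin m → ℂ) (CS m))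

theorem RPm.Br_inj (h : RPm M Q r κ Q' r' HH ρ) {w : Fin m → ℂ} (hw : Br Q κ HH ρ 0 w = 0) : w = 0 := by
  have hH : HasFDerivWithinAt HH (fderivWithin ℝ HH (SE Q κ r) 0) (SE Q κ r) (pf Q 0) := by
    rw [h.pf_zero]; exact h.reg.diff (zero_mem_SE h.toIsSet)
  have h1 := hH.comp 0 (h.pf_deriv.hasFDerivWithinAt (s := SP Q κ ρ)) h.pSE
  have h2 := (((conjWL m).comp (ContinuousLinearMap.fst ℝ _ _)).hasFDerivAt.comp_hasFDerivWithinAt 0 h1).fderivWithin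
    (h.dom.ud 0 h.zero_mem)
  have h3 : fderivWithin ℝ (Gf Q HH) (SP Q κ ρ) 0 = _ := h2
  rw [Br, h3] at hw
  have e : conjW (fderivWithin ℝ HH (SE Q κ r) 0 (Vv Q w)).1 = 0 := hw
  set u := fderivWithin ℝ HH (SE Q κ r) 0 (Vv Q w) with hu
  have h4 := h.HM_derivC (h.toIsSet.Vv_tan w) (by rw [Vv_I]; exact h.toIsSet.Vv_tan _)
  simp only [← hu] at h4
  have hz : ((conjW u.1, 0) : (Fin m → ℂ) × CS m) = 0 := by rw [e]; rfl
  rw [hz, map_zero] at h4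
  have hu1 : u.1 = 0 := by rw [← conjW_conjW u.1, e, conjW_zero]
  have hu2 : u.2 = 0 := by simpa using h4
  have hV := h.inj _ (h.toIsSet.Vv_tan w) (Prod.ext hu1 hu2)
  have : conjW w = 0 := congrArg Prod.fst hV
  rw [← conjW_conjW w, this, conjW_zero]

theorem RPm.Br_shrink {ρ' : ℝ} (hle : ρ' ≤ ρ) {x : (Fin m → ℂ) × CS m}
    (hx : x ∈ ball (0 : (Fin m → ℂ) × CS m) ρ') : Br Q κ HH ρ' x = Br Q κ HH ρ x := by
  have : SP Q κ ρ' = SP Q κ ρ ∩ ball 0 ρ' := by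
    ext x
    exact ⟨fun hx => ⟨⟨ball_subset_ball hle hx.1, hx.2⟩, hx.1⟩, fun hx => ⟨hx.2, hx.1.2⟩⟩
  rw [Br, Br, this, fderivWithin_inter (isOpen_ball.mem_nhds hx)]

theorem RPm.Br_cont (h : RPm M Q r κ Q' r' HH ρ) : ContDiffOn ℝ (⊤ : ℕ∞) (Br Q κ HH ρ) (SP Q κ ρ) := by
  have h1 : ContDiffOn ℝ (⊤ : ℕ∞) (fderivWithin ℝ (Gf Q HH) (SP Q κ ρ)) (SP Q κ ρ) :=
    h.G_reg.sm.fderivWithin (m := (⊤ : ℕ∞)) h.dom.ud (by simp)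
  exact h1.clm_comp contDiffOn_const

structure RS (M : Set (CS m)) (Q : (Fin m → ℂ) × CS m → ℂ) (r : ℝ) (κ : ℂ)
    (Q' : (Fin m → ℂ) × CS m → ℂ) (r' : ℝ) (HH : CS m → CS m) (ρ K : ℝ) : Prop extends RPm M Q r κ Q' r' HH ρ where
  Kp : 0 < K
  bK : ∀ x ∈ SP Q κ ρ, ∀ w, ‖w‖ ≤ K * ‖Br Q κ HH ρ x w‖

theorem RP.exists_RS (h0 : RP M Q r κ Q' r' HH) : ∃ ρ K, RS M Q r κ Q' r' HH ρ K := by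
  obtain ⟨ρ, h⟩ := h0.exists_RPm
  have hinj : Function.Injective (Br Q κ HH ρ 0) := by
    rw [injective_iff_map_eq_zero]
    exact fun w hw => h.Br_inj hw
  obtain ⟨K, hK, hanti⟩ := LinearMap.exists_antilipschitzWith ((Br Q κ HH ρ 0) : (Fin m → ℂ) →ₗ[ℝ] (Fin m → ℂ))
    (LinearMap.ker_eq_bot.2 hinj)
  have hKp : (0 : ℝ) < K := hK
  have hb0 : ∀ w, ‖w‖ ≤ K * ‖Br Q κ HH ρ 0 w‖ := fun w => hanti.le_mul_norm (map_zero _) w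
  have hc : ContinuousWithinAt (Br Q κ HH ρ) (SP Q κ ρ) 0 := h.Br_cont.continuousOn 0 h.zero_mem
  have hev : ∀ᶠ x in 𝓝[SP Q κ ρ] 0, dist (Br Q κ HH ρ x) (Br Q κ HH ρ 0) < 1 / (2 * K) :=
    Metric.tendsto_nhds.1 hc _ (by positivity)
  obtain ⟨δ, hδ, hb⟩ := Metric.mem_nhdsWithin_iff.1 hev
  have hp : 0 < min δ ρ := lt_min hδ h.ρ_pos
  refine ⟨min δ ρ, 2 * K, h.mono hp (min_le_right _ _), by positivity, ?_⟩
  intro x hx w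
  rw [RPm.Br_shrink (min_le_right δ ρ) hx.1]
  have h1 := hb ⟨ball_subset_ball (min_le_left _ _) hx.1, ⟨ball_subset_ball (min_le_right _ _) hx.1, hx.2⟩⟩
  have h2 : ‖Br Q κ HH ρ x - Br Q κ HH ρ 0‖ < 1 / (2 * K) := by rw [← dist_eq_norm]; exact h1
  have h3 := (Br Q κ HH ρ x - Br Q κ HH ρ 0).le_opNorm w
  have h4 : ‖Br Q κ HH ρ 0 w‖ ≤ ‖Br Q κ HH ρ x w‖ + ‖(Br Q κ HH ρ x - Br Q κ HH ρ 0) w‖ := by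
    have : Br Q κ HH ρ 0 w = Br Q κ HH ρ x w - (Br Q κ HH ρ x - Br Q κ HH ρ 0) w := by simp
    rw [this]; exact norm_sub_le _ _
  have h5 := hb0 w
  have h6 : ‖(Br Q κ HH ρ x - Br Q κ HH ρ 0) w‖ ≤ 1 / (2 * K) * ‖w‖ :=
    h3.trans (mul_le_mul_of_nonneg_right h2.le (norm_nonneg _))
  have h7 : K * ‖Br Q κ HH ρ 0 w‖ ≤ K * (‖Br Q κ HH ρ x w‖ + 1 / (2 * K) * ‖w‖) :=
    mul_le_mul_of_nonneg_left (h4.trans (by linarith)) hKp.le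
  have h8 : (K : ℝ) * (1 / (2 * K) * ‖w‖) = ‖w‖ / 2 := by field_simp
  nlinarith

end PRsec

section PSsec
variable {m : ℕ} {M : Set (CS m)} {Q : (Fin m → ℂ) × CS m → ℂ} {r : ℝ} {κ : ℂ}
  {Q' : (Fin m → ℂ) × CS m → ℂ} {r' : ℝ} {HH : CS m → CS m} {ρ K : ℝ}

def bf (Q : (Fin m → ℂ) × CS m → ℂ) (κ : ℂ) (HH : CS m → CS m) (ρ : ℝ)
    (q : (Fin m → ℂ) × ((Fin m → ℂ) × CS m)) : Fin m → ℂ := (Br Q κ HH ρ q.2).inverse q.1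

def bbf (Q : (Fin m → ℂ) × CS m → ℂ) (κ : ℂ) (HH : CS m → CS m) (ρ : ℝ)
    (q : (Fin m → ℂ) × ((Fin m → ℂ) × CS m)) : (Fin m → ℂ) × ((Fin m → ℂ) × CS m) := (0, (bf Q κ HH ρ q, 0))

theorem inj_equiv {𝕜 V : Type*} [NontriviallyNormedField 𝕜] [CompleteSpace 𝕜] [NormedAddCommGroup V] [NormedSpace 𝕜 V]
    [FiniteDimensional 𝕜 V] (B : V →L[𝕜] V) (hB : Function.Injective B) :
    ∃ e : V ≃L[𝕜] V, (e : V →L[𝕜] V) = B := by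
  refine ⟨(LinearEquiv.ofInjectiveEndo (B : V →ₗ[𝕜] V) hB).toContinuousLinearEquiv, ?_⟩
  ext v; rfl

theorem RS.Br_injective (h : RS M Q r κ Q' r' HH ρ K) {x : (Fin m → ℂ) × CS m} (hx : x ∈ SP Q κ ρ) :
    Function.Injective (Br Q κ HH ρ x) := by
  rw [injective_iff_map_eq_zero]
  intro w hw
  have := h.bK x hx w
  rw [hw, norm_zero, mul_zero] at this
  exact norm_le_zero_iff.1 this

theorem RS.b_spec (h : RS M Q r κ Q' r' HH ρ K) {x : (Fin m → ℂ) × CS m} (hx : x ∈ SP Q κ ρ) (e : Fin m → ℂ) :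
    Br Q κ HH ρ x (bf Q κ HH ρ (e, x)) = e := by
  obtain ⟨E, hE⟩ := inj_equiv _ (h.Br_injective hx)
  rw [bf]
  simp only
  rw [← hE, ContinuousLinearMap.inverse_equiv]
  simp

theorem RS.b_bound (h : RS M Q r κ Q' r' HH ρ K) {x : (Fin m → ℂ) × CS m} (hx : x ∈ SP Q κ ρ) (e : Fin m → ℂ) :
    ‖bf Q κ HH ρ (e, x)‖ ≤ K * ‖e‖ := by
  have := h.bK x hx (bf Q κ HH ρ (e, x))
  rwa [h.b_spec hx] at this

def SX (Q : (Fin m → ℂ) × CS m → ℂ) (κ : ℂ) (ρ : ℝ) : Set ((Fin m → ℂ) × ((Fin m → ℂ) × CS m)) := univ ×ˢ SP Q κ ρ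
def OX (Q : (Fin m → ℂ) × CS m → ℂ) (κ : ℂ) (ρ : ℝ) : Set ((Fin m → ℂ) × ((Fin m → ℂ) × CS m)) := univ ×ˢ OP Q κ ρ

theorem RPm.domX (h : RPm M Q r κ Q' r' HH ρ) : Dom (SX Q κ ρ) (OX Q κ ρ) := h.dom.prod_univ

theorem RS.b_reg (h : RS M Q r κ Q' r' HH ρ K) : Reg (SX Q κ ρ) (OX Q κ ρ) (bf Q κ HH ρ) := by
  constructor
  · have h1 : ContDiffOn ℝ (⊤ : ℕ∞) (fun x => (Br Q κ HH ρ x).inverse) (SP Q κ ρ) := by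
      intro x hx
      obtain ⟨E, hE⟩ := inj_equiv _ (h.Br_injective hx)
      have h2 : ContDiffAt ℝ (⊤ : ℕ∞) ContinuousLinearMap.inverse (Br Q κ HH ρ x) := by
        rw [← hE]; exact contDiffAt_map_inverse E
      exact h2.comp_contDiffWithinAt x (h.Br_cont x hx)
    have h2 : ContDiffOn ℝ (⊤ : ℕ∞) (fun q : (Fin m → ℂ) × ((Fin m → ℂ) × CS m) => (Br Q κ HH ρ q.2).inverse) (SX Q κ ρ) :=
      h1.comp contDiffOn_snd fun q hq => hq.2
    exact h2.clm_apply contDiffOn_fst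
  · have hG : ContDiffOn ℂ 2 (Gf Q HH) (OP Q κ ρ) :=
      contDiffOn_pi.2 fun i => hol_contDiffOn h.dom.op 2 (differentiableOn_pi.1 h.G_reg.hol i)
    have hG1 : ContDiffOn ℂ 1 (fderiv ℂ (Gf Q HH)) (OP Q κ ρ) := hG.fderiv_of_isOpen h.dom.op (by norm_num)
    set Bc : (Fin m → ℂ) × CS m → ((Fin m → ℂ) →L[ℂ] (Fin m → ℂ)) := fun x =>
      (fderiv ℂ (Gf Q HH) x).comp (ContinuousLinearMap.inl ℂ (Fin m → ℂ) (CS m)) with hBc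
    have hBd : DifferentiableOn ℂ Bc (OP Q κ ρ) :=
      (hG1.clm_comp contDiffOn_const).differentiableOn (by norm_num)
    have hBB : ∀ x ∈ OP Q κ ρ, ∀ w, Bc x w = Br Q κ HH ρ x w := by
      intro x hx w
      rw [Br]
      simp only [hBc, ContinuousLinearMap.coe_comp, Function.comp_apply]
      exact (h.dom.fd h.G_reg.hol hx _).symm
    have hBe : ∀ x ∈ OP Q κ ρ, ∃ e : (Fin m → ℂ) ≃L[ℂ] (Fin m → ℂ), (e : (Fin m → ℂ) →L[ℂ] (Fin m → ℂ)) = Bc x := by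
      intro x hx
      refine inj_equiv _ fun a b hab => h.Br_injective (h.dom.sub hx) ?_
      rw [← hBB x hx, ← hBB x hx, hab]
    have h1 : DifferentiableOn ℂ (fun x => (Bc x).inverse) (OP Q κ ρ) := by
      intro x hx
      obtain ⟨E, hE⟩ := hBe x hx
      have h2 : DifferentiableAt ℂ ContinuousLinearMap.inverse (Bc x) := by
        rw [← hE]; exact (contDiffAt_map_inverse (n := 1) E).differentiableAt (by norm_num)
      exact h2.comp_differentiableWithinAt x (hBd x hx)
    have h2 : DifferentiableOn ℂ (fun q : (Fin m → ℂ) × ((Fin m → ℂ) × CS m) => (Bc q.2).inverse) (OX Q κ ρ) :=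
      h1.comp differentiableOn_snd fun q hq => hq.2
    refine (h2.clm_apply differentiableOn_fst).congr ?_
    rintro ⟨e, x⟩ ⟨-, hx⟩
    obtain ⟨E, hE⟩ := hBe x hx
    apply h.Br_injective (h.dom.sub hx)
    rw [h.b_spec (h.dom.sub hx), ← hBB x hx]
    simp only
    rw [← hE, ContinuousLinearMap.inverse_equiv]
    simp

theorem RS.bb_reg (h : RS M Q r κ Q' r' HH ρ K) : Reg (SX Q κ ρ) (OX Q κ ρ) (bbf Q κ HH ρ) :=
  ⟨contDiffOn_const.prodMk (h.b_reg.sm.prodMk contDiffOn_const),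
    (differentiableOn_const _).prodMk (h.b_reg.hol.prodMk (differentiableOn_const _))⟩

def Rn (Q : (Fin m → ℂ) × CS m → ℂ) (κ : ℂ) (HH : CS m → CS m) (ρ : ℝ) : ℕ →
    (Fin m → ℂ) × ((Fin m → ℂ) × CS m) → ℂ
  | 0 => fun q => S0f Q HH q.2
  | N + 1 => fun q => fderivWithin ℝ (Rn Q κ HH ρ N) (SX Q κ ρ) q (bbf Q κ HH ρ q)

theorem RS.R_reg (h : RS M Q r κ Q' r' HH ρ K) (N : ℕ) : Reg (SX Q κ ρ) (OX Q κ ρ) (Rn Q κ HH ρ N) := by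
  induction N with
  | zero => exact ⟨h.S_reg.sm.comp contDiffOn_snd fun q hq => hq.2, h.S_reg.hol.comp differentiableOn_snd fun q hq => hq.2⟩
  | succ N ih => exact ih.dir h.domX h.bb_reg

def Wn (Q' : (Fin m → ℂ) × CS m → ℂ) (e : Fin m → ℂ) : ℕ → (Fin m → ℂ) × CS m → ℂ
  | 0 => Q'
  | N + 1 => fun q => fderiv ℂ (Wn Q' e N) q (e, 0)

theorem Wn_hol (h : DifferentiableOn ℂ Q' (ball 0 r')) (e : Fin m → ℂ) (N : ℕ) :
    DifferentiableOn ℂ (Wn Q' e N) (ball 0 r') := by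
  have : ProperSpace ((Fin m → ℂ) × CS m) := FiniteDimensional.proper ℂ _
  induction N with
  | zero => exact h
  | succ N ih => exact hol_fderiv_apply isOpen_ball ih _

theorem RPm.ct_mem (h : RPm M Q r κ Q' r' HH ρ) {t : CS m} (ht : t ∈ ball (0 : CS m) ρ) (hy : yf Q κ t ≤ 0) :
    ((conjW t.1, t) : (Fin m → ℂ) × CS m) ∈ SP Q κ ρ := by
  refine ⟨?_, by rw [h.ref t ht]; linarith⟩
  rw [mem_ball_zero_iff, norm_conjWt]; exact mem_ball_zero_iff.1 ht

theorem RPm.HM_mem (h : RPm M Q r κ Q' r' HH ρ) {t : CS m} (ht : t ∈ SE Q κ r) :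
    ((conjW (HH t).1, HH t) : (Fin m → ℂ) × CS m) ∈ ball (0 : (Fin m → ℂ) × CS m) r' := by
  rw [mem_ball_zero_iff, norm_conjWt]; linarith [h.small t ht, h.r'_pos]

theorem RPm.key1 (h : RPm M Q r κ Q' r' HH ρ) {t : CS m} (ht : t ∈ ball (0 : CS m) ρ) (hy : yf Q κ t = 0)
    {v : CS m} (hv : fderiv ℝ (yf Q κ) t v = 0) {u w : (Fin m → ℂ) × CS m → ℂ}
    {A : (Fin m → ℂ) × CS m →L[ℝ] ℂ} (hu : HasFDerivWithinAt u A (SP Q κ ρ) (conjW t.1, t))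
    {Dw : (Fin m → ℂ) × CS m →L[ℂ] ℂ} (hw : HasFDerivAt w Dw (conjW (HH t).1, HH t))
    (heq : ∀ s ∈ ball (0 : CS m) ρ, yf Q κ s = 0 → u (conjW s.1, s) = w (conjW (HH s).1, HH s)) :
    A (conjW v.1, v) = Dw (conjW (fderivWithin ℝ HH (SE Q κ r) t v).1, fderivWithin ℝ HH (SE Q κ r) t v) := by
  have htr := ball_subset_ball h.ρ_le ht
  obtain ⟨c, hc0, hc, hcM⟩ := h.toIsSet.curve le_rfl h.dir htr hy hv
  have hct := hc.continuousAt.tendsto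
  rw [hc0] at hct
  have hcb : ∀ᶠ s in 𝓝 (0 : ℝ), c s ∈ ball (0 : CS m) ρ := hct.eventually (isOpen_ball.mem_nhds ht)
  have hcS : ∀ᶠ s in 𝓝 (0 : ℝ), c s ∈ SE Q κ r := by
    filter_upwards [hcM, hcb] with s h1 h2 using ⟨ball_subset_ball h.ρ_le h2, h1.2.ge⟩
  have hcP : ∀ᶠ s in 𝓝 (0 : ℝ), ctL m (c s) ∈ SP Q κ ρ := by
    filter_upwards [hcM, hcb] with s h1 h2 using h.ct_mem h2 h1.2.le
  have h1 := (ctL m).hasFDerivAt.comp_hasDerivAt (0 : ℝ) hc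
  have hu2 : HasFDerivWithinAt u A (SP Q κ ρ) ((ctL m ∘ c) 0) := by
    simp only [Function.comp, hc0]; exact hu
  have h2 := hu2.comp_hasDerivAt (0 : ℝ) h1 hcP
  have hH : HasFDerivWithinAt HH (fderivWithin ℝ HH (SE Q κ r) t) (SE Q κ r) (c 0) := by
    rw [hc0]; exact h.reg.diff ⟨htr, hy.ge⟩
  have h3 := (ctL m).hasFDerivAt.comp_hasDerivAt (0 : ℝ) (hH.comp_hasDerivAt (0 : ℝ) hc hcS)
  have hw2 : HasFDerivAt w (Dw.restrictScalars ℝ) ((ctL m ∘ HH ∘ c) 0) := by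
    simp only [Function.comp, hc0]; exact hw.restrictScalars ℝ
  have h4 := hw2.comp_hasDerivAt (0 : ℝ) h3
  have h5 : u ∘ ctL m ∘ c =ᶠ[𝓝 0] w ∘ ctL m ∘ HH ∘ c := by
    filter_upwards [hcM, hcb] with s h1 h2 using heq _ h2 h1.2
  exact h2.unique (h4.congr_of_eventuallyEq h5)

theorem RPm.key2 (h : RPm M Q r κ Q' r' HH ρ) {t : CS m} (ht : t ∈ ball (0 : CS m) ρ) (hy : yf Q κ t = 0)
    {v : CS m} (hv : fderiv ℝ (yf Q κ) t v = 0) (hv2 : fderiv ℝ (yf Q κ) t (I • v) = 0)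
    {u w : (Fin m → ℂ) × CS m → ℂ}
    {A : (Fin m → ℂ) × CS m →L[ℝ] ℂ} (hu : HasFDerivWithinAt u A (SP Q κ ρ) (conjW t.1, t))
    (hA : ∀ v, A (I • v) = I • A v)
    {Dw : (Fin m → ℂ) × CS m →L[ℂ] ℂ} (hw : HasFDerivAt w Dw (conjW (HH t).1, HH t))
    (heq : ∀ s ∈ ball (0 : CS m) ρ, yf Q κ s = 0 → u (conjW s.1, s) = w (conjW (HH s).1, HH s)) :
    A (conjW v.1, 0) = Dw (conjW (fderivWithin ℝ HH (SE Q κ r) t v).1, 0) := by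
  have h1 := h.key1 ht hy hv hu hw heq
  have h2 := h.key1 ht hy hv2 hu hw heq
  have htr := ball_subset_ball h.ρ_le ht
  rw [h.reg.cl h.domE ⟨htr, hy.ge⟩] at h2
  set a := fderivWithin ℝ HH (SE Q κ r) t v with ha
  have e1 : ∀ u : CS m, ((conjW u.1, u) : (Fin m → ℂ) × CS m) = (conjW u.1, 0) + (0, u) := fun u => by simp
  have e2 : ∀ u : CS m, ((conjW (I • u).1, I • u) : (Fin m → ℂ) × CS m) = I • (-(conjW u.1, 0) + (0, u)) := by
    intro u
    refine Prod.ext (funext fun i => ?_) ?_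
    · simp [conjW]
    · simp
  rw [e1, e1 a, map_add, map_add] at h1
  rw [e2, e2 a, hA, map_smul, map_add, map_add, map_neg, map_neg, smul_eq_mul, smul_eq_mul] at h2
  have h3 := mul_left_cancel₀ I_ne_zero h2
  linear_combination (1 / 2) * h1 - (1 / 2) * h3

theorem RPm.exists_ct (h : RPm M Q r κ Q' r' HH ρ) {t : CS m} (ht : t ∈ ball (0 : CS m) r) (ζ : Fin m → ℂ) :
    ∃ v : CS m, conjW v.1 = ζ ∧ fderiv ℝ (yf Q κ) t v = 0 ∧ fderiv ℝ (yf Q κ) t (I • v) = 0 := by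
  set D := fderiv ℝ (yf Q κ) t with hD
  set f : CS m → ℂ := fun v => (D v : ℂ) - I * D (I • v) with hf
  have hfa : ∀ v w, f (v - w) = f v - f w := by intro v w; simp only [hf, smul_sub, map_sub, ofReal_sub]; ring
  have hfc : ∀ (c : ℂ) v, f (c • v) = c * f v := by
    intro c v
    have e1 : c • v = c.re • v + c.im • (I • v) := by
      conv_lhs => rw [← Complex.re_add_im c]
      rw [add_smul, mul_smul]
      simp
    have e2 : I • (c • v) = c.re • (I • v) - c.im • v := by
      have : I • (c • v) = ((c.re : ℂ) * I) • v - (c.im : ℂ) • v := by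
        rw [smul_smul, ← sub_smul]; congr 1
        conv_lhs => rw [← Complex.re_add_im c]
        linear_combination (c.im : ℂ) * I_sq
      rw [this, mul_smul]; simp
    simp only [hf]
    rw [e2, e1]
    simp only [map_add, map_sub, map_smul, smul_eq_mul, ofReal_add, ofReal_sub, ofReal_mul]
    conv_rhs => rw [← Complex.re_add_im c]
    linear_combination (c.im : ℂ) * (D (I • v) : ℂ) * I_sq
  have hfn : f (nv m κ) ≠ 0 := by
    intro h0
    apply h.dn t ht
    have := congrArg re h0
    simpa [hf] using this
  refine ⟨(conjW ζ, 0) - (f (conjW ζ, 0) / f (nv m κ)) • nv m κ, ?_, ?_⟩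
  · simp [nv, conjW_conjW]
  · have h0 : f ((conjW ζ, 0) - (f (conjW ζ, 0) / f (nv m κ)) • nv m κ) = 0 := by
      rw [hfa, hfc, div_mul_cancel₀ _ hfn, sub_self]
    have h1 := congrArg re h0
    have h2 := congrArg im h0
    simp only [hf, sub_re, sub_im, ofReal_re, ofReal_im, mul_re, mul_im, I_re, I_im, zero_re, zero_im] at h1 h2
    constructor <;> linarith

theorem RS.boundary (h : RS M Q r κ Q' r' HH ρ K) (N : ℕ) (e : Fin m → ℂ) : ∀ t ∈ ball (0 : CS m) ρ, yf Q κ t = 0 →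
    Rn Q κ HH ρ N (e, (conjW t.1, t)) = Wn Q' e N (conjW (HH t).1, HH t) := by
  induction N with
  | zero => exact fun t ht hy => h.S_M (ball_subset_ball h.ρ_le ht) hy
  | succ N ih =>
    intro t ht hy
    have htr := ball_subset_ball h.ρ_le ht
    have hS := h.ct_mem ht hy.le
    set b := bf Q κ HH ρ (e, (conjW t.1, t)) with hb
    obtain ⟨v, hv, hv1, hv2⟩ := h.exists_ct htr b
    have hR := h.R_reg N
    have hSX : (e, ((conjW t.1, t) : (Fin m → ℂ) × CS m)) ∈ SX Q κ ρ := ⟨mem_univ _, hS⟩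
    set D := fderivWithin ℝ (Rn Q κ HH ρ N) (SX Q κ ρ) (e, (conjW t.1, t)) with hD
    have hDd : HasFDerivWithinAt (Rn Q κ HH ρ N) D (SX Q κ ρ) (e, (conjW t.1, t)) := hR.diff hSX
    have hsl : HasFDerivWithinAt (fun x : (Fin m → ℂ) × CS m => (e, x))
        (ContinuousLinearMap.inr ℝ (Fin m → ℂ) ((Fin m → ℂ) × CS m)) (SP Q κ ρ) (conjW t.1, t) :=
      (hasFDerivAt_prodMk_right e _).hasFDerivWithinAt
    have hu := HasFDerivWithinAt.comp (g := Rn Q κ HH ρ N) (f := fun x : (Fin m → ℂ) × CS m => (e, x))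
      (conjW t.1, t) hDd hsl (t := SX Q κ ρ) fun x hx => ⟨mem_univ _, hx⟩
    have hW := ((Wn_hol h.hol' e N).differentiableAt (isOpen_ball.mem_nhds (h.HM_mem ⟨htr, hy.ge⟩))).hasFDerivAt
    have k1 := h.key2 ht hy hv1 hv2 hu (by
      intro w
      have := hR.cl h.domX hSX (0, w)
      simpa using this) hW ih
    have k2 : ∀ i, Br Q κ HH ρ (conjW t.1, t) b i = conjW (fderivWithin ℝ HH (SE Q κ r) t v).1 i := by
      intro i
      have hG := hasFDerivWithinAt_pi'.1 (h.G_reg.diff hS) i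
      have hp : HasFDerivAt (fun x : (Fin m → ℂ) × CS m => x.1 i)
        ((ContinuousLinearMap.proj (R := ℂ) (φ := fun _ : Fin m => ℂ) i).comp (ContinuousLinearMap.fst ℂ (Fin m → ℂ) (CS m)))
        (conjW (HH t).1, HH t) :=
        ((ContinuousLinearMap.proj (R := ℂ) (φ := fun _ : Fin m => ℂ) i).comp
          (ContinuousLinearMap.fst ℂ (Fin m → ℂ) (CS m))).hasFDerivAt
      have := h.key2 ht hy hv1 hv2 hG (by
        intro w
        have := congrFun (h.G_reg.cl h.dom hS w) i
        simpa using this) hp (fun s hs hys => by rw [h.G_M (ball_subset_ball h.ρ_le hs) hys])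
      rw [hv] at this
      exact this
    have k3 : conjW (fderivWithin ℝ HH (SE Q κ r) t v).1 = e := by
      rw [← h.b_spec hS e, ← hb]
      exact (funext k2).symm
    rw [k3, hv] at k1
    exact k1

end PSsec

section PTsec

theorem dir_bound {V : Type*} [NormedAddCommGroup V] [NormedSpace ℂ V] {f : V → ℂ} {x : V} {s C : ℝ} (hs : 0 < s)
    (hf : DifferentiableOn ℂ f (ball x s)) (hC : ∀ y ∈ ball x s, ‖f y‖ ≤ C) (v : V) :
    ‖fderiv ℂ f x v‖ ≤ 2 * C / s * ‖v‖ := by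
  by_cases hv : v = 0
  · simp [hv]
  have hv' : 0 < ‖v‖ := norm_pos_iff.2 hv
  have hin : ∀ a ∈ ball (0 : ℂ) (s / ‖v‖), x + a • v ∈ ball x s := by
    intro a ha
    rw [mem_ball_zero_iff, lt_div_iff₀ hv'] at ha
    rw [mem_ball_iff_norm, add_sub_cancel_left, norm_smul]; exact ha
  have hg : DifferentiableOn ℂ (fun a : ℂ => f (x + a • v)) (ball 0 (s / ‖v‖)) :=
    hf.comp (f := fun a : ℂ => x + a • v) (by fun_prop) hin
  have h1 := cauchy_deriv_bound (by positivity) hg fun a ha => hC _ (hin a ha)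
  have h2 : HasFDerivAt f (fderiv ℂ f x) (x + (0 : ℂ) • v) := by
    rw [zero_smul, add_zero]
    exact (hf.differentiableAt (isOpen_ball.mem_nhds (mem_ball_self hs))).hasFDerivAt
  have h3 : HasDerivAt (fun a : ℂ => x + a • v) v 0 := by
    simpa using ((hasDerivAt_id (0 : ℂ)).smul_const v).const_add x
  have h4 : deriv (fun a : ℂ => f (x + a • v)) 0 = fderiv ℂ f x v := (h2.comp_hasDerivAt (0 : ℂ) h3).deriv
  rw [h4] at h1
  refine h1.trans (le_of_eq ?_)
  field_simp

theorem iter_bound {V : Type*} [NormedAddCommGroup V] [NormedSpace ℂ V] {f : ℕ → V → ℂ} {b : V → V} {Ω : Set V}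
    {s B C : ℝ} (hs : 0 < s) (hC0 : 0 ≤ C) (hB0 : 0 ≤ B)
    (hf : ∀ k, DifferentiableOn ℂ (f k) Ω) (hb : ∀ x ∈ Ω, ‖b x‖ ≤ B)
    (hC : ∀ x ∈ Ω, ‖f 0 x‖ ≤ C) (hr : ∀ k, ∀ x ∈ Ω, f (k + 1) x = fderiv ℂ (f k) x (b x)) (k : ℕ) :
    ∀ x ∈ Ω, ball x (k * s) ⊆ Ω → ‖f k x‖ ≤ C * (2 * B / s) ^ k := by
  induction k with
  | zero => intro x hx _; simpa using hC x hx
  | succ k ih =>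
    intro x hx hΩ
    push_cast at hΩ
    have hsub : ball x s ⊆ Ω := (ball_subset_ball (by nlinarith [(Nat.cast_nonneg k : (0 : ℝ) ≤ k)])).trans hΩ
    have h1 : ∀ y ∈ ball x s, ‖f k y‖ ≤ C * (2 * B / s) ^ k := by
      intro y hy
      refine ih y (hsub hy) ((ball_subset_ball' ?_).trans hΩ)
      rw [mem_ball] at hy; linarith
    rw [hr k x hx]
    refine (dir_bound hs ((hf k).mono hsub) h1 _).trans ?_
    calc 2 * (C * (2 * B / s) ^ k) / s * ‖b x‖ ≤ 2 * (C * (2 * B / s) ^ k) / s * B := by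
          gcongr; exact hb x hx
      _ = C * (2 * B / s) ^ (k + 1) := by rw [pow_succ]; ring

theorem pow_le_fact (N : ℕ) : (N : ℝ) ^ N ≤ N.factorial * Real.exp 1 ^ N := by
  have h := Real.pow_div_factorial_le_exp (N : ℝ) (by positivity) N
  rw [div_le_iff₀ (by positivity)] at h
  rw [← Real.exp_nat_mul, mul_one, mul_comm]; exact h

theorem iter_bound' {V : Type*} [NormedAddCommGroup V] [NormedSpace ℂ V] {f : ℕ → V → ℂ} {b : V → V} {Ω : Set V}
    {a B C : ℝ} (ha : 0 < a) (hC0 : 0 ≤ C) (hB0 : 0 ≤ B)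
    (hf : ∀ k, DifferentiableOn ℂ (f k) Ω) (hb : ∀ x ∈ Ω, ‖b x‖ ≤ B)
    (hC : ∀ x ∈ Ω, ‖f 0 x‖ ≤ C) (hr : ∀ k, ∀ x ∈ Ω, f (k + 1) x = fderiv ℂ (f k) x (b x)) (N : ℕ)
    {x : V} (hx : ball x a ⊆ Ω) : ‖f N x‖ ≤ C * N.factorial * (2 * Real.exp 1 * B / a) ^ N := by
  have hxΩ := hx (mem_ball_self ha)
  rcases Nat.eq_zero_or_pos N with rfl | hN
  · simpa using hC x hxΩ
  have hN' : (0 : ℝ) < N := by exact_mod_cast hN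
  have h1 := iter_bound (s := a / N) (by positivity) hC0 hB0 hf hb hC hr N x hxΩ (by
    rw [mul_div_cancel₀ _ hN'.ne']; exact hx)
  refine h1.trans ?_
  have : (2 * B / (a / N)) ^ N = (N : ℝ) ^ N * (2 * B / a) ^ N := by rw [← mul_pow]; congr 1; field_simp
  rw [this]
  calc C * ((N : ℝ) ^ N * (2 * B / a) ^ N) ≤ C * ((N.factorial * Real.exp 1 ^ N) * (2 * B / a) ^ N) := by
        gcongr; exact pow_le_fact N
    _ = C * N.factorial * (2 * Real.exp 1 * B / a) ^ N := by
        rw [show 2 * Real.exp 1 * B / a = Real.exp 1 * (2 * B / a) by ring, mul_pow]; ring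

variable {m : ℕ} {M : Set (CS m)} {Q : (Fin m → ℂ) × CS m → ℂ} {r : ℝ} {κ : ℂ}
  {Q' : (Fin m → ℂ) × CS m → ℂ} {r' : ℝ} {HH : CS m → CS m} {ρ K : ℝ}

theorem RPm.psf_zero (h : RPm M Q r κ Q' r' HH ρ) : psf Q κ 0 = 0 := by
  rw [psf, h.pf_zero]; exact h.y_zero

/-- interior bound -/
theorem RS.interior (h : RS M Q r κ Q' r' HH ρ K) : ∃ δ > 0, δ ≤ ρ ∧ ∃ A > 0, ∃ C > 0, ∀ t ∈ ball (0 : CS m) δ,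
    yf Q κ t < 0 → ∀ N e, ‖Rn Q κ HH ρ N (e, (conjW t.1, t))‖ ≤ C * N.factorial * (A * ‖e‖ / (-yf Q κ t)) ^ N := by
  obtain ⟨L, U, hU, hL⟩ := ((h.ps_smooth.contDiffAt (ball_mem_nhds _ h.ρ_pos)).of_le
    (m := 1) (by exact_mod_cast le_top)).exists_lipschitzOnWith
  obtain ⟨δ1, hδ1, hb⟩ := Metric.mem_nhds_iff.1 hU
  set δ := min δ1 ρ with hδ
  have hδp : 0 < δ := lt_min hδ1 h.ρ_pos
  set L1 : ℝ := L + 1 with hL1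
  have hL1p : 0 < L1 := by positivity
  have hLip : ∀ x ∈ ball (0 : (Fin m → ℂ) × CS m) δ, ∀ y ∈ ball (0 : (Fin m → ℂ) × CS m) δ,
      |psf Q κ x - psf Q κ y| ≤ L1 * ‖x - y‖ := by
    intro x hx y hy
    have := hL.dist_le_mul x (hb (ball_subset_ball (min_le_left _ _) hx)) y (hb (ball_subset_ball (min_le_left _ _) hy))
    rw [Real.dist_eq, dist_eq_norm] at this
    exact this.trans (by gcongr; simp [hL1])
  refine ⟨δ / 2, by positivity, by linarith [min_le_right δ1 ρ], 2 * Real.exp 1 * K * L1, by have := h.Kp; positivity,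
    r', h.r'_pos, ?_⟩
  intro t ht hy N e
  set x : (Fin m → ℂ) × CS m := (conjW t.1, t) with hx
  have hxn : ‖x‖ < δ / 2 := by rw [hx, norm_conjWt]; exact mem_ball_zero_iff.1 ht
  have hxd : x ∈ ball (0 : (Fin m → ℂ) × CS m) δ := by rw [mem_ball_zero_iff]; linarith
  have hps : psf Q κ x = -yf Q κ t := h.ref t (ball_subset_ball (by linarith [min_le_right δ1 ρ]) ht)
  set d := -yf Q κ t with hd
  have hdp : 0 < d := by simp only [hd]; linarith
  have hdle : d / L1 ≤ δ / 2 := by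
    have := hLip x hxd 0 (mem_ball_self hδp)
    rw [h.psf_zero, hps, sub_zero, sub_zero, abs_of_pos hdp] at this
    rw [div_le_iff₀ hL1p]; nlinarith
  have hsub : ball x (d / L1) ⊆ OP Q κ ρ := by
    intro y hyb
    rw [mem_ball_iff_norm] at hyb
    have hyd : y ∈ ball (0 : (Fin m → ℂ) × CS m) δ := by
      rw [mem_ball_zero_iff]
      have := norm_le_norm_add_norm_sub' y x
      linarith
    refine ⟨ball_subset_ball (min_le_right _ _) hyd, ?_⟩
    have h1 := hLip y hyd x hxd
    rw [lt_div_iff₀ hL1p] at hyb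
    have h2 := (abs_le.1 h1).1
    rw [hps] at h2; linarith
  have hsl : ∀ k, DifferentiableOn ℂ (fun x => Rn Q κ HH ρ k (e, x)) (OP Q κ ρ) := fun k =>
    (h.R_reg k).hol.comp (f := fun x : (Fin m → ℂ) × CS m => (e, x))
      ((differentiableOn_const _).prodMk differentiableOn_id) fun x hx => ⟨mem_univ _, hx⟩
  have key := iter_bound' (f := fun k x => Rn Q κ HH ρ k (e, x))
    (b := fun x => ((bf Q κ HH ρ (e, x), 0) : (Fin m → ℂ) × CS m)) (Ω := OP Q κ ρ) (a := d / L1) (B := K * ‖e‖)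
    (C := r') (by positivity) h.r'_pos.le (by have := h.Kp; positivity) hsl ?_ ?_ ?_ N hsub
  · refine key.trans (le_of_eq ?_)
    congr 2
    field_simp
  · intro x hx
    simpa [Prod.norm_def, h.Kp.le] using h.b_bound (h.dom.sub hx) e
  · intro x hx
    have h1 := h.small _ (h.pSE (h.dom.sub hx))
    have h2 : ‖S0f Q HH x‖ ≤ ‖HH (pf Q x)‖ := by
      rw [S0f, RCLike.norm_conj]; exact norm_snd_le _
    have := h.r'_pos
    show ‖S0f Q HH x‖ ≤ r'
    linarith
  · intro k x hx
    have hxX : ((e, x) : (Fin m → ℂ) × ((Fin m → ℂ) × CS m)) ∈ OX Q κ ρ := ⟨mem_univ _, hx⟩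
    have h1 := (((h.R_reg k).hol.differentiableAt (h.domX.op.mem_nhds hxX)).hasFDerivAt.comp x
      (hasFDerivAt_prodMk_right (𝕜 := ℂ) e x)).fderiv
    have h2 : (fun x => Rn Q κ HH ρ k (e, x)) = Rn Q κ HH ρ k ∘ fun x => (e, x) := rfl
    beta_reduce
    rw [h2, h1]
    simp only [Rn, bbf, ContinuousLinearMap.coe_comp, Function.comp_apply, ContinuousLinearMap.inr_apply]
    exact h.domX.fd (h.R_reg k).hol hxX _

theorem RPm.Q'_bound (h : RPm M Q r κ Q' r' HH ρ) : ∃ C > 0, ∀ q ∈ ball (0 : (Fin m → ℂ) × CS m) (r' / 2), ‖Q' q‖ ≤ C := by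
  have : ProperSpace ((Fin m → ℂ) × CS m) := FiniteDimensional.proper ℂ _
  obtain ⟨C, hC⟩ := (isCompact_closedBall (0 : (Fin m → ℂ) × CS m) (r' / 2)).exists_bound_of_continuousOn
    (h.hol'.continuousOn.mono (closedBall_subset_ball (by linarith [h.r'_pos])))
  exact ⟨|C| + 1, by positivity, fun q hq => (hC q (ball_subset_closedBall hq)).trans (by linarith [le_abs_self C])⟩

theorem W_bound (hr' : 0 < r') (h : DifferentiableOn ℂ Q' (ball 0 r')) {C : ℝ} (hC0 : 0 ≤ C)
    (hC : ∀ q ∈ ball (0 : (Fin m → ℂ) × CS m) (r' / 2), ‖Q' q‖ ≤ C) {q : (Fin m → ℂ) × CS m} (hq : ‖q‖ < r' / 4)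
    (e : Fin m → ℂ) (N : ℕ) : ‖Wn Q' e N q‖ ≤ C * N.factorial * (8 * Real.exp 1 / r' * ‖e‖) ^ N := by
  have hsub : ball q (r' / 4) ⊆ ball (0 : (Fin m → ℂ) × CS m) (r' / 2) := ball_subset_ball' (by
    rw [dist_zero_right]; linarith)
  refine (iter_bound' (f := Wn Q' e) (b := fun _ => ((e, 0) : (Fin m → ℂ) × CS m)) (B := ‖e‖) (a := r' / 4)
    (by positivity) hC0 (norm_nonneg _)
    (fun k => (Wn_hol h e k).mono (ball_subset_ball (by linarith))) ?_ hC (fun k x _ => rfl) N hsub).trans (le_of_eq ?_)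
  · intro x _; simp [Prod.norm_def]
  · congr 2; field_simp; ring

theorem W_sum (h : DifferentiableOn ℂ Q' (ball 0 r')) {q : (Fin m → ℂ) × CS m} (hq : ‖q‖ < r' / 4)
    {e : Fin m → ℂ} (he : ‖e‖ < r' / 4) :
    HasSum (fun N => (N.factorial : ℂ)⁻¹ * Wn Q' e N q) (Q' (q + (e, 0))) := by
  have hin : ∀ a ∈ ball (0 : ℂ) 2, q + a • ((e, 0) : (Fin m → ℂ) × CS m) ∈ ball (0 : (Fin m → ℂ) × CS m) r' := by
    intro a ha
    rw [mem_ball_zero_iff] at ha ⊢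
    have h1 : ‖a • ((e, 0) : (Fin m → ℂ) × CS m)‖ = ‖a‖ * ‖e‖ := by rw [norm_smul]; simp [Prod.norm_def]
    have := norm_add_le q (a • ((e, 0) : (Fin m → ℂ) × CS m))
    nlinarith [norm_nonneg a, norm_nonneg e]
  have hd : ∀ N, ∀ a ∈ ball (0 : ℂ) 2, iteratedDeriv N (fun a : ℂ => Q' (q + a • ((e, 0) : (Fin m → ℂ) × CS m))) a
      = Wn Q' e N (q + a • ((e, 0) : (Fin m → ℂ) × CS m)) := by
    intro N
    induction N with
    | zero => intro a _; simp [Wn]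
    | succ N ih =>
      intro a ha
      rw [iteratedDeriv_succ]
      have h1 : iteratedDeriv N (fun a : ℂ => Q' (q + a • ((e, 0) : (Fin m → ℂ) × CS m))) =ᶠ[𝓝 a]
          fun a => Wn Q' e N (q + a • ((e, 0) : (Fin m → ℂ) × CS m)) := by
        filter_upwards [isOpen_ball.mem_nhds ha] with a ha using ih a ha
      rw [h1.deriv_eq]
      have h2 : HasDerivAt (fun a : ℂ => q + a • ((e, 0) : (Fin m → ℂ) × CS m)) (e, 0) a := by
        simpa using ((hasDerivAt_id a).smul_const ((e, 0) : (Fin m → ℂ) × CS m)).const_add q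
      exact (((Wn_hol h e N).differentiableAt (isOpen_ball.mem_nhds (hin a ha))).hasFDerivAt.comp_hasDerivAt a h2).deriv
  have h1 : DifferentiableOn ℂ (fun a : ℂ => Q' (q + a • ((e, 0) : (Fin m → ℂ) × CS m))) (ball 0 2) :=
    h.comp (f := fun a : ℂ => q + a • ((e, 0) : (Fin m → ℂ) × CS m)) (by fun_prop) hin
  have h2 := Complex.hasSum_taylorSeries_on_ball h1 (z := 1) (by simp)
  simp only [sub_zero, one_pow, one_smul, smul_eq_mul] at h2
  refine h2.congr_fun fun N => ?_
  rw [hd N 0 (by simp), zero_smul, add_zero, one_mul]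

end PTsec

section PUsec

theorem max_core {X g : ℂ → ℂ} {η η' a B C : ℝ} {N : ℕ} (hη' : η < η') (ha : 0 < a) (ha1 : a ≤ 1) (hB : 0 ≤ B)
    (hC0 : 0 ≤ C)
    (hX : DifferentiableOn ℂ X (ball 0 η')) (hout : ∀ z, ‖z‖ = η → a < ‖X z‖)
    (hgc : ContinuousOn g {z | z ∈ closedBall (0 : ℂ) η ∧ (X z).im ≤ 0})
    (hgd : DifferentiableOn ℂ g {z | z ∈ ball (0 : ℂ) η ∧ (X z).im < 0})
    (hi : ∀ z ∈ ball (0 : ℂ) η, (X z).im < 0 → ‖g z‖ ≤ C * (B / (-(X z).im)) ^ N)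
    (hb : ∀ z ∈ ball (0 : ℂ) η, (X z).im = 0 → ‖g z‖ ≤ C * B ^ N) :
    ∀ z ∈ ball (0 : ℂ) η, ‖X z‖ < a / 2 → (X z).im ≤ 0 → ‖g z‖ ≤ C * (8 * B / (3 * a)) ^ N := by
  intro z hz hXz hIm
  have hBB : B ≤ 8 * B / (3 * a) := by
    rw [le_div_iff₀ (by positivity)]; nlinarith
  rcases hIm.lt_or_eq with hlt | heq
  swap
  · exact (hb z hz heq).trans (by gcongr)
  have hcb : closedBall (0 : ℂ) η ⊆ ball 0 η' := closedBall_subset_ball hη'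
  set D : Set ℂ := {z | z ∈ ball (0 : ℂ) η ∧ ‖X z‖ < a ∧ (X z).im < 0} with hD
  have hXc : ContinuousOn X (closedBall 0 η) := hX.continuousOn.mono hcb
  have hDop : IsOpen D := by
    have := (hX.continuousOn.mono (ball_subset_closedBall.trans hcb)).isOpen_inter_preimage
      (isOpen_ball (x := (0 : ℂ)) (ε := η)) (t := {x : ℂ | ‖x‖ < a} ∩ {x | x.im < 0})
      ((isOpen_lt continuous_norm continuous_const).inter (isOpen_lt continuous_im continuous_const))
    exact this
  have hcl : closure D ⊆ {z | z ∈ closedBall (0 : ℂ) η ∧ ‖X z‖ ≤ a ∧ (X z).im ≤ 0} := by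
    refine closure_minimal (fun z hz => ⟨ball_subset_closedBall hz.1, hz.2.1.le, hz.2.2.le⟩) ?_
    have := hXc.preimage_isClosed_of_isClosed isClosed_closedBall (t := {x : ℂ | ‖x‖ ≤ a} ∩ {x | x.im ≤ 0})
      ((isClosed_le continuous_norm continuous_const).inter (isClosed_le continuous_im continuous_const))
    exact this
  set f : ℂ → ℂ := fun z => (X z ^ 2 - (a : ℂ) ^ 2) ^ N * g z with hf
  have hfd : DiffContOnCl ℂ f D := by
    constructor
    · have h1 : DifferentiableOn ℂ X D := hX.mono fun z hz => hcb (ball_subset_closedBall hz.1)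
      have h2 : DifferentiableOn ℂ g D := hgd.mono fun z hz => ⟨hz.1, hz.2.2⟩
      exact (((h1.pow 2).sub_const _).pow N).mul h2
    · have h1 : ContinuousOn X (closure D) := hXc.mono fun z hz => (hcl hz).1
      have h2 : ContinuousOn g (closure D) := hgc.mono fun z hz => ⟨(hcl hz).1, (hcl hz).2.2⟩
      exact (((h1.pow 2).sub continuousOn_const).pow N).mul h2
  have hfr : ∀ z ∈ frontier D, ‖f z‖ ≤ C * (2 * a * B) ^ N := by
    intro z hz
    rw [hDop.frontier_eq] at hz
    obtain ⟨h1, h2, h3⟩ := hcl hz.1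
    have hzb : z ∈ ball (0 : ℂ) η := by
      rw [mem_ball_zero_iff]
      rw [mem_closedBall_zero_iff] at h1
      exact lt_of_le_of_ne h1 fun h => absurd (hout z h) (not_lt.2 h2)
    simp only [hf, norm_mul, norm_pow]
    rcases h3.lt_or_eq with h4 | h4
    · have h5 : ‖X z‖ = a := le_antisymm h2 (not_lt.1 fun h => hz.2 ⟨hzb, h, h4⟩)
      have h6 : ‖X z ^ 2 - (a : ℂ) ^ 2‖ = 2 * a * (-(X z).im) := by
        have : X z ^ 2 - (a : ℂ) ^ 2 = X z * (X z - starRingEnd ℂ (X z)) := by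
          rw [mul_sub, Complex.mul_conj, Complex.normSq_eq_norm_sq, h5]; push_cast; ring
        rw [this, norm_mul, h5, Complex.sub_conj, norm_mul, norm_I, mul_one, norm_real, Real.norm_eq_abs,
          abs_of_neg (by linarith)]
        ring
      rw [h6]
      have h7 : 0 < -(X z).im := by linarith
      have h8 := hi z hzb h4
      generalize -(X z).im = d at h7 h8 ⊢
      calc (2 * a * d) ^ N * ‖g z‖ ≤ (2 * a * d) ^ N * (C * (B / d) ^ N) := by gcongr
        _ = C * ((2 * a * d) * (B / d)) ^ N := by rw [mul_pow (2 * a * d)]; ring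
        _ = C * (2 * a * B) ^ N := by congr 2; field_simp
    · have h5 : ‖X z ^ 2 - (a : ℂ) ^ 2‖ ≤ 2 * a := by
        refine (norm_sub_le _ _).trans ?_
        rw [norm_pow, norm_pow, norm_real, Real.norm_eq_abs, abs_of_pos ha]
        nlinarith [norm_nonneg (X z)]
      calc ‖X z ^ 2 - (a : ℂ) ^ 2‖ ^ N * ‖g z‖ ≤ (2 * a) ^ N * (C * B ^ N) := by
            gcongr; exact hb z hzb h4
        _ = C * (2 * a * B) ^ N := by rw [mul_pow (2 * a)]; ring
  have hbd : Bornology.IsBounded D := isBounded_ball.subset fun z hz => hz.1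
  have hmax := Complex.norm_le_of_forall_mem_frontier_norm_le hbd hfd hfr
    (subset_closure (⟨hz, by linarith, hlt⟩ : z ∈ D))
  simp only [hf, norm_mul, norm_pow] at hmax
  have hlow : 3 / 4 * a ^ 2 ≤ ‖X z ^ 2 - (a : ℂ) ^ 2‖ := by
    have := norm_sub_norm_le ((a : ℂ) ^ 2) (X z ^ 2)
    rw [norm_sub_rev, norm_pow, norm_pow, norm_real, Real.norm_eq_abs, abs_of_pos ha] at this
    nlinarith [norm_nonneg (X z)]
  have h8 : (3 / 4 * a ^ 2) ^ N * ‖g z‖ ≤ C * (2 * a * B) ^ N := le_trans (by gcongr) hmax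
  have h9 : (0 : ℝ) < (3 / 4 * a ^ 2) ^ N := by positivity
  rw [← le_div_iff₀' h9] at h8
  refine h8.trans (le_of_eq ?_)
  rw [mul_div_assoc, ← div_pow]; congr 2; field_simp; ring

variable {m : ℕ} {M : Set (CS m)} {Q : (Fin m → ℂ) × CS m → ℂ} {r : ℝ} {κ : ℂ}
  {Q' : (Fin m → ℂ) × CS m → ℂ} {r' : ℝ} {HH : CS m → CS m} {ρ K : ℝ}

theorem IsSet.X_lin (h : IsSet M Q r κ) : ∃ δ > 0, δ ≤ r ∧ ∀ w : Fin m → ℂ, ‖w‖ < δ → ∀ z ∈ ball (0 : ℂ) δ,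
    ∀ z' ∈ ball (0 : ℂ) δ, ‖Xf Q κ (w, z) - Xf Q κ (w, z') - κ * (z - z')‖ ≤ 1 / 2 * ‖z - z'‖ := by
  obtain ⟨S, hS, hS'⟩ := h.strict_ct.approximates_deriv_on_nhds (c := 1) (Or.inr one_pos)
  obtain ⟨δ, hδ, hb⟩ := Metric.mem_nhds_iff.1 hS
  refine ⟨min δ r, lt_min hδ h.r_pos, min_le_right _ _, fun w hw z hz z' hz' => ?_⟩
  have hm : ∀ z ∈ ball (0 : ℂ) (min δ r), ((w, z) : CS m) ∈ S := by
    intro z hz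
    refine hb (mem_ball_zero_iff.2 ?_)
    rw [mem_ball_zero_iff] at hz
    exact max_lt (hw.trans_le (min_le_left _ _)) (hz.trans_le (min_le_left _ _))
  have h1 := hS' (w, z) (hm z hz) (w, z') (hm z' hz')
  have e1 : ((w, z) : CS m) - (w, z') = (0, z - z') := by simp
  rw [e1] at h1
  have e2 : ‖((0, z - z') : CS m)‖ = ‖z - z'‖ := by simp [Prod.norm_def]
  rw [e2] at h1
  simp only [NNReal.coe_one, one_mul, ContinuousLinearMap.coe_comp, Function.comp_apply,
    ContinuousLinearMap.coe_restrictScalars', ctL_apply, conjW_zero] at h1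
  rw [fderiv_z] at h1
  have e3 : Xf Q κ (w, z) - Xf Q κ (w, z') - κ * (z - z') =
      starRingEnd ℂ κ / 2 * (Q (conjW w, (w, z)) - Q (conjW w, (w, z')) - Qz Q * (z - z')) := by
    rw [Xf, Xf]; simp only
    linear_combination ((z - z') / 2) * h.kq
  rw [e3, norm_mul, norm_div, RCLike.norm_conj, h.kn]
  norm_num
  linarith

theorem IsQ.X_slice (h : IsQ M Q r) (κ : ℂ) {w : Fin m → ℂ} (hw : ‖w‖ < r) :
    DifferentiableOn ℂ (fun z => Xf Q κ (w, z)) (ball 0 r) := by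
  have := h.slice_hol (ω := conjW w) (by rwa [norm_conjW]) hw
  exact ((differentiableOn_id.const_mul κ).add (this.const_mul _)).div_const 2

theorem RS.unif (h : RS M Q r κ Q' r' HH ρ K) : ∃ δ > 0, δ ≤ ρ ∧ ∃ A > 0, ∃ C > 0, ∀ t ∈ ball (0 : CS m) δ,
    yf Q κ t ≤ 0 → ∀ N e, ‖Rn Q κ HH ρ N (e, (conjW t.1, t))‖ ≤ C * N.factorial * (A * ‖e‖) ^ N := by
  obtain ⟨δ1, hδ1, hδ1ρ, A1, hA1, C1, hC1, hintg⟩ := h.interior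
  obtain ⟨C2, hC2, hQb⟩ := h.Q'_bound
  obtain ⟨δ2, hδ2, hδ2r, hlin⟩ := h.X_lin
  set A := max A1 (8 * Real.exp 1 / r') with hA
  set C := max C1 C2 with hC
  have hAp : 0 < A := lt_max_of_lt_left hA1
  have hCp : 0 < C := lt_max_of_lt_left hC1
  set η' := min (min δ1 δ2) 1 with hη'
  have hη'p : 0 < η' := by positivity
  have hη'1 : η' ≤ δ1 := (min_le_left _ _).trans (min_le_left _ _)
  have hη'2 : η' ≤ δ2 := (min_le_left _ _).trans (min_le_right _ _)
  have hη'3 : η' ≤ 1 := min_le_right _ _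
  set η := η' / 2 with hη
  have hηp : 0 < η := by positivity
  set a := η / 4 with ha
  have hap : 0 < a := by positivity
  have hXc : ContinuousAt (Xf Q κ) 0 := (h.X_smooth κ).continuousOn.continuousAt (ball_mem_nhds _ h.r_pos)
  have hev : ∀ᶠ t in 𝓝 (0 : CS m), ‖Xf Q κ t‖ < a / 2 := by
    refine hXc.norm.eventually_lt continuousAt_const ?_
    rw [h.X_zero, norm_zero]; positivity
  obtain ⟨δ3, hδ3, hX3⟩ := Metric.eventually_nhds_iff_ball.1 hev
  refine ⟨min δ3 η, lt_min hδ3 hηp, (min_le_right _ _).trans (by linarith), 8 * A / (3 * a), by positivity, C, hCp, ?_⟩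
  rintro ⟨w, z0⟩ ht hy N e
  have ht0 := hX3 _ (ball_subset_ball (min_le_left _ _) ht)
  have ht1 : ‖((w, z0) : CS m)‖ < η := (mem_ball_zero_iff.1 ht).trans_le (min_le_right _ _)
  have hw : ‖w‖ < η := (norm_fst_le ((w, z0) : CS m)).trans_lt ht1
  have hz0 : z0 ∈ ball (0 : ℂ) η := mem_ball_zero_iff.2 ((norm_snd_le ((w, z0) : CS m)).trans_lt ht1)
  have hw0 : ‖Xf Q κ (w, 0)‖ < a / 2 := by
    refine hX3 _ (mem_ball_zero_iff.2 (lt_of_le_of_lt ?_ ((mem_ball_zero_iff.1 ht).trans_le (min_le_left _ _))))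
    simp [Prod.norm_def]
  have hball : ∀ z ∈ closedBall (0 : ℂ) η, ((w, z) : CS m) ∈ ball (0 : CS m) δ1 := by
    intro z hz
    rw [mem_closedBall_zero_iff] at hz
    exact mem_ball_zero_iff.2 (max_lt (by linarith) (by linarith))
  have hct : ∀ z ∈ closedBall (0 : ℂ) η, (Xf Q κ (w, z)).im ≤ 0 → ((conjW w, (w, z)) : (Fin m → ℂ) × CS m) ∈ SP Q κ ρ :=
    fun z hz hy => h.ct_mem (t := (w, z)) (ball_subset_ball hδ1ρ (hball z hz)) hy
  have key := max_core (X := fun z => Xf Q κ (w, z)) (g := fun z => Rn Q κ HH ρ N (e, (conjW w, (w, z))))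
    (η := η) (η' := η') (a := a) (B := A * ‖e‖) (C := C * N.factorial) (N := N) (by linarith) hap (by linarith)
    (by positivity) (by positivity)
    ((h.X_slice κ (by linarith)).mono (ball_subset_ball (by linarith))) ?_ ?_ ?_ ?_ ?_ z0 hz0 ht0 hy
  · refine key.trans (le_of_eq ?_); congr 2; ring
  · intro z hz
    have h1 := hlin w (by linarith) z (mem_ball_zero_iff.2 (by linarith)) 0 (mem_ball_self hδ2)
    rw [sub_zero, hz] at h1
    have h2 := norm_sub_norm_le (κ * z) (κ * z - (Xf Q κ (w, z) - Xf Q κ (w, 0)))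
    rw [sub_sub_cancel, norm_mul, h.kn, one_mul, hz, norm_sub_rev (κ * z)] at h2
    have h3 := norm_sub_le (Xf Q κ (w, z)) (Xf Q κ (w, 0))
    beta_reduce
    linarith
  · exact (h.R_reg N).sm.continuousOn.comp (f := fun z => (e, (conjW w, (w, z)))) (by fun_prop)
      fun z hz => ⟨mem_univ _, hct z hz.1 hz.2⟩
  · refine (h.R_reg N).hol.comp (f := fun z => (e, (conjW w, (w, z)))) (by fun_prop) fun z hz => ⟨mem_univ _, ?_⟩
    have hz1 := hball z (ball_subset_closedBall hz.1)
    refine ⟨(hct z (ball_subset_closedBall hz.1) hz.2.le).1, ?_⟩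
    have := h.ref (w, z) (ball_subset_ball hδ1ρ hz1)
    simp only at this
    rw [this, yf]; linarith [hz.2]
  · intro z hz hzy
    refine (hintg (w, z) (hball z (ball_subset_closedBall hz)) hzy N e).trans ?_
    have : 0 < -(Xf Q κ (w, z)).im := by linarith
    rw [yf]
    gcongr
    · exact le_max_left _ _
    · exact le_max_left _ _
  · intro z hz hzy
    have hz1 := ball_subset_ball hδ1ρ (hball z (ball_subset_closedBall hz))
    have hb := h.boundary N e (w, z) hz1 hzy
    simp only at hb
    beta_reduce
    rw [hb]
    have hs := h.small (w, z) ⟨ball_subset_ball h.ρ_le hz1, hzy.ge⟩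
    rw [← norm_conjWt] at hs
    refine (W_bound h.r'_pos h.hol' hC2.le hQb hs e N).trans ?_
    have := h.r'_pos
    gcongr
    · exact le_max_right _ _
    · exact le_max_right _ _

end PUsec

section PVsec

theorem glue_line {f : ℂ → ℂ} {c : ℂ} {R : ℝ} (hc : ContinuousOn f (ball c R))
    (hd : ∀ z ∈ ball c R, z.im ≠ 0 → DifferentiableAt ℂ f z) : DifferentiableOn ℂ f (ball c R) := by
  refine IsExactOn.differentiableOn isOpen_ball (IsConservativeOn.isExactOn_ball hc ?_)
  intro z w hzw
  have hmem : ∀ x ∈ uIcc z.re w.re, ∀ y ∈ uIcc z.im w.im, (x + y * I : ℂ) ∈ ball c R := by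
    intro x hx y hy
    apply hzw
    rw [Rectangle, mem_reProdIm]
    simpa using ⟨hx, hy⟩
  -- boundary integral over a subrectangle that does not cross the axis
  have hsub : ∀ p ∈ uIcc z.im w.im, ∀ q ∈ uIcc z.im w.im, (0 ∉ Ioo (min p q) (max p q)) →
      ((∫ x : ℝ in z.re..w.re, f (x + p * I)) - ∫ x : ℝ in z.re..w.re, f (x + q * I)) +
        I • (∫ y : ℝ in p..q, f (w.re + y * I)) - I • ∫ y : ℝ in p..q, f (z.re + y * I) = 0 := by
    intro p hp q hq h0
    have hpq : uIcc p q ⊆ uIcc z.im w.im := uIcc_subset_uIcc hp hq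
    have := integral_boundary_rect_eq_zero_of_continuousOn_of_differentiableOn f (z.re + p * I) (w.re + q * I) ?_ ?_
    · simpa using this
    · refine hc.mono fun u hu => ?_
      rw [mem_reProdIm] at hu
      have := hmem u.re (by simpa using hu.1) u.im (hpq (by simpa using hu.2))
      rwa [re_add_im] at this
    · intro u hu
      rw [mem_reProdIm] at hu
      simp only [add_re, ofReal_re, mul_re, I_re, mul_zero, ofReal_im, I_im, mul_one, sub_self, add_zero, add_im,
        mul_im, zero_add] at hu
      have := hmem u.re (Ioo_subset_Icc_self hu.1) u.im (hpq (Ioo_subset_Icc_self hu.2))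
      rw [re_add_im] at this
      exact (hd u this fun h => h0 (h ▸ hu.2)).differentiableWithinAt
  have e1 : z.wedgeIntegral w f + w.wedgeIntegral z f =
      ((∫ x : ℝ in z.re..w.re, f (x + z.im * I)) - ∫ x : ℝ in z.re..w.re, f (x + w.im * I)) +
        I • (∫ y : ℝ in z.im..w.im, f (w.re + y * I)) - I • ∫ y : ℝ in z.im..w.im, f (z.re + y * I) := by
    rw [wedgeIntegral, wedgeIntegral, intervalIntegral.integral_symm z.re w.re, intervalIntegral.integral_symm z.im w.im,
      smul_neg]
    ring
  rw [eq_neg_iff_add_eq_zero, e1]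
  by_cases h0 : (0 : ℝ) ∈ Ioo (min z.im w.im) (max z.im w.im)
  swap
  · exact hsub _ left_mem_uIcc _ right_mem_uIcc h0
  have h0' : (0 : ℝ) ∈ uIcc z.im w.im := Ioo_subset_Icc_self h0
  have hA := hsub z.im left_mem_uIcc 0 h0' (by
    rintro ⟨h1, h2⟩
    rcases min_lt_iff.1 h1 with h | h <;> rcases lt_max_iff.1 h2 with h' | h' <;> linarith)
  have hB := hsub 0 h0' w.im right_mem_uIcc (by
    rintro ⟨h1, h2⟩
    rcases min_lt_iff.1 h1 with h | h <;> rcases lt_max_iff.1 h2 with h' | h' <;> linarith)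
  have hii : ∀ x ∈ uIcc z.re w.re, ∀ p ∈ uIcc z.im w.im, ∀ q ∈ uIcc z.im w.im,
      IntervalIntegrable (fun y : ℝ => f (x + y * I)) MeasureTheory.volume p q := by
    intro x hx p hp q hq
    refine (hc.comp (f := fun y : ℝ => (x + y * I : ℂ)) (by fun_prop) ?_).intervalIntegrable
    exact fun y hy => hmem x hx y (uIcc_subset_uIcc hp hq hy)
  have i1 := intervalIntegral.integral_add_adjacent_intervals
    (hii _ right_mem_uIcc _ left_mem_uIcc _ h0') (hii _ right_mem_uIcc _ h0' _ right_mem_uIcc)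
  have i2 := intervalIntegral.integral_add_adjacent_intervals
    (hii _ left_mem_uIcc _ left_mem_uIcc _ h0') (hii _ left_mem_uIcc _ h0' _ right_mem_uIcc)
  rw [← i1, ← i2]
  simp only [smul_eq_mul] at hA hB ⊢
  linear_combination hA + hB

theorem glue_curve {f X : ℂ → ℂ} {U : Set ℂ} (hU : IsOpen U) (hX : DifferentiableOn ℂ X U)
    (hX' : ∀ z ∈ U, deriv X z ≠ 0) (hc : ContinuousOn f U)
    (hd : ∀ z ∈ U, (X z).im ≠ 0 → DifferentiableAt ℂ f z) : DifferentiableOn ℂ f U := by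
  intro x hx
  refine DifferentiableAt.differentiableWithinAt ?_
  have hXx : ContDiffAt ℂ 1 X x := (hol_contDiffOn hU 1 hX).contDiffAt (hU.mem_nhds hx)
  have hXd : HasStrictDerivAt X (deriv X x) x := hXx.hasStrictDerivAt (by norm_num)
  have hXe := hXd.hasStrictFDerivAt_equiv (hX' x hx)
  set g := hXe.localInverse X _ x with hg
  have hg1 : ∀ᶠ z in 𝓝 x, g (X z) = z := hXe.eventually_left_inverse
  have hg2 : ∀ᶠ u in 𝓝 (X x), X (g u) = u := hXe.eventually_right_inverse
  have hgx : g (X x) = x := hXe.localInverse_apply_image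
  have hgc : ContDiffAt ℂ 1 g (X x) := hXx.to_localInverse hXe.hasFDerivAt (by norm_num)
  have hg3 : ∀ᶠ u in 𝓝 (X x), DifferentiableAt ℂ g u := by
    filter_upwards [hgc.eventually (by norm_num)] with u hu using hu.differentiableAt (by norm_num)
  have hg4 : ∀ᶠ u in 𝓝 (X x), g u ∈ U := by
    refine hgc.continuousAt.eventually_mem ?_
    rw [hgx]; exact hU.mem_nhds hx
  obtain ⟨R, hR, hb⟩ := Metric.eventually_nhds_iff_ball.1 ((hg2.and hg3).and hg4)
  have hF : DifferentiableOn ℂ (fun u => f (g u)) (ball (X x) R) := by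
    apply glue_line
    · exact hc.comp (fun u hu => (hb u hu).1.2.continuousAt.continuousWithinAt) fun u hu => (hb u hu).2
    · intro u hu hi
      refine DifferentiableAt.comp (g := f) u (hd _ (hb u hu).2 ?_) (hb u hu).1.2
      rwa [(hb u hu).1.1]
  have h1 : DifferentiableAt ℂ (fun z => f (g (X z))) x :=
    DifferentiableAt.comp (g := fun u => f (g u)) x (hF.differentiableAt (isOpen_ball.mem_nhds (mem_ball_self hR)))
      (hX.differentiableAt (hU.mem_nhds hx))
  refine h1.congr_of_eventuallyEq ?_
  filter_upwards [hg1] with z hz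
  rw [hz]

variable {m : ℕ} {M : Set (CS m)} {Q : (Fin m → ℂ) × CS m → ℂ} {r : ℝ} {κ : ℂ}
  {Q' : (Fin m → ℂ) × CS m → ℂ} {r' : ℝ} {HH : CS m → CS m} {ρ K : ℝ}

def Fser (Q : (Fin m → ℂ) × CS m → ℂ) (κ : ℂ) (HH : CS m → CS m) (ρ : ℝ) (l : Fin m → ℂ) (t : CS m) : ℂ :=
  ∑' N : ℕ, (N.factorial : ℂ)⁻¹ * Rn Q κ HH ρ N (l - Gf Q HH (conjW t.1, t), (conjW t.1, t))

open Classical in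
def Phi (Q : (Fin m → ℂ) × CS m → ℂ) (κ : ℂ) (Q' : (Fin m → ℂ) × CS m → ℂ) (HH : CS m → CS m) (ρ : ℝ)
    (l : Fin m → ℂ) (t : CS m) : ℂ :=
  if yf Q κ t ≤ 0 then Fser Q κ HH ρ l t else Q' (l, HH t)

theorem RPm.G_zero (h : RPm M Q r κ Q' r' HH ρ) : Gf Q HH 0 = 0 := by
  rw [Gf, h.pf_zero, h.H0, Prod.fst_zero, conjW_zero]

theorem RS.phi (h : RS M Q r κ Q' r' HH ρ K) : ∃ δ > 0, δ ≤ ρ ∧ δ ≤ r' / 8 ∧ ∃ C, ∀ l : Fin m → ℂ, ‖l‖ < δ →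
    (∀ t ∈ ball (0 : CS m) δ, ‖Phi Q κ Q' HH ρ l t‖ ≤ C) ∧
    (∀ t ∈ ball (0 : CS m) δ, 0 ≤ yf Q κ t → Phi Q κ Q' HH ρ l t = Q' (l, HH t)) ∧
    (∀ w : Fin m → ℂ, ‖w‖ < δ → DifferentiableOn ℂ (fun z => Phi Q κ Q' HH ρ l (w, z)) (ball 0 δ)) := by
  obtain ⟨δ1, hδ1, hδ1ρ, A, hA, C1, hC1, hun⟩ := h.unif
  obtain ⟨C2, hC2, hQb⟩ := h.Q'_bound
  obtain ⟨δ2, hδ2, hδ2r, hlin⟩ := h.X_lin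
  have hr' := h.r'_pos
  set σ := min (1 / (4 * A)) (r' / 8) with hσ
  have hσp : 0 < σ := by positivity
  obtain ⟨δ3, hδ3, hG3⟩ := Metric.continuousWithinAt_iff.1 (h.G_reg.sm.continuousOn 0 h.zero_mem) σ hσp
  simp only [dist_zero_right, h.G_zero] at hG3
  set δ := min (min δ1 δ2) (min δ3 σ) with hδ
  have hδp : 0 < δ := by positivity
  have hd1 : δ ≤ δ1 := (min_le_left _ _).trans (min_le_left _ _)
  have hd2 : δ ≤ δ2 := (min_le_left _ _).trans (min_le_right _ _)
  have hd3 : δ ≤ δ3 := (min_le_right _ _).trans (min_le_left _ _)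
  have hd4 : δ ≤ σ := (min_le_right _ _).trans (min_le_right _ _)
  have hd5 : δ ≤ r' / 8 := hd4.trans (min_le_right _ _)
  have hdρ : δ ≤ ρ := hd1.trans hδ1ρ
  have hdr : δ ≤ r := hdρ.trans h.ρ_le
  refine ⟨δ, hδp, hdρ, hd5, max (2 * C1) C2, fun l hl => ?_⟩
  have he : ∀ t ∈ ball (0 : CS m) δ, yf Q κ t ≤ 0 → ‖l - Gf Q HH (conjW t.1, t)‖ < 2 * σ := by
    intro t ht hy
    have h1 := hG3 (h.ct_mem (ball_subset_ball hdρ ht) hy)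
      (by rw [norm_conjWt]; exact (mem_ball_zero_iff.1 ht).trans_le hd3)
    have := norm_sub_le l (Gf Q HH (conjW t.1, t))
    linarith
  have hterm : ∀ N : ℕ, ∀ t ∈ ball (0 : CS m) δ, yf Q κ t ≤ 0 →
      ‖(N.factorial : ℂ)⁻¹ * Rn Q κ HH ρ N (l - Gf Q HH (conjW t.1, t), (conjW t.1, t))‖ ≤ C1 * (1 / 2) ^ N := by
    intro N t ht hy
    have h1 := hun t (ball_subset_ball hd1 ht) hy N (l - Gf Q HH (conjW t.1, t))
    have h2 : A * ‖l - Gf Q HH (conjW t.1, t)‖ ≤ 1 / 2 := by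
      have h3 := he t ht hy
      have h4 : A * (2 * σ) ≤ A * (2 * (1 / (4 * A))) := by gcongr; exact min_le_left _ _
      have h5 : A * (2 * (1 / (4 * A))) = 1 / 2 := by field_simp; norm_num
      nlinarith
    have hf : (0 : ℝ) < N.factorial := by positivity
    rw [norm_mul, norm_inv, norm_natCast, inv_mul_le_iff₀ hf]
    refine h1.trans ?_
    calc C1 * N.factorial * (A * ‖l - Gf Q HH (conjW t.1, t)‖) ^ N ≤ C1 * N.factorial * (1 / 2) ^ N := by gcongr
      _ = N.factorial * (C1 * (1 / 2) ^ N) := by ring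
  have hsum : Summable fun N : ℕ => C1 * (1 / 2 : ℝ) ^ N := summable_geometric_two.mul_left C1
  have hq : ∀ t ∈ ball (0 : CS m) δ, 0 ≤ yf Q κ t →
      ((l, HH t) : (Fin m → ℂ) × CS m) ∈ ball (0 : (Fin m → ℂ) × CS m) (r' / 2) := by
    intro t ht hy
    have h1 := h.small t ⟨ball_subset_ball hdr ht, hy⟩
    exact mem_ball_zero_iff.2 (max_lt (by linarith) (by linarith))
  have hup : ∀ t ∈ ball (0 : CS m) δ, 0 ≤ yf Q κ t → Phi Q κ Q' HH ρ l t = Q' (l, HH t) := by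
    intro t ht hy
    rw [Phi]
    split_ifs with hy2
    swap
    · rfl
    have hy0 : yf Q κ t = 0 := le_antisymm hy2 hy
    have hs := h.small t ⟨ball_subset_ball hdr ht, hy⟩
    rw [← norm_conjWt] at hs
    have he' := he t ht hy2
    rw [h.G_M (ball_subset_ball hdr ht) hy0] at he'
    have hW := W_sum h.hol' hs (e := l - conjW (HH t).1) (by
      have : σ ≤ r' / 8 := min_le_right _ _
      linarith)
    rw [Fser, h.G_M (ball_subset_ball hdr ht) hy0]
    simp only [h.boundary _ _ t (ball_subset_ball hdρ ht) hy0]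
    rw [hW.tsum_eq]
    congr 1
    simp
  refine ⟨?_, hup, ?_⟩
  · intro t ht
    by_cases hy : yf Q κ t ≤ 0
    · rw [Phi, if_pos hy, Fser]
      refine (tsum_of_norm_bounded (summable_geometric_two.hasSum.mul_left C1) fun N => hterm N t ht hy).trans ?_
      rw [tsum_geometric_two, mul_comm]; exact le_max_left _ _
    · push Not at hy
      rw [hup t ht hy.le]
      exact (hQb _ (hq t ht hy.le)).trans (le_max_right _ _)
  intro w hw
  have hwz : ∀ z ∈ ball (0 : ℂ) δ, ((w, z) : CS m) ∈ ball (0 : CS m) δ := fun z hz =>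
    mem_ball_zero_iff.2 (max_lt hw (mem_ball_zero_iff.1 hz))
  have hXd : DifferentiableOn ℂ (fun z => Xf Q κ (w, z)) (ball 0 δ) :=
    (h.X_slice κ (hw.trans_le hdr)).mono (ball_subset_ball hdr)
  have hop1 : IsOpen {z | z ∈ ball (0 : ℂ) δ ∧ yf Q κ (w, z) < 0} :=
    hXd.continuousOn.isOpen_inter_preimage isOpen_ball (isOpen_lt continuous_im continuous_const)
  have hop2 : IsOpen {z | z ∈ ball (0 : ℂ) δ ∧ 0 < yf Q κ (w, z)} :=
    hXd.continuousOn.isOpen_inter_preimage isOpen_ball (isOpen_lt continuous_const continuous_im)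
  have hcA : ContinuousOn (fun z => Phi Q κ Q' HH ρ l (w, z)) {z | z ∈ ball (0 : ℂ) δ ∧ yf Q κ (w, z) ≤ 0} := by
    have hG : ContinuousOn (fun z => Gf Q HH (conjW w, (w, z))) {z | z ∈ ball (0 : ℂ) δ ∧ yf Q κ (w, z) ≤ 0} :=
      h.G_reg.sm.continuousOn.comp (f := fun z => (conjW w, (w, z))) (by fun_prop)
        fun z hz => h.ct_mem (t := (w, z)) (ball_subset_ball hdρ (hwz z hz.1)) hz.2
    have : ContinuousOn (fun z => Fser Q κ HH ρ l (w, z)) {z | z ∈ ball (0 : ℂ) δ ∧ yf Q κ (w, z) ≤ 0} := by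
      refine continuousOn_tsum (fun N => continuousOn_const.mul ?_) hsum fun N z hz => hterm N _ (hwz z hz.1) hz.2
      exact (h.R_reg N).sm.continuousOn.comp (f := fun z => (l - Gf Q HH (conjW w, (w, z)), (conjW w, (w, z))))
        ((continuousOn_const.sub hG).prodMk (by fun_prop))
        fun z hz => ⟨mem_univ _, h.ct_mem (t := (w, z)) (ball_subset_ball hdρ (hwz z hz.1)) hz.2⟩
    refine this.congr fun z hz => ?_
    simp only [Phi]; rw [if_pos hz.2]
  have hcB : ContinuousOn (fun z => Phi Q κ Q' HH ρ l (w, z)) {z | z ∈ ball (0 : ℂ) δ ∧ 0 ≤ yf Q κ (w, z)} := by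
    have : ContinuousOn (fun z => Q' (l, HH (w, z))) {z | z ∈ ball (0 : ℂ) δ ∧ 0 ≤ yf Q κ (w, z)} := by
      refine h.hol'.continuousOn.comp (f := fun z => (l, HH (w, z))) (continuousOn_const.prodMk ?_)
        fun z hz => ball_subset_ball (by linarith) (hq _ (hwz z hz.1) hz.2)
      exact h.reg.sm.continuousOn.comp (f := fun z => (w, z)) (by fun_prop)
        fun z hz => ⟨ball_subset_ball hdr (hwz z hz.1), hz.2⟩
    exact this.congr fun z hz => hup _ (hwz z hz.1) hz.2
  have hdA : DifferentiableOn ℂ (fun z => Phi Q κ Q' HH ρ l (w, z)) {z | z ∈ ball (0 : ℂ) δ ∧ yf Q κ (w, z) < 0} := by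
    have hm : ∀ z ∈ {z | z ∈ ball (0 : ℂ) δ ∧ yf Q κ (w, z) < 0},
        ((conjW w, (w, z)) : (Fin m → ℂ) × CS m) ∈ OP Q κ ρ := by
      intro z hz
      have h1 := ball_subset_ball hdρ (hwz z hz.1)
      refine ⟨(h.ct_mem (t := (w, z)) h1 hz.2.le).1, ?_⟩
      have := h.ref (w, z) h1
      simp only at this
      rw [this]; linarith [hz.2]
    have hG : DifferentiableOn ℂ (fun z => Gf Q HH (conjW w, (w, z))) {z | z ∈ ball (0 : ℂ) δ ∧ yf Q κ (w, z) < 0} :=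
      h.G_reg.hol.comp (f := fun z => (conjW w, (w, z))) (by fun_prop) hm
    have : DifferentiableOn ℂ (fun z => Fser Q κ HH ρ l (w, z)) {z | z ∈ ball (0 : ℂ) δ ∧ yf Q κ (w, z) < 0} := by
      refine differentiableOn_tsum_of_summable_norm hsum (fun N => DifferentiableOn.const_mul ?_ _) hop1
        fun N z hz => hterm N _ (hwz z hz.1) hz.2.le
      exact (h.R_reg N).hol.comp (f := fun z => (l - Gf Q HH (conjW w, (w, z)), (conjW w, (w, z))))
        ((hG.const_sub _).prodMk (by fun_prop)) fun z hz => ⟨mem_univ _, hm z hz⟩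
    refine this.congr fun z hz => ?_
    simp only [Phi]; rw [if_pos hz.2.le]
  have hdB : DifferentiableOn ℂ (fun z => Phi Q κ Q' HH ρ l (w, z)) {z | z ∈ ball (0 : ℂ) δ ∧ 0 < yf Q κ (w, z)} := by
    have : DifferentiableOn ℂ (fun z => Q' (l, HH (w, z))) {z | z ∈ ball (0 : ℂ) δ ∧ 0 < yf Q κ (w, z)} := by
      refine h.hol'.comp (f := fun z => (l, HH (w, z))) ((differentiableOn_const _).prodMk ?_)
        fun z hz => ball_subset_ball (by linarith) (hq _ (hwz z hz.1) hz.2.le)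
      exact h.reg.hol.comp (f := fun z => (w, z)) (by fun_prop)
        fun z hz => ⟨ball_subset_ball hdr (hwz z hz.1), hz.2⟩
    exact this.congr fun z hz => hup _ (hwz z hz.1) hz.2.le
  refine glue_curve isOpen_ball hXd ?_ ?_ ?_
  · intro z hz h0
    have hLip : LipschitzOnWith (1 / 2) (fun z => Xf Q κ (w, z) - κ * z) (ball 0 δ) := by
      refine LipschitzOnWith.of_dist_le_mul fun a ha b hb => ?_
      rw [dist_eq_norm, dist_eq_norm]
      have := hlin w (hw.trans_le hd2) a (ball_subset_ball hd2 ha) b (ball_subset_ball hd2 hb)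
      rw [show Xf Q κ (w, a) - κ * a - (Xf Q κ (w, b) - κ * b) = Xf Q κ (w, a) - Xf Q κ (w, b) - κ * (a - b) by ring]
      simpa using this
    have h1 := norm_deriv_le_of_lipschitzOn (isOpen_ball.mem_nhds hz) hLip
    have h2 : HasDerivAt (fun z => Xf Q κ (w, z) - κ * z) (deriv (fun z => Xf Q κ (w, z)) z - κ * 1) z :=
      (hXd.differentiableAt (isOpen_ball.mem_nhds hz)).hasDerivAt.fun_sub ((hasDerivAt_id z).const_mul κ)
    rw [h2.deriv, h0, zero_sub, norm_neg, mul_one, h.kn] at h1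
    norm_num at h1
  · intro z hz
    rcases lt_trichotomy (yf Q κ (w, z)) 0 with hy | hy | hy
    · exact (hdA.differentiableAt (hop1.mem_nhds ⟨hz, hy⟩)).continuousAt.continuousWithinAt
    · refine ((hcA z ⟨hz, hy.le⟩).union (hcB z ⟨hz, hy.ge⟩)).mono fun u hu => ?_
      rcases le_total (yf Q κ (w, u)) 0 with h1 | h1
      · exact Or.inl ⟨hu, h1⟩
      · exact Or.inr ⟨hu, h1⟩
    · exact (hdB.differentiableAt (hop2.mem_nhds ⟨hz, hy⟩)).continuousAt.continuousWithinAt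
  · intro z hz hi
    rcases lt_or_gt_of_ne hi with hy | hy
    · exact hdA.differentiableAt (hop1.mem_nhds ⟨hz, hy⟩)
    · exact hdB.differentiableAt (hop2.mem_nhds ⟨hz, hy⟩)

end PVsec

section PWsec
variable {m : ℕ} {M : Set (CS m)} {Q : (Fin m → ℂ) × CS m → ℂ} {r : ℝ} {κ : ℂ}
  {Q' : (Fin m → ℂ) × CS m → ℂ} {r' : ℝ} {HH : CS m → CS m} {ρ K : ℝ}

theorem RS.hol_ext (h : RS M Q r κ Q' r' HH ρ K) : ∃ δ > 0, δ ≤ ρ ∧ δ ≤ r' / 8 ∧ ∃ Ψ : (Fin m → ℂ) × CS m → ℂ,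
    DifferentiableOn ℂ Ψ (ball 0 δ ×ˢ ball 0 δ) ∧
    ∀ l ∈ ball (0 : Fin m → ℂ) δ, ∀ t ∈ ball (0 : CS m) δ, yf Q κ t = 0 → Ψ (l, t) = Q' (l, HH t) := by
  obtain ⟨δ, hδ, hδρ, hδr', C, hΦ⟩ := h.phi
  have hδr : δ ≤ r := hδρ.trans h.ρ_le
  set s := δ / 4 with hs
  have hsp : 0 < s := by positivity
  set zc : ℂ := s * (I * starRingEnd ℂ κ) with hzc
  have hzcn : ‖zc‖ = s := by
    rw [hzc, norm_mul, norm_mul, norm_I, RCLike.norm_conj, h.kn, norm_real, Real.norm_eq_abs, abs_of_pos hsp]; ring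
  have hsn : s • nv m κ = (0, zc) := by
    rw [nv, hzc]; ext <;> simp
  have hzcr : ((0, zc) : CS m) ∈ ball (0 : CS m) r := by
    rw [mem_ball_zero_iff]
    refine max_lt (by simpa using h.r_pos) ?_
    simp only; rw [hzcn]; linarith
  have hzcO : ((0, zc) : CS m) ∈ OE Q κ r := by
    refine ⟨hzcr, ?_⟩
    have := h.dir 0 (mem_ball_self h.r_pos) s (by rw [zero_add, hsn]; exact hzcr)
    rw [zero_add, hsn, h.y_zero, abs_of_pos hsp] at this
    have := (abs_le.1 this).1
    linarith
  obtain ⟨ε, hε, hball⟩ := Metric.isOpen_iff.1 h.domE.op _ hzcO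
  set ε' := min ε δ with hε'
  have hε'p : 0 < ε' := by positivity
  set V : Set ((Fin m → ℂ) × (Fin m → ℂ)) := ball 0 δ ×ˢ ball 0 ε' with hV
  have hball2 : ball zc (2 * s) ⊆ ball (0 : ℂ) δ := ball_subset_ball' (by
    rw [dist_zero_right, hzcn]; linarith)
  have hproper : ProperSpace ((Fin m → ℂ) × (Fin m → ℂ)) := FiniteDimensional.proper ℂ _
  have hH := hartogs_extend (P := (Fin m → ℂ) × (Fin m → ℂ)) (V := V) (isOpen_ball.prod isOpen_ball) (zc := zc)
    (R := 2 * s) (r := min ε (2 * s)) (C := C) (by positivity)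
    (f := fun q => Phi Q κ Q' HH ρ q.1.1 (q.1.2, q.2)) ?_ ?_ ?_
  · refine ⟨min ε' s, by positivity, (min_le_left _ _).trans ((min_le_right _ _).trans hδρ),
      (min_le_left _ _).trans ((min_le_right _ _).trans hδr'), fun q => Phi Q κ Q' HH ρ q.1 q.2, ?_, ?_⟩
    · refine hH.comp (f := fun q : (Fin m → ℂ) × CS m => ((q.1, q.2.1), q.2.2)) (by fun_prop) ?_
      rintro ⟨l, w, z⟩ ⟨hl, ht⟩
      rw [mem_ball_zero_iff] at hl ht
      have hw : ‖w‖ < min ε' s := (norm_fst_le ((w, z) : CS m)).trans_lt ht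
      have hz : ‖z‖ < min ε' s := (norm_snd_le ((w, z) : CS m)).trans_lt ht
      refine ⟨⟨mem_ball_zero_iff.2 (hl.trans_le ((min_le_left _ _).trans (min_le_right _ _))),
        mem_ball_zero_iff.2 (hw.trans_le (min_le_left _ _))⟩, ?_⟩
      rw [mem_ball_iff_norm]
      have h1 := norm_sub_le z zc
      have h2 := hz.trans_le (min_le_right _ _)
      simp only
      linarith
    · intro l hl t ht hy
      have hle : min ε' s ≤ δ := (min_le_left _ _).trans (min_le_right _ _)
      exact (hΦ l ((mem_ball_zero_iff.1 hl).trans_le hle)).2.1 t (ball_subset_ball hle ht) hy.ge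
  · rintro ⟨l, w⟩ ⟨hl, hw⟩
    exact ((hΦ l (mem_ball_zero_iff.1 hl)).2.2 w ((mem_ball_zero_iff.1 hw).trans_le (min_le_right _ _))).mono hball2
  · rintro ⟨l, w⟩ ⟨hl, hw⟩ z hz
    refine (hΦ l (mem_ball_zero_iff.1 hl)).1 (w, z) (mem_ball_zero_iff.2 (max_lt ?_ ?_))
    · exact (mem_ball_zero_iff.1 hw).trans_le (min_le_right _ _)
    · exact mem_ball_zero_iff.1 (hball2 hz)
  · have hO : ∀ q ∈ V ×ˢ ball zc (min ε (2 * s)), ((q.1.2, q.2) : CS m) ∈ OE Q κ r := by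
      rintro ⟨⟨l, w⟩, z⟩ ⟨⟨hl, hw⟩, hz⟩
      refine hball (mem_ball_iff_norm.2 (max_lt ?_ ?_))
      · simpa using (mem_ball_zero_iff.1 hw).trans_le (min_le_left _ _)
      · exact (mem_ball_iff_norm.1 hz).trans_le (min_le_left _ _)
    have h1 : DifferentiableOn ℂ (fun q : ((Fin m → ℂ) × (Fin m → ℂ)) × ℂ => Q' (q.1.1, HH (q.1.2, q.2)))
        (V ×ˢ ball zc (min ε (2 * s))) := by
      have h2 : DifferentiableOn ℂ (fun q : ((Fin m → ℂ) × (Fin m → ℂ)) × ℂ => HH (q.1.2, q.2))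
          (V ×ˢ ball zc (min ε (2 * s))) :=
        h.reg.hol.comp (f := fun q : ((Fin m → ℂ) × (Fin m → ℂ)) × ℂ => ((q.1.2, q.2) : CS m)) (by fun_prop) hO
      refine h.hol'.comp (f := fun q : ((Fin m → ℂ) × (Fin m → ℂ)) × ℂ => (q.1.1, HH (q.1.2, q.2)))
        (DifferentiableOn.prodMk (by fun_prop) h2) ?_
      intro q hq
      have h3 := h.small _ (h.domE.sub (hO q hq))
      have h4 := mem_ball_zero_iff.1 hq.1.1
      have := h.r'_pos
      exact mem_ball_zero_iff.2 (max_lt (by simp only; linarith) (by simp only; linarith))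
    refine h1.congr ?_
    intro q hq
    have hO' := hO q hq
    refine (hΦ q.1.1 (mem_ball_zero_iff.1 hq.1.1)).2.1 (q.1.2, q.2) (mem_ball_zero_iff.2 (max_lt ?_ ?_)) hO'.2.le
    · exact (mem_ball_zero_iff.1 hq.1.2).trans_le (min_le_right _ _)
    · exact mem_ball_zero_iff.1 (hball2 (ball_subset_ball (min_le_right _ _) hq.2))

theorem theta_isQ {d : DefData m} (hd : d.IsDefiningSeriesOf M) :
    IsQ M (fun q : (Fin m → ℂ) × CS m => ThetaSum d.Θ q.1 q.2) d.r := by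
  have hr : 0 < d.r := hd.1
  refine ⟨hr, (theta_hol hd).mono ?_, theta_zero_zero hd, hd.2.2.2.2.2⟩
  intro q hq
  rw [mem_ball_zero_iff] at hq
  exact ⟨mem_ball_zero_iff.2 ((norm_fst_le q).trans_lt hq),
    mem_ball_zero_iff.2 (((norm_snd_le q).trans_lt hq).trans (by linarith))⟩

theorem coeff_ext {d' : DefData m} {M' : Set (CS m)} (hd' : d'.IsDefiningSeriesOf M')
    {δ : ℝ} (hδ : 0 < δ) (hδr : δ ≤ d'.r) {Ψ : (Fin m → ℂ) × CS m → ℂ}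
    (hΨ : DifferentiableOn ℂ Ψ (ball 0 δ ×ˢ ball 0 δ)) (β : Fin m → ℕ) :
    ∃ ψ : CS m → ℂ, DifferentiableOn ℂ ψ (ball 0 δ) ∧ ∀ t ∈ ball (0 : CS m) δ, ∀ t' ∈ ball (0 : CS m) (2 * d'.r),
      (∀ l ∈ ball (0 : Fin m → ℂ) δ, Ψ (l, t) = ThetaSum d'.Θ l t') → ψ t = d'.Θ β t' := by
  have hproper : ProperSpace (CS m) := FiniteDimensional.proper ℂ _
  set s := δ / 2 with hs
  have hsp : 0 < s := by positivity
  set T : Set (Fin m → ℝ) := Set.pi univ (fun _ : Fin m => Icc (0 : ℝ) (2 * Real.pi)) with hT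
  have hTc : IsCompact T := isCompact_univ_pi fun _ => isCompact_Icc
  have hl : ∀ θ : Fin m → ℝ, (fun j => (s : ℂ) * Complex.exp (θ j * I)) ∈ ball (0 : Fin m → ℂ) δ := by
    intro θ
    rw [mem_ball_zero_iff, pi_norm_lt_iff hδ]
    intro j
    rw [norm_mul, norm_exp_ofReal_mul_I, norm_real, Real.norm_eq_abs, abs_of_pos hsp]; linarith
  have hintg : DifferentiableOn ℂ (fun t => ∫ θ in T, (∏ j, Complex.exp (-(β j * θ j * I))) *
      Ψ ((fun j => (s : ℂ) * Complex.exp (θ j * I)), t)) (ball 0 δ) := by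
    refine hol_param_integral (μ := MeasureTheory.volume) hTc isOpen_ball
      (f := fun (θ : Fin m → ℝ) t => (∏ j, Complex.exp (-(β j * θ j * I))) *
        Ψ ((fun j => (s : ℂ) * Complex.exp (θ j * I)), t)) ?_ ?_
    · refine ContinuousOn.mul (by fun_prop) ?_
      exact hΨ.continuousOn.comp (f := fun q : (Fin m → ℝ) × CS m => ((fun j => (s : ℂ) * Complex.exp (q.1 j * I)), q.2))
        (by fun_prop) fun q hq => ⟨hl q.1, hq.2⟩
    · intro θ _
      refine DifferentiableOn.const_mul ?_ _
      exact hΨ.comp (f := fun t : CS m => ((fun j => (s : ℂ) * Complex.exp (θ j * I)), t))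
        (by fun_prop) fun q hq => ⟨hl θ, hq⟩
  refine ⟨fun t => ((2 * Real.pi) ^ m * s ^ mdeg β : ℂ)⁻¹ * ∫ θ in T, (∏ j, Complex.exp (-(β j * θ j * I))) *
      Ψ ((fun j => (s : ℂ) * Complex.exp (θ j * I)), t), hintg.const_mul _, ?_⟩
  intro t ht t' ht' heq
  have hsum : Summable fun α : Fin m → ℕ => s ^ mdeg α * ‖d'.Θ α t'‖ := by
    have hr := hd'.1
    have hC := hd'.2.1
    refine Summable.of_nonneg_of_le (fun α => by positivity) (fun α => ?_)
      ((summable_mdeg (m := m) (x := 1 / 2) (by norm_num) (by norm_num)).mul_left d'.C)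
    calc s ^ mdeg α * ‖d'.Θ α t'‖ ≤ d'.r ^ mdeg α * (d'.C / (2 * d'.r) ^ mdeg α) := by
          gcongr
          · linarith
          · exact hd'.2.2.2.1 α t' ht'
      _ = d'.C * (1 / 2) ^ mdeg α := by rw [mul_pow, div_pow, one_pow]; field_simp
  have h1 := torus_coeff hsp hsum β
  have h2 : ∀ θ : Fin m → ℝ, Ψ ((fun j => (s : ℂ) * Complex.exp (θ j * I)), t) =
      ∑' α, mpow (fun j => (s : ℂ) * Complex.exp (θ j * I)) α * d'.Θ α t' := fun θ => heq _ (hl θ)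
  simp only [h2]
  rw [h1]
  have h3 : (Real.pi : ℂ) ≠ 0 := ofReal_ne_zero.2 Real.pi_ne_zero
  have h4 : (s : ℂ) ≠ 0 := ofReal_ne_zero.2 hsp.ne'
  field_simp

theorem hol_anti {ψ : CS m → ℂ} {q : CS m} (h : DifferentiableAt ℂ ψ q) (v : CS m) : antiCDeriv ψ q v = 0 := by
  have h1 := (h.hasFDerivAt.restrictScalars ℝ).fderiv
  rw [antiCDeriv, h1]
  simp only [ContinuousLinearMap.coe_restrictScalars', map_smul, smul_eq_mul]
  linear_combination (fderiv ℂ ψ q v / 2) * I_sq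

theorem components_hol {M M' : Set (CS m)}
    (hM : IsRealAnalyticHypersurface M) (hmin : MinimalAt M 0)
    {h : CS m → CS m} (hdiffeo : IsCRDiffeoOn (⊤ : ℕ∞) M M' h)
    (h0M : (0 : CS m) ∈ M) (h00 : h 0 = 0)
    {d d' : DefData m} (hd : d.IsDefiningSeriesOf M) (hd' : d'.IsDefiningSeriesOf M') :
    ∃ δ > 0, δ ≤ d.r ∧ ∀ β, ∃ ψ : CS m → ℂ, DifferentiableOn ℂ ψ (ball 0 δ) ∧
      ∀ t ∈ M ∩ ball (0 : CS m) δ, ψ t = d'.Θ β (h t) := by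
  obtain ⟨κ, r1, hr1, hr1d, hs⟩ := exists_isSet hM h0M (theta_isQ hd)
  obtain ⟨κ', r2, HH, hr2, hRP, hHH⟩ := exists_RP hs hmin h0M hdiffeo h00 (theta_isQ hd')
  obtain ⟨ρ, K, hRS⟩ := hRP.exists_RS
  obtain ⟨δ, hδ, hδρ, hδr', Ψ, hΨ, hΨM⟩ := hRS.hol_ext
  have hd'r := hd'.1
  have hδ2 : δ ≤ r2 := hδρ.trans hRS.ρ_le
  refine ⟨δ, hδ, hδ2.trans (hr2.trans hr1d), fun β => ?_⟩
  obtain ⟨ψ, hψ, hψM⟩ := coeff_ext hd' hδ (by linarith) hΨ β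
  refine ⟨ψ, hψ, ?_⟩
  rintro t ⟨htM, ht⟩
  have ht2 := ball_subset_ball hδ2 ht
  have hy := (hRP.memy t ht2).1 htM
  rw [← hHH t ht2 hy]
  refine hψM t ht _ ?_ fun l hl => hΨM l hl t ht hy
  have := hRP.small t ⟨ht2, hy.ge⟩
  rw [mem_ball_zero_iff]; linarith

end PWsec

theorem components_extend_as_CR_over_levi_flat_hat
    (m : ℕ) (hm : 1 ≤ m) (M M' : Set (CS m))
    (hM : IsRealAnalyticHypersurface M) (hM' : IsRealAnalyticHypersurface M')
    (hminM : ∀ q ∈ M, MinimalAt M q) (hminM' : ∀ q' ∈ M', MinimalAt M' q')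
    (h : CS m → CS m) (hdiffeo : IsCRDiffeoOn (⊤ : ℕ∞) M M' h)
    (h0M : (0 : CS m) ∈ M) (h00 : h 0 = 0)
    (d d' : DefData m) (hd : d.IsDefiningSeriesOf M)
    (hd' : d'.IsDefiningSeriesOf M')
    (ε₀ : ℝ) (hε₀ : 0 < ε₀)
    (γ : (Fin m → ℂ) × ℝ → ℝ → CS m)
    (hγsmooth : ContDiffOn ℝ (⊤ : ℕ∞)
      (fun q : ((Fin m → ℂ) × ℝ) × ℝ => γ q.1 q.2)
      {q | ‖q.1.1‖ < ε₀ ∧ |q.1.2| < ε₀ ∧ |q.2| < 3 * d.r})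
    (hγM : ∀ p : (Fin m → ℂ) × ℝ, ‖p.1‖ < ε₀ → |p.2| < ε₀ →
      ∀ s : ℝ, |s| ≤ 2 * d.r → γ p s ∈ M ∩ ball (0 : CS m) d.r)
    (hγemb : ∀ p : (Fin m → ℂ) × ℝ, ‖p.1‖ < ε₀ → |p.2| < ε₀ →
      Set.InjOn (γ p) (Icc (-(2 * d.r)) (2 * d.r)))
    (hγtrans : ∀ p : (Fin m → ℂ) × ℝ, ‖p.1‖ < ε₀ → |p.2| < ε₀ →
      ∀ s : ℝ, |s| ≤ 2 * d.r → deriv (γ p) s ≠ 0 ∧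
        ¬ ComplexTangentAt M (γ p s) (deriv (γ p) s)) :
    ∃ r : ℝ, 0 < r ∧ r ≤ d.r ∧ ∃ ε : ℝ, 0 < ε ∧ ε ≤ ε₀ ∧
      ∀ p : (Fin m → ℂ) × ℝ, ‖p.1‖ < ε → |p.2| < ε →
        ∀ β : Fin m → ℕ, ∃ g : CS m → ℂ,
          IsCRFunctionOn (⊤ : ℕ∞)
            (⋃ s ∈ Icc (-(2 * d.r)) (2 * d.r), segreVariety d.Θ r (γ p s))
            g ∧
          ∀ s ∈ Icc (-(2 * d.r)) (2 * d.r), γ p s ∈ ball (0 : CS m) r →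
            g (γ p s) = d'.Θ β (h (γ p s)) := by
  obtain ⟨δ, hδ, hδd, hψ⟩ := components_hol hM (hminM 0 h0M) hdiffeo h0M h00 hd hd'
  refine ⟨δ, hδ, hδd, ε₀, hε₀, le_rfl, fun p hp1 hp2 β => ?_⟩
  obtain ⟨ψ, hψd, hψM⟩ := hψ β
  refine ⟨ψ, ?_, fun s hs hb => hψM _ ⟨(hγM p hp1 hp2 s (abs_le.2 hs)).1, hb⟩⟩
  intro q hq
  obtain ⟨s, hs, hq'⟩ := mem_iUnion₂.1 hq
  refine ⟨ball 0 δ, ψ, isOpen_ball, hq'.1, hol_contDiffOn_real isOpen_ball hψd, fun _ _ => rfl, ?_⟩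
  intro x hx v _
  exact hol_anti (hψd.differentiableAt (isOpen_ball.mem_nhds hx.2)) v
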